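/- The spectral locus Z of the PT-symmetric cubic oscillator is a nonempty, closed, connected subset of ℂ × ℂ. -/

import Mathlib

open Complex Filter

/-- `y` is an eigenfunction of the PT-symmetric cubic oscillator with
parameter `a` and eigenvalue `λ`: an entire function, not identically zero,
satisfying `-y'' + (z³ - a z) y = -λ y` and tending to `0` along the positive
and negative imaginary axes. -/
def IsCubicEigenfunction (a lam : ℂ) (y : ℂ → ℂ) : Prop :=
  Differentiable ℂ y ∧ y ≠ 0 ∧
  (∀ z : ℂ, -(deriv (deriv y) z) + (z ^ 3 - a * z) * y z = -lam * y z) ∧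
  Tendsto (fun t : ℝ => y (Complex.I * t)) atTop (nhds 0) ∧
  Tendsto (fun t : ℝ => y (Complex.I * t)) atBot (nhds 0)

/-- The spectral locus of the PT-symmetric cubic oscillator. -/
def cubicSpectralLocus : Set (ℂ × ℂ) :=
  {p : ℂ × ℂ | ∃ y : ℂ → ℂ, IsCubicEigenfunction p.1 p.2 y}

open Complex Filter

namespace PTC
open Topology Set

/-- continuous on `S` and holomorphic along every holomorphic curve in `S`. -/
def HolOn {E : Type*} [NormedAddCommGroup E] [NormedSpace ℂ E] (S : Set E) (f : E → ℂ) : Prop :=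
  ContinuousOn f S ∧ ∀ (U : Set ℂ) (γ : ℂ → E), IsOpen U → DifferentiableOn ℂ γ U →
    MapsTo γ U S → DifferentiableOn ℂ (fun ζ => f (γ ζ)) U

namespace HolOn
variable {E : Type*} [NormedAddCommGroup E] [NormedSpace ℂ E] {S : Set E} {f g : E → ℂ}

theorem of_diff (h : DifferentiableOn ℂ f S) : HolOn S f :=
  ⟨h.continuousOn, fun _ _ _ hγ hm => h.comp hγ hm⟩

theorem const (c : ℂ) : HolOn S (fun _ => c) := of_diff (differentiableOn_const c)

theorem mono {S' : Set E} (h : HolOn S f) (hs : S' ⊆ S) : HolOn S' f :=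
  ⟨h.1.mono hs, fun U γ hU hγ hm => h.2 U γ hU hγ (fun _ hx => hs (hm hx))⟩

theorem add (hf : HolOn S f) (hg : HolOn S g) : HolOn S (fun x => f x + g x) :=
  ⟨hf.1.add hg.1, fun U γ hU hγ hm => (hf.2 U γ hU hγ hm).add (hg.2 U γ hU hγ hm)⟩

theorem sub (hf : HolOn S f) (hg : HolOn S g) : HolOn S (fun x => f x - g x) :=
  ⟨hf.1.sub hg.1, fun U γ hU hγ hm => (hf.2 U γ hU hγ hm).sub (hg.2 U γ hU hγ hm)⟩

theorem mul (hf : HolOn S f) (hg : HolOn S g) : HolOn S (fun x => f x * g x) :=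
  ⟨hf.1.mul hg.1, fun U γ hU hγ hm => (hf.2 U γ hU hγ hm).mul (hg.2 U γ hU hγ hm)⟩

theorem comp_diff {E' : Type*} [NormedAddCommGroup E'] [NormedSpace ℂ E'] {S' : Set E'}
    {φ : E' → E} (hf : HolOn S f) (hφ : DifferentiableOn ℂ φ S') (hm : MapsTo φ S' S) :
    HolOn S' (fun x => f (φ x)) :=
  ⟨hf.1.comp hφ.continuousOn hm, fun U γ hU hγ hmγ =>
    hf.2 U (fun ζ => φ (γ ζ)) hU (hφ.comp hγ hmγ) (fun _ hx => hm (hmγ hx))⟩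

theorem post {φ : ℂ → ℂ} {T : Set ℂ} (hφ : DifferentiableOn ℂ φ T) (hf : HolOn S f)
    (hm : MapsTo f S T) : HolOn S (fun x => φ (f x)) :=
  ⟨hφ.continuousOn.comp hf.1 hm, fun U γ hU hγ hmγ =>
    hφ.comp (hf.2 U γ hU hγ hmγ) (fun _ hx => hm (hmγ hx))⟩

theorem congr (hf : HolOn S f) (h : ∀ x ∈ S, g x = f x) : HolOn S g :=
  ⟨hf.1.congr h, fun U γ hU hγ hm => (hf.2 U γ hU hγ hm).congr (fun _ hx => h _ (hm hx))⟩

theorem tsum {F : ℕ → E → ℂ} {u : ℕ → ℝ} (hu : Summable u) (hF : ∀ i, HolOn S (F i))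
    (hb : ∀ i, ∀ x ∈ S, ‖F i x‖ ≤ u i) : HolOn S (fun x => ∑' i, F i x) :=
  ⟨continuousOn_tsum (fun i => (hF i).1) hu hb, fun U γ hU hγ hm =>
    differentiableOn_tsum_of_summable_norm hu (fun i => (hF i).2 U γ hU hγ hm) hU
      (fun i _ hw => hb i _ (hm hw))⟩

theorem of_local (hS : IsOpen S) (h : ∀ x ∈ S, ∃ V, IsOpen V ∧ x ∈ V ∧ HolOn (V ∩ S) f) : HolOn S f := by
  refine ⟨?_, ?_⟩
  · intro x hx
    obtain ⟨V, hV, hxV, hf⟩ := h x hx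
    exact ((hf.1 x ⟨hxV, hx⟩).continuousAt ((hV.inter hS).mem_nhds ⟨hxV, hx⟩)).continuousWithinAt
  · intro U γ hU hγ hm ζ hζ
    obtain ⟨V, hV, hxV, hf⟩ := h _ (hm hζ)
    have hU' : IsOpen (U ∩ γ ⁻¹' V) := hγ.continuousOn.isOpen_inter_preimage hU hV
    have := hf.2 (U ∩ γ ⁻¹' V) γ hU' (hγ.mono inter_subset_left) (fun x hx => ⟨hx.2, hm hx.1⟩) ζ ⟨hζ, hxV⟩
    exact (this.differentiableAt (hU'.mem_nhds ⟨hζ, hxV⟩)).differentiableWithinAt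

end HolOn

/-- coefficients of power series solutions of `y'' = (z^3+p z+l) y`. -/
def cf {R : Type*} [Field R] (p l c0 c1 : R) : ℕ → R
  | 0 => c0
  | 1 => c1
  | 2 => l * c0 / 2
  | 3 => (p * c0 + l * c1) / 6
  | 4 => (p * c1 + l * (l * c0 / 2)) / 12
  | (n + 5) => (cf p l c0 c1 n + p * cf p l c0 c1 (n + 2) + l * cf p l c0 c1 (n + 3)) /
      ((n + 5) * (n + 4))

theorem cf_norm_le {p l c0 c1 : ℂ} {M : ℝ} (hp : ‖p‖ ≤ M) (hl : ‖l‖ ≤ M) (h0 : ‖c0‖ ≤ M)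
    (h1 : ‖c1‖ ≤ M) (n : ℕ) : ‖cf p l c0 c1 n‖ ≤ cf M M M M n := by
  have hM : 0 ≤ M := (norm_nonneg _).trans hp
  induction n using Nat.strong_induction_on with
  | _ n ih =>
  match n with
  | 0 => simpa [cf] using h0
  | 1 => simpa [cf] using h1
  | 2 => simp only [cf, norm_div, norm_mul]; norm_num; gcongr
  | 3 =>
    simp only [cf, norm_div]; norm_num; gcongr
    refine (norm_add_le _ _).trans ?_
    simp only [norm_mul]; gcongr
  | 4 =>
    simp only [cf, norm_div]; norm_num; gcongr
    refine (norm_add_le _ _).trans ?_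
    simp only [norm_mul, norm_div]; norm_num; gcongr
  | (n + 5) =>
    have e1 := ih n (by omega)
    have e2 := ih (n + 2) (by omega)
    have e3 := ih (n + 3) (by omega)
    simp only [cf, norm_div]
    have : ‖((n : ℂ) + 5) * (n + 4)‖ = ((n : ℝ) + 5) * (n + 4) := by
      have : ((n : ℂ) + 5) * (n + 4) = ((((n : ℝ) + 5) * (n + 4) : ℝ) : ℂ) := by push_cast; ring
      rw [this, Complex.norm_real, Real.norm_of_nonneg (by positivity)]
    rw [this]
    gcongr
    refine (norm_add₃_le).trans ?_
    simp only [norm_mul]; gcongr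

theorem cf_nonneg {M : ℝ} (hM : 0 ≤ M) (n : ℕ) : 0 ≤ cf M M M M n := by
  have := cf_norm_le (p := (M:ℂ)) (l := M) (c0 := M) (c1 := M) (M := M) (by simp [abs_of_nonneg hM])
    (by simp [abs_of_nonneg hM]) (by simp [abs_of_nonneg hM]) (by simp [abs_of_nonneg hM]) n
  exact (norm_nonneg _).trans this

theorem cf_bound {M : ℝ} (hM : 0 ≤ M) {r : ℝ} (hr : 0 ≤ r) : ∃ C, ∀ n, cf M M M M n * r ^ n ≤ C := by
  obtain ⟨N, hN⟩ := exists_nat_ge (r ^ 5 + M * r ^ 3 + M * r ^ 2)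
  obtain ⟨C, hC⟩ : ∃ C, ∀ n ≤ N + 5, cf M M M M n * r ^ n ≤ C := by
    refine ⟨∑ n ∈ Finset.range (N + 6), cf M M M M n * r ^ n, fun n hn => ?_⟩
    exact Finset.single_le_sum (f := fun n => cf M M M M n * r ^ n)
      (fun i _ => mul_nonneg (cf_nonneg hM i) (by positivity)) (Finset.mem_range.2 (by omega))
  have hC0 : 0 ≤ C := (mul_nonneg (cf_nonneg hM 0) (by positivity)).trans (hC 0 (by omega))
  refine ⟨C, fun n => ?_⟩
  induction n using Nat.strong_induction_on with
  | _ n ih =>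
  by_cases hn : n ≤ N + 5
  · exact hC n hn
  obtain ⟨m, rfl⟩ : ∃ m, n = m + 5 := ⟨n - 5, by omega⟩
  have e1 := ih m (by omega)
  have e2 := ih (m + 2) (by omega)
  have e3 := ih (m + 3) (by omega)
  have hm : (N : ℝ) ≤ m := by exact_mod_cast (by omega)
  have : cf M M M M (m + 5) * r ^ (m + 5) = (r ^ 5 * (cf M M M M m * r ^ m) +
     M * r ^ 3 * (cf M M M M (m + 2) * r ^ (m + 2)) + M * r ^ 2 * (cf M M M M (m + 3) * r ^ (m + 3))) /
     ((m + 5) * (m + 4)) := by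
    rw [cf]; ring
  rw [this, div_le_iff₀ (by positivity)]
  have h1 := mul_le_mul_of_nonneg_left e1 (by positivity : 0 ≤ r ^ 5)
  have h2 := mul_le_mul_of_nonneg_left e2 (by positivity : 0 ≤ M * r ^ 3)
  have h3 := mul_le_mul_of_nonneg_left e3 (by positivity : 0 ≤ M * r ^ 2)
  have h4 : (r ^ 5 + M * r ^ 3 + M * r ^ 2) * C ≤ m * C := by gcongr; linarith
  have hm0 : (0:ℝ) ≤ m := by positivity
  nlinarith [mul_nonneg hC0 hm0, mul_nonneg (mul_nonneg hC0 hm0) hm0]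

theorem cf_summable {M : ℝ} (hM : 0 ≤ M) {r : ℝ} (hr : 0 ≤ r) : Summable fun n => cf M M M M n * r ^ n := by
  obtain ⟨C, hC⟩ := cf_bound hM (r := 2 * r) (by positivity)
  refine Summable.of_nonneg_of_le (fun n => mul_nonneg (cf_nonneg hM n) (by positivity))
    (fun n => ?_) (summable_geometric_two.mul_left C)
  have := hC n
  rw [mul_pow] at this
  have h2 : (0:ℝ) < 2 ^ n := by positivity
  have : cf M M M M n * r ^ n = (cf M M M M n * (2 ^ n * r ^ n)) * (1 / 2) ^ n := by
    rw [one_div, inv_pow]; field_simp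
  rw [this]
  gcongr

theorem ps_summable {c : ℕ → ℂ} (h : ∀ r : ℝ, 0 ≤ r → Summable fun n => ‖c n‖ * r ^ n) :
    ∀ r : ℝ, 0 ≤ r → Summable fun n : ℕ => ‖((n:ℂ) + 1) * c (n + 1)‖ * r ^ n := by
  intro r hr
  have h1 := (summable_nat_add_iff 1).2 (h (2 * (r + 1)) (by positivity))
  refine Summable.of_nonneg_of_le (fun n => by positivity) (fun n => ?_) h1
  rw [norm_mul]
  have : ‖(n:ℂ) + 1‖ = n + 1 := by
    have := Complex.norm_natCast (n + 1); push_cast at this; exact this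
  rw [this, mul_pow]
  have h2 : (n:ℝ) + 1 ≤ 2 ^ (n + 1) := by
    have := (Nat.lt_two_pow_self (n := n + 1)).le
    exact_mod_cast this
  have h3 : r ^ n ≤ (r + 1) ^ (n + 1) := by
    calc r ^ n ≤ (r + 1) ^ n := by gcongr; linarith
      _ ≤ (r + 1) ^ (n + 1) := pow_le_pow_right₀ (by linarith) (by omega)
  calc (n + 1) * ‖c (n + 1)‖ * r ^ n ≤ 2 ^ (n + 1) * ‖c (n + 1)‖ * (r + 1) ^ (n + 1) := by gcongr
    _ = _ := by ring

theorem ps_hasDerivAt {c : ℕ → ℂ} (h : ∀ r : ℝ, 0 ≤ r → Summable fun n => ‖c n‖ * r ^ n) (z : ℂ) :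
    HasDerivAt (fun z => ∑' n, c n * z ^ n) (∑' n : ℕ, ((n:ℂ) + 1) * c (n + 1) * z ^ n) z := by
  have hs := ps_summable h
  have hsum (z : ℂ) : Summable fun n : ℕ => ((n:ℂ) + 1) * c (n + 1) * z ^ n := by
    refine Summable.of_norm ?_
    simpa only [norm_mul, norm_pow] using hs ‖z‖ (norm_nonneg _)
  have h1 : HasDerivAt (fun z => ∑' n, c n * z ^ n) (∑' n, c n * (n * z ^ (n - 1))) z := by
    have hR : 0 ≤ ‖z‖ + 1 := by positivity
    refine hasDerivAt_tsum_of_isPreconnected (g := fun (n : ℕ) z => c n * z ^ n)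
      (g' := fun (n : ℕ) z => c n * (n * z ^ (n - 1))) (t := Metric.ball (0:ℂ) (‖z‖ + 1)) (y₀ := 0)
      (u := fun n => ‖c n‖ * (n * (‖z‖ + 1) ^ (n - 1))) ?_ Metric.isOpen_ball
      (convex_ball _ _).isPreconnected ?_ ?_ ?_ ?_ ?_
    · rw [← summable_nat_add_iff 1]
      refine (hs _ hR).congr fun n => ?_
      rw [norm_mul]
      have : ‖(n:ℂ) + 1‖ = n + 1 := by
        have := Complex.norm_natCast (n + 1); push_cast at this; exact this
      rw [this]; push_cast; ring
    · intro n y _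
      exact (hasDerivAt_pow n y).const_mul _
    · intro n y hy
      have hy' : ‖y‖ ≤ ‖z‖ + 1 := by simpa using (mem_ball_zero_iff.1 hy).le
      rw [norm_mul, norm_mul, norm_pow, Complex.norm_natCast]
      gcongr
    · simp; positivity
    · refine Summable.of_norm ?_
      simpa only [norm_mul, norm_pow] using h ‖(0:ℂ)‖ (norm_nonneg _)
    · simp
  convert h1 using 1
  rw [Summable.tsum_eq_zero_add (f := fun n => c n * (n * z ^ (n - 1)))]
  · simp; refine tsum_congr fun n => by ring
  · rw [← summable_nat_add_iff 1]
    refine (hsum z).congr fun n => ?_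
    push_cast; ring

/-- entire solution with Cauchy data c0,c1 at 0 -/
noncomputable def fs (p l c0 c1 z : ℂ) : ℂ := ∑' n, cf p l c0 c1 n * z ^ n
noncomputable def fs' (p l c0 c1 z : ℂ) : ℂ := ∑' n : ℕ, ((n:ℂ) + 1) * cf p l c0 c1 (n + 1) * z ^ n

theorem cf_summ (p l c0 c1 : ℂ) : ∀ r : ℝ, 0 ≤ r → Summable fun n => ‖cf p l c0 c1 n‖ * r ^ n := by
  intro r hr
  set M := ‖p‖ + ‖l‖ + ‖c0‖ + ‖c1‖ with hM
  have a1 := norm_nonneg p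
  have a2 := norm_nonneg l
  have a3 := norm_nonneg c0
  have a4 := norm_nonneg c1
  refine Summable.of_nonneg_of_le (fun n => by positivity) (fun n => ?_) (cf_summable (M := M) (by positivity) hr)
  gcongr
  apply cf_norm_le <;> linarith

theorem fs_hasDerivAt (p l c0 c1 z : ℂ) : HasDerivAt (fs p l c0 c1) (fs' p l c0 c1 z) z :=
  ps_hasDerivAt (cf_summ p l c0 c1) z

theorem fs'_hasDerivAt (p l c0 c1 z : ℂ) :
    HasDerivAt (fs' p l c0 c1) ((z ^ 3 + p * z + l) * fs p l c0 c1 z) z := by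
  have h := ps_hasDerivAt (c := fun n : ℕ => ((n:ℂ) + 1) * cf p l c0 c1 (n + 1)) (ps_summable (cf_summ p l c0 c1)) z
  refine HasDerivAt.congr_deriv h ?_
  symm
  have hs (z : ℂ) : Summable fun n => cf p l c0 c1 n * z ^ n := by
    refine Summable.of_norm ?_
    simpa only [norm_mul, norm_pow] using cf_summ p l c0 c1 ‖z‖ (norm_nonneg _)
  have hs2 : Summable fun n : ℕ => ((n:ℂ) + 1) * (((n + 1 : ℕ):ℂ) + 1) * cf p l c0 c1 (n + 1 + 1) * z ^ n := by
    refine Summable.of_norm ?_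
    have := ps_summable (ps_summable (cf_summ p l c0 c1)) ‖z‖ (norm_nonneg _)
    refine this.congr fun n => ?_
    simp only [norm_mul, norm_pow]; ring
  have e : ∀ n : ℕ, ((n:ℂ) + 1) * ((((n + 1 : ℕ):ℂ) + 1) * cf p l c0 c1 (n + 1 + 1)) * z ^ n =
     ((n:ℂ) + 1) * (((n + 1 : ℕ):ℂ) + 1) * cf p l c0 c1 (n + 1 + 1) * z ^ n := fun n => by ring
  rw [tsum_congr e, ← hs2.sum_add_tsum_nat_add 3]
  have e2 : ∀ n : ℕ, (((n + 3 : ℕ):ℂ) + 1) * (((n + 3 + 1 : ℕ):ℂ) + 1) * cf p l c0 c1 (n + 3 + 1 + 1) * z ^ (n + 3)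
     = z ^ 3 * (cf p l c0 c1 n * z ^ n) + (p * z) * (cf p l c0 c1 (n + 2) * z ^ (n + 2)) +
       l * (cf p l c0 c1 (n + 3) * z ^ (n + 3)) := by
    intro n
    have : cf p l c0 c1 (n + 3 + 1 + 1) = cf p l c0 c1 (n + 5) := rfl
    rw [this, cf]
    have h1 : (n:ℂ) + 5 ≠ 0 := by exact_mod_cast (by omega : n + 5 ≠ 0)
    have h2 : (n:ℂ) + 4 ≠ 0 := by exact_mod_cast (by omega : n + 4 ≠ 0)
    have h3 : (((n + 3 : ℕ):ℂ) + 1) * (((n + 3 + 1 : ℕ):ℂ) + 1) = (n + 5) * (n + 4) := by push_cast; ring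
    rw [h3]; field_simp; ring
  rw [tsum_congr e2, Summable.tsum_add, Summable.tsum_add, tsum_mul_left, tsum_mul_left, tsum_mul_left]
  · have k0 : ∑' n, cf p l c0 c1 n * z ^ n = fs p l c0 c1 z := rfl
    have k2 := (hs z).sum_add_tsum_nat_add 2
    have k3 := (hs z).sum_add_tsum_nat_add 3
    rw [k0] at k2 k3
    rw [k0, eq_sub_iff_add_eq'.2 k2, eq_sub_iff_add_eq'.2 k3]
    simp only [Finset.sum_range_succ, Finset.sum_range_zero, cf]
    push_cast
    ring
  · exact ((hs z).mul_left _)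
  · exact (((summable_nat_add_iff 2).2 (hs z)).mul_left _)
  · exact ((hs z).mul_left _).add (((summable_nat_add_iff 2).2 (hs z)).mul_left _)
  · exact (((summable_nat_add_iff 3).2 (hs z)).mul_left _)

theorem fs_zero (p l c0 c1 : ℂ) : fs p l c0 c1 0 = c0 := by
  rw [fs, tsum_eq_single 0]
  · simp [cf]
  · intro n hn; simp [hn]

theorem fs'_zero (p l c0 c1 : ℂ) : fs' p l c0 c1 0 = c1 := by
  rw [fs', tsum_eq_single 0]
  · simp [cf]
  · intro n hn; simp [hn]

theorem cf_diff (n : ℕ) : Differentiable ℂ fun x : ℂ × ℂ × ℂ × ℂ × ℂ => cf x.1 x.2.1 x.2.2.1 x.2.2.2.1 n := by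
  induction n using Nat.strong_induction_on with
  | _ n ih =>
  match n with
  | 0 => simp only [cf]; fun_prop
  | 1 => simp only [cf]; fun_prop
  | 2 => simp only [cf]; fun_prop
  | 3 => simp only [cf]; fun_prop
  | 4 => simp only [cf]; fun_prop
  | (n + 5) =>
    have e1 := ih n (by omega)
    have e2 := ih (n + 2) (by omega)
    have e3 := ih (n + 3) (by omega)
    simp only [cf]
    simp only [div_eq_mul_inv]
    fun_prop

theorem fs_hol : HolOn univ fun x : ℂ × ℂ × ℂ × ℂ × ℂ => fs x.1 x.2.1 x.2.2.1 x.2.2.2.1 x.2.2.2.2 := by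
  refine HolOn.of_local isOpen_univ fun x _ => ⟨Metric.ball 0 (‖x‖ + 1), Metric.isOpen_ball, by simp, ?_⟩
  refine HolOn.tsum (cf_summable (M := ‖x‖ + 1) (by positivity) (r := ‖x‖ + 1) (by positivity)) ?_ ?_
  · intro i
    apply HolOn.of_diff
    have := cf_diff i
    fun_prop
  · rintro i ⟨p, l, c0, c1, z⟩ ⟨h, _⟩
    simp only [mem_ball_zero_iff, Prod.norm_mk, max_lt_iff] at h
    obtain ⟨h1, h2, h3, h4, h5⟩ := h
    rw [norm_mul, norm_pow]
    gcongr
    · exact cf_nonneg (by positivity) _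
    · exact cf_norm_le h1.le h2.le h3.le h4.le i

theorem fs'_hol : HolOn univ fun x : ℂ × ℂ × ℂ × ℂ × ℂ => fs' x.1 x.2.1 x.2.2.1 x.2.2.2.1 x.2.2.2.2 := by
  refine HolOn.of_local isOpen_univ fun x _ => ⟨Metric.ball 0 (‖x‖ + 1), Metric.isOpen_ball, by simp, ?_⟩
  have hM : 0 ≤ ‖x‖ + 1 := by positivity
  have hs := ps_summable (c := fun n => ((cf (‖x‖ + 1) (‖x‖ + 1) (‖x‖ + 1) (‖x‖ + 1) n : ℝ) : ℂ)) (by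
    intro r hr
    refine (cf_summable hM hr).congr fun n => ?_
    rw [Complex.norm_real, Real.norm_of_nonneg (cf_nonneg hM n)]) _ hM
  refine HolOn.tsum hs ?_ ?_
  · intro i
    apply HolOn.of_diff
    have := cf_diff (i + 1)
    fun_prop
  · rintro i ⟨p, l, c0, c1, z⟩ ⟨h, _⟩
    simp only [mem_ball_zero_iff, Prod.norm_mk, max_lt_iff] at h
    obtain ⟨h1, h2, h3, h4, h5⟩ := h
    rw [norm_mul, norm_pow, norm_mul, norm_mul, Complex.norm_real, Real.norm_of_nonneg (cf_nonneg hM _)]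
    gcongr
    · exact mul_nonneg (norm_nonneg _) (cf_nonneg hM _)
    · exact cf_norm_le h1.le h2.le h3.le h4.le _

end PTC

open Complex Filter

namespace PTC
open Topology Set MeasureTheory

theorem hol_param {α : Type*} [MeasurableSpace α] {μ : Measure α} {G : ℂ → α → ℂ} {B : α → ℝ}
    {U : Set ℂ} (hU : IsOpen U) (hB : Integrable B μ)
    (hmeas : ∀ ζ ∈ U, AEStronglyMeasurable (G ζ) μ)
    (hd : ∀ᵐ t ∂μ, DifferentiableOn ℂ (fun ζ => G ζ t) U)
    (hb : ∀ᵐ t ∂μ, ∀ ζ ∈ U, ‖G ζ t‖ ≤ B t) :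
    DifferentiableOn ℂ (fun ζ => ∫ t, G ζ t ∂μ) U := by
  intro ζ hζ
  obtain ⟨r, hr, hrU⟩ := Metric.isOpen_iff.1 hU ζ hζ
  have key := hasDerivAt_integral_of_dominated_loc_of_deriv_le (μ := μ) (F := G) (x₀ := ζ)
    (s := Metric.ball ζ (r / 2)) (F' := fun z t => deriv (fun w => G w t) z)
    (bound := fun t => B t / (r / 2)) (Metric.ball_mem_nhds _ (by positivity)) ?_ ?_ ?_ ?_ ?_ ?_
  · exact key.2.differentiableAt.differentiableWithinAt
  · filter_upwards [hU.mem_nhds hζ] with x hx using hmeas x hx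
  · exact hB.mono' (hmeas ζ hζ) (hb.mono fun t ht => ht ζ hζ)
  · have hseq : ∃ u : ℕ → ℂ, (∀ n, u n ≠ 0 ∧ ζ + u n ∈ U) ∧ Tendsto u atTop (𝓝[≠] 0) := by
      refine ⟨fun n => ((r / 2 / (n + 1) : ℝ) : ℂ), fun n => ⟨?_, hrU ?_⟩, ?_⟩
      · have : r / 2 / ((n:ℝ) + 1) ≠ 0 := by positivity
        exact Complex.ofReal_ne_zero.2 this
      · simp only [Metric.mem_ball, dist_eq_norm, add_sub_cancel_left, Complex.norm_real]
        rw [Real.norm_of_nonneg (by positivity)]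
        have : r / 2 / ((n:ℝ) + 1) ≤ r / 2 := div_le_self (by positivity) (by linarith [n.cast_nonneg (α := ℝ)])
        linarith
      · rw [tendsto_nhdsWithin_iff]
        refine ⟨?_, Eventually.of_forall fun n => ?_⟩
        · have h1 : Tendsto (fun n : ℕ => r / 2 / ((n:ℝ) + 1)) atTop (𝓝 0) := by
            have := (tendsto_one_div_add_atTop_nhds_zero_nat (𝕜 := ℝ)).const_mul (r / 2)
            simpa [div_eq_mul_inv] using this
          have := (Complex.continuous_ofReal.tendsto 0).comp h1
          simpa only [Complex.ofReal_zero, Function.comp_def] using this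
        · have : r / 2 / ((n:ℝ) + 1) ≠ 0 := by positivity
          exact Complex.ofReal_ne_zero.2 this
    obtain ⟨u, hu, hlim⟩ := hseq
    refine aestronglyMeasurable_of_tendsto_ae atTop (f := fun n t => (u n)⁻¹ • (G (ζ + u n) t - G ζ t)) ?_ ?_
    · intro n
      exact ((hmeas _ (hu n).2).sub (hmeas _ hζ)).const_smul (u n)⁻¹
    · filter_upwards [hd] with t ht
      have h1 : HasDerivAt (fun w => G w t) (deriv (fun w => G w t) ζ) ζ :=
        (ht.differentiableAt (hU.mem_nhds hζ)).hasDerivAt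
      exact (hasDerivAt_iff_tendsto_slope_zero.1 h1).comp hlim
  · filter_upwards [hd, hb] with t h1 h2 x hx
    have hsub : Metric.closedBall x (r / 2) ⊆ U := by
      intro y hy
      apply hrU
      simp only [Metric.mem_ball, Metric.mem_closedBall] at *
      linarith [dist_triangle y x ζ]
    refine Complex.norm_deriv_le_of_forall_mem_sphere_norm_le (by positivity) ?_ ?_
    · exact (h1.mono hsub).diffContOnCl_ball subset_rfl
    · intro z hz
      exact h2 z (hsub (Metric.sphere_subset_closedBall hz))
  · exact hB.div_const _
  · filter_upwards [hd] with t ht x hx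
    have : x ∈ U := hrU (Metric.ball_subset_ball (by linarith) hx)
    exact (ht.differentiableAt (hU.mem_nhds this)).hasDerivAt

theorem HolOn.integral {E : Type*} [NormedAddCommGroup E] [NormedSpace ℂ E] {S : Set E}
    {α : Type*} [MeasurableSpace α] {μ : Measure α} {f : E → α → ℂ} {B : α → ℝ}
    (hB : Integrable B μ) (hmeas : ∀ w ∈ S, AEStronglyMeasurable (f w) μ)
    (hd : ∀ᵐ t ∂μ, HolOn S (fun w => f w t))
    (hb : ∀ᵐ t ∂μ, ∀ w ∈ S, ‖f w t‖ ≤ B t) : HolOn S (fun w => ∫ t, f w t ∂μ) := by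
  refine ⟨?_, fun U γ hU hγ hm => ?_⟩
  · refine continuousOn_of_dominated hmeas (fun w hw => hb.mono fun t ht => ht w hw) hB
      (hd.mono fun t ht => ht.1)
  · refine hol_param hU hB (fun ζ hζ => hmeas _ (hm hζ)) (hd.mono fun t ht => ht.2 U γ hU hγ hm)
      (hb.mono fun t ht ζ hζ => ht _ (hm hζ))

open BoundedContinuousFunction in
theorem volterra {E : Type*} [NormedAddCommGroup E] [NormedSpace ℂ E] {W : Set E} {e : E}
    (hW : ∀ w ∈ W, ∀ t : ℝ, 0 ≤ t → w + (t:ℂ) • e ∈ W) {N : E → ℝ → ℂ} {B : ℝ → ℝ}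
    (hN : ContinuousOn (fun x : E × ℝ => N x.1 x.2) (W ×ˢ Ici 0))
    (hB : IntegrableOn B (Ioi 0)) (hNB : ∀ w ∈ W, ∀ t : ℝ, 0 < t → ‖N w t‖ ≤ B t)
    (hB2 : ∫ t in Ioi 0, B t ≤ 1 / 2) :
    ∃ η : E → ℂ, ContinuousOn η W ∧ (∀ w ∈ W, ‖η w‖ ≤ 1) ∧
      (∀ w ∈ W, η w = ∫ t in Ioi (0:ℝ), N w t * (1 + η (w + (t:ℂ) • e))) ∧
      ((∀ t : ℝ, 0 < t → HolOn W (fun w => N w t)) → HolOn W η) := by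
  classical
  rcases W.eq_empty_or_nonempty with rfl | hne
  · exact ⟨0, by simp, by simp, by simp, fun _ => HolOn.const 0⟩
  have hB0 : ∀ t : ℝ, 0 < t → 0 ≤ B t := fun t ht => (norm_nonneg _).trans (hNB _ hne.some_mem t ht)
  -- the extension of a function on the subtype
  let ext : (W →ᵇ ℂ) → E → ℂ := fun f w => if h : w ∈ W then f ⟨w, h⟩ else 0
  have ext_mem : ∀ f w (h : w ∈ W), ext f w = f ⟨w, h⟩ := fun f w h => by simp [ext, h]
  have ext_cont : ∀ f, ContinuousOn (ext f) W := fun f => by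
    rw [continuousOn_iff_continuous_domRestrict]
    convert f.continuous using 1
    ext ⟨w, h⟩
    simp [ext_mem f w h]
  have ext_le : ∀ f w, ‖ext f w‖ ≤ ‖f‖ := fun f w => by
    by_cases h : w ∈ W
    · rw [ext_mem f w h]; exact f.norm_coe_le_norm _
    · simp [ext, h]
  have shc : ∀ w ∈ W, ContinuousOn (fun t : ℝ => w + (t:ℂ) • e) (Ioi 0) := fun w _ => by fun_prop
  have intc : ∀ f : E → ℂ, ContinuousOn f W → ∀ w ∈ W,
      AEStronglyMeasurable (fun t : ℝ => N w t * (1 + f (w + (t:ℂ) • e))) (volume.restrict (Ioi 0)) := by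
    intro f hf w hw
    apply ContinuousOn.aestronglyMeasurable _ measurableSet_Ioi
    refine ContinuousOn.mul ?_ (continuousOn_const.add (hf.comp (shc w hw) (fun t ht => hW w hw t (le_of_lt ht))))
    exact hN.comp (f := fun t : ℝ => (w, t)) (by fun_prop) (fun t ht => ⟨hw, le_of_lt (mem_Ioi.1 ht)⟩)
  have hbd : ∀ (f : E → ℂ) (C : ℝ), (∀ w ∈ W, ‖f w‖ ≤ C) → ∀ t : ℝ, 0 < t → ∀ w ∈ W,
      ‖N w t * (1 + f (w + (t:ℂ) • e))‖ ≤ B t * (1 + C) := by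
    intro f C hC t ht w hw
    rw [norm_mul]
    have h1 := hC _ (hW w hw t ht.le)
    have h2 : ‖1 + f (w + (t:ℂ) • e)‖ ≤ 1 + C := (norm_add_le _ _).trans (by simpa using h1)
    exact mul_le_mul (hNB w hw t ht) h2 (norm_nonneg _) (hB0 t ht)
  have hae : ∀ {p : ℝ → Prop}, (∀ t, 0 < t → p t) → ∀ᵐ t ∂(volume.restrict (Ioi (0:ℝ))), p t :=
    fun h => (ae_restrict_iff' measurableSet_Ioi).2 (Eventually.of_forall h)
  have Tcont : ∀ (f : E → ℂ) (C : ℝ), ContinuousOn f W → (∀ w ∈ W, ‖f w‖ ≤ C) →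
      ContinuousOn (fun w => ∫ t in Ioi (0:ℝ), N w t * (1 + f (w + (t:ℂ) • e))) W := by
    intro f C hf hC
    refine continuousOn_of_dominated (intc f hf) (fun w hw => hae fun t ht => hbd f C hC t ht w hw)
      (hB.mul_const _) (hae fun t ht => ?_)
    refine ContinuousOn.mul ?_ (continuousOn_const.add (hf.comp (by fun_prop) (fun w hw => hW w hw t ht.le)))
    exact hN.comp (f := fun w : E => (w, t)) (by fun_prop) (fun w hw => ⟨hw, ht.le⟩)
  have Tle : ∀ (f : E → ℂ) (C : ℝ), 0 ≤ C → (∀ w ∈ W, ‖f w‖ ≤ C) → ∀ w ∈ W,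
      ‖∫ t in Ioi (0:ℝ), N w t * (1 + f (w + (t:ℂ) • e))‖ ≤ 1 / 2 * (1 + C) := by
    intro f C hC0 hC w hw
    refine (norm_integral_le_of_norm_le (hB.mul_const (1 + C)) (hae fun t ht => hbd f C hC t ht w hw)).trans ?_
    rw [integral_mul_const]
    gcongr
  let T : (W →ᵇ ℂ) → (W →ᵇ ℂ) := fun f =>
    BoundedContinuousFunction.ofNormedAddCommGroup
      (fun w : W => ∫ t in Ioi (0:ℝ), N w t * (1 + ext f (w + (t:ℂ) • e)))
      (continuousOn_iff_continuous_domRestrict.1 (Tcont (ext f) ‖f‖ (ext_cont f) (fun w _ => ext_le f w)))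
      (1 / 2 * (1 + ‖f‖)) (fun w => Tle (ext f) ‖f‖ (norm_nonneg _) (fun w _ => ext_le f w) w w.2)
  have hcon : ContractingWith (1 / 2) T := by
    refine ⟨by rw [← NNReal.coe_lt_coe]; norm_num, LipschitzWith.of_dist_le_mul fun f g => ?_⟩
    rw [BoundedContinuousFunction.dist_le (by positivity)]
    intro w
    have hi : ∀ f : W →ᵇ ℂ, IntegrableOn (fun t : ℝ => N w t * (1 + ext f (w + (t:ℂ) • e))) (Ioi 0) := fun f =>
      Integrable.mono' (hB.mul_const (1 + ‖f‖)) (intc _ (ext_cont f) w w.2)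
        (hae fun t ht => hbd _ _ (fun w _ => ext_le f w) t ht w w.2)
    have hT : ∀ f : W →ᵇ ℂ, T f w = ∫ t in Ioi (0:ℝ), N w t * (1 + ext f (w + (t:ℂ) • e)) := fun f => rfl
    rw [hT, hT, dist_eq_norm, ← integral_sub (hi f) (hi g)]
    have := norm_integral_le_of_norm_le (μ := volume.restrict (Ioi (0:ℝ)))
      (f := fun t : ℝ => N w t * (1 + ext f (w + (t:ℂ) • e)) - N w t * (1 + ext g (w + (t:ℂ) • e)))
      (hB.mul_const (dist f g)) (hae fun t ht => by
        rw [← mul_sub, norm_mul]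
        refine mul_le_mul (hNB w w.2 t ht) ?_ (norm_nonneg _) (hB0 t ht)
        rw [add_sub_add_left_eq_sub, ext_mem _ _ (hW w w.2 t ht.le), ext_mem _ _ (hW w w.2 t ht.le), ← dist_eq_norm]
        exact BoundedContinuousFunction.dist_coe_le_dist _)
    refine this.trans ?_
    rw [integral_mul_const]
    push_cast
    gcongr
  let η := ContractingWith.fixedPoint T hcon
  have hη : T η = η := hcon.fixedPoint_isFixedPt
  have hfix : ∀ w ∈ W, ext η w = ∫ t in Ioi (0:ℝ), N w t * (1 + ext η (w + (t:ℂ) • e)) := by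
    intro w hw
    conv_lhs => rw [ext_mem _ _ hw, ← hη]
    rfl
  refine ⟨ext η, ext_cont η, fun w hw => ?_, hfix, fun hol => ?_⟩
  · have hn : ‖η‖ ≤ 1 / 2 * (1 + ‖η‖) := by
      conv_lhs => rw [← hη]
      exact (BoundedContinuousFunction.norm_le (by positivity)).2 fun w =>
        Tle (ext η) ‖η‖ (norm_nonneg _) (fun w _ => ext_le η w) w w.2
    exact (ext_le η w).trans (by linarith)
  · have hit : ∀ n, HolOn W (ext (T^[n] 0)) := by
      intro n
      induction n with
      | zero => exact (HolOn.const 0).congr fun w hw => by simp [ext]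
      | succ n ih =>
        rw [Function.iterate_succ', Function.comp]
        set f := T^[n] 0
        have : HolOn W (fun w => ∫ t in Ioi (0:ℝ), N w t * (1 + ext f (w + (t:ℂ) • e))) := by
          refine HolOn.integral (hB.mul_const (1 + ‖f‖)) (intc _ (ext_cont f)) (hae fun t ht => ?_)
            (hae fun t ht => hbd _ _ (fun w _ => ext_le f w) t ht)
          refine (hol t ht).mul ((HolOn.const 1).add (ih.comp_diff (by fun_prop) (fun w hw => hW w hw t ht.le)))
        refine this.congr fun w hw => ?_
        rw [ext_mem _ _ hw]; rfl
    have hlim : TendstoUniformlyOn (fun n => ext (T^[n] 0)) (ext η) atTop W := by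
      have h0 := hcon.tendsto_iterate_fixedPoint 0
      rw [Metric.tendstoUniformlyOn_iff]
      intro ε hε
      filter_upwards [(Metric.tendsto_nhds.1 h0) ε hε] with n hn w hw
      rw [ext_mem _ _ hw, ext_mem _ _ hw]
      exact (BoundedContinuousFunction.dist_coe_le_dist _).trans_lt (by rwa [dist_comm])
    refine ⟨ext_cont η, fun U γ hU hγ hm => ?_⟩
    have := (hlim.comp γ).mono (fun x hx => hm hx)
    exact this.tendstoLocallyUniformlyOn.differentiableOn
      (Eventually.of_forall fun n => (hit n).2 U γ hU hγ hm) hU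

end PTC

open Complex Filter

namespace PTC
open Topology Set MeasureTheory

theorem integral_shift {F : Type*} [NormedAddCommGroup F] [NormedSpace ℝ F] (f : ℝ → F) (τ : ℝ) : ∫ t in Ioi (0:ℝ), f (τ + t) = ∫ s in Ioi τ, f s := by
  have := (measurePreserving_add_left (volume : Measure ℝ) τ).setIntegral_preimage_emb
    (MeasurableEquiv.addLeft τ).measurableEmbedding f (Ioi τ)
  rw [← this]; congr 2
  simp

theorem integrableOn_shift {F : Type*} [NormedAddCommGroup F] {f : ℝ → F} {τ : ℝ} (h : IntegrableOn f (Ioi τ)) :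
    IntegrableOn (fun t => f (τ + t)) (Ioi 0) := by
  have := (measurePreserving_add_left (volume : Measure ℝ) τ).integrableOn_comp_preimage
    (MeasurableEquiv.addLeft τ).measurableEmbedding (f := f) (s := Ioi τ)
  have h2 := this.2 h
  simpa [Function.comp_def] using h2

theorem hasDerivAt_tail {f : ℝ → ℂ} {t0 τ : ℝ} (hτ : t0 < τ) (hc : ContinuousOn f (Ioi t0))
    (hi : ∀ s, t0 < s → IntegrableOn f (Ioi s)) : HasDerivAt (fun s => ∫ t in Ioi s, f t) (-f τ) τ := by
  obtain ⟨σ, h1, h2⟩ := exists_between hτ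
  have hIoi : ∀ s, σ < s → ∫ t in Ioi s, f t = (∫ t in Ioi σ, f t) - ∫ t in σ..s, f t := by
    intro s hs
    have := intervalIntegral.integral_interval_add_Ioi' (μ := volume) (f := f) (a := σ) (b := s)
      ((intervalIntegrable_iff_integrableOn_Ioc_of_le hs.le).2 ((hi σ h1).mono_set Ioc_subset_Ioi_self))
      (hi s (h1.trans hs))
    rw [← this]; ring
  have hd : HasDerivAt (fun s => (∫ t in Ioi σ, f t) - ∫ t in σ..s, f t) (-f τ) τ := by
    have hca : ContinuousAt f τ := hc.continuousAt (Ioi_mem_nhds hτ)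
    have := intervalIntegral.integral_hasDerivAt_right (f := f) (a := σ) (b := τ)
      ((intervalIntegrable_iff_integrableOn_Ioc_of_le h2.le).2 ((hi σ h1).mono_set Ioc_subset_Ioi_self))
      (hc.stronglyMeasurableAtFilter isOpen_Ioi τ hτ) hca
    exact (this.const_sub _)
  refine hd.congr_of_eventuallyEq ?_
  filter_upwards [Ioi_mem_nhds h2] with s hs using hIoi s hs

theorem exp_le_one_aux {x y : ℂ} (h : y.re ≤ x.re) : ‖Complex.exp (-2 * (x - y))‖ ≤ 1 := by
  rw [Complex.norm_exp]
  simpa using h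

theorem kernel_le_two {x y : ℂ} (h : y.re ≤ x.re) : ‖1 - Complex.exp (-2 * (x - y))‖ ≤ 2 := by
  refine (norm_sub_le _ _).trans ?_
  have := exp_le_one_aux h
  simp only [norm_one]; linarith

theorem ray_deriv {t0 : ℝ} {Θ q h η b : ℝ → ℂ} (hΘ : ∀ t, t0 < t → HasDerivAt Θ (q t) t)
    (hmono : ∀ t, t0 < t → ∀ s, 0 ≤ s → (Θ t).re ≤ (Θ (t + s)).re)
    (hc : ContinuousOn h (Ioi t0)) (hi : ∀ s, t0 < s → IntegrableOn h (Ioi s))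
    (hη : ∀ t, t0 < t → η t = ∫ s in Ioi (0:ℝ), (1 - Complex.exp (-2 * (Θ (t + s) - Θ t))) * h (t + s))
    (hb : ∀ t, t0 < t → b t = ∫ s in Ioi (0:ℝ), Complex.exp (-2 * (Θ (t + s) - Θ t)) * h (t + s)) :
    ∀ t, t0 < t → HasDerivAt η (-2 * q t * b t) t ∧ HasDerivAt b (2 * q t * b t - h t) t := by
  have hΘc : ContinuousOn Θ (Ioi t0) := fun t ht => (hΘ t ht).continuousAt.continuousWithinAt
  have hEc : ContinuousOn (fun s => Complex.exp (-2 * Θ s) * h s) (Ioi t0) := by fun_prop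
  have hEi : ∀ s, t0 < s → IntegrableOn (fun s => Complex.exp (-2 * Θ s) * h s) (Ioi s) := by
    intro s hs
    refine Integrable.mono' ((hi s hs).norm.const_mul (Real.exp (-2 * (Θ s).re)))
      ((hEc.mono (Ioi_subset_Ioi hs.le)).aestronglyMeasurable measurableSet_Ioi) ?_
    refine (ae_restrict_iff' measurableSet_Ioi).2 (Eventually.of_forall fun t ht => ?_)
    rw [norm_mul, Complex.norm_exp]
    gcongr
    have := hmono s hs (t - s) (sub_nonneg.2 (le_of_lt ht))
    simp at this ⊢; exact this
  have hb' : ∀ t, t0 < t → b t = Complex.exp (2 * Θ t) * ∫ s in Ioi t, Complex.exp (-2 * Θ s) * h s := by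
    intro t ht
    rw [hb t ht, ← integral_const_mul]
    rw [← integral_shift (fun s => Complex.exp (2 * Θ t) * (Complex.exp (-2 * Θ s) * h s)) t]
    refine integral_congr_ae (Eventually.of_forall fun s => ?_)
    simp only
    rw [← mul_assoc, ← Complex.exp_add]; congr 2; ring
  have hη' : ∀ t, t0 < t → η t = (∫ s in Ioi t, h s) - b t := by
    intro t ht
    rw [hη t ht, hb t ht, ← integral_shift h, ← integral_sub (integrableOn_shift (hi t ht))]
    · refine integral_congr_ae (Eventually.of_forall fun s => ?_)
      simp only; ring
    · have := integrableOn_shift ((hEi t ht).const_mul (Complex.exp (2 * Θ t)))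
      refine this.congr (Eventually.of_forall fun s => ?_)
      simp only
      rw [← mul_assoc, ← Complex.exp_add]; congr 2; ring
  have hbd : ∀ t, t0 < t → HasDerivAt b (2 * q t * b t - h t) t := by
    intro t ht
    have h1 : HasDerivAt (fun t => Complex.exp (2 * Θ t)) (Complex.exp (2 * Θ t) * (2 * q t)) t :=
      ((hΘ t ht).const_mul 2).cexp
    have h2 := h1.mul (hasDerivAt_tail ht hEc hEi)
    refine (h2.congr_of_eventuallyEq ?_).congr_deriv ?_
    · filter_upwards [Ioi_mem_nhds ht] with s hs using hb' s hs
    · rw [hb' t ht]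
      have : Complex.exp (2 * Θ t) * Complex.exp (-2 * Θ t) = 1 := by
        rw [← Complex.exp_add]; simp
      linear_combination (-h t) * this
  intro t ht
  refine ⟨?_, hbd t ht⟩
  have := (hasDerivAt_tail ht hc hi).sub (hbd t ht)
  refine (this.congr_of_eventuallyEq ?_).congr_deriv (by ring)
  filter_upwards [Ioi_mem_nhds ht] with s hs using hη' s hs

/-- The WKB ansatz solves the equation. -/
theorem wkb_solves {η b g q q1 : ℝ → ℂ} {m q2 Q : ℂ} {t : ℝ} (hq0 : q t ≠ 0)
    (hq : HasDerivAt q (q1 t) t) (hq1 : HasDerivAt q1 q2 t)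
    (hg : HasDerivAt g (g t * (-q t - q1 t / (2 * q t))) t)
    (hη : HasDerivAt η (-2 * q t * b t) t) (hb : HasDerivAt b (2 * q t * b t - m * (1 + η t)) t)
    (hm : 2 * q t * m = Q - q t ^ 2 + q2 / (2 * q t) - 3 * q1 t ^ 2 / (4 * q t ^ 2)) :
    HasDerivAt (fun t => g t * (1 + η t)) (g t * ((-q t - q1 t / (2 * q t)) * (1 + η t) - 2 * q t * b t)) t ∧
    HasDerivAt (fun t => g t * ((-q t - q1 t / (2 * q t)) * (1 + η t) - 2 * q t * b t)) (Q * (g t * (1 + η t))) t := by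
  constructor
  · exact (hg.mul (hη.const_add 1)).congr_deriv (by ring)
  · have h1 := hg.mul ((((hq.neg).sub (hq1.div (hq.const_mul 2) (by simpa using hq0))).mul (hη.const_add 1)).sub
      ((hq.const_mul 2).mul hb))
    refine HasDerivAt.congr_deriv h1 ?_
    have hm' : Q = 2 * q t * m + q t ^ 2 - q2 / (2 * q t) + 3 * q1 t ^ 2 / (4 * q t ^ 2) := by
      rw [hm]; ring
    rw [hm']
    simp only [Pi.mul_apply, Pi.neg_apply, Pi.sub_apply, Pi.div_apply]
    field_simp
    ring

end PTC

open Complex Filter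

namespace PTC
open Topology Set MeasureTheory

noncomputable def sq (z : ℂ) : ℂ := z ^ (1 / 2 : ℂ)

theorem sq_sq (z : ℂ) : sq z ^ 2 = z := by
  rw [sq, ← Complex.cpow_nat_mul]; norm_num

theorem sq_ne {z : ℂ} (h : z ≠ 0) : sq z ≠ 0 := by
  intro h1; apply h; rw [← sq_sq z, h1]; simp

theorem norm_sq_sq (z : ℂ) : ‖sq z‖ ^ 2 = ‖z‖ := by rw [← norm_pow, sq_sq]

theorem norm_sq (z : ℂ) : ‖sq z‖ = ‖z‖ ^ (1 / 2 : ℝ) := by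
  rw [← norm_sq_sq z, ← Real.rpow_natCast, ← Real.rpow_mul (norm_nonneg _)]; norm_num

theorem norm_sq_mul (z : ℂ) : ‖sq z‖ * ‖z‖ = ‖z‖ ^ (3 / 2 : ℝ) := by
  rw [norm_sq]
  by_cases h : ‖z‖ = 0
  · rw [h]; norm_num
  have h0 : 0 < ‖z‖ := lt_of_le_of_ne (norm_nonneg _) (Ne.symm h)
  nth_rewrite 2 [← Real.rpow_one ‖z‖]
  rw [← Real.rpow_add h0]; norm_num

theorem sq_hasDerivAt {z : ℂ} (h : z ∈ slitPlane) : HasDerivAt sq (sq z / (2 * z)) z := by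
  have h0 : z ≠ 0 := slitPlane_ne_zero h
  have := (hasDerivAt_id z).cpow_const (c := (1 / 2 : ℂ)) h
  refine HasDerivAt.congr_deriv this ?_
  simp only [id, mul_one]
  rw [Complex.cpow_sub _ _ h0, Complex.cpow_one, sq]; field_simp

theorem sq_diff {z : ℂ} (h : z ∈ slitPlane) : DifferentiableAt ℂ sq z := (sq_hasDerivAt h).differentiableAt

theorem sq_re_pos {z : ℂ} (h : z ∈ slitPlane) : 0 < (sq z).re := by
  have h0 : z ≠ 0 := slitPlane_ne_zero h
  rw [sq, Complex.cpow_def_of_ne_zero h0, Complex.exp_re]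
  have hlog : (Complex.log z * (1 / 2)).im = Complex.arg z / 2 := by
    have : (Complex.log z * (1 / 2)) = ((1 / 2 : ℝ) : ℂ) * Complex.log z := by push_cast; ring
    rw [this, Complex.im_ofReal_mul, Complex.log_im]; ring
  rw [hlog]
  have h1 := Complex.neg_pi_lt_arg z
  have h2 := (Complex.mem_slitPlane_iff_arg.1 h).1
  have h3 := Complex.arg_le_pi z
  have h4 : Complex.arg z < Real.pi := lt_of_le_of_ne h3 h2
  exact mul_pos (Real.exp_pos _) (Real.cos_pos_of_mem_Ioo ⟨by linarith, by linarith⟩)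

/-- the sector -/
def sect : Set ℂ := {z | |z.im| < 1.4 * z.re}

theorem sect_re {z : ℂ} (h : z ∈ sect) : 0 < z.re := by
  have : |z.im| < 1.4 * z.re := h
  have := abs_nonneg z.im
  linarith

theorem sect_slit {z : ℂ} (h : z ∈ sect) : z ∈ slitPlane := Or.inl (sect_re h)

theorem sect_norm {z : ℂ} (h : z ∈ sect) : ‖z‖ ≤ 2.4 * z.re := by
  have h1 : |z.im| < 1.4 * z.re := h
  have h0 := sect_re h
  have := Complex.norm_le_abs_re_add_abs_im z
  rw [abs_of_pos h0] at this
  linarith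

theorem re_le_norm' (z : ℂ) : z.re ≤ ‖z‖ := (le_abs_self _).trans (Complex.abs_re_le_norm z)

theorem sect_cube {z : ℂ} (h : z ∈ sect) : 0.1 * (‖sq z‖ * ‖z‖) ≤ (sq z * z).re := by
  have hz := sq_sq z
  have hu := sq_re_pos (sect_slit h)
  have hn := norm_sq_sq z
  have h1 : |z.im| < 1.4 * z.re := h
  set u := (sq z).re with hu'
  set v := (sq z).im with hv'
  have hre : z.re = u ^ 2 - v ^ 2 := by
    rw [← hz, pow_two, Complex.mul_re]; ring
  have him : z.im = 2 * u * v := by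
    rw [← hz, pow_two, Complex.mul_im]; ring
  have hcube : (sq z * z).re = u * (u ^ 2 - 3 * v ^ 2) := by
    rw [Complex.mul_re, hre, him, ← hu', ← hv']; ring
  have hv : v ^ 2 ≤ 0.27 * u ^ 2 := by
    by_contra hcon
    push Not at hcon
    rw [hre, him, abs_mul, abs_of_pos (by positivity : 0 < 2 * u)] at h1
    have h2 : 0.519 * u ≤ |v| := by
      apply le_of_sq_le_sq _ (abs_nonneg v) |>.trans le_rfl
      rw [sq_abs]; nlinarith
    nlinarith
  have hnorm : ‖sq z‖ ^ 2 = u ^ 2 + v ^ 2 := by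
    rw [← Complex.normSq_eq_norm_sq, Complex.normSq_apply]; ring
  have hle : ‖sq z‖ ≤ 1.13 * u := by
    apply le_of_sq_le_sq _ (by positivity) |>.trans le_rfl
    rw [hnorm]; nlinarith
  rw [hcube, ← hn]
  have h0 := norm_nonneg (sq z)
  calc 0.1 * (‖sq z‖ * ‖sq z‖ ^ 2) = 0.1 * ‖sq z‖ ^ 3 := by ring
    _ ≤ 0.1 * (1.13 * u) ^ 3 := by gcongr
    _ ≤ u * (u ^ 2 - 3 * (0.27 * u ^ 2)) := by nlinarith [pow_pos hu 3]
    _ ≤ _ := by gcongr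

noncomputable def Th (p z : ℂ) : ℂ := sq z * (2 / 5 * z ^ 2 + p)
noncomputable def qq (p z : ℂ) : ℂ := sq z * (z + p / (2 * z))
noncomputable def qq1 (p z : ℂ) : ℂ := sq z * (3 / 2 - p / (4 * z ^ 2))
noncomputable def qq2 (p z : ℂ) : ℂ := sq z * (3 / (4 * z) + 3 * p / (8 * z ^ 3))
noncomputable def RR (p l z : ℂ) : ℂ := l - p ^ 2 / (4 * z) +
  (3 / (4 * z) + 3 * p / (8 * z ^ 3)) / (2 * (z + p / (2 * z))) -
  3 * (3 / 2 - p / (4 * z ^ 2)) ^ 2 / (4 * (z + p / (2 * z)) ^ 2)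
noncomputable def mm (p l z : ℂ) : ℂ := RR p l z / (2 * qq p z)
noncomputable def ss (p z : ℂ) : ℂ := z ^ (-(3 / 4) : ℂ) * (1 + p / (2 * z ^ 2)) ^ (-(1 / 2) : ℂ)
noncomputable def gg (p z : ℂ) : ℂ := Complex.exp (-Th p z) * ss p z

theorem Th_hasDerivAt {p z : ℂ} (h : z ∈ slitPlane) : HasDerivAt (Th p) (qq p z) z := by
  have h0 : z ≠ 0 := slitPlane_ne_zero h
  have := (sq_hasDerivAt h).mul ((((hasDerivAt_id z).pow 2).const_mul (2 / 5 : ℂ)).add_const p)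
  refine HasDerivAt.congr_deriv this ?_
  simp only [qq, Pi.pow_apply, id]; field_simp; push_cast; ring

theorem qq_hasDerivAt {p z : ℂ} (h : z ∈ slitPlane) : HasDerivAt (qq p) (qq1 p z) z := by
  have h0 : z ≠ 0 := slitPlane_ne_zero h
  have := (sq_hasDerivAt h).mul ((hasDerivAt_id z).add ((hasDerivAt_const z p).div ((hasDerivAt_id z).const_mul 2) (by simpa using h0)))
  refine HasDerivAt.congr_deriv this ?_
  simp only [qq1, Pi.add_apply, Pi.div_apply, id]; field_simp; ring

theorem qq1_hasDerivAt {p z : ℂ} (h : z ∈ slitPlane) : HasDerivAt (qq1 p) (qq2 p z) z := by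
  have h0 : z ≠ 0 := slitPlane_ne_zero h
  have := (sq_hasDerivAt h).mul (((hasDerivAt_const z p).div (((hasDerivAt_id z).pow 2).const_mul 4) (by simpa using h0)).const_sub (3 / 2))
  refine HasDerivAt.congr_deriv this ?_
  simp only [qq2, Pi.pow_apply, Pi.div_apply, id]; field_simp; push_cast; ring

/-- the half-sector domain -/
def dom (X : ℝ) : Set ℂ := {z | X < z.re} ∩ sect

theorem ratio_le {M : ℝ} (hM : 1 ≤ M) {p z : ℂ} (hp : ‖p‖ ≤ M) (hz : M ≤ ‖z‖) : ‖p / (2 * z ^ 2)‖ ≤ 1 / 2 := by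
  rw [norm_div, norm_mul, norm_pow, div_le_iff₀ (by simp; apply pow_pos; linarith)]
  simp; nlinarith

theorem zp_ge {M : ℝ} (hM : 1 ≤ M) {p z : ℂ} (hp : ‖p‖ ≤ M) (hz : M ≤ ‖z‖) : ‖z‖ / 2 ≤ ‖z + p / (2 * z)‖ := by
  have hz0 : z ≠ 0 := norm_pos_iff.1 (by linarith)
  have : z + p / (2 * z) = z * (1 + p / (2 * z ^ 2)) := by field_simp
  rw [this, norm_mul]
  have h1 := ratio_le hM hp hz
  have h2 : 1 - 1 / 2 ≤ ‖1 + p / (2 * z ^ 2)‖ := by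
    have := norm_sub_le_norm_add (1:ℂ) (p / (2 * z ^ 2))
    rw [norm_one] at this
    linarith
  nlinarith [norm_nonneg z]

theorem qq_ne {M : ℝ} (hM : 1 ≤ M) {p z : ℂ} (hp : ‖p‖ ≤ M) (hz : M ≤ ‖z‖) : qq p z ≠ 0 := by
  have hz0 : z ≠ 0 := norm_pos_iff.1 (by linarith)
  refine mul_ne_zero (sq_ne hz0) (norm_pos_iff.1 ?_)
  have := zp_ge hM hp hz
  linarith

theorem RR_le {M : ℝ} (hM : 1 ≤ M) {p l z : ℂ} (hp : ‖p‖ ≤ M) (hl : ‖l‖ ≤ M) (hz : M ≤ ‖z‖) :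
    ‖RR p l z‖ ≤ 20 * M ^ 2 := by
  have hz1 : 1 ≤ ‖z‖ := hM.trans hz
  have hzp := zp_ge hM hp hz
  have hzp1 : 1 / 2 ≤ ‖z + p / (2 * z)‖ := by linarith
  have hp0 := norm_nonneg p
  have hz2 : 1 ≤ ‖z‖ ^ 2 := one_le_pow₀ hz1
  have hz3 : 1 ≤ ‖z‖ ^ 3 := one_le_pow₀ hz1
  have a1 : ‖p ^ 2 / (4 * z)‖ ≤ M ^ 2 / 4 := by
    rw [norm_div, norm_mul, norm_pow]; simp; gcongr; linarith
  have b1 : ‖3 / (4 * z) + 3 * p / (8 * z ^ 3)‖ ≤ 3 / 4 + 3 * M / 8 := by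
    refine (norm_add_le _ _).trans ?_
    rw [norm_div, norm_div, norm_mul, norm_mul, norm_mul, norm_pow]; simp
    gcongr <;> linarith
  have a2 : ‖(3 / (4 * z) + 3 * p / (8 * z ^ 3)) / (2 * (z + p / (2 * z)))‖ ≤ 3 / 4 + 3 * M / 8 := by
    rw [norm_div, norm_mul]
    simp only [Complex.norm_ofNat]
    refine (div_le_self (norm_nonneg _) ?_).trans b1
    linarith
  have b2 : ‖(3 / 2 - p / (4 * z ^ 2))‖ ≤ 3 / 2 + M / 4 := by
    refine (norm_sub_le _ _).trans ?_
    rw [norm_div, norm_div, norm_mul, norm_pow]; simp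
    gcongr; linarith
  have a3 : ‖3 * (3 / 2 - p / (4 * z ^ 2)) ^ 2 / (4 * (z + p / (2 * z)) ^ 2)‖ ≤ 3 * (3 / 2 + M / 4) ^ 2 := by
    rw [norm_div, norm_mul, norm_mul, norm_pow, norm_pow]
    simp only [Complex.norm_ofNat]
    refine (div_le_self (by positivity) ?_).trans (by gcongr)
    nlinarith
  have := norm_sub_le (l - p ^ 2 / (4 * z) +
  (3 / (4 * z) + 3 * p / (8 * z ^ 3)) / (2 * (z + p / (2 * z)))) (3 * (3 / 2 - p / (4 * z ^ 2)) ^ 2 / (4 * (z + p / (2 * z)) ^ 2))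
  have h2 := norm_add_le (l - p ^ 2 / (4 * z)) ((3 / (4 * z) + 3 * p / (8 * z ^ 3)) / (2 * (z + p / (2 * z))))
  have h3 := norm_sub_le l (p ^ 2 / (4 * z))
  rw [RR]
  nlinarith

theorem qq_norm_ge {M : ℝ} (hM : 1 ≤ M) {p z : ℂ} (hp : ‖p‖ ≤ M) (hz : M ≤ ‖z‖) :
    ‖z‖ ^ (3 / 2 : ℝ) ≤ ‖2 * qq p z‖ := by
  rw [← norm_sq_mul, qq, norm_mul, norm_mul]
  simp only [Complex.norm_ofNat]
  have := zp_ge hM hp hz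
  nlinarith [norm_nonneg (sq z), mul_le_mul_of_nonneg_left this (norm_nonneg (sq z))]

theorem mm_le {M : ℝ} (hM : 1 ≤ M) {p l z : ℂ} (hp : ‖p‖ ≤ M) (hl : ‖l‖ ≤ M) (hz : M ≤ z.re) :
    ‖mm p l z‖ ≤ 20 * M ^ 2 * z.re ^ (-(3 / 2) : ℝ) := by
  have hz' := hz.trans (re_le_norm' z)
  have hpos : 0 < z.re := by linarith
  rw [mm, norm_div]
  have h1 := RR_le hM hp hl hz'
  have h2 := qq_norm_ge hM hp hz'
  have h3 : z.re ^ (3 / 2 : ℝ) ≤ ‖z‖ ^ (3 / 2 : ℝ) := by gcongr; exact re_le_norm' z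
  rw [Real.rpow_neg hpos.le, ← div_eq_mul_inv]
  have : 0 < z.re ^ (3 / 2 : ℝ) := by positivity
  gcongr
  linarith

theorem qq_re_nonneg {M : ℝ} (hM : 5 ≤ M) {p z : ℂ} (hp : ‖p‖ ≤ M) (hz : M ≤ z.re) (hs : z ∈ sect) :
    0 ≤ (qq p z).re := by
  have hz' := hz.trans (re_le_norm' z)
  have hz0 : z ≠ 0 := norm_pos_iff.1 (by linarith)
  have h1 := sect_cube hs
  have h2 : qq p z = sq z * z + sq z * (p / (2 * z)) := by rw [qq]; ring
  have h3 : ‖sq z * (p / (2 * z))‖ ≤ ‖sq z‖ * (1 / 2) := by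
    rw [norm_mul]
    gcongr
    rw [norm_div, norm_mul, div_le_iff₀ (by simp; exact hz0)]
    simp; linarith
  have h4 := (Complex.abs_re_le_norm (sq z * (p / (2 * z))))
  rw [h2, Complex.add_re]
  have h5 := neg_abs_le (sq z * (p / (2 * z))).re
  nlinarith [norm_nonneg (sq z)]

theorem base_slit {M : ℝ} (hM : 1 ≤ M) {p z : ℂ} (hp : ‖p‖ ≤ M) (hz : M ≤ ‖z‖) : 1 + p / (2 * z ^ 2) ∈ slitPlane := by
  left
  have h1 := ratio_le hM hp hz
  have := neg_abs_le (p / (2 * z ^ 2)).re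
  have := Complex.abs_re_le_norm (p / (2 * z ^ 2))
  rw [Complex.add_re, Complex.one_re]; linarith

theorem ss_hasDerivAt {M : ℝ} (hM : 1 ≤ M) {p z : ℂ} (hp : ‖p‖ ≤ M) (hz : M ≤ z.re) :
    HasDerivAt (ss p) (ss p z * (-qq1 p z / (2 * qq p z))) z := by
  have hz' := hz.trans (re_le_norm' z)
  have hz0 : z ≠ 0 := norm_pos_iff.1 (by linarith)
  have hzs : z ∈ slitPlane := Or.inl (by linarith)
  have hb := base_slit hM hp hz'
  have hb0 := slitPlane_ne_zero hb
  have h1 := (hasDerivAt_id z).cpow_const (c := (-(3 / 4) : ℂ)) hzs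
  have h2 : HasDerivAt (fun z : ℂ => 1 + p / (2 * z ^ 2)) (-p / z ^ 3) z := by
    have := ((hasDerivAt_const z p).div (((hasDerivAt_id z).pow 2).const_mul 2) (by simpa using hz0)).const_add 1
    refine HasDerivAt.congr_deriv this ?_
    simp only [Pi.pow_apply, id]; field_simp; push_cast; ring
  have h3 := h2.cpow_const (c := (-(1 / 2) : ℂ)) hb
  have h4 := h1.mul h3
  refine HasDerivAt.congr_deriv h4 ?_
  have hzp : z + p / (2 * z) ≠ 0 := by
    have := zp_ge hM hp hz'
    exact norm_pos_iff.1 (by linarith)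
  simp only [id, mul_one]
  rw [Complex.cpow_sub _ _ hz0, Complex.cpow_sub _ _ hb0, Complex.cpow_one, Complex.cpow_one, ss, qq1, qq]
  have hs := sq_ne hz0
  have e1 : z + p / (2 * z) = z * (1 + p / (2 * z ^ 2)) := by field_simp
  rw [e1]
  have e2 : p / z ^ 3 = 2 / z * (p / (2 * z ^ 2)) := by field_simp
  have e3 : p / (4 * z ^ 2) = 1 / 2 * (p / (2 * z ^ 2)) := by field_simp; ring
  rw [neg_div, e2, e3]
  generalize p / (2 * z ^ 2) = r at *
  generalize z ^ (-(3 / 4) : ℂ) = A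
  generalize (1 + r) ^ (-(1 / 2) : ℂ) = B
  field_simp
  ring

theorem gg_hasDerivAt {M : ℝ} (hM : 1 ≤ M) {p z : ℂ} (hp : ‖p‖ ≤ M) (hz : M ≤ z.re) :
    HasDerivAt (gg p) (gg p z * (-qq p z - qq1 p z / (2 * qq p z))) z := by
  have hzs : z ∈ slitPlane := Or.inl (by linarith)
  have := ((Th_hasDerivAt (p := p) hzs).neg.cexp).mul (ss_hasDerivAt hM hp hz)
  refine HasDerivAt.congr_deriv this ?_
  simp only [gg, Pi.neg_apply]; ring

theorem mm_eq {M : ℝ} (hM : 1 ≤ M) {p l z : ℂ} (hp : ‖p‖ ≤ M) (hz : M ≤ z.re) :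
    2 * qq p z * mm p l z = (z ^ 3 + p * z + l) - qq p z ^ 2 + qq2 p z / (2 * qq p z) -
      3 * qq1 p z ^ 2 / (4 * qq p z ^ 2) := by
  have hz' := hz.trans (re_le_norm' z)
  have hz0 : z ≠ 0 := norm_pos_iff.1 (by linarith)
  have hq := qq_ne hM hp hz'
  have hzp : z + p / (2 * z) ≠ 0 := by
    have := zp_ge hM hp hz'
    exact norm_pos_iff.1 (by linarith)
  rw [mm, mul_div_cancel₀ _ (by simpa using hq)]
  have hs := sq_ne hz0
  have e1 : qq2 p z / (2 * qq p z) = (3 / (4 * z) + 3 * p / (8 * z ^ 3)) / (2 * (z + p / (2 * z))) := by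
    rw [qq2, qq, mul_left_comm, mul_div_mul_left _ _ hs]
  have e2 : 3 * qq1 p z ^ 2 / (4 * qq p z ^ 2) = 3 * (3 / 2 - p / (4 * z ^ 2)) ^ 2 / (4 * (z + p / (2 * z)) ^ 2) := by
    rw [qq1, qq, mul_pow, mul_pow, mul_left_comm, mul_left_comm 4, mul_div_mul_left _ _ (pow_ne_zero 2 hs)]
  have e3 : qq p z ^ 2 = z ^ 3 + p * z + p ^ 2 / (4 * z) := by
    rw [qq, mul_pow, sq_sq]; field_simp; ring
  rw [e1, e2, e3, RR]; ring

end PTC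

open Complex Filter

namespace PTC
open Topology Set MeasureTheory

theorem diff_div {E : Type*} [NormedAddCommGroup E] [NormedSpace ℂ E] {f g : E → ℂ} {x : E}
    (hf : DifferentiableAt ℂ f x) (hg : DifferentiableAt ℂ g x) (h : g x ≠ 0) :
    DifferentiableAt ℂ (fun x => f x / g x) x := by
  simp only [div_eq_mul_inv]
  exact hf.mul ((differentiableAt_inv h).comp x hg)

def WW (X M : ℝ) : Set (ℂ × ℂ × ℂ) := {w | w.1 ∈ dom X ∧ ‖w.2.1‖ < M ∧ ‖w.2.2‖ < M}

theorem dom_open (X : ℝ) : IsOpen (dom X) := by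
  refine IsOpen.inter (isOpen_lt continuous_const Complex.continuous_re) ?_
  exact isOpen_lt (by fun_prop) (by fun_prop)

theorem dom_shift {X : ℝ} {z : ℂ} (hz : z ∈ dom X) {t : ℝ} (ht : 0 ≤ t) : z + t ∈ dom X := by
  obtain ⟨h1, h2⟩ := hz
  have h1' : X < z.re := h1
  have h2' : |z.im| < 1.4 * z.re := h2
  refine ⟨?_, ?_⟩
  · change X < (z + t).re
    simp; linarith
  · change |(z + t).im| < 1.4 * (z + t).re
    simp; linarith

theorem WW_shift {X M : ℝ} : ∀ w ∈ WW X M, ∀ t : ℝ, 0 ≤ t → w + (t:ℂ) • ((1:ℂ), (0:ℂ), (0:ℂ)) ∈ WW X M := by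
  rintro ⟨z, p, l⟩ ⟨h1, h2, h3⟩ t ht
  simp only [Prod.smul_mk, Prod.mk_add_mk, smul_eq_mul, mul_one, mul_zero, add_zero]
  exact ⟨dom_shift h1 ht, h2, h3⟩

theorem rpow_shift_int {x : ℝ} (hx : 0 < x) : IntegrableOn (fun t : ℝ => (x + t) ^ (-(3 / 2) : ℝ)) (Ioi 0) ∧
    ∫ t in Ioi (0:ℝ), (x + t) ^ (-(3 / 2) : ℝ) = 2 * x ^ (-(1 / 2) : ℝ) := by
  refine ⟨integrableOn_shift (integrableOn_Ioi_rpow_of_lt (by norm_num) hx), ?_⟩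
  rw [integral_shift (fun t : ℝ => t ^ (-(3 / 2) : ℝ)), integral_Ioi_rpow_of_lt (by norm_num) hx]
  norm_num; ring

theorem Th_diffOn (X M : ℝ) : DifferentiableOn ℂ (fun w : ℂ × ℂ × ℂ => Th w.2.1 w.1) (WW X M) := by
  intro w hw
  have h : DifferentiableAt ℂ sq w.1 := sq_diff (sect_slit hw.1.2)
  apply DifferentiableAt.differentiableWithinAt
  unfold Th
  have h2 : DifferentiableAt ℂ (fun w : ℂ × ℂ × ℂ => sq w.1) w := h.comp w (by fun_prop)
  fun_prop

theorem mm_diffOn (X M : ℝ) (hM : 1 ≤ M) (hX : M ≤ X) : DifferentiableOn ℂ (fun w : ℂ × ℂ × ℂ => mm w.2.1 w.2.2 w.1) (WW X M) := by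
  intro w hw
  have h : DifferentiableAt ℂ sq w.1 := sq_diff (sect_slit hw.1.2)
  have hre : X < w.1.re := hw.1.1
  have hn : M ≤ ‖w.1‖ := by linarith [re_le_norm' w.1]
  have hz0 : w.1 ≠ 0 := norm_pos_iff.1 (by linarith)
  have hzp : w.1 + w.2.1 / (2 * w.1) ≠ 0 := by
    have := zp_ge hM hw.2.1.le hn
    exact norm_pos_iff.1 (by linarith)
  have hq := qq_ne hM hw.2.1.le hn
  apply DifferentiableAt.differentiableWithinAt
  have h2 : DifferentiableAt ℂ (fun w : ℂ × ℂ × ℂ => sq w.1) w := h.comp w (by fun_prop)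
  have hzp' : DifferentiableAt ℂ (fun w : ℂ × ℂ × ℂ => w.1 + w.2.1 / (2 * w.1)) w := by
    have k0 : DifferentiableAt ℂ (fun w : ℂ × ℂ × ℂ => w.2.1 / (2 * w.1)) w :=
      diff_div (by fun_prop) (by fun_prop) (by simpa using hz0)
    exact DifferentiableAt.add (by fun_prop) k0
  have hqd : DifferentiableAt ℂ (fun w : ℂ × ℂ × ℂ => qq w.2.1 w.1) w := h2.mul hzp'
  have k1 : DifferentiableAt ℂ (fun w : ℂ × ℂ × ℂ => w.2.1 ^ 2 / (4 * w.1)) w :=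
    diff_div (by fun_prop) (by fun_prop) (by simpa using hz0)
  have k2 : DifferentiableAt ℂ (fun w : ℂ × ℂ × ℂ => 3 / (4 * w.1)) w :=
    diff_div (by fun_prop) (by fun_prop) (by simpa using hz0)
  have k3 : DifferentiableAt ℂ (fun w : ℂ × ℂ × ℂ => 3 * w.2.1 / (8 * w.1 ^ 3)) w :=
    diff_div (by fun_prop) (by fun_prop) (by simpa using hz0)
  have k4 : DifferentiableAt ℂ (fun w : ℂ × ℂ × ℂ => w.2.1 / (4 * w.1 ^ 2)) w :=
    diff_div (by fun_prop) (by fun_prop) (by simpa using hz0)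
  have k5 : DifferentiableAt ℂ (fun w : ℂ × ℂ × ℂ => (3 / (4 * w.1) + 3 * w.2.1 / (8 * w.1 ^ 3)) / (2 * (w.1 + w.2.1 / (2 * w.1)))) w :=
    diff_div (by fun_prop) (by fun_prop) (by simpa using hzp)
  have k6 : DifferentiableAt ℂ (fun w : ℂ × ℂ × ℂ => 3 * (3 / 2 - w.2.1 / (4 * w.1 ^ 2)) ^ 2 / (4 * (w.1 + w.2.1 / (2 * w.1)) ^ 2)) w :=
    diff_div (by fun_prop) (by fun_prop) (by simpa using hzp)
  have k7 : DifferentiableAt ℂ (fun w : ℂ × ℂ × ℂ => RR w.2.1 w.2.2 w.1) w :=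
    ((DifferentiableAt.sub (by fun_prop) k1).add k5).sub k6
  have k8 : DifferentiableAt ℂ (fun w : ℂ × ℂ × ℂ => RR w.2.1 w.2.2 w.1 / (2 * qq w.2.1 w.1)) w :=
    diff_div k7 (by fun_prop) (by simpa using hq)
  exact k8

theorem Th_mono {X M : ℝ} (hM : 5 ≤ M) (hX : M ≤ X) {p z : ℂ} (hp : ‖p‖ < M) (hz : z ∈ dom X) {t : ℝ} (ht : 0 ≤ t) :
    (Th p z).re ≤ (Th p (z + t)).re := by
  have hd : ∀ s : ℝ, 0 ≤ s → HasDerivAt (fun s : ℝ => (Th p (z + s)).re) (qq p (z + s)).re s := by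
    intro s hs
    have h1 := (Th_hasDerivAt (p := p) (sect_slit (dom_shift hz hs).2))
    have h2 : HasDerivAt (fun s : ℝ => z + (s:ℂ)) 1 s := (Complex.ofRealCLM.hasDerivAt).const_add z
    have h3 := h1.comp s h2
    have h4 := Complex.reCLM.hasFDerivAt.comp_hasDerivAt s h3
    rw [mul_one] at h4
    exact h4
  have hmono : MonotoneOn (fun s : ℝ => (Th p (z + s)).re) (Ici 0) := by
    refine monotoneOn_of_deriv_nonneg (convex_Ici 0) (fun s hs => (hd s hs).continuousAt.continuousWithinAt)
      (fun s hs => ?_) (fun s hs => ?_)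
    · rw [interior_Ici] at hs
      exact (hd s (le_of_lt hs)).differentiableAt.differentiableWithinAt
    · rw [interior_Ici] at hs
      rw [(hd s (le_of_lt hs)).deriv]
      have := dom_shift hz (le_of_lt (mem_Ioi.1 hs))
      have hre : X < (z + s).re := this.1
      exact qq_re_nonneg hM hp.le (by linarith) this.2
  have := hmono (mem_Ici.2 le_rfl) (mem_Ici.2 ht) ht
  simpa using this

theorem Y0_eta (M : ℝ) (hM : 5 ≤ M) : ∃ X, M ≤ X ∧ ∃ η b : ℂ × ℂ × ℂ → ℂ, HolOn (WW X M) η ∧ HolOn (WW X M) b ∧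
    (∀ w ∈ WW X M, ‖η w‖ ≤ 160 * M ^ 2 * w.1.re ^ (-(1 / 2) : ℝ) ∧ ‖b w‖ ≤ 160 * M ^ 2 * w.1.re ^ (-(1 / 2) : ℝ)) ∧
    ∀ p l : ℂ, ‖p‖ < M → ‖l‖ < M → ∀ t : ℝ, X < t →
      HasDerivAt (fun t : ℝ => η (t, p, l)) (-2 * qq p t * b (t, p, l)) t ∧
      HasDerivAt (fun t : ℝ => b (t, p, l)) (2 * qq p t * b (t, p, l) - mm p l t * (1 + η (t, p, l))) t := by
  set X := M + (160 * M ^ 2) ^ 2 with hXdef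
  have hMX : M ≤ X := by rw [hXdef]; nlinarith [sq_nonneg (160 * M ^ 2)]
  have hX0 : 0 < X := by linarith
  refine ⟨X, hMX, ?_⟩
  set C := 20 * M ^ 2 with hC
  have hC0 : 0 ≤ C := by positivity
  have hXC : 4 * C * X ^ (-(1 / 2) : ℝ) ≤ 1 / 2 := by
    rw [Real.rpow_neg hX0.le, ← Real.sqrt_eq_rpow, ← div_eq_mul_inv, div_le_iff₀ (Real.sqrt_pos.2 hX0)]
    have : 160 * M ^ 2 ≤ √X := Real.le_sqrt_of_sq_le (by rw [hXdef]; linarith)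
    rw [hC]; linarith
  let e : ℂ × ℂ × ℂ := ((1:ℂ), (0:ℂ), (0:ℂ))
  have hW : ∀ w ∈ WW X M, ∀ t : ℝ, 0 ≤ t → w + (t:ℂ) • e ∈ WW X M := WW_shift
  let TT : ℂ × ℂ × ℂ → ℂ := fun w => Th w.2.1 w.1
  let mw : ℂ × ℂ × ℂ → ℂ := fun w => mm w.2.1 w.2.2 w.1
  let K : ℂ × ℂ × ℂ → ℝ → ℂ := fun w t => Complex.exp (-2 * (TT (w + (t:ℂ) • e) - TT w))
  have hTd : DifferentiableOn ℂ TT (WW X M) := Th_diffOn X M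
  have hmd : DifferentiableOn ℂ mw (WW X M) := mm_diffOn X M (by linarith) hMX
  have hmono : ∀ w ∈ WW X M, ∀ t : ℝ, 0 ≤ t → (TT w).re ≤ (TT (w + (t:ℂ) • e)).re := by
    rintro ⟨z, p, l⟩ ⟨h1, h2, h3⟩ t ht
    have := Th_mono hM hMX h2 h1 ht
    simpa [TT, e] using this
  have hmle : ∀ w ∈ WW X M, ∀ t : ℝ, 0 ≤ t → ‖mw (w + (t:ℂ) • e)‖ ≤ C * (w.1.re + t) ^ (-(3 / 2) : ℝ) := by
    intro w hw t ht
    obtain ⟨h1, h2, h3⟩ := hW w hw t ht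
    have hre : X < (w + (t:ℂ) • e).1.re := h1.1
    have := mm_le (by linarith : 1 ≤ M) h2.le h3.le (hMX.trans hre.le)
    simpa [e, mw, hC] using this
  have hwre : ∀ w ∈ WW X M, X < w.1.re := fun w hw => hw.1.1
  have hmX : ∀ w ∈ WW X M, ∀ t : ℝ, 0 ≤ t → ‖mw (w + (t:ℂ) • e)‖ ≤ C * (X + t) ^ (-(3 / 2) : ℝ) := by
    intro w hw t ht
    refine (hmle w hw t ht).trans ?_
    have := hwre w hw
    gcongr C * ?_
    exact Real.rpow_le_rpow_of_nonpos (by linarith) (by linarith) (by norm_num)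
  have hKhol : ∀ t : ℝ, 0 < t → HolOn (WW X M) (fun w => K w t) := by
    intro t ht
    apply HolOn.of_diff
    have h1 : DifferentiableOn ℂ (fun w => TT (w + (t:ℂ) • e)) (WW X M) :=
      hTd.comp (by fun_prop) (fun w hw => hW w hw t ht.le)
    exact ((h1.sub hTd).const_mul (-2)).cexp
  have hmhol : ∀ t : ℝ, 0 < t → HolOn (WW X M) (fun w => mw (w + (t:ℂ) • e)) := by
    intro t ht
    exact HolOn.of_diff (hmd.comp (by fun_prop) (fun w hw => hW w hw t ht.le))
  have hshc : ContinuousOn (fun x : (ℂ × ℂ × ℂ) × ℝ => x.1 + (x.2:ℂ) • e) ((WW X M) ×ˢ Ici 0) := by fun_prop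
  have hshm : MapsTo (fun x : (ℂ × ℂ × ℂ) × ℝ => x.1 + (x.2:ℂ) • e) ((WW X M) ×ˢ Ici 0) (WW X M) :=
    fun x hx => hW x.1 hx.1 x.2 hx.2
  have hKc : ContinuousOn (fun x : (ℂ × ℂ × ℂ) × ℝ => K x.1 x.2) ((WW X M) ×ˢ Ici 0) := by
    have h1 := hTd.continuousOn.comp hshc hshm
    have h2 : ContinuousOn (fun x : (ℂ × ℂ × ℂ) × ℝ => TT x.1) ((WW X M) ×ˢ Ici 0) :=
      hTd.continuousOn.comp continuousOn_fst (fun x hx => hx.1)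
    have h3 : ContinuousOn (fun x : (ℂ × ℂ × ℂ) × ℝ => TT (x.1 + (x.2:ℂ) • e)) ((WW X M) ×ˢ Ici 0) := h1
    exact (continuousOn_const.mul (h3.sub h2)).cexp
  have hmc : ContinuousOn (fun x : (ℂ × ℂ × ℂ) × ℝ => mw (x.1 + (x.2:ℂ) • e)) ((WW X M) ×ˢ Ici 0) :=
    hmd.continuousOn.comp hshc hshm
  have hIX := rpow_shift_int hX0
  obtain ⟨η, hηc, hη1, hηeq, hηhol⟩ := volterra (W := WW X M) (e := e) hW
    (N := fun w t => (1 - K w t) * mw (w + (t:ℂ) • e)) (B := fun t => 2 * (C * (X + t) ^ (-(3 / 2) : ℝ)))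
    ((continuousOn_const.sub hKc).mul hmc) ((hIX.1.const_mul C).const_mul 2)
    (fun w hw t ht => by
      rw [norm_mul]
      exact mul_le_mul (kernel_le_two (hmono w hw t ht.le)) (hmX w hw t ht.le) (norm_nonneg _) (by norm_num))
    (by rw [integral_const_mul, integral_const_mul, hIX.2]; linarith)
  have hηH := hηhol fun t ht => ((HolOn.const 1).sub (hKhol t ht)).mul (hmhol t ht)
  have h1η : ∀ w ∈ WW X M, ‖1 + η w‖ ≤ 2 := fun w hw => by
    refine (norm_add_le _ _).trans ?_
    have := hη1 w hw
    simp only [norm_one]; linarith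
  have hae : ∀ {p : ℝ → Prop}, (∀ t, 0 < t → p t) → ∀ᵐ t ∂(volume.restrict (Ioi (0:ℝ))), p t :=
    fun h => (ae_restrict_iff' measurableSet_Ioi).2 (Eventually.of_forall h)
  let b : ℂ × ℂ × ℂ → ℂ := fun w => ∫ t in Ioi (0:ℝ), K w t * (mw (w + (t:ℂ) • e) * (1 + η (w + (t:ℂ) • e)))
  have hhle : ∀ w ∈ WW X M, ∀ t : ℝ, 0 ≤ t → ‖mw (w + (t:ℂ) • e) * (1 + η (w + (t:ℂ) • e))‖ ≤
      2 * (C * (w.1.re + t) ^ (-(3 / 2) : ℝ)) := by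
    intro w hw t ht
    rw [norm_mul, mul_comm]
    exact mul_le_mul (h1η _ (hW w hw t ht)) (hmle w hw t ht) (norm_nonneg _) (by norm_num)
  refine ⟨η, b, hηH, ?_, ?_, ?_⟩
  · refine HolOn.integral ((hIX.1.const_mul C).const_mul 2) ?_ (hae fun t ht => ?_) (hae fun t ht w hw => ?_)
    · intro w hw
      apply ContinuousOn.aestronglyMeasurable _ measurableSet_Ioi
      have hs : ContinuousOn (fun t : ℝ => (w, t)) (Ioi 0) := by fun_prop
      have hm' : MapsTo (fun t : ℝ => (w, t)) (Ioi 0) ((WW X M) ×ˢ Ici 0) := fun t ht => ⟨hw, le_of_lt (mem_Ioi.1 ht)⟩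
      refine (hKc.comp hs hm').mul ((hmc.comp hs hm').mul (continuousOn_const.add ?_))
      exact (hηc.comp hshc hshm).comp hs hm'
    · exact (hKhol t ht).mul ((hmhol t ht).mul ((HolOn.const 1).add
        (hηH.comp_diff (by fun_prop) (fun w hw => hW w hw t ht.le))))
    · rw [norm_mul]
      have h1 := exp_le_one_aux (hmono w hw t ht.le)
      have h2 : ‖mw (w + (t:ℂ) • e) * (1 + η (w + (t:ℂ) • e))‖ ≤ 2 * (C * (X + t) ^ (-(3 / 2) : ℝ)) := by
        rw [norm_mul, mul_comm]
        exact mul_le_mul (h1η _ (hW w hw t ht.le)) (hmX w hw t ht.le) (norm_nonneg _) (by norm_num)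
      calc _ ≤ 1 * (2 * (C * (X + t) ^ (-(3 / 2) : ℝ))) := mul_le_mul h1 h2 (norm_nonneg _) (by norm_num)
        _ = _ := one_mul _
  · intro w hw
    have hx := (hX0.trans (hwre w hw))
    have hI := rpow_shift_int hx
    constructor
    · rw [hηeq w hw]
      refine (norm_integral_le_of_norm_le ((hI.1.const_mul C).const_mul 4) (hae fun t ht => ?_)).trans ?_
      · rw [mul_assoc, norm_mul]
        refine (mul_le_mul (kernel_le_two (hmono w hw t ht.le)) (hhle w hw t ht.le) (norm_nonneg _) (by norm_num)).trans ?_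
        apply le_of_eq; ring
      · rw [integral_const_mul, integral_const_mul, hI.2, hC]; apply le_of_eq; ring
    · refine (norm_integral_le_of_norm_le ((hI.1.const_mul C).const_mul 2) (hae fun t ht => ?_)).trans ?_
      · rw [norm_mul]
        refine (mul_le_mul (exp_le_one_aux (hmono w hw t ht.le)) (hhle w hw t ht.le) (norm_nonneg _) (by norm_num)).trans ?_
        apply le_of_eq; ring
      · rw [integral_const_mul, integral_const_mul, hI.2, hC]
        have : 0 ≤ w.1.re ^ (-(1 / 2) : ℝ) := by positivity
        nlinarith [mul_nonneg (sq_nonneg M) this]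
  · intro p l hp hl
    have hmem : ∀ t : ℝ, X < t → ((t:ℂ), p, l) ∈ WW X M := by
      intro t ht
      refine ⟨⟨?_, ?_⟩, hp, hl⟩
      · simpa using ht
      · change |((t:ℂ)).im| < 1.4 * ((t:ℂ)).re
        simp; linarith
    have hsh : ∀ t s : ℝ, ((t:ℂ), p, l) + (s:ℂ) • e = (((t + s : ℝ) : ℂ), p, l) := by
      intro t s; simp [e]
    have hcurve : ContinuousOn (fun t : ℝ => ((t:ℂ), p, l)) (Ioi X) := by fun_prop
    have key := ray_deriv (t0 := X) (Θ := fun t : ℝ => Th p t) (q := fun t : ℝ => qq p t)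
      (h := fun t : ℝ => mm p l t * (1 + η (t, p, l))) (η := fun t : ℝ => η (t, p, l)) (b := fun t : ℝ => b (t, p, l))
      ?_ ?_ ?_ ?_ ?_ ?_
    · exact key
    · intro t ht
      have := (Th_hasDerivAt (p := p) (z := (t:ℂ)) (Or.inl (by simp; linarith))).comp_ofReal
      exact this
    · intro t ht s hs
      have := hmono _ (hmem t ht) s hs
      rw [hsh] at this
      exact this
    · have h1 := hmd.continuousOn.comp hcurve (fun t ht => hmem t ht)
      have h2 := hηc.comp hcurve (fun t ht => hmem t ht)
      exact h1.mul (continuousOn_const.add h2)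
    · intro s hs
      have h1 : ContinuousOn (fun t : ℝ => mm p l t * (1 + η (t, p, l))) (Ioi X) := by
        have h1 := hmd.continuousOn.comp hcurve (fun t ht => hmem t ht)
        have h2 := hηc.comp hcurve (fun t ht => hmem t ht)
        exact h1.mul (continuousOn_const.add h2)
      refine Integrable.mono' (g := fun t : ℝ => 2 * (C * t ^ (-(3 / 2) : ℝ)))
        (((integrableOn_Ioi_rpow_of_lt (by norm_num) (hX0.trans hs)).const_mul C).const_mul 2)
        ((h1.mono (Ioi_subset_Ioi hs.le)).aestronglyMeasurable measurableSet_Ioi) ?_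
      refine (ae_restrict_iff' measurableSet_Ioi).2 (Eventually.of_forall fun t ht => ?_)
      have := hhle _ (hmem t (hs.trans ht)) 0 le_rfl
      simpa [mw] using this
    · intro t ht
      have := hηeq _ (hmem t ht)
      rw [this]
      refine integral_congr_ae (Eventually.of_forall fun s => ?_)
      simp only [K, TT, mw, hsh, mul_assoc]
    · intro t ht
      refine integral_congr_ae (Eventually.of_forall fun s => ?_)
      simp only [K, TT, mw, hsh]

end PTC

open Complex Filter

namespace PTC
open Topology Set MeasureTheory

/-- a solution pair of the equation `y'' = (z^3+pz+l) y` -/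
def Sol (p l : ℂ) (y y' : ℂ → ℂ) : Prop :=
  ∀ z, HasDerivAt y (y' z) z ∧ HasDerivAt y' ((z ^ 3 + p * z + l) * y z) z

theorem Sol.fs (p l c0 c1 : ℂ) : Sol p l (fs p l c0 c1) (fs' p l c0 c1) :=
  fun z => ⟨fs_hasDerivAt p l c0 c1 z, fs'_hasDerivAt p l c0 c1 z⟩

theorem Sol.wronsk {p l : ℂ} {y y' v v' : ℂ → ℂ} (h : Sol p l y y') (k : Sol p l v v') (z : ℂ) :
    y z * v' z - y' z * v z = y 0 * v' 0 - y' 0 * v 0 := by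
  have hd : ∀ z, HasDerivAt (fun z => y z * v' z - y' z * v z) 0 z := by
    intro z
    refine (((h z).1.mul (k z).2).sub ((h z).2.mul (k z).1)).congr_deriv ?_
    ring
  exact is_const_of_deriv_eq_zero (fun z => (hd z).differentiableAt) (fun z => (hd z).deriv) z 0

theorem wronsk_fs (p l c0 c1 d0 d1 z : ℂ) : fs p l c0 c1 z * fs' p l d0 d1 z - fs' p l c0 c1 z * fs p l d0 d1 z =
    c0 * d1 - c1 * d0 := by
  rw [(Sol.fs p l c0 c1).wronsk (Sol.fs p l d0 d1) z]
  simp [fs_zero, fs'_zero]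

theorem Sol.eq_fs {p l : ℂ} {y y' : ℂ → ℂ} (h : Sol p l y y') (z : ℂ) :
    y z = PTC.fs p l (y 0) (y' 0) z ∧ y' z = fs' p l (y 0) (y' 0) z := by
  have e : ∀ {y y' : ℂ → ℂ}, Sol p l y y' → ∀ z, y z = y 0 * PTC.fs p l 1 0 z + y' 0 * PTC.fs p l 0 1 z ∧
      y' z = y 0 * fs' p l 1 0 z + y' 0 * fs' p l 0 1 z := by
    intro y y' h z
    have w1 := h.wronsk (Sol.fs p l 1 0) z
    have w2 := h.wronsk (Sol.fs p l 0 1) z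
    have w3 := wronsk_fs p l 1 0 0 1 z
    simp only [fs_zero, fs'_zero] at w1 w2
    constructor
    · linear_combination (-y z) * w3 - PTC.fs p l 0 1 z * w1 + PTC.fs p l 1 0 z * w2
    · linear_combination (-y' z) * w3 - fs' p l 0 1 z * w1 + fs' p l 1 0 z * w2
  have h1 := e h z
  have h2 := e (Sol.fs p l (y 0) (y' 0)) z
  simp only [fs_zero, fs'_zero] at h2
  exact ⟨h1.1.trans h2.1.symm, h1.2.trans h2.2.symm⟩

theorem fs_lin (p l c0 c1 z : ℂ) : fs p l c0 c1 z = c0 * fs p l 1 0 z + c1 * fs p l 0 1 z ∧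
    fs' p l c0 c1 z = c0 * fs' p l 1 0 z + c1 * fs' p l 0 1 z := by
  have hs : Sol p l (fun z => c0 * fs p l 1 0 z + c1 * fs p l 0 1 z)
      (fun z => c0 * fs' p l 1 0 z + c1 * fs' p l 0 1 z) := by
    intro z
    refine ⟨((fs_hasDerivAt p l 1 0 z).const_mul c0).add ((fs_hasDerivAt p l 0 1 z).const_mul c1), ?_⟩
    refine (((fs'_hasDerivAt p l 1 0 z).const_mul c0).add ((fs'_hasDerivAt p l 0 1 z).const_mul c1)).congr_deriv ?_
    ring
  have := hs.eq_fs z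
  simp only [fs_zero, fs'_zero, mul_one, mul_zero, add_zero, zero_add] at this
  exact ⟨this.1.symm, this.2.symm⟩

/-- going to infinity inside the sector -/
def SF : Filter ℂ := comap Complex.re atTop ⊓ 𝓟 sect

theorem SF_dom (X : ℝ) : dom X ∈ SF := by
  refine inter_mem_inf (preimage_mem_comap (Ioi_mem_atTop X)) (mem_principal_self _)

theorem ray_SF : Tendsto (fun t : ℝ => (t:ℂ)) atTop SF := by
  refine tendsto_inf.2 ⟨tendsto_comap_iff.2 ?_, tendsto_principal.2 ?_⟩
  · exact tendsto_id
  · filter_upwards [eventually_gt_atTop 0] with t ht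
    change |((t:ℂ)).im| < 1.4 * ((t:ℂ)).re
    simp; linarith

theorem SF_re : Tendsto Complex.re SF atTop := tendsto_comap.mono_left inf_le_left

theorem SF_norm : Tendsto (fun z : ℂ => ‖z‖) SF atTop :=
  tendsto_atTop_mono re_le_norm' SF_re

theorem SF_inv : Tendsto (fun z : ℂ => z⁻¹) SF (𝓝 0) :=
  tendsto_inv₀_cobounded.comp (tendsto_norm_atTop_iff_cobounded.1 SF_norm)

def IsY0 (p l c0 c1 : ℂ) : Prop :=
  Tendsto (fun z => fs p l c0 c1 z * (z ^ (3 / 4 : ℂ) * Complex.exp (Th p z))) SF (𝓝 1) ∧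
  Tendsto (fun z => fs' p l c0 c1 z * (z ^ (-(3 / 4) : ℂ) * Complex.exp (Th p z))) SF (𝓝 (-1))

theorem dom_convex (X : ℝ) : Convex ℝ (dom X) := by
  refine (convex_halfSpace_re_gt X).inter ?_
  intro x hx y hy a b ha hb hab
  have hx' : |x.im| < 1.4 * x.re := hx
  have hy' : |y.im| < 1.4 * y.re := hy
  change |(a • x + b • y).im| < 1.4 * (a • x + b • y).re
  simp only [Complex.add_im, Complex.add_re, Complex.real_smul, Complex.im_ofReal_mul, Complex.re_ofReal_mul]
  rw [abs_lt] at *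
  rcases eq_or_lt_of_le ha with h | h
  · have : b = 1 := by linarith
    subst this; subst h; constructor <;> linarith
  · constructor <;> nlinarith

theorem eqOn_dom {X : ℝ} (hX : 0 ≤ X) {f g : ℂ → ℂ} (hf : DifferentiableOn ℂ f (dom X)) (hg : DifferentiableOn ℂ g (dom X))
    (h : ∀ t : ℝ, X < t → f t = g t) : EqOn f g (dom X) := by
  have hmem : ∀ t : ℝ, X < t → (t:ℂ) ∈ dom X := by
    intro t ht
    refine ⟨by simpa using ht, ?_⟩
    change |((t:ℂ)).im| < 1.4 * ((t:ℂ)).re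
    simp; linarith
  refine AnalyticOnNhd.eqOn_of_preconnected_of_frequently_eq (hf.analyticOnNhd (dom_open X)) (hg.analyticOnNhd (dom_open X))
    (dom_convex X).isPreconnected (hmem (X + 1) (by linarith)) ?_
  have ht : Tendsto (fun t : ℝ => (t:ℂ)) (𝓝[≠] (X + 1)) (𝓝[≠] ((X + 1 : ℝ) : ℂ)) := by
    refine tendsto_nhdsWithin_of_tendsto_nhds_of_eventually_within _
      ((Complex.continuous_ofReal.tendsto _).mono_left nhdsWithin_le_nhds) ?_
    filter_upwards [self_mem_nhdsWithin] with t ht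
    intro hh; exact ht (Complex.ofReal_injective hh)
  refine ht.frequently (Eventually.frequently ?_)
  have : ∀ᶠ t in 𝓝[≠] (X + 1), X < t := nhdsWithin_le_nhds (lt_mem_nhds (by linarith))
  filter_upwards [this] with t ht using h t ht

end PTC

open Complex Filter

namespace PTC
open Topology Set MeasureTheory

noncomputable def LL (p z : ℂ) : ℂ := -qq p z - qq1 p z / (2 * qq p z)

theorem mem_dom_real {X t : ℝ} (hX : 0 ≤ X) (ht : X < t) : (t:ℂ) ∈ dom X := by
  refine ⟨by simpa using ht, ?_⟩
  change |((t:ℂ)).im| < 1.4 * ((t:ℂ)).re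
  simp; linarith

theorem pp_lim (p : ℂ) : Tendsto (fun z : ℂ => 1 + p / (2 * z ^ 2)) SF (𝓝 1) := by
  have h := ((SF_inv.pow 2).const_mul (p / 2)).const_add 1
  simp only [ne_eq, OfNat.ofNat_ne_zero, not_false_eq_true, zero_pow, mul_zero, add_zero] at h
  refine h.congr fun z => ?_
  rw [inv_pow]; ring

theorem ev_ne : ∀ᶠ z in SF, z ≠ 0 := by
  filter_upwards [SF_dom 1] with z hz h
  have : (1:ℝ) < z.re := hz.1
  rw [h] at this; norm_num at this

theorem cpow_34 {z : ℂ} (hz : z ≠ 0) : z ^ (-(3 / 4) : ℂ) * z ^ (-(3 / 4) : ℂ) * (sq z * z) = 1 := by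
  rw [← Complex.cpow_add _ _ hz, sq]
  nth_rewrite 3 [← Complex.cpow_one z]
  rw [← Complex.cpow_add _ _ hz, ← Complex.cpow_add _ _ hz]
  norm_num

theorem cpow_34' {z : ℂ} (hz : z ≠ 0) : z ^ (-(3 / 4) : ℂ) * z ^ (3 / 4 : ℂ) = 1 := by
  rw [← Complex.cpow_add _ _ hz]
  norm_num

theorem sqz_lim : Tendsto (fun z : ℂ => (sq z * z)⁻¹) SF (𝓝 0) := by
  refine tendsto_inv₀_cobounded.comp (tendsto_norm_atTop_iff_cobounded.1 ?_)
  simp only [norm_mul, norm_sq_mul]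
  exact (tendsto_rpow_atTop (by norm_num)).comp SF_norm

theorem LL_lim (p : ℂ) : Tendsto (fun z => z ^ (-(3 / 4) : ℂ) * z ^ (-(3 / 4) : ℂ) * LL p z) SF (𝓝 (-1)) ∧
    Tendsto (fun z => z ^ (-(3 / 4) : ℂ) * z ^ (-(3 / 4) : ℂ) * qq p z) SF (𝓝 1) := by
  have h1 := pp_lim p
  have hne : ∀ᶠ z in SF, 1 + p / (2 * z ^ 2) ≠ 0 := h1.eventually_ne one_ne_zero
  have h2 : Tendsto (fun z => z ^ (-(3 / 4) : ℂ) * z ^ (-(3 / 4) : ℂ) * qq p z) SF (𝓝 1) := by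
    refine h1.congr' ?_
    filter_upwards [ev_ne] with z hz
    have := cpow_34 hz
    rw [qq, show sq z * (z + p / (2 * z)) = (sq z * z) * (1 + p / (2 * z ^ 2)) by field_simp,
      ← mul_assoc, this, one_mul]
  refine ⟨?_, h2⟩
  have h3 : Tendsto (fun z : ℂ => (sq z * z)⁻¹ * ((3 / 2 - p / (2 * z ^ 2) / 2) * z⁻¹ / (2 * (1 + p / (2 * z ^ 2))))) SF (𝓝 0) := by
    have h4 : Tendsto (fun z : ℂ => p / (2 * z ^ 2)) SF (𝓝 0) := by
      have := h1.sub_const 1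
      simpa using this
    have := sqz_lim.mul ((((h4.div_const 2).const_sub (3 / 2)).mul SF_inv).div (h1.const_mul 2) (by norm_num))
    simpa using this
  have h5 := h2.neg.sub h3
  rw [sub_zero] at h5
  refine h5.congr' ?_
  filter_upwards [ev_ne, hne] with z hz hn
  have := cpow_34 hz
  have hs := sq_ne hz
  have e1 : z ^ (-(3 / 4) : ℂ) * z ^ (-(3 / 4) : ℂ) = (sq z * z)⁻¹ := eq_inv_of_mul_eq_one_left this
  rw [e1, LL]
  have e2 : qq1 p z / (2 * qq p z) = (3 / 2 - p / (2 * z ^ 2) / 2) * z⁻¹ / (2 * (1 + p / (2 * z ^ 2))) := by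
    rw [qq1, qq, show sq z * (z + p / (2 * z)) = (sq z * z) * (1 + p / (2 * z ^ 2)) by field_simp]
    rw [div_eq_div_iff (mul_ne_zero two_ne_zero (mul_ne_zero (mul_ne_zero hs hz) hn)) (mul_ne_zero two_ne_zero hn)]
    field_simp
    ring
  rw [e2]; ring

theorem Y0_exists (M : ℝ) (hM : 5 ≤ M) : ∃ A B : ℂ × ℂ → ℂ,
    HolOn {w : ℂ × ℂ | ‖w.1‖ < M ∧ ‖w.2‖ < M} A ∧ HolOn {w : ℂ × ℂ | ‖w.1‖ < M ∧ ‖w.2‖ < M} B ∧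
    ∀ w : ℂ × ℂ, ‖w.1‖ < M ∧ ‖w.2‖ < M → IsY0 w.1 w.2 (A w) (B w) := by
  obtain ⟨X, hMX, η, b, hη, hb, hbd, hder⟩ := Y0_eta M hM
  have hX0 : 0 < X := by linarith
  have hM1 : 1 ≤ M := by linarith
  let Y : ℂ × ℂ × ℂ → ℂ := fun w => gg w.2.1 w.1 * (1 + η w)
  let Y' : ℂ × ℂ × ℂ → ℂ := fun w => gg w.2.1 w.1 * (LL w.2.1 w.1 * (1 + η w) - 2 * qq w.2.1 w.1 * b w)
  let S : Set (ℂ × ℂ) := {w : ℂ × ℂ | ‖w.1‖ < M ∧ ‖w.2‖ < M}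
  let x1 : ℂ := ((X + 1 : ℝ) : ℂ)
  have hx1 : x1 ∈ dom X := mem_dom_real hX0.le (by linarith)
  have hmap : MapsTo (fun w : ℂ × ℂ => (x1, w)) S (WW X M) := fun w hw => ⟨hx1, hw.1, hw.2⟩
  have hx1n : M ≤ ‖x1‖ := hMX.trans ((le_of_lt hx1.1).trans (re_le_norm' _))
  have hx10 : x1 ≠ 0 := norm_pos_iff.1 (by linarith)
  -- holomorphy at x1
  have hgd : DifferentiableOn ℂ (fun w : ℂ × ℂ => gg w.1 x1) S := by
    intro w hw
    apply DifferentiableAt.differentiableWithinAt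
    have hb' := base_slit hM1 (le_of_lt hw.1) hx1n
    have k1 : DifferentiableAt ℂ (fun w : ℂ × ℂ => (1 + w.1 / (2 * x1 ^ 2)) ^ (-(1 / 2) : ℂ)) w :=
      DifferentiableAt.cpow_const (by fun_prop) hb'
    have k2 : DifferentiableAt ℂ (fun w : ℂ × ℂ => Complex.exp (-(sq x1 * (2 / 5 * x1 ^ 2 + w.1)))) w := by fun_prop
    exact k2.mul (k1.const_mul _)
  have hqd : DifferentiableOn ℂ (fun w : ℂ × ℂ => qq w.1 x1) S := by unfold qq; fun_prop
  have hLd : DifferentiableOn ℂ (fun w : ℂ × ℂ => LL w.1 x1) S := by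
    intro w hw
    apply DifferentiableAt.differentiableWithinAt
    have hq := qq_ne hM1 (le_of_lt hw.1) hx1n
    have k1 : DifferentiableAt ℂ (fun w : ℂ × ℂ => qq w.1 x1) w := by unfold qq; fun_prop
    have k2 : DifferentiableAt ℂ (fun w : ℂ × ℂ => qq1 w.1 x1) w := by unfold qq1; fun_prop
    exact k1.neg.sub (diff_div k2 (k1.const_mul 2) (by simpa using hq))
  have hηx := hη.comp_diff (φ := fun w : ℂ × ℂ => (x1, w)) (S' := S) (by fun_prop) hmap
  have hbx := hb.comp_diff (φ := fun w : ℂ × ℂ => (x1, w)) (S' := S) (by fun_prop) hmap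
  have hYx : HolOn S fun w => Y (x1, w) := (HolOn.of_diff hgd).mul ((HolOn.const 1).add hηx)
  have hYx' : HolOn S fun w => Y' (x1, w) := (HolOn.of_diff hgd).mul
    (((HolOn.of_diff hLd).mul ((HolOn.const 1).add hηx)).sub (((HolOn.const 2).mul (HolOn.of_diff hqd)).mul hbx))
  have hfs : ∀ c0 c1 : ℂ, HolOn S fun w => fs w.1 w.2 c0 c1 x1 := fun c0 c1 =>
    fs_hol.comp_diff (φ := fun w : ℂ × ℂ => (w.1, w.2, c0, c1, x1)) (by fun_prop) (mapsTo_univ _ _)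
  have hfs' : ∀ c0 c1 : ℂ, HolOn S fun w => fs' w.1 w.2 c0 c1 x1 := fun c0 c1 =>
    fs'_hol.comp_diff (φ := fun w : ℂ × ℂ => (w.1, w.2, c0, c1, x1)) (by fun_prop) (mapsTo_univ _ _)
  refine ⟨fun w => Y (x1, w) * fs' w.1 w.2 0 1 x1 - Y' (x1, w) * fs w.1 w.2 0 1 x1,
    fun w => Y' (x1, w) * fs w.1 w.2 1 0 x1 - Y (x1, w) * fs' w.1 w.2 1 0 x1,
    (hYx.mul (hfs' 0 1)).sub (hYx'.mul (hfs 0 1)), (hYx'.mul (hfs 1 0)).sub (hYx.mul (hfs' 1 0)), ?_⟩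
  rintro ⟨p, l⟩ ⟨hp, hl⟩
  simp only at hp hl ⊢
  set c0 := Y (x1, p, l) * fs' p l 0 1 x1 - Y' (x1, p, l) * fs p l 0 1 x1 with hc0
  set c1 := Y' (x1, p, l) * fs p l 1 0 x1 - Y (x1, p, l) * fs' p l 1 0 x1 with hc1
  have hsol : ∀ t : ℝ, X < t → HasDerivAt (fun t : ℝ => Y (t, p, l)) (Y' (t, p, l)) t ∧
      HasDerivAt (fun t : ℝ => Y' (t, p, l)) (((t:ℂ) ^ 3 + p * t + l) * Y (t, p, l)) t := by
    intro t ht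
    have htn : M ≤ ((t:ℂ)).re := by simp; linarith
    have hts : (t:ℂ) ∈ slitPlane := Or.inl (by simp; linarith)
    exact wkb_solves (η := fun t : ℝ => η (t, p, l)) (b := fun t : ℝ => b (t, p, l)) (g := fun t : ℝ => gg p t)
      (q := fun t : ℝ => qq p t) (q1 := fun t : ℝ => qq1 p t) (m := mm p l t) (q2 := qq2 p t)
      (Q := (t:ℂ) ^ 3 + p * t + l) (t := t) (qq_ne hM1 hp.le (htn.trans (re_le_norm' _)))
      (qq_hasDerivAt hts).comp_ofReal (qq1_hasDerivAt hts).comp_ofReal (gg_hasDerivAt hM1 hp.le htn).comp_ofReal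
      (hder p l hp hl t ht).1 (hder p l hp hl t ht).2 (mm_eq hM1 hp.le htn)
  -- Wronskians on the ray are constant
  have hconst : ∀ d0 d1 : ℂ, ∀ t : ℝ, X < t →
      Y (t, p, l) * fs' p l d0 d1 t - Y' (t, p, l) * fs p l d0 d1 t =
      Y (x1, p, l) * fs' p l d0 d1 x1 - Y' (x1, p, l) * fs p l d0 d1 x1 := by
    intro d0 d1 t ht
    have hd : ∀ t ∈ Ioi X, HasDerivAt (fun t : ℝ => Y (t, p, l) * fs' p l d0 d1 t - Y' (t, p, l) * fs p l d0 d1 t) 0 t := by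
      intro t ht
      refine (((hsol t ht).1.mul (fs'_hasDerivAt p l d0 d1 t).comp_ofReal).sub
        ((hsol t ht).2.mul (fs_hasDerivAt p l d0 d1 t).comp_ofReal)).congr_deriv ?_
      ring
    exact isOpen_Ioi.is_const_of_deriv_eq_zero isPreconnected_Ioi
      (fun t ht => (hd t ht).differentiableAt.differentiableWithinAt) (fun t ht => (hd t ht).deriv)
      ht (show X + 1 ∈ Ioi X by simp)
  have hray : ∀ t : ℝ, X < t → fs p l c0 c1 t = Y (t, p, l) ∧ fs' p l c0 c1 t = Y' (t, p, l) := by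
    intro t ht
    have e1 := hconst 0 1 t ht
    have e2 := hconst 1 0 t ht
    have w3 := wronsk_fs p l 1 0 0 1 t
    rw [(fs_lin p l c0 c1 t).1, (fs_lin p l c0 c1 t).2, hc0, ← e1]
    have e3 : c1 = Y' (t, p, l) * fs p l 1 0 t - Y (t, p, l) * fs' p l 1 0 t := by
      rw [hc1]; linear_combination e2
    rw [e3]
    constructor
    · linear_combination Y (t, p, l) * w3
    · linear_combination Y' (t, p, l) * w3
  have hcurve : ∀ z ∈ dom X, (z, p, l) ∈ WW X M := fun z hz => ⟨hz, hp, hl⟩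
  have hre : ∀ z ∈ dom X, M ≤ z.re := fun z hz => hMX.trans (le_of_lt hz.1)
  have hdη : DifferentiableOn ℂ (fun z => η (z, p, l)) (dom X) :=
    hη.2 _ (fun z => (z, p, l)) (dom_open X) (by fun_prop) hcurve
  have hdb : DifferentiableOn ℂ (fun z => b (z, p, l)) (dom X) :=
    hb.2 _ (fun z => (z, p, l)) (dom_open X) (by fun_prop) hcurve
  have hdg : DifferentiableOn ℂ (fun z => gg p z) (dom X) := fun z hz =>
    (gg_hasDerivAt hM1 hp.le (hre z hz)).differentiableAt.differentiableWithinAt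
  have hdq : DifferentiableOn ℂ (fun z => qq p z) (dom X) := fun z hz =>
    (qq_hasDerivAt (sect_slit hz.2)).differentiableAt.differentiableWithinAt
  have hdL : DifferentiableOn ℂ (fun z => LL p z) (dom X) := fun z hz => by
    have hq := qq_ne hM1 hp.le ((hre z hz).trans (re_le_norm' _))
    have k1 := (qq_hasDerivAt (p := p) (sect_slit hz.2)).differentiableAt
    exact (k1.neg.sub (diff_div (qq1_hasDerivAt (p := p) (sect_slit hz.2)).differentiableAt (k1.const_mul 2)
      (by simpa using hq))).differentiableWithinAt
  have E1 : EqOn (fs p l c0 c1) (fun z => Y (z, p, l)) (dom X) :=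
    eqOn_dom hX0.le (fun z _ => (fs_hasDerivAt p l c0 c1 z).differentiableAt.differentiableWithinAt)
      (hdg.mul (hdη.const_add 1)) (fun t ht => (hray t ht).1)
  have E2 : EqOn (fs' p l c0 c1) (fun z => Y' (z, p, l)) (dom X) :=
    eqOn_dom hX0.le (fun z _ => (fs'_hasDerivAt p l c0 c1 z).differentiableAt.differentiableWithinAt)
      (hdg.mul ((hdL.mul (hdη.const_add 1)).sub ((hdq.const_mul 2).mul hdb))) (fun t ht => (hray t ht).2)
  have hbnd : Tendsto (fun z : ℂ => 160 * M ^ 2 * z.re ^ (-(1 / 2) : ℝ)) SF (𝓝 0) := by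
    have := ((tendsto_rpow_neg_atTop (y := (1 / 2 : ℝ)) (by norm_num)).comp SF_re).const_mul (160 * M ^ 2)
    simpa using this
  have hηl : Tendsto (fun z => η (z, p, l)) SF (𝓝 0) := by
    refine squeeze_zero_norm' ?_ hbnd
    filter_upwards [SF_dom X] with z hz using (hbd _ (hcurve z hz)).1
  have hbl : Tendsto (fun z => b (z, p, l)) SF (𝓝 0) := by
    refine squeeze_zero_norm' ?_ hbnd
    filter_upwards [SF_dom X] with z hz using (hbd _ (hcurve z hz)).2
  have hpw : Tendsto (fun z : ℂ => (1 + p / (2 * z ^ 2)) ^ (-(1 / 2) : ℂ)) SF (𝓝 1) := by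
    have hc : ContinuousAt (fun w : ℂ => w ^ (-(1 / 2) : ℂ)) 1 :=
      continuousAt_cpow_const (by simp [slitPlane])
    have := hc.tendsto.comp (pp_lim p)
    rw [Complex.one_cpow] at this
    exact this
  have hexp : ∀ z, Complex.exp (-Th p z) * Complex.exp (Th p z) = 1 := by
    intro z; rw [← Complex.exp_add]; simp
  constructor
  · have := hpw.mul (hηl.const_add 1)
    simp only [add_zero, mul_one] at this
    refine this.congr' ?_
    filter_upwards [SF_dom X, ev_ne] with z hz hz0
    rw [E1 hz]
    simp only [Y, gg, ss]
    have e1 := hexp z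
    have e2 := cpow_34' hz0
    linear_combination (-(1 + p / (2 * z ^ 2)) ^ (-(1 / 2) : ℂ) * (1 + η (z, p, l))) *
      (z ^ (-(3 / 4) : ℂ) * z ^ (3 / 4 : ℂ) * e1 + e2)
  · have := hpw.mul (((LL_lim p).1.mul (hηl.const_add 1)).sub (((LL_lim p).2.const_mul 2).mul hbl))
    simp only [add_zero, mul_one, mul_zero, sub_zero, one_mul] at this
    refine this.congr' ?_
    filter_upwards [SF_dom X, ev_ne] with z hz hz0
    rw [E2 hz]
    simp only [Y', gg, ss]
    have e1 := hexp z
    linear_combination (-(z ^ (-(3 / 4) : ℂ) * z ^ (-(3 / 4) : ℂ)) * (1 + p / (2 * z ^ 2)) ^ (-(1 / 2) : ℂ) *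
      (LL p z * (1 + η (z, p, l)) - 2 * qq p z * b (z, p, l))) * e1

end PTC

open Complex Filter

namespace PTC
open Topology Set MeasureTheory

/-- narrow sector -/
def nsect : Set ℂ := {z | |z.im| ≤ 0.68 * z.re ∧ 0 < z.re}
def SN : Filter ℂ := comap Complex.re atTop ⊓ 𝓟 nsect

theorem nsect_sect {z : ℂ} (h : z ∈ nsect) : z ∈ sect := by
  obtain ⟨h1, h2⟩ := h
  change |z.im| < 1.4 * z.re
  linarith

theorem SN_le : SN ≤ SF := inf_le_inf_left _ (principal_mono.2 fun _ h => nsect_sect h)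

theorem SN_mem : ∀ᶠ z in SN, z ∈ nsect := mem_inf_of_right (mem_principal_self _)

theorem ray_SN : Tendsto (fun t : ℝ => (t:ℂ)) atTop SN := by
  refine tendsto_inf.2 ⟨tendsto_comap_iff.2 ?_, tendsto_principal.2 ?_⟩
  · exact tendsto_id
  · filter_upwards [eventually_gt_atTop 0] with t ht
    change |((t:ℂ)).im| ≤ 0.68 * ((t:ℂ)).re ∧ 0 < ((t:ℂ)).re
    simp; exact ⟨by positivity, ht⟩

theorem nsect_five {z : ℂ} (h : z ∈ nsect) : 0.01 * ‖sq z‖ ^ 5 ≤ (sq z * z ^ 2).re := by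
  have hz := sq_sq z
  have hu := sq_re_pos (sect_slit (nsect_sect h))
  obtain ⟨h1, h2⟩ := h
  set u := (sq z).re with hu'
  set v := (sq z).im with hv'
  have e0 : sq z = ⟨u, v⟩ := rfl
  have ez : z = ⟨u ^ 2 - v ^ 2, 2 * u * v⟩ := by
    rw [← hz, e0, pow_two]; apply Complex.ext <;> simp <;> ring
  have h1' : |2 * u * v| ≤ 0.68 * (u ^ 2 - v ^ 2) := by rw [ez] at h1; exact h1
  have e5 : (sq z * z ^ 2).re = u * (u ^ 4 - 10 * u ^ 2 * v ^ 2 + 5 * v ^ 4) := by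
    have : sq z * z ^ 2 = (sq z) ^ 5 := by nth_rewrite 2 [← hz]; ring
    rw [this, e0]; simp [pow_succ]; ring
  have hv : v ^ 2 ≤ 0.0948 * u ^ 2 := by
    rw [abs_le] at h1'
    have hv2 : |v| ≤ 0.3078 * u := by
      rw [abs_le]
      constructor
      · by_contra hcon; push Not at hcon; nlinarith
      · by_contra hcon; push Not at hcon; nlinarith
    have := sq_le_sq' (by linarith [neg_abs_le v, abs_le.1 hv2]) (abs_le.1 hv2).2
    nlinarith [sq_nonneg u]
  have hn : ‖sq z‖ ^ 2 = u ^ 2 + v ^ 2 := by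
    rw [← Complex.normSq_eq_norm_sq, Complex.normSq_apply]; ring
  have hn1 : ‖sq z‖ ≤ 1.05 * u := by
    apply le_of_sq_le_sq _ (by positivity)
    rw [hn]; nlinarith
  have hn5 : ‖sq z‖ ^ 5 ≤ 1.05 ^ 5 * u ^ 5 := by
    rw [← mul_pow]; gcongr
  rw [e5]
  have : 0.05 * u ^ 4 ≤ u ^ 4 - 10 * u ^ 2 * v ^ 2 + 5 * v ^ 4 := by
    nlinarith [mul_nonneg (sq_nonneg u) (sub_nonneg.2 hv), sq_nonneg v, sq_nonneg (v ^ 2)]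
  have h6 := mul_le_mul_of_nonneg_left this hu.le
  have : 0 < u ^ 5 := by positivity
  have e6 : u * (0.05 * u ^ 4) = 0.05 * u ^ 5 := by ring
  norm_num at hn5 h6 e6 ⊢
  linarith

/-- decay of the exponential, with a power -/
theorem exp_decay (p : ℂ) : Tendsto (fun z : ℂ => Complex.exp (-Th p z) * z ^ 2) SN (𝓝 0) := by
  have hg : Tendsto (fun x : ℝ => x ^ 4 * Real.exp (-x)) atTop (𝓝 0) := Real.tendsto_pow_mul_exp_neg_atTop_nhds_zero 4
  have hs : Tendsto (fun z : ℂ => ‖sq z‖) SN atTop := by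
    simp only [norm_sq]
    exact (tendsto_rpow_atTop (by norm_num)).comp (SF_norm.mono_left SN_le)
  refine squeeze_zero_norm' ?_ (hg.comp hs)
  filter_upwards [SN_mem, hs.eventually_ge_atTop (1 + 250 * (‖p‖ + 1))] with z hz hb
  simp only [Function.comp]
  rw [norm_mul, Complex.norm_exp, norm_pow, ← norm_sq_sq z, mul_comm, ← pow_mul]
  gcongr
  have h5 := nsect_five hz
  have hT : (Th p z).re = 2 / 5 * (sq z * z ^ 2).re + (sq z * p).re := by
    have : Th p z = ((2 / 5 : ℝ) : ℂ) * (sq z * z ^ 2) + sq z * p := by rw [Th]; push_cast; ring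
    rw [this, Complex.add_re, Complex.re_ofReal_mul]
  have h6 : |(sq z * p).re| ≤ ‖sq z‖ * ‖p‖ := by rw [← norm_mul]; exact Complex.abs_re_le_norm _
  have h7 := (abs_le.1 h6).1
  rw [Complex.neg_re, neg_le_neg_iff, hT]
  set r := ‖sq z‖
  have hp := norm_nonneg p
  have hr : 1 ≤ r := by linarith
  have hr5 : r * r ≤ r ^ 5 := by
    have : 1 ≤ r ^ 3 := one_le_pow₀ hr
    nlinarith [mul_nonneg (mul_self_nonneg r) (sub_nonneg.2 this)]
  nlinarith

theorem Y0_decay {p l c0 c1 : ℂ} (h : IsY0 p l c0 c1) :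
    Tendsto (fs p l c0 c1) SN (𝓝 0) ∧ Tendsto (fs' p l c0 c1) SN (𝓝 0) ∧
    Tendsto (fun z => Complex.exp (-Th p z)) SN (𝓝 0) := by
  have hd := exp_decay p
  have hne : ∀ᶠ z in SN, z ≠ 0 := ev_ne.filter_mono SN_le
  have hbig : ∀ᶠ z in SN, 1 ≤ ‖z‖ := (SF_norm.mono_left SN_le).eventually_ge_atTop 1
  have hexp : ∀ z, Complex.exp (Th p z) * Complex.exp (-Th p z) = 1 := by
    intro z; rw [← Complex.exp_add]; simp
  have small : ∀ c : ℝ, c ≤ 1 → Tendsto (fun z : ℂ => Complex.exp (-Th p z) * z ^ (c : ℂ)) SN (𝓝 0) := by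
    intro c hc
    refine squeeze_zero_norm' ?_ (by simpa using hd.norm)
    filter_upwards [hbig, hne] with z hz h0
    rw [norm_mul]
    gcongr
    rw [Complex.norm_cpow_real, ← Real.rpow_natCast]
    exact Real.rpow_le_rpow_of_exponent_le hz (by push_cast; linarith)
  refine ⟨?_, ?_, ?_⟩
  · have := (h.1.mono_left SN_le).mul (small (-(3 / 4)) (by norm_num))
    rw [mul_zero] at this
    refine this.congr' ?_
    filter_upwards [hne] with z h0
    have e2 := cpow_34' h0
    push_cast
    linear_combination fs p l c0 c1 z * (z ^ (-(3 / 4) : ℂ) * z ^ (3 / 4 : ℂ) * hexp z + e2)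
  · have := (h.2.mono_left SN_le).mul (small (3 / 4) (by norm_num))
    rw [mul_zero] at this
    refine this.congr' ?_
    filter_upwards [hne] with z h0
    have e2 := cpow_34' h0
    push_cast
    linear_combination fs' p l c0 c1 z * (z ^ (-(3 / 4) : ℂ) * z ^ (3 / 4 : ℂ) * hexp z + e2)
  · have := small 0 (by norm_num)
    simpa using this

theorem SN_neBot : SN.NeBot := ray_SN.neBot

theorem Y0_unique {p l c0 c1 d0 d1 : ℂ} (h : IsY0 p l c0 c1) (k : IsY0 p l d0 d1) : c0 = d0 ∧ c1 = d1 := by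
  have := SN_neBot
  have he := (Y0_decay h).2.2
  have hexp : ∀ z, Complex.exp (Th p z) * Complex.exp (-Th p z) = 1 := by
    intro z; rw [← Complex.exp_add]; simp
  have hne : ∀ᶠ z in SN, z ≠ 0 := ev_ne.filter_mono SN_le
  have hw : c0 * d1 - c1 * d0 = 0 := by
    have h1 := (((h.1.mul k.2).sub (h.2.mul k.1)).mono_left SN_le).mul (he.mul he)
    simp only [mul_zero] at h1
    refine tendsto_nhds_unique (Tendsto.congr' ?_ tendsto_const_nhds) h1
    filter_upwards [hne] with z h0
    rw [← wronsk_fs p l c0 c1 d0 d1 z]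
    have e2 := cpow_34' h0
    have e3 := hexp z
    have e4 : (Complex.exp (Th p z) * Complex.exp (-Th p z)) ^ 2 = 1 := by rw [e3]; norm_num
    linear_combination (-(fs p l c0 c1 z * fs' p l d0 d1 z - fs' p l c0 c1 z * fs p l d0 d1 z)) *
      (z ^ (-(3 / 4) : ℂ) * z ^ (3 / 4 : ℂ) * e4 + e2)
  -- ratio
  have h1 := h.1.mono_left SN_le
  have k1 := k.1.mono_left SN_le
  have r0 : d0 * 1 = c0 * 1 := by
    refine tendsto_nhds_unique (h1.const_mul d0) ((k1.const_mul c0).congr fun z => ?_)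
    rw [(fs_lin p l c0 c1 z).1, (fs_lin p l d0 d1 z).1]
    linear_combination (fs p l 0 1 z * (z ^ (3 / 4 : ℂ) * Complex.exp (Th p z))) * hw
  have r1 : d1 * 1 = c1 * 1 := by
    refine tendsto_nhds_unique (h1.const_mul d1) ((k1.const_mul c1).congr fun z => ?_)
    rw [(fs_lin p l c0 c1 z).1, (fs_lin p l d0 d1 z).1]
    linear_combination (-(fs p l 1 0 z * (z ^ (3 / 4 : ℂ) * Complex.exp (Th p z)))) * hw
  exact ⟨by simpa using r0.symm, by simpa using r1.symm⟩

theorem Y0_ex (p l : ℂ) : ∃ c : ℂ × ℂ, IsY0 p l c.1 c.2 := by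
  obtain ⟨A, B, -, -, h⟩ := Y0_exists (5 + ‖p‖ + ‖l‖) (by linarith [norm_nonneg p, norm_nonneg l])
  exact ⟨(A (p, l), B (p, l)), h (p, l) ⟨by simp only; linarith [norm_nonneg p, norm_nonneg l],
    by simp only; linarith [norm_nonneg p, norm_nonneg l]⟩⟩

noncomputable def gA (w : ℂ × ℂ) : ℂ := (Y0_ex w.1 w.2).choose.1
noncomputable def gB (w : ℂ × ℂ) : ℂ := (Y0_ex w.1 w.2).choose.2

theorem gAB (p l : ℂ) : IsY0 p l (gA (p, l)) (gB (p, l)) := (Y0_ex p l).choose_spec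

theorem gA_gB_hol : HolOn univ gA ∧ HolOn univ gB := by
  have key : ∀ x : ℂ × ℂ, ∃ V, IsOpen V ∧ x ∈ V ∧ HolOn V gA ∧ HolOn V gB := by
    intro x
    have hx1 := norm_nonneg x.1
    have hx2 := norm_nonneg x.2
    obtain ⟨A, B, hA, hB, h⟩ := Y0_exists (5 + ‖x.1‖ + ‖x.2‖) (by linarith)
    refine ⟨{w : ℂ × ℂ | ‖w.1‖ < 5 + ‖x.1‖ + ‖x.2‖ ∧ ‖w.2‖ < 5 + ‖x.1‖ + ‖x.2‖}, ?_, ?_, ?_, ?_⟩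
    · exact (isOpen_lt (continuous_fst.norm) continuous_const).inter (isOpen_lt (continuous_snd.norm) continuous_const)
    · exact ⟨by linarith, by linarith⟩
    · exact hA.congr fun w hw => (Y0_unique (gAB w.1 w.2) (h w hw)).1
    · exact hB.congr fun w hw => (Y0_unique (gAB w.1 w.2) (h w hw)).2
  constructor
  · refine HolOn.of_local isOpen_univ fun x _ => ?_
    obtain ⟨V, h1, h2, h3, h4⟩ := key x
    exact ⟨V, h1, h2, h3.mono inter_subset_left⟩
  · refine HolOn.of_local isOpen_univ fun x _ => ?_
    obtain ⟨V, h1, h2, h3, h4⟩ := key x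
    exact ⟨V, h1, h2, h4.mono inter_subset_left⟩

end PTC

open Complex Filter

namespace PTC
open Topology Set MeasureTheory

/-- unit complex number with argument `x` degrees -/
noncomputable def rt (x : ℝ) : ℂ := Complex.exp ((x * (Real.pi / 180) : ℝ) * I)

theorem rt_add (x y : ℝ) : rt (x + y) = rt x * rt y := by
  rw [rt, rt, rt, ← Complex.exp_add]; congr 1; push_cast; ring

theorem rt_zero : rt 0 = 1 := by simp [rt]

theorem rt_180 : rt 180 = -1 := by
  rw [rt, show (180 * (Real.pi / 180) : ℝ) = Real.pi by ring, Complex.exp_pi_mul_I]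

theorem rt_90 : rt 90 = I := by
  rw [rt, show (90 * (Real.pi / 180) : ℝ) = Real.pi / 2 by ring]; push_cast; exact Complex.exp_pi_div_two_mul_I

theorem neg_rt (x : ℝ) : -rt x = rt (x + 180) := by rw [rt_add, rt_180]; ring

theorem rt_360 : rt 360 = 1 := by
  rw [show (360:ℝ) = 180 + 180 by norm_num, rt_add, rt_180]; norm_num

theorem rt_add_360 (x : ℝ) : rt (x + 360) = rt x := by rw [rt_add, rt_360, mul_one]

theorem rt_neg (x : ℝ) : rt (-x) * rt x = 1 := by rw [← rt_add]; simp [rt_zero]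

theorem rt_ne (x : ℝ) : rt x ≠ 0 := Complex.exp_ne_zero _

theorem rt_inv (x : ℝ) : (rt x)⁻¹ = rt (-x) := by
  rw [inv_eq_iff_eq_inv, eq_comm, inv_eq_of_mul_eq_one_right (rt_neg x)]

theorem rt_norm (x : ℝ) : ‖rt x‖ = 1 := Complex.norm_exp_ofReal_mul_I _

theorem rt_pow (x : ℝ) (n : ℕ) : rt x ^ n = rt (n * x) := by
  rw [rt, rt, ← Complex.exp_nat_mul]; congr 1; push_cast; ring

theorem rt_re (x : ℝ) : (rt x).re = Real.cos (x * (Real.pi / 180)) := by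
  rw [rt, Complex.exp_ofReal_mul_I_re]

theorem rt_im (x : ℝ) : (rt x).im = Real.sin (x * (Real.pi / 180)) := by
  rw [rt, Complex.exp_ofReal_mul_I_im]

theorem rt_conj (x : ℝ) : (starRingEnd ℂ) (rt x) = rt (-x) := by
  apply Complex.ext
  · rw [Complex.conj_re, rt_re, rt_re, neg_mul, Real.cos_neg]
  · rw [Complex.conj_im, rt_im, rt_im, neg_mul, Real.sin_neg]

theorem ray_cpow {t θ : ℝ} (c : ℝ) (ht : 0 < t) (h1 : -180 < θ) (h2 : θ < 180) :
    ((t:ℂ) * rt θ) ^ (c:ℂ) = ((t ^ c : ℝ) : ℂ) * rt (θ * c) := by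
  have h0 : (t:ℂ) * rt θ ≠ 0 := mul_ne_zero (by exact_mod_cast ht.ne') (rt_ne _)
  have hlog : Complex.log ((t:ℂ) * rt θ) = Real.log t + (θ * (Real.pi / 180) : ℝ) * I := by
    rw [Complex.log_ofReal_mul ht (rt_ne _), rt, Complex.log_exp]
    · simp; nlinarith [Real.pi_pos]
    · simp; nlinarith [Real.pi_pos]
  rw [Complex.cpow_def_of_ne_zero h0, hlog, Real.rpow_def_of_pos ht, add_mul, Complex.exp_add, rt]
  push_cast
  congr 2; ring

theorem ray_SF' {θ : ℝ} (h : |(rt θ).im| < 1.4 * (rt θ).re) : Tendsto (fun t : ℝ => (t:ℂ) * rt θ) atTop SF := by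
  have hc : 0 < (rt θ).re := by linarith [abs_nonneg (rt θ).im]
  refine tendsto_inf.2 ⟨tendsto_comap_iff.2 ?_, tendsto_principal.2 ?_⟩
  · have : (Complex.re ∘ fun t : ℝ => (t:ℂ) * rt θ) = fun t : ℝ => t * (rt θ).re := by
      funext t; simp
    rw [this]
    exact tendsto_id.atTop_mul_const hc
  · filter_upwards [eventually_gt_atTop 0] with t ht
    change |((t:ℂ) * rt θ).im| < 1.4 * ((t:ℂ) * rt θ).re
    rw [Complex.re_ofReal_mul, Complex.im_ofReal_mul, abs_mul, abs_of_pos ht]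
    nlinarith

theorem cs36 : (rt 36).re ^ 2 < 0.66 ∧ 0.8 < (rt 36).re ∧ (rt 36).re < 0.81 ∧ 0.58 < (rt 36).im ∧ (rt 36).im < 0.6 := by
  have h5 : √5 ^ 2 = 5 := Real.sq_sqrt (by norm_num)
  have h5' : 2.236 < √5 := Real.lt_sqrt_of_sq_lt (by norm_num)
  have h5'' : √5 < 2.237 := by rw [Real.sqrt_lt' (by norm_num)]; norm_num
  have hc : (rt 36).re = (1 + √5) / 4 := by
    rw [rt_re, show (36 * (Real.pi / 180) : ℝ) = Real.pi / 5 by ring, Real.cos_pi_div_five]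
  have hs : 0 < (rt 36).im := by
    rw [rt_im]; apply Real.sin_pos_of_pos_of_lt_pi <;> nlinarith [Real.pi_pos]
  have hn : (rt 36).re ^ 2 + (rt 36).im ^ 2 = 1 := by
    rw [rt_re, rt_im]; exact Real.cos_sq_add_sin_sq _
  rw [hc] at hn ⊢
  refine ⟨by nlinarith, by linarith, by linarith, ?_, ?_⟩
  · by_contra hh; push Not at hh; nlinarith
  · by_contra hh; push Not at hh; nlinarith

theorem cs54 : (rt 54).re = (rt 36).im ∧ (rt 54).im = (rt 36).re := by
  rw [rt_re, rt_im, rt_re, rt_im]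
  rw [show (54 * (Real.pi / 180) : ℝ) = Real.pi / 2 - 36 * (Real.pi / 180) by ring, Real.cos_pi_div_two_sub,
    Real.sin_pi_div_two_sub]
  exact ⟨rfl, rfl⟩

theorem rt_neg_re (x : ℝ) : (rt (-x)).re = (rt x).re ∧ (rt (-x)).im = -(rt x).im := by
  rw [← rt_conj]; exact ⟨Complex.conj_re _, Complex.conj_im _⟩

theorem sect36 : |(rt 36).im| < 1.4 * (rt 36).re ∧ |(rt (-36)).im| < 1.4 * (rt (-36)).re := by
  obtain ⟨h1, h2, h3, h4, h5⟩ := cs36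
  rw [(rt_neg_re 36).1, (rt_neg_re 36).2, abs_neg, abs_of_pos (by linarith)]
  constructor <;> linarith

theorem sect54 : |(rt 54).im| < 1.4 * (rt 54).re ∧ |(rt (-54)).im| < 1.4 * (rt (-54)).re := by
  obtain ⟨h1, h2, h3, h4, h5⟩ := cs36
  rw [(rt_neg_re 54).1, (rt_neg_re 54).2, abs_neg, cs54.1, cs54.2, abs_of_pos (by linarith)]
  constructor <;> linarith

/-- initial data of the rotated subdominant solution -/
noncomputable def cA (x : ℝ) (p l : ℂ) : ℂ := gA (rt (3 * x) * p, rt (2 * x) * l)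
noncomputable def cB (x : ℝ) (p l : ℂ) : ℂ := rt (-x) * gB (rt (3 * x) * p, rt (2 * x) * l)
noncomputable def WR (x y : ℝ) (p l : ℂ) : ℂ := cA x p l * cB y p l - cB x p l * cA y p l

theorem rot_fs {x : ℝ} (hx : rt (5 * x) = 1) (p l z : ℂ) :
    fs p l (cA x p l) (cB x p l) z =
      fs (rt (3 * x) * p) (rt (2 * x) * l) (gA (rt (3 * x) * p, rt (2 * x) * l)) (gB (rt (3 * x) * p, rt (2 * x) * l)) (rt (-x) * z) ∧
    fs' p l (cA x p l) (cB x p l) z =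
      rt (-x) * fs' (rt (3 * x) * p) (rt (2 * x) * l) (gA (rt (3 * x) * p, rt (2 * x) * l)) (gB (rt (3 * x) * p, rt (2 * x) * l)) (rt (-x) * z) := by
  set P := rt (3 * x) * p with hP
  set L := rt (2 * x) * l with hL
  have hs : Sol p l (fun z => fs P L (gA (P, L)) (gB (P, L)) (rt (-x) * z))
      (fun z => rt (-x) * fs' P L (gA (P, L)) (gB (P, L)) (rt (-x) * z)) := by
    intro z
    have hm : HasDerivAt (fun z => rt (-x) * z) (rt (-x)) z := by
      simpa using (hasDerivAt_id z).const_mul (rt (-x))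
    constructor
    · exact ((fs_hasDerivAt P L (gA (P, L)) (gB (P, L)) (rt (-x) * z)).comp z hm).congr_deriv (by ring)
    · refine (((fs'_hasDerivAt P L (gA (P, L)) (gB (P, L)) (rt (-x) * z)).comp z hm).const_mul (rt (-x))).congr_deriv ?_
      have e1 : rt (-x) * rt x = 1 := rt_neg x
      have e5 : rt x ^ 5 = 1 := by rw [rt_pow]; exact_mod_cast hx
      have e5' : rt (-x) ^ 5 = 1 := by
        have : (rt (-x) * rt x) ^ 5 = 1 := by rw [e1]; norm_num
        rwa [mul_pow, e5, mul_one] at this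
      have e3 : rt (3 * x) = rt x ^ 3 := by rw [rt_pow]; norm_cast
      have e2 : rt (2 * x) = rt x ^ 2 := by rw [rt_pow]; norm_cast
      have f3 : rt (-x) ^ 3 * rt x ^ 3 = 1 := by rw [← mul_pow, e1]; norm_num
      have f2 : rt (-x) ^ 2 * rt x ^ 2 = 1 := by rw [← mul_pow, e1]; norm_num
      rw [hP, hL, e3, e2]
      linear_combination (fs (rt x ^ 3 * p) (rt x ^ 2 * l) (gA (rt x ^ 3 * p, rt x ^ 2 * l)) (gB (rt x ^ 3 * p, rt x ^ 2 * l)) (rt (-x) * z)) *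
        (e5' * z ^ 3 + f3 * p * z + f2 * l)
  have := hs.eq_fs z
  simp only [mul_zero, fs_zero, fs'_zero] at this
  exact ⟨this.1.symm, this.2.symm⟩

theorem WR_adj0 (p l : ℂ) : WR 0 72 p l = 2 * rt 54 := by
  have h72 : rt (5 * 72) = 1 := by rw [show (5 * 72 : ℝ) = 360 by norm_num, rt_360]
  have h00 : rt (5 * 0) = 1 := by rw [mul_zero, rt_zero]
  set P := rt (3 * 72) * p with hP
  set L := rt (2 * 72) * l with hL
  set c0 := gA (p, l) with hc0
  set c1 := gB (p, l) with hc1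
  set d0 := gA (P, L) with hd0
  set d1 := gB (P, L) with hd1
  have hA0 : cA 0 p l = c0 := by simp [cA, rt_zero, hc0]
  have hB0 : cB 0 p l = c1 := by simp [cB, rt_zero, hc1]
  have hY0 : IsY0 p l c0 c1 := gAB p l
  have hY1 : IsY0 P L d0 d1 := gAB P L
  have l1 := hY0.1.comp (ray_SF' sect36.1)
  have l2 := hY0.2.comp (ray_SF' sect36.1)
  have m1 := hY1.1.comp (ray_SF' sect36.2)
  have m2 := hY1.2.comp (ray_SF' sect36.2)
  have hlim := (((l1.mul m2).const_mul (rt (-72) * rt (-54))).sub ((l2.mul m1).const_mul (rt 54)))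
  have hval : rt (-72) * rt (-54) * (1 * -1) - rt 54 * (-1 * 1) = 2 * rt 54 := by
    rw [← rt_add, show (-72 + -54 : ℝ) = 54 + (-180) by norm_num, rt_add]
    have : rt (-180) = -1 := by
      have := rt_neg 180; rw [rt_180] at this; linear_combination -this
    rw [this]; ring
  rw [hval] at hlim
  refine tendsto_nhds_unique (Tendsto.congr' ?_ tendsto_const_nhds) hlim
  filter_upwards [eventually_gt_atTop 0] with t ht
  simp only [Function.comp]
  set z : ℂ := (t:ℂ) * rt 36 with hz
  have hw : rt (-72) * z = (t:ℂ) * rt (-36) := by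
    have e36 : rt 36 = rt 72 * rt (-36) := by rw [← rt_add]; norm_num
    rw [hz, e36]
    linear_combination (t * rt (-36)) * rt_neg 72
  have hrot := rot_fs h72 p l z
  rw [← hP, ← hL, ← hd0, ← hd1, hw] at hrot
  have hwr := wronsk_fs p l (cA 0 p l) (cB 0 p l) (cA 72 p l) (cB 72 p l) z
  rw [hrot.1, hrot.2] at hwr
  rw [WR, ← hwr, hA0, hB0]
  have q1 := ray_cpow (3 / 4) ht (θ := 36) (by norm_num) (by norm_num)
  have q2 := ray_cpow (-(3 / 4)) ht (θ := 36) (by norm_num) (by norm_num)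
  have q3 := ray_cpow (3 / 4) ht (θ := -36) (by norm_num) (by norm_num)
  have q4 := ray_cpow (-(3 / 4)) ht (θ := -36) (by norm_num) (by norm_num)
  have s1 : sq z = ((t ^ (1 / 2 : ℝ) : ℝ) : ℂ) * rt 18 := by
    have := ray_cpow (1 / 2) ht (θ := 36) (by norm_num) (by norm_num)
    rw [sq, hz]; push_cast at this ⊢; rw [this]; norm_num
  have s2 : sq ((t:ℂ) * rt (-36)) = ((t ^ (1 / 2 : ℝ) : ℝ) : ℂ) * rt (-18) := by
    have := ray_cpow (1 / 2) ht (θ := -36) (by norm_num) (by norm_num)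
    rw [sq]; push_cast at this ⊢; rw [this]; norm_num
  have hTh : Th P ((t:ℂ) * rt (-36)) = - Th p z := by
    rw [Th, Th, s1, s2, hz, hP, mul_pow, mul_pow, rt_pow, rt_pow]
    have a1 : rt (-18) * rt (((2:ℕ):ℝ) * -36) = - (rt 18 * rt (((2:ℕ):ℝ) * 36)) := by
      rw [← rt_add, ← rt_add, neg_rt, ← rt_add_360]; congr 1; norm_num
    have a2 : rt (-18) * rt (3 * 72) = - rt 18 := by
      rw [← rt_add, neg_rt]; congr 1; norm_num
    linear_combination (((t ^ (1 / 2 : ℝ) : ℝ) : ℂ) * (2 / 5) * t ^ 2) * a1 + ((t ^ (1 / 2 : ℝ) : ℝ) : ℂ) * p * a2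
  push_cast at q1 q2 q3 q4
  rw [hTh, hz, q1, q2, q3, q4, Real.rpow_neg ht.le]
  have hexp : Complex.exp (Th p z) * Complex.exp (- Th p z) = 1 := by rw [← Complex.exp_add]; simp
  rw [← hz]
  have hr0 : ((t ^ (3 / 4 : ℝ) : ℝ) : ℂ) ≠ 0 := by exact_mod_cast (Real.rpow_pos_of_pos ht _).ne'
  have hr : ((t ^ (3 / 4 : ℝ) : ℝ) : ℂ) * (((t ^ (3 / 4 : ℝ))⁻¹ : ℝ) : ℂ) = 1 := by
    push_cast; exact mul_inv_cancel₀ hr0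
  have b1 : rt (-54) * (rt (36 * (3 / 4)) * rt (-36 * -(3 / 4))) = 1 := by
    rw [← rt_add, ← rt_add, ← rt_zero]; congr 1; norm_num
  have b2 : rt 54 * (rt (36 * -(3 / 4)) * rt (-36 * (3 / 4))) = 1 := by
    rw [← rt_add, ← rt_add, ← rt_zero]; congr 1; norm_num
  set F0 := fs p l c0 c1 z
  set F0' := fs' p l c0 c1 z
  set F1 := fs P L d0 d1 ((t:ℂ) * rt (-36))
  set F1' := fs' P L d0 d1 ((t:ℂ) * rt (-36))
  set r := ((t ^ (3 / 4 : ℝ) : ℝ) : ℂ)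
  set r' := (((t ^ (3 / 4 : ℝ))⁻¹ : ℝ) : ℂ)
  set e := Complex.exp (Th p z)
  set e' := Complex.exp (-Th p z)
  have g1 : (r * r') * (e * e') * (rt (-54) * (rt (36 * (3 / 4)) * rt (-36 * -(3 / 4)))) = 1 := by rw [hr, hexp, b1]; norm_num
  have g2 : (r * r') * (e * e') * (rt 54 * (rt (36 * -(3 / 4)) * rt (-36 * (3 / 4)))) = 1 := by rw [hr, hexp, b2]; norm_num
  linear_combination (- rt (-72) * F0 * F1') * g1 + F0' * F1 * g2

theorem cA_shift (x y : ℝ) (p l : ℂ) : cA (x + y) p l = cA y (rt (3 * x) * p) (rt (2 * x) * l) := by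
  rw [cA, cA, mul_add, mul_add, rt_add, rt_add]; congr 2 <;> ring

theorem cB_shift (x y : ℝ) (p l : ℂ) : cB (x + y) p l = rt (-x) * cB y (rt (3 * x) * p) (rt (2 * x) * l) := by
  rw [cB, cB, mul_add, mul_add, rt_add, rt_add, neg_add, rt_add, mul_assoc]; congr 4 <;> ring

theorem WR_shift (x y z : ℝ) (p l : ℂ) : WR (x + y) (x + z) p l = rt (-x) * WR y z (rt (3 * x) * p) (rt (2 * x) * l) := by
  rw [WR, WR, cA_shift, cA_shift, cB_shift, cB_shift]; ring

theorem WR_adj (x : ℝ) (p l : ℂ) : WR x (x + 72) p l = 2 * rt (54 - x) := by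
  have := WR_shift x 0 72 p l
  rw [add_zero, WR_adj0] at this
  rw [this, sub_eq_add_neg, rt_add]; ring

theorem cAB_period (x : ℝ) (p l : ℂ) : cA (x + 360) p l = cA x p l ∧ cB (x + 360) p l = cB x p l := by
  have e1 : rt (3 * (x + 360)) = rt (3 * x) := by
    rw [show 3 * (x + 360) = 3 * x + 360 + 360 + 360 by ring]; simp [rt_add_360]
  have e2 : rt (2 * (x + 360)) = rt (2 * x) := by
    rw [show 2 * (x + 360) = 2 * x + 360 + 360 by ring]; simp [rt_add_360]
  have e3 : rt (-(x + 360)) = rt (-x) := by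
    rw [← rt_add_360 (-(x + 360))]; congr 1; ring
  rw [cA, cB, e1, e2, e3]; exact ⟨rfl, rfl⟩

end PTC

open Complex Filter

namespace PTC
open Topology Set MeasureTheory

theorem line_SN {θ : ℝ} (c : ℂ) (h : |(rt θ).im| < 0.68 * (rt θ).re) :
    Tendsto (fun x : ℝ => rt θ * (x + c)) atTop SN := by
  have hc : 0 < (rt θ).re := by linarith [abs_nonneg (rt θ).im]
  have hre : ∀ x : ℝ, (rt θ * (x + c)).re = x * (rt θ).re + (rt θ * c).re := by
    intro x; rw [mul_add, Complex.add_re, mul_comm (rt θ) (x:ℂ), Complex.re_ofReal_mul]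
  have him : ∀ x : ℝ, (rt θ * (x + c)).im = x * (rt θ).im + (rt θ * c).im := by
    intro x; rw [mul_add, Complex.add_im, mul_comm (rt θ) (x:ℂ), Complex.im_ofReal_mul]
  have hlim : Tendsto (fun x : ℝ => (rt θ * (x + c)).re) atTop atTop := by
    simp only [hre]
    exact tendsto_atTop_add_const_right _ _ (tendsto_id.atTop_mul_const hc)
  refine tendsto_inf.2 ⟨tendsto_comap_iff.2 hlim, tendsto_principal.2 ?_⟩
  have hd : 0 < 0.68 * (rt θ).re - |(rt θ).im| := by linarith
  filter_upwards [eventually_ge_atTop 0, hlim.eventually_gt_atTop 0,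
    (tendsto_id.atTop_mul_const hd).eventually_ge_atTop (|(rt θ * c).im| - 0.68 * (rt θ * c).re)] with x hx0 hx1 hx2
  refine ⟨?_, hx1⟩
  rw [hre, him]
  have h1 := abs_add_le (x * (rt θ).im) ((rt θ * c).im)
  rw [abs_mul, abs_of_nonneg hx0] at h1
  simp only [id] at hx2
  nlinarith

theorem rot_decay {x : ℝ} (hx : rt (5 * x) = 1) (p l : ℂ) {α : Type*} {G : Filter α} {z : α → ℂ}
    (hz : Tendsto (fun s => rt (-x) * z s) G SN) :
    Tendsto (fun s => fs p l (cA x p l) (cB x p l) (z s)) G (𝓝 0) ∧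
    Tendsto (fun s => fs' p l (cA x p l) (cB x p l) (z s)) G (𝓝 0) := by
  have hd := Y0_decay (gAB (rt (3 * x) * p) (rt (2 * x) * l))
  constructor
  · refine (hd.1.comp hz).congr fun s => ?_
    rw [(rot_fs hx p l (z s)).1]; rfl
  · have := (hd.2.1.comp hz).const_mul (rt (-x))
    rw [mul_zero] at this
    refine this.congr fun s => ?_
    rw [(rot_fs hx p l (z s)).2]; rfl

theorem Th_rot (p : ℂ) {t θ σ : ℝ} (hσ : σ = 1 ∨ σ = -1) (ht : 0 < t) (h1 : -90 < θ) (h2 : θ < 90) :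
    Th (rt (216 * σ) * p) ((t:ℂ) * rt (θ - 72 * σ)) = - Th p ((t:ℂ) * rt θ) := by
  have hb : -180 < θ - 72 * σ ∧ θ - 72 * σ < 180 := by rcases hσ with h | h <;> subst h <;> constructor <;> linarith
  have s1 : sq ((t:ℂ) * rt θ) = ((t ^ (1 / 2 : ℝ) : ℝ) : ℂ) * rt (θ / 2) := by
    have := ray_cpow (1 / 2) ht (θ := θ) (by linarith) (by linarith)
    rw [sq]; push_cast at this ⊢; rw [this]; congr 2; ring
  have s2 : sq ((t:ℂ) * rt (θ - 72 * σ)) = ((t ^ (1 / 2 : ℝ) : ℝ) : ℂ) * rt (θ / 2 - 36 * σ) := by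
    have := ray_cpow (1 / 2) ht (θ := θ - 72 * σ) hb.1 hb.2
    rw [sq]; push_cast at this ⊢; rw [this]; congr 2; ring
  rw [Th, Th, s1, s2, mul_pow, mul_pow, rt_pow, rt_pow]
  have hh : ∀ x y : ℝ, x = y + 180 ∨ x = y - 180 → rt x = - rt y := by
    intro x y h
    rcases h with h | h
    · rw [h, neg_rt]
    · rw [neg_rt, ← rt_add_360 x]; congr 1; linarith
  have a1 : rt (θ / 2 - 36 * σ) * rt (((2:ℕ):ℝ) * (θ - 72 * σ)) = - (rt (θ / 2) * rt (((2:ℕ):ℝ) * θ)) := by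
    rw [← rt_add, ← rt_add]
    apply hh; push_cast
    rcases hσ with h | h <;> subst h
    · right; ring
    · left; ring
  have a2 : rt (θ / 2 - 36 * σ) * rt (216 * σ) = - rt (θ / 2) := by
    rw [← rt_add]
    apply hh
    rcases hσ with h | h <;> subst h
    · left; ring
    · right; ring
  linear_combination (((t ^ (1 / 2 : ℝ) : ℝ) : ℂ) * (2 / 5) * t ^ 2) * a1 + ((t ^ (1 / 2 : ℝ) : ℝ) : ℂ) * p * a2

theorem n18 : |(rt 18).im| < 0.68 * (rt 18).re ∧ |(rt (-18)).im| < 0.68 * (rt (-18)).re := by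
  obtain ⟨h1, h2, h3, h4, h5⟩ := cs36
  have e : rt 36 = rt 18 * rt 18 := by rw [← rt_add]; norm_num
  have e1 : (rt 36).im = 2 * (rt 18).re * (rt 18).im := by rw [e, Complex.mul_im]; ring
  have hc : 0 < (rt 18).re := by rw [rt_re]; apply Real.cos_pos_of_mem_Ioo; constructor <;> nlinarith [Real.pi_pos]
  have hn : (rt 18).re ^ 2 + (rt 18).im ^ 2 = 1 := by rw [rt_re, rt_im]; exact Real.cos_sq_add_sin_sq _
  have e2 : (rt 36).re = (rt 18).re ^ 2 - (rt 18).im ^ 2 := by rw [e, Complex.mul_re]; ring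
  have hs : 0 < (rt 18).im := by
    by_contra hh; push Not at hh; nlinarith
  rw [(rt_neg_re 18).1, (rt_neg_re 18).2, abs_neg, abs_of_pos hs]
  constructor <;> by_contra hh <;> push Not at hh <;> nlinarith

theorem blow (P : ℂ) {σ : ℝ} (hσ : σ = 1 ∨ σ = -1) :
    Tendsto (fun t : ℝ => ((t:ℂ) * rt (-(54 * σ))) ^ (3 / 4 : ℂ) * Complex.exp (Th P ((t:ℂ) * rt (-(54 * σ))))) atTop (𝓝 0) := by
  set p := rt (-(216 * σ)) * P with hp
  have hP : P = rt (216 * σ) * p := by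
    rw [hp, ← mul_assoc, mul_comm (rt (216 * σ)), rt_neg, one_mul]
  have hn : |(rt (18 * σ)).im| < 0.68 * (rt (18 * σ)).re := by
    rcases hσ with h | h <;> subst h
    · simpa using n18.1
    · simpa using n18.2
  have hl := line_SN 0 hn
  have hd := (exp_decay p).comp hl
  have hd' : Tendsto (fun t : ℝ => ‖Complex.exp (-Th p ((t:ℂ) * rt (18 * σ)))‖ * ‖((t:ℂ) * rt (18 * σ)) ^ 2‖) atTop (𝓝 0) := by
    have := hd.norm
    rw [norm_zero] at this
    refine this.congr fun t => ?_
    simp only [Function.comp]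
    rw [add_zero, mul_comm (rt (18 * σ)) (t:ℂ), norm_mul]
  refine squeeze_zero_norm' ?_ hd'
  filter_upwards [eventually_ge_atTop 1] with t ht
  have ht0 : 0 < t := by linarith
  have e1 := Th_rot p (t := t) (θ := 18 * σ) hσ ht0 (by rcases hσ with h | h <;> subst h <;> norm_num)
    (by rcases hσ with h | h <;> subst h <;> norm_num)
  rw [← hP, show 18 * σ - 72 * σ = -(54 * σ) by ring] at e1
  have e2 : rt (18 * σ) * ((t:ℂ) + 0) = (t:ℂ) * rt (18 * σ) := by ring
  rw [norm_mul, mul_comm, e1]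
  gcongr
  rw [norm_pow]
  rw [show (3 / 4 : ℂ) = ((3 / 4 : ℝ) : ℂ) by push_cast; rfl, Complex.norm_cpow_real, norm_mul, norm_mul, rt_norm, rt_norm,
    mul_one, Complex.norm_real, Real.norm_of_nonneg ht0.le, ← Real.rpow_natCast]
  exact Real.rpow_le_rpow_of_exponent_le ht (by norm_num)

theorem dec_wr {x1 x2 σ : ℝ} (hσ : σ = 1 ∨ σ = -1) {u : ℂ} (hx1 : rt (5 * x1) = 1) (hx2 : rt (5 * x2) = 1)
    (hu1 : rt (-x1) * u = rt (18 * σ)) (hu2 : rt (-x2) * u = rt (-(54 * σ))) {p l c0 c1 : ℂ}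
    (h : Tendsto (fun t : ℝ => fs p l c0 c1 (u * t)) atTop (𝓝 0)) : c0 * cB x1 p l - c1 * cA x1 p l = 0 := by
  have hn : |(rt (18 * σ)).im| < 0.68 * (rt (18 * σ)).re := by
    rcases hσ with h | h <;> subst h
    · simpa using n18.1
    · simpa using n18.2
  have hn54 : |(rt (-(54 * σ))).im| < 1.4 * (rt (-(54 * σ))).re := by
    rcases hσ with h | h <;> subst h
    · simpa using sect54.2
    · simpa using sect54.1
  have d1 : Tendsto (fun t : ℝ => fs p l (cA x1 p l) (cB x1 p l) (u * t)) atTop (𝓝 0) := by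
    refine (rot_decay hx1 p l (G := atTop) (z := fun t : ℝ => u * t) ?_).1
    refine (line_SN 0 hn).congr fun t => ?_
    rw [← hu1]; ring
  have d2 := (gAB (rt (3 * x2) * p) (rt (2 * x2) * l)).1.comp (ray_SF' hn54)
  have d3 := blow (rt (3 * x2) * p) hσ
  have d4 := d2.const_mul (c0 * cB x1 p l - c1 * cA x1 p l)
  rw [mul_one] at d4
  have d5 := (((d1.const_mul (c0 * cB x2 p l - c1 * cA x2 p l)).sub (h.const_mul (WR x1 x2 p l))).mul d3)
  simp only [mul_zero, sub_zero] at d5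
  refine tendsto_nhds_unique d4 (d5.congr fun t => ?_)
  simp only [Function.comp]
  have e1 : rt (-x2) * (u * t) = (t:ℂ) * rt (-(54 * σ)) := by rw [← hu2]; ring
  rw [← e1, ← (rot_fs hx2 p l (u * t)).1, (fs_lin p l (cA x1 p l) (cB x1 p l) _).1, (fs_lin p l (cA x2 p l) (cB x2 p l) _).1,
    (fs_lin p l c0 c1 _).1, WR]
  ring

theorem r5 : rt (5 * 72) = 1 ∧ rt (5 * 144) = 1 ∧ rt (5 * 216) = 1 ∧ rt (5 * 288) = 1 := by
  refine ⟨?_, ?_, ?_, ?_⟩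
  · rw [← rt_360]; norm_num
  · rw [show (5 * 144 : ℝ) = 0 + 360 + 360 by norm_num]; simp [rt_add_360, rt_360]
  · rw [show (5 * 216 : ℝ) = 0 + 360 + 360 + 360 by norm_num]; simp [rt_add_360, rt_360]
  · rw [show (5 * 288 : ℝ) = 0 + 360 + 360 + 360 + 360 by norm_num]; simp [rt_add_360, rt_360]

theorem u72 : rt (-72) * I = rt 18 ∧ rt (-144) * I = rt (-54) ∧ rt (-288) * (-I) = rt (-18) ∧ rt (-216) * (-I) = rt 54 := by
  rw [← rt_90, neg_rt, ← rt_add, ← rt_add, ← rt_add, ← rt_add]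
  norm_num

/-- the spectral determinant -/
noncomputable def FF (a l : ℂ) : ℂ := WR 72 288 (-a) l

theorem cAB_ne (x : ℝ) (p l : ℂ) : ¬ (cA x p l = 0 ∧ cB x p l = 0) := by
  rintro ⟨h1, h2⟩
  have := WR_adj x p l
  rw [WR, h1, h2] at this
  simp [rt_ne] at this

theorem eig_sol {a lam : ℂ} {y : ℂ → ℂ} (h : IsCubicEigenfunction a lam y) : Sol (-a) lam y (deriv y) := by
  obtain ⟨h1, -, h3, -, -⟩ := h
  intro z
  refine ⟨(h1 z).hasDerivAt, ?_⟩
  have hd : Differentiable ℂ (deriv y) := by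
    have := (h1.contDiff (n := 2))
    exact (this.differentiable_deriv_two)
  refine (hd z).hasDerivAt.congr_deriv ?_
  linear_combination -h3 z

theorem eig_coef {a lam : ℂ} {y : ℂ → ℂ} (h : IsCubicEigenfunction a lam y) :
    ∃ c0 c1 : ℂ, ¬ (c0 = 0 ∧ c1 = 0) ∧ (∀ z, y z = fs (-a) lam c0 c1 z) ∧
      c0 * cB 72 (-a) lam - c1 * cA 72 (-a) lam = 0 ∧ c0 * cB 288 (-a) lam - c1 * cA 288 (-a) lam = 0 := by
  have hs := eig_sol h
  obtain ⟨-, hne, -, ht1, ht2⟩ := h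
  have he := fun z => (hs.eq_fs z).1
  refine ⟨y 0, deriv y 0, ?_, he, ?_, ?_⟩
  · rintro ⟨h0, h1⟩
    apply hne
    funext z
    rw [he z, (fs_lin _ _ _ _ z).1, h0, h1]; simp
  · refine dec_wr (σ := 1) (Or.inl rfl) (x2 := 144) r5.1 r5.2.1 (u := I) (by rw [mul_one]; exact u72.1)
      (by rw [mul_one]; exact u72.2.1) (ht1.congr fun t => he _)
  · refine dec_wr (σ := -1) (Or.inr rfl) (x2 := 216) r5.2.2.2 r5.2.2.1 (u := -I) (by rw [u72.2.2.1]; norm_num)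
      (by rw [u72.2.2.2]; norm_num) ?_
    refine (ht2.comp tendsto_neg_atTop_atBot).congr fun t => ?_
    simp only [Function.comp]
    rw [he]; congr 1; push_cast; ring

theorem eig_iff (a lam : ℂ) : (∃ y, IsCubicEigenfunction a lam y) ↔ FF a lam = 0 := by
  constructor
  · rintro ⟨y, hy⟩
    obtain ⟨c0, c1, hc, -, w1, w2⟩ := eig_coef hy
    rw [FF, WR]
    by_cases h0 : c0 = 0
    · have h1 : c1 ≠ 0 := fun h => hc ⟨h0, h⟩
      apply mul_left_cancel₀ h1
      linear_combination -cB 288 (-a) lam * w1 + cB 72 (-a) lam * w2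
    · apply mul_left_cancel₀ h0
      linear_combination -cA 288 (-a) lam * w1 + cA 72 (-a) lam * w2
  · intro hF
    rw [FF, WR] at hF
    have hs := Sol.fs (-a) lam (cA 72 (-a) lam) (cB 72 (-a) lam)
    have hdr : deriv (fs (-a) lam (cA 72 (-a) lam) (cB 72 (-a) lam)) = fs' (-a) lam (cA 72 (-a) lam) (cB 72 (-a) lam) :=
      funext fun z => (hs z).1.deriv
    refine ⟨fs (-a) lam (cA 72 (-a) lam) (cB 72 (-a) lam), fun z => (hs z).1.differentiableAt, ?_, ?_, ?_, ?_⟩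
    · intro h0
      apply cAB_ne 72 (-a) lam
      rw [h0] at hdr
      have e1 := fs_zero (-a) lam (cA 72 (-a) lam) (cB 72 (-a) lam)
      have e2 := fs'_zero (-a) lam (cA 72 (-a) lam) (cB 72 (-a) lam)
      rw [h0] at e1
      rw [← hdr] at e2
      constructor
      · rw [← e1]; rfl
      · rw [← e2, show (0 : ℂ → ℂ) = fun _ => 0 from rfl]; simp
    · intro z
      rw [hdr, (hs z).2.deriv]; ring
    · refine (rot_decay r5.1 (-a) lam (G := atTop) (z := fun t : ℝ => I * t) ?_).1
      refine (line_SN 0 n18.1).congr fun t => ?_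
      rw [← u72.1]; ring
    · have d4 : Tendsto (fun t : ℝ => fs (-a) lam (cA 288 (-a) lam) (cB 288 (-a) lam) (I * t)) atBot (𝓝 0) := by
        refine (rot_decay r5.2.2.2 (-a) lam (G := atBot) (z := fun t : ℝ => I * t) ?_).1
        refine ((line_SN 0 n18.2).comp tendsto_neg_atBot_atTop).congr fun t => ?_
        simp only [Function.comp]
        rw [← u72.2.2.1]; push_cast; ring
      by_cases h0 : cA 288 (-a) lam = 0
      · have h1 : cB 288 (-a) lam ≠ 0 := fun h => cAB_ne 288 (-a) lam ⟨h0, h⟩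
        have := d4.const_mul ((cB 288 (-a) lam)⁻¹ * cB 72 (-a) lam)
        rw [mul_zero] at this
        refine this.congr fun t => ?_
        rw [(fs_lin _ _ (cA 72 (-a) lam) _ _).1, (fs_lin _ _ (cA 288 (-a) lam) _ _).1, mul_assoc, inv_mul_eq_iff_eq_mul₀ h1]
        linear_combination (-fs (-a) lam 1 0 (I * t)) * hF
      · have := d4.const_mul ((cA 288 (-a) lam)⁻¹ * cA 72 (-a) lam)
        rw [mul_zero] at this
        refine this.congr fun t => ?_
        rw [(fs_lin _ _ (cA 72 (-a) lam) _ _).1, (fs_lin _ _ (cA 288 (-a) lam) _ _).1, mul_assoc, inv_mul_eq_iff_eq_mul₀ h0]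
        linear_combination (fs (-a) lam 0 1 (I * t)) * hF

theorem FF_hol : HolOn univ (fun w : ℂ × ℂ => FF w.1 w.2) := by
  obtain ⟨hA, hB⟩ := gA_gB_hol
  have a1 : ∀ x, HolOn univ (fun w : ℂ × ℂ => cA x (-w.1) w.2) := fun x =>
    hA.comp_diff (φ := fun w : ℂ × ℂ => (rt (3 * x) * (-w.1), rt (2 * x) * w.2)) (by fun_prop) (mapsTo_univ _ _)
  have b1 : ∀ x, HolOn univ (fun w : ℂ × ℂ => cB x (-w.1) w.2) := fun x =>
    (HolOn.const _).mul
    (hB.comp_diff (φ := fun w : ℂ × ℂ => (rt (3 * x) * (-w.1), rt (2 * x) * w.2)) (by fun_prop) (mapsTo_univ _ _))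
  exact ((a1 72).mul (b1 288)).sub ((b1 72).mul (a1 288))

theorem locus_eq : cubicSpectralLocus = {w : ℂ × ℂ | FF w.1 w.2 = 0} := by
  ext w; exact eig_iff w.1 w.2

theorem locus_closed : IsClosed cubicSpectralLocus := by
  rw [locus_eq]
  exact isClosed_eq (continuousOn_univ.1 FF_hol.1) continuous_const

end PTC

open Complex Filter

namespace PTC
open Topology Set MeasureTheory

/-- the Volterra equation of WKB type on a half line -/
theorem line_eta {q m : ℝ → ℂ} {κ : ℝ} (hq : Continuous q) (hm : Continuous m) (hqre : ∀ s, 0 ≤ (q s).re)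
    (hκ : 0 ≤ κ) (hκ1 : 8 * κ ≤ 1) (hmb : ∀ s, -1 ≤ s → ‖m s‖ ≤ κ * (2 + s) ^ (-(3 / 2) : ℝ)) :
    ∃ η b : ℝ → ℂ, ∀ t, -1 < t → ‖η t‖ ≤ 8 * κ * (2 + t) ^ (-(1 / 2) : ℝ) ∧ ‖b t‖ ≤ 8 * κ * (2 + t) ^ (-(1 / 2) : ℝ) ∧
      HasDerivAt η (-2 * q t * b t) t ∧ HasDerivAt b (2 * q t * b t - m t * (1 + η t)) t := by
  set Θ : ℝ → ℂ := fun s => ∫ x in (0:ℝ)..s, q x with hΘdef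
  have hΘ : ∀ s, HasDerivAt Θ (q s) s := fun s => (hq.integral_hasStrictDerivAt 0 s).hasDerivAt
  have hΘc : Continuous Θ := continuous_iff_continuousAt.2 fun s => (hΘ s).continuousAt
  have hΘm : Monotone (fun s => (Θ s).re) := by
    have hd : ∀ s, HasDerivAt (fun s => (Θ s).re) (q s).re s := fun s => by
      have := (Complex.reCLM.hasFDerivAt.comp_hasDerivAt s (hΘ s))
      exact this
    refine monotone_of_deriv_nonneg (fun s => (hd s).differentiableAt) fun s => ?_
    rw [(hd s).deriv]; exact hqre s
  have hmono : ∀ t s : ℝ, 0 ≤ s → (Θ t).re ≤ (Θ (t + s)).re := fun t s hs => hΘm (by linarith)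
  let W : Set ℂ := {w | -1 ≤ w.re}
  have hI1 := rpow_shift_int (x := 1) one_pos
  have hm1 : ∀ x t : ℝ, -1 ≤ x → 0 ≤ t → ‖m (x + t)‖ ≤ κ * ((2 + x) + t) ^ (-(3 / 2) : ℝ) := by
    intro x t hx ht
    have := hmb (x + t) (by linarith)
    rwa [← add_assoc] at this
  have hm2 : ∀ x t : ℝ, -1 ≤ x → 0 ≤ t → ‖m (x + t)‖ ≤ κ * (1 + t) ^ (-(3 / 2) : ℝ) := by
    intro x t hx ht
    refine (hm1 x t hx ht).trans ?_
    gcongr κ * ?_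
    exact Real.rpow_le_rpow_of_nonpos (by linarith) (by linarith) (by norm_num)
  have hsh : ∀ (w : ℂ) (t : ℝ), (w + (t:ℂ) • (1:ℂ)).re = w.re + t := by intro w t; simp
  obtain ⟨η, hηc, hη1, hηeq, -⟩ := volterra (W := W) (e := (1:ℂ))
    (fun w hw t ht => by
      change -1 ≤ (w + (t:ℂ) • (1:ℂ)).re
      rw [hsh]; have : -1 ≤ w.re := hw
      linarith)
    (N := fun w t => (1 - Complex.exp (-2 * (Θ (w.re + t) - Θ w.re))) * m (w.re + t))
    (B := fun t => 2 * (κ * (1 + t) ^ (-(3 / 2) : ℝ)))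
    (by
      apply Continuous.continuousOn
      have : Continuous (fun x : ℂ × ℝ => x.1.re + x.2) := by fun_prop
      have h1 := hΘc.comp this
      have h2 := hm.comp this
      have h3 : Continuous (fun x : ℂ × ℝ => Θ x.1.re) := by fun_prop
      exact (continuous_const.sub (continuous_const.mul (h1.sub h3)).cexp).mul h2)
    ((hI1.1.const_mul κ).const_mul 2)
    (fun w hw t ht => by
      rw [norm_mul]
      exact mul_le_mul (kernel_le_two (hmono _ t ht.le)) (hm2 _ t hw ht.le) (norm_nonneg _) (by norm_num))
    (by rw [integral_const_mul, integral_const_mul, hI1.2, Real.one_rpow]; linarith)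
  have hae : ∀ {p : ℝ → Prop}, (∀ t, 0 < t → p t) → ∀ᵐ t ∂(volume.restrict (Ioi (0:ℝ))), p t :=
    fun h => (ae_restrict_iff' measurableSet_Ioi).2 (Eventually.of_forall h)
  have hmem : ∀ t : ℝ, -1 ≤ t → (t:ℂ) ∈ W := by
    intro t ht; change -1 ≤ ((t:ℂ)).re; simpa using ht
  let e : ℝ → ℂ := fun t => η t
  let h : ℝ → ℂ := fun t => m t * (1 + e t)
  have hhc : ContinuousOn h (Ioi (-1)) := by
    have h1 : ContinuousOn (fun t : ℝ => η t) (Ioi (-1)) :=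
      hηc.comp (by fun_prop) (fun t ht => hmem t (le_of_lt ht))
    exact hm.continuousOn.mul (continuousOn_const.add h1)
  have hhle : ∀ t s : ℝ, -1 ≤ t → 0 ≤ s → ‖h (t + s)‖ ≤ 2 * (κ * ((2 + t) + s) ^ (-(3 / 2) : ℝ)) := by
    intro t s ht hs
    rw [norm_mul, mul_comm]
    refine mul_le_mul ?_ (hm1 t s ht hs) (norm_nonneg _) (by norm_num)
    refine (norm_add_le _ _).trans ?_
    have := hη1 _ (hmem (t + s) (by linarith))
    simp only [norm_one, e]; linarith
  have heq : ∀ t : ℝ, -1 < t → e t = ∫ s in Ioi (0:ℝ), (1 - Complex.exp (-2 * (Θ (t + s) - Θ t))) * h (t + s) := by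
    intro t ht
    have := hηeq _ (hmem t ht.le)
    simp only [e]
    rw [this]
    refine integral_congr_ae (Eventually.of_forall fun s => ?_)
    simp [h, e, mul_assoc]
  let b : ℝ → ℂ := fun t => ∫ s in Ioi (0:ℝ), Complex.exp (-2 * (Θ (t + s) - Θ t)) * h (t + s)
  have key := ray_deriv (t0 := -1) (Θ := Θ) (q := q) (h := h) (η := e) (b := b) (fun t _ => hΘ t)
    (fun t _ s hs => hmono t s hs) hhc ?_ heq (fun t _ => rfl)
  · refine ⟨e, b, fun t ht => ?_⟩
    have hI := rpow_shift_int (x := 2 + t) (by linarith)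
    have hp : 0 ≤ (2 + t) ^ (-(1 / 2) : ℝ) := Real.rpow_nonneg (by linarith) _
    refine ⟨?_, ?_, (key t ht).1, (key t ht).2⟩
    · rw [heq t ht]
      refine (norm_integral_le_of_norm_le ((hI.1.const_mul κ).const_mul 4) (hae fun s hs => ?_)).trans ?_
      · rw [norm_mul]
        refine (mul_le_mul (kernel_le_two (hmono t s hs.le)) (hhle t s ht.le hs.le) (norm_nonneg _) (by norm_num)).trans ?_
        apply le_of_eq; ring
      · rw [integral_const_mul, integral_const_mul, hI.2]; apply le_of_eq; ring
    · refine (norm_integral_le_of_norm_le ((hI.1.const_mul κ).const_mul 2) (hae fun s hs => ?_)).trans ?_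
      · rw [norm_mul]
        refine (mul_le_mul (exp_le_one_aux (hmono t s hs.le)) (hhle t s ht.le hs.le) (norm_nonneg _) (by norm_num)).trans ?_
        apply le_of_eq; ring
      · rw [integral_const_mul, integral_const_mul, hI.2]
        nlinarith [mul_nonneg hκ hp]
  · intro s hs
    have h2 : IntegrableOn (fun t : ℝ => 2 * (κ * (t + 2) ^ (-(3 / 2) : ℝ))) (Ioi s) := by
      have := (integrableOn_add_rpow_Ioi_of_lt (a := -(3/2)) (c := s) (m := 2) (by norm_num) (by linarith))
      exact (this.const_mul κ).const_mul 2
    refine Integrable.mono' h2 ((hhc.mono (Ioi_subset_Ioi hs.le)).aestronglyMeasurable measurableSet_Ioi) ?_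
    refine (ae_restrict_iff' measurableSet_Ioi).2 (Eventually.of_forall fun t ht => ?_)
    have := hhle t 0 (by have : s < t := ht; linarith) le_rfl
    simpa [add_comm] using this

end PTC

open Complex Filter

namespace PTC
open Topology Set MeasureTheory

noncomputable def Qf (p β : ℂ) (s : ℝ) : ℂ := (s:ℂ) ^ 3 + p * s + β

def El (c0 : ℝ) (p β : ℂ) : Prop :=
  ∀ s : ℝ, 0 ≤ s → c0 * (1 + s ^ 3) ≤ (Qf p β s).re ∧ |(Qf p β s).im| ≤ 3.2 * (Qf p β s).re

theorem El.re_pos {c0 : ℝ} {p β : ℂ} (h : El c0 p β) (hc : 0 < c0) {s : ℝ} (hs : 0 ≤ s) : 0 < (Qf p β s).re :=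
  lt_of_lt_of_le (by positivity) (h s hs).1

theorem El.slit {c0 : ℝ} {p β : ℂ} (h : El c0 p β) (hc : 0 < c0) {s : ℝ} (hs : 0 ≤ s) : Qf p β s ∈ slitPlane :=
  Or.inl (h.re_pos hc hs)

theorem El.norm_ge {c0 : ℝ} {p β : ℂ} (h : El c0 p β) {s : ℝ} (hs : 0 ≤ s) : c0 * (1 + s ^ 3) ≤ ‖Qf p β s‖ :=
  (h s hs).1.trans (re_le_norm' _)

theorem El.cont {c0 : ℝ} {p β : ℂ} (h : El c0 p β) (hc : 0 < c0) : Continuous (fun s : ℝ => sq (Qf p β (max s 0))) := by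
  refine continuous_iff_continuousAt.2 fun s => ?_
  have h1 : ContinuousAt sq (Qf p β (max s 0)) := (sq_diff (h.slit hc (le_max_right _ _))).continuousAt
  have h2 : Continuous (fun s : ℝ => Qf p β (max s 0)) := by unfold Qf; fun_prop
  exact ContinuousAt.comp (f := fun s : ℝ => Qf p β (max s 0)) h1 h2.continuousAt

/-- the square root of a number in the sector of opening `arctan 3.2` -/
theorem sq_sector {z : ℂ} (h0 : 0 < z.re) (h : |z.im| ≤ 3.2 * z.re) : |(sq z).im| ≤ 0.74 * (sq z).re := by
  have hz := sq_sq z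
  have hx := sq_re_pos (z := z) (Or.inl h0)
  set w := sq z
  have e1 : z.re = w.re ^ 2 - w.im ^ 2 := by rw [← hz, pow_two, Complex.mul_re]; ring
  have e2 : z.im = 2 * w.re * w.im := by rw [← hz, pow_two, Complex.mul_im]; ring
  rw [e1, e2] at h
  have h' := abs_le.1 h
  rw [abs_le]
  constructor <;> by_contra hh <;> push Not at hh <;> nlinarith

theorem nu_re {ν z : ℂ} (hν0 : 0 < ν.re) (hν : |ν.im| ≤ 1.3 * ν.re) (h0 : 0 < z.re) (h : |z.im| ≤ 3.2 * z.re) :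
    0.03 * (ν.re * (sq z).re) ≤ (ν * sq z).re := by
  have h1 := sq_sector h0 h
  have hx := sq_re_pos (z := z) (Or.inl h0)
  rw [Complex.mul_re]
  have : ν.im * (sq z).im ≤ |ν.im| * |(sq z).im| := by rw [← abs_mul]; exact le_abs_self _
  have h2 : |ν.im| * |(sq z).im| ≤ (1.3 * ν.re) * (0.74 * (sq z).re) := by gcongr
  nlinarith [mul_pos hν0 hx]

/-- second order WKB correction -/
noncomputable def mf (ν p β : ℂ) (s : ℝ) : ℂ :=
  (6 * s / (4 * Qf p β s) - 5 * (3 * s ^ 2 + p) ^ 2 / (16 * Qf p β s ^ 2)) / (2 * ν * sq (Qf p β s))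

theorem mf_le {c0 M : ℝ} (hc : 0 < c0) (hc1 : c0 ≤ 1) {ν p β : ℂ} (h : El c0 p β) (hp : ‖p‖ ≤ M) {s : ℝ}
    (hs : 0 ≤ s) : ‖mf ν p β s‖ ≤ (40 + 2 * M ^ 2) / c0 ^ 3 / ‖ν‖ * (1 / (1 + s ^ 2)) := by
  have hM : 0 ≤ M := (norm_nonneg _).trans hp
  have hQ := h.norm_ge hs
  have hQ0 : 0 < ‖Qf p β s‖ := lt_of_lt_of_le (by positivity) hQ
  have hsq : c0 ≤ ‖sq (Qf p β s)‖ := by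
    have h1 := norm_sq_sq (Qf p β s)
    have h2 : c0 ≤ ‖sq (Qf p β s)‖ ^ 2 := by
      rw [h1]; refine le_trans ?_ hQ
      have : 0 ≤ s ^ 3 := by positivity
      nlinarith
    by_contra hh; push Not at hh
    nlinarith [norm_nonneg (sq (Qf p β s))]
  have t1 : ‖(6:ℂ) * s / (4 * Qf p β s)‖ ≤ 3 / c0 * (1 / (1 + s ^ 2)) := by
    rw [norm_div, norm_mul, norm_mul, Complex.norm_real, Real.norm_of_nonneg hs]
    simp only [Complex.norm_ofNat]
    rw [div_le_iff₀ (by positivity)]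
    have : 3 / c0 * (1 / (1 + s ^ 2)) * (4 * (c0 * (1 + s ^ 3))) ≤ 3 / c0 * (1 / (1 + s ^ 2)) * (4 * ‖Qf p β s‖) := by gcongr
    refine le_trans ?_ this
    have e : 3 / c0 * (1 / (1 + s ^ 2)) * (4 * (c0 * (1 + s ^ 3))) = 12 * (1 + s ^ 3) / (1 + s ^ 2) := by field_simp; ring
    rw [e, le_div_iff₀ (by positivity)]
    nlinarith [sq_nonneg (s - 1), mul_nonneg hs (sq_nonneg (s - 1)), mul_nonneg hs hs]
  have t2 : ‖5 * (3 * (s:ℂ) ^ 2 + p) ^ 2 / (16 * Qf p β s ^ 2)‖ ≤ (12 + 2 * M ^ 2) / c0 ^ 2 * (1 / (1 + s ^ 2)) := by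
    rw [norm_div, norm_mul, norm_mul, norm_pow, norm_pow]
    simp only [Complex.norm_ofNat]
    rw [div_le_iff₀ (by positivity)]
    have hn : ‖3 * (s:ℂ) ^ 2 + p‖ ≤ 3 * s ^ 2 + M := by
      refine (norm_add_le _ _).trans ?_
      rw [norm_mul, norm_pow, Complex.norm_real, Real.norm_of_nonneg hs]
      simp only [Complex.norm_ofNat]; linarith
    have : (12 + 2 * M ^ 2) / c0 ^ 2 * (1 / (1 + s ^ 2)) * (16 * (c0 * (1 + s ^ 3)) ^ 2) ≤
      (12 + 2 * M ^ 2) / c0 ^ 2 * (1 / (1 + s ^ 2)) * (16 * ‖Qf p β s‖ ^ 2) := by gcongr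
    refine le_trans ?_ this
    have e : (12 + 2 * M ^ 2) / c0 ^ 2 * (1 / (1 + s ^ 2)) * (16 * (c0 * (1 + s ^ 3)) ^ 2) =
      (12 + 2 * M ^ 2) * 16 * (1 + s ^ 3) ^ 2 / (1 + s ^ 2) := by field_simp
    rw [e, le_div_iff₀ (by positivity)]
    have h3 : ‖3 * (s:ℂ) ^ 2 + p‖ ^ 2 ≤ (3 * s ^ 2 + M) ^ 2 := by gcongr
    have h4 : (3 * s ^ 2 + M) ^ 2 ≤ 18 * s ^ 4 + 2 * M ^ 2 := by nlinarith [sq_nonneg (3 * s ^ 2 - M)]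
    have h5 : s ^ 4 * (1 + s ^ 2) ≤ 2 * (1 + s ^ 3) ^ 2 := by
      have : 0 ≤ s ^ 3 := by positivity
      nlinarith [sq_nonneg (s ^ 2 - s), sq_nonneg (s ^ 3 - s), sq_nonneg (s^2 - 1), sq_nonneg (s^3-1)]
    have h6 : 1 * (1 + s ^ 2) ≤ 2 * (1 + s ^ 3) ^ 2 := by
      have : 0 ≤ s ^ 3 := by positivity
      nlinarith [sq_nonneg (s ^ 2 - s), sq_nonneg (s ^ 3 - s), sq_nonneg (s - 1), mul_nonneg hs (sq_nonneg (s - 1))]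
    have hx : 0 ≤ 1 + s ^ 2 := by positivity
    have h7 := mul_le_mul_of_nonneg_right (h3.trans h4) hx
    nlinarith [mul_le_mul_of_nonneg_left h6 (sq_nonneg M)]
  have t3 : ‖mf ν p β s‖ ≤ ((3 / c0 * (1 / (1 + s ^ 2))) + (12 + 2 * M ^ 2) / c0 ^ 2 * (1 / (1 + s ^ 2))) / (2 * ‖ν‖ * ‖sq (Qf p β s)‖) := by
    rw [mf, norm_div, norm_mul, norm_mul]
    simp only [Complex.norm_ofNat]
    gcongr
    exact (norm_sub_le _ _).trans (add_le_add t1 t2)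
  refine t3.trans ?_
  rcases eq_or_ne ν 0 with rfl | hν
  · simp
  have hν0 : 0 < ‖ν‖ := norm_pos_iff.2 hν
  calc _ ≤ ((3 / c0 * (1 / (1 + s ^ 2))) + (12 + 2 * M ^ 2) / c0 ^ 2 * (1 / (1 + s ^ 2))) / (2 * ‖ν‖ * c0) := by gcongr
    _ = (3 * c0 + (12 + 2 * M ^ 2)) / 2 / c0 ^ 3 / ‖ν‖ * (1 / (1 + s ^ 2)) := by field_simp
    _ ≤ _ := by
      gcongr
      nlinarith [sq_nonneg M]

/-- WKB data on a half line -/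
theorem wkb_line {c0 M : ℝ} (hc : 0 < c0) (hc1 : c0 ≤ 1) : ∃ C : ℝ, 0 < C ∧ ∀ ν p β : ℂ, El c0 p β → ‖p‖ ≤ M →
    0 < ν.re → |ν.im| ≤ 1.3 * ν.re → C ≤ ‖ν‖ → ∃ η b : ℝ → ℂ, ∀ t, -1 < t →
      ‖η t‖ ≤ C / ‖ν‖ * (2 + t) ^ (-(1 / 2) : ℝ) ∧ ‖b t‖ ≤ C / ‖ν‖ * (2 + t) ^ (-(1 / 2) : ℝ) ∧
      HasDerivAt η (-2 * (ν * sq (Qf p β (max t 0))) * b t) t ∧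
      HasDerivAt b (2 * (ν * sq (Qf p β (max t 0))) * b t - mf ν p β (max t 0) * (1 + η t)) t := by
  set K := 8 * ((40 + 2 * M ^ 2) / c0 ^ 3) with hK
  have hK0 : 0 < K := by positivity
  refine ⟨8 * K, by positivity, fun ν p β h hp hν0 hν hνC => ?_⟩
  have hn : 0 < ‖ν‖ := lt_of_lt_of_le (by positivity) hνC
  have hνne : ν ≠ 0 := norm_pos_iff.1 hn
  have hcont := h.cont hc
  have hQc : Continuous (fun s : ℝ => Qf p β (max s 0)) := by unfold Qf; fun_prop
  have hQ0 : ∀ s : ℝ, Qf p β (max s 0) ≠ 0 := fun s => slitPlane_ne_zero (h.slit hc (le_max_right _ _))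
  have hmc : Continuous (fun s : ℝ => mf ν p β (max s 0)) := by
    unfold mf
    have hsm : Continuous (fun s : ℝ => ((max s 0 : ℝ) : ℂ)) := by fun_prop
    refine Continuous.div ((Continuous.div (by fun_prop) (by fun_prop) fun s => ?_).sub
      (Continuous.div (by fun_prop) (by fun_prop) fun s => ?_)) (by fun_prop) fun s => ?_
    · simpa using hQ0 s
    · simpa using hQ0 s
    · simpa [hνne] using sq_ne (hQ0 s)
  have := line_eta (q := fun t => ν * sq (Qf p β (max t 0))) (m := fun t => mf ν p β (max t 0)) (κ := K / ‖ν‖)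
    (by fun_prop) hmc (fun s => ?_) (by positivity) ?_ (fun s hs => ?_)
  · simp only [← mul_div_assoc] at this
    exact this
  · have h1 := h.re_pos hc (le_max_right s 0)
    refine le_trans ?_ (nu_re hν0 hν h1 (h _ (le_max_right s 0)).2)
    have := sq_re_pos (h.slit hc (le_max_right s 0))
    positivity
  · rw [← mul_div_assoc, div_le_one hn]; exact hνC
  · refine (mf_le hc hc1 h hp (le_max_right s 0)).trans ?_
    rw [hK]
    have h2 : 0 < 2 + s := by linarith
    have e : (1:ℝ) / (1 + (max s 0) ^ 2) ≤ 8 * (2 + s) ^ (-(3 / 2) : ℝ) := by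
      have h3 : (2 + s) ^ (-(2:ℝ)) ≤ (2 + s) ^ (-(3 / 2) : ℝ) := Real.rpow_le_rpow_of_exponent_le (by linarith) (by norm_num)
      have h4 : (1:ℝ) / (1 + (max s 0) ^ 2) ≤ 8 * (2 + s) ^ (-(2:ℝ)) := by
        rw [Real.rpow_neg h2.le, Real.rpow_two, ← div_eq_mul_inv, div_le_div_iff₀ (by positivity) (by positivity)]
        have h5 : s ≤ max s 0 := le_max_left _ _
        have h6 : 0 ≤ max s 0 := le_max_right _ _
        have : (2 + s) ^ 2 ≤ (2 + max s 0) ^ 2 := by gcongr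
        nlinarith [sq_nonneg (max s 0 - 2)]
      linarith
    calc _ ≤ (40 + 2 * M ^ 2) / c0 ^ 3 / ‖ν‖ * (8 * (2 + s) ^ (-(3 / 2) : ℝ)) := by gcongr
      _ = _ := by ring

end PTC

open Complex Filter

namespace PTC
open Topology Set MeasureTheory

theorem sq_unique {w z : ℂ} (hw : 0 < w.re) (h : w ^ 2 = z) : sq z = w := by
  have hz : z ∈ slitPlane := by
    rw [← h, mem_slitPlane_iff, pow_two, Complex.mul_re, Complex.mul_im]
    by_cases hi : w.im = 0
    · left; rw [hi]; nlinarith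
    · right; intro hh; apply hi
      have : w.re * w.im = 0 := by linarith
      rcases mul_eq_zero.1 this with h | h
      · linarith
      · exact h
  have h1 := sq_re_pos hz
  have h2 : sq z ^ 2 = w ^ 2 := by rw [sq_sq, h]
  rcases sq_eq_sq_iff_eq_or_eq_neg.1 h2 with h3 | h3
  · exact h3
  · rw [h3, Complex.neg_re] at h1; linarith

theorem sq_real_mul {t : ℝ} (ht : 0 < t) {z : ℂ} (hz : z ∈ slitPlane) : sq ((t ^ 2 : ℝ) * z) = t * sq z := by
  apply sq_unique
  · rw [Complex.re_ofReal_mul]; exact mul_pos ht (sq_re_pos hz)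
  · rw [mul_pow, sq_sq]; push_cast; rfl

noncomputable def psi (p β : ℂ) (s : ℝ) : ℂ := sq (Qf p β s) - (s * (√s : ℝ) + p / (2 * (√s : ℝ)))

noncomputable def env (s : ℝ) : ℝ := if s ≤ 1 then s ^ (-(1 / 2) : ℝ) else s ^ (-(3 / 2) : ℝ)

theorem env_int : IntegrableOn env (Ioi 0) := by
  have h1 : IntegrableOn env (Ioc 0 1) := by
    have : IntegrableOn (fun s : ℝ => s ^ (-(1 / 2) : ℝ)) (Ioc 0 1) := by
      have := (intervalIntegral.intervalIntegrable_rpow' (a := 0) (b := 1) (r := -(1 / 2)) (by norm_num))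
      exact (intervalIntegrable_iff_integrableOn_Ioc_of_le zero_le_one).1 this
    refine this.congr_fun (fun s hs => ?_) measurableSet_Ioc
    simp [env, hs.2]
  have h2 : IntegrableOn env (Ioi 1) := by
    refine (integrableOn_Ioi_rpow_of_lt (a := -(3 / 2)) (c := 1) (by norm_num) one_pos).congr_fun (fun s hs => ?_) measurableSet_Ioi
    have : ¬ s ≤ 1 := not_le.2 hs
    simp [env, this]
  have := h1.union h2
  rwa [Ioc_union_Ioi_eq_Ioi zero_le_one] at this

theorem psi_le {M : ℝ} {p β : ℂ} (hp : ‖p‖ ≤ M) (hβ : ‖β‖ ≤ M) {s : ℝ} (hs : 0 < s) (hQ : Qf p β s ∈ slitPlane) :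
    ‖psi p β s‖ ≤ (2 + 3 * M + M ^ 2) * env s := by
  have hM : 0 ≤ M := (norm_nonneg _).trans hp
  have hr : 0 < √s := Real.sqrt_pos.2 hs
  have hr2 : √s ^ 2 = s := Real.sq_sqrt hs.le
  have hrpow : s ^ (-(1 / 2) : ℝ) = 1 / √s := by
    rw [Real.rpow_neg hs.le, ← Real.sqrt_eq_rpow, one_div]
  have hrpow3 : s ^ (-(3 / 2) : ℝ) = 1 / (s * √s) := by
    rw [show (-(3 / 2) : ℝ) = -1 + -(1 / 2) by norm_num, Real.rpow_add hs, hrpow, Real.rpow_neg_one]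
    field_simp
  have hnr : ‖((√s : ℝ) : ℂ)‖ = √s := by rw [Complex.norm_real, Real.norm_of_nonneg hr.le]
  have hns : ‖(s : ℂ)‖ = s := by rw [Complex.norm_real, Real.norm_of_nonneg hs.le]
  unfold env
  split_ifs with h1
  · rw [hrpow]
    have hr1 : √s ≤ 1 := Real.sqrt_le_iff.2 ⟨by norm_num, by simpa using h1⟩
    have hQn : ‖Qf p β s‖ ≤ 1 + 2 * M := by
      unfold Qf
      refine (norm_add₃_le).trans ?_
      rw [norm_pow, norm_mul, hns]
      have : s ^ 3 ≤ 1 := pow_le_one₀ hs.le h1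
      nlinarith [mul_le_mul hp h1 hs.le hM]
    have hsq : ‖sq (Qf p β s)‖ ≤ 1 + 2 * M := by
      have := norm_sq_sq (Qf p β s)
      by_contra hh; push Not at hh; nlinarith
    have hb : ‖(s:ℂ) * (√s : ℝ) + p / (2 * (√s : ℝ))‖ ≤ 1 + M / (2 * √s) := by
      refine (norm_add_le _ _).trans ?_
      rw [norm_mul, norm_div, norm_mul, hnr, hns]
      simp only [Complex.norm_ofNat]
      gcongr
      nlinarith
    refine (norm_sub_le _ _).trans ((add_le_add hsq hb).trans ?_)
    rw [mul_one_div, le_div_iff₀ hr, add_mul, add_mul, add_mul, div_mul_eq_mul_div]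
    have : M * √s / (2 * √s) = M / 2 := by field_simp
    rw [this]
    nlinarith [sq_nonneg M, mul_le_mul_of_nonneg_left hr1 hM]
  · push Not at h1
    rw [hrpow3]
    have hr1 : 1 ≤ √s := by rw [Real.one_le_sqrt]; exact h1.le
    set W := sq (Qf p β s) with hW
    set r : ℂ := ((√s : ℝ) : ℂ) with hrdef
    have hrne : r ≠ 0 := by rw [hrdef]; exact_mod_cast hr.ne'
    have hrs : r ^ 2 = s := by rw [hrdef]; exact_mod_cast hr2
    have hWp := sq_re_pos hQ
    have hden : s * √s ≤ ‖W + s * r‖ := by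
      refine le_trans ?_ (re_le_norm' _)
      rw [Complex.add_re, hrdef, ← Complex.ofReal_mul, Complex.ofReal_re]; linarith
    have hdpos : 0 < s * √s := by positivity
    have hdne : W + s * r ≠ 0 := norm_pos_iff.1 (hdpos.trans_le hden)
    have hWsq : W ^ 2 = (s:ℂ) ^ 3 + p * s + β := sq_sq _
    have h2 : W - s * r = (p * s + β) / (W + s * r) := by
      rw [eq_div_iff hdne]
      linear_combination hWsq - (s:ℂ) ^ 2 * hrs
    have h3 : ‖W - s * r‖ ≤ 2 * M := by
      rw [h2, norm_div, div_le_iff₀ (hdpos.trans_le hden)]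
      refine (norm_add_le _ _).trans ?_
      rw [norm_mul, hns]
      have : s ≤ s * √s := by nlinarith
      nlinarith [mul_le_mul_of_nonneg_right hp hs.le, mul_le_mul_of_nonneg_left (this.trans hden) hM]
    have h4 : psi p β s = (2 * r * β - p * (W - s * r)) / (2 * r * (W + s * r)) := by
      have : psi p β s = W - s * r - p / (2 * r) := by unfold psi; ring
      rw [this, h2]
      field_simp
      linear_combination -p * hWsq + (s:ℂ) ^ 2 * p * hrs
    rw [h4, norm_div, norm_mul, norm_mul, hrdef, hnr, ← hrdef]
    simp only [Complex.norm_ofNat]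
    have h5 : ‖2 * r * β - p * (W - s * r)‖ ≤ 2 * √s * M + M * (2 * M) := by
      refine (norm_sub_le _ _).trans ?_
      rw [norm_mul, norm_mul, norm_mul, hrdef, hnr, ← hrdef]
      simp only [Complex.norm_ofNat]
      gcongr
    rw [mul_one_div, div_le_div_iff₀ (by positivity) hdpos]
    calc _ ≤ (2 * √s * M + M * (2 * M)) * (s * √s) := by gcongr
      _ ≤ (2 * √s * M + M * (2 * M)) * ‖W + s * r‖ := by gcongr
      _ ≤ ((2 + 3 * M + M ^ 2) * (2 * √s)) * ‖W + s * r‖ := by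
        gcongr
        nlinarith [mul_nonneg hM hr.le, mul_le_mul_of_nonneg_left hr1 (sq_nonneg M)]
      _ = _ := by ring

noncomputable def Ps (p β : ℂ) : ℂ := ∫ s in Ioi (0:ℝ), psi p β s

theorem psi_cont {p β : ℂ} (h : ∀ s : ℝ, 0 < s → Qf p β s ∈ slitPlane) : ContinuousOn (psi p β) (Ioi 0) := by
  intro s hs
  have h1 : ContinuousAt sq (Qf p β s) := (sq_diff (h s hs)).continuousAt
  have h2 : Continuous (fun s : ℝ => Qf p β s) := by unfold Qf; fun_prop
  have h3 : ContinuousAt (fun s : ℝ => sq (Qf p β s)) s := ContinuousAt.comp (f := fun s : ℝ => Qf p β s) h1 h2.continuousAt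
  have hr : ((√s : ℝ) : ℂ) ≠ 0 := by exact_mod_cast (Real.sqrt_pos.2 hs).ne'
  unfold psi
  refine (h3.sub (ContinuousAt.add (by fun_prop) (ContinuousAt.div (by fun_prop) (by fun_prop) (by simpa using hr)))).continuousWithinAt

theorem psi_int {p β : ℂ} (h : ∀ s : ℝ, 0 < s → Qf p β s ∈ slitPlane) : IntegrableOn (psi p β) (Ioi 0) := by
  refine Integrable.mono' (env_int.const_mul (2 + 3 * (‖p‖ + ‖β‖) + (‖p‖ + ‖β‖) ^ 2))
    ((psi_cont h).aestronglyMeasurable measurableSet_Ioi) ?_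
  refine (ae_restrict_iff' measurableSet_Ioi).2 (Eventually.of_forall fun s hs => ?_)
  exact psi_le (by linarith [norm_nonneg β]) (by linarith [norm_nonneg p]) hs (h s hs)

noncomputable def Jp (p β : ℂ) (s : ℝ) : ℂ := ∫ x in Ioi s, psi p β x

theorem Jp_deriv {p β : ℂ} (h : ∀ s : ℝ, 0 < s → Qf p β s ∈ slitPlane) {s : ℝ} (hs : 0 < s) :
    HasDerivAt (Jp p β) (-psi p β s) s :=
  hasDerivAt_tail hs (psi_cont h) fun x hx => (psi_int h).mono_set (Ioi_subset_Ioi hx.le)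

theorem Jp_eq {p β : ℂ} (h : ∀ s : ℝ, 0 < s → Qf p β s ∈ slitPlane) {s : ℝ} (hs : 0 ≤ s) :
    Jp p β s = Ps p β - ∫ x in (0:ℝ)..s, (Ioi (0:ℝ)).indicator (psi p β) x := by
  have hi := psi_int h
  have e : ∫ x in (0:ℝ)..s, (Ioi (0:ℝ)).indicator (psi p β) x = ∫ x in (0:ℝ)..s, psi p β x := by
    rw [intervalIntegral.integral_of_le hs, intervalIntegral.integral_of_le hs]
    refine setIntegral_congr_fun measurableSet_Ioc fun x hx => ?_
    exact indicator_of_mem (mem_Ioi.2 hx.1) _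
  have := intervalIntegral.integral_interval_add_Ioi' (μ := volume) (f := psi p β) (a := 0) (b := s)
      ((intervalIntegrable_iff_integrableOn_Ioc_of_le hs).2 (hi.mono_set Ioc_subset_Ioi_self))
      (hi.mono_set (Ioi_subset_Ioi hs))
  rw [e, Ps, Jp, ← this]; ring

theorem Jp_zero {p β : ℂ} (h : ∀ s : ℝ, 0 < s → Qf p β s ∈ slitPlane) : Tendsto (Jp p β) (𝓝[>] 0) (𝓝 (Ps p β)) := by
  have hi : Integrable ((Ioi (0:ℝ)).indicator (psi p β)) := (integrable_indicator_iff measurableSet_Ioi).2 (psi_int h)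
  have hc : Continuous (fun s => ∫ x in (0:ℝ)..s, (Ioi (0:ℝ)).indicator (psi p β) x) := hi.continuous_primitive 0
  have h1 := (hc.tendsto 0).mono_left (nhdsWithin_le_nhds (s := Ioi 0))
  rw [intervalIntegral.integral_same] at h1
  have h2 := h1.const_sub (Ps p β)
  rw [sub_zero] at h2
  refine h2.congr' ?_
  filter_upwards [self_mem_nhdsWithin] with s hs
  rw [Jp_eq h (le_of_lt hs)]

theorem Jp_top {p β : ℂ} (h : ∀ s : ℝ, 0 < s → Qf p β s ∈ slitPlane) : Tendsto (Jp p β) atTop (𝓝 0) := by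
  have hi : Integrable ((Ioi (0:ℝ)).indicator (psi p β)) := (integrable_indicator_iff measurableSet_Ioi).2 (psi_int h)
  have h1 := intervalIntegral_tendsto_integral_Ioi (μ := volume) 0 (hi.integrableOn (s := Ioi 0)) tendsto_id
  rw [setIntegral_indicator measurableSet_Ioi, inter_self] at h1
  have h2 := h1.const_sub (Ps p β)
  rw [show Ps p β - ∫ x in Ioi (0:ℝ), psi p β x = 0 by simp [Ps]] at h2
  refine h2.congr' ?_
  filter_upwards [eventually_ge_atTop 0] with s hs
  rw [Jp_eq h hs]; rfl

end PTC

open Complex Filter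

namespace PTC
open Topology Set MeasureTheory

theorem ray_match {P L c k : ℂ} {y y1 : ℝ → ℂ} (hc : c ≠ 0) (hray : Tendsto (fun s : ℝ => c * s) atTop SN)
    (hy : ∀ s : ℝ, 0 < s → HasDerivAt y (y1 s) s)
    (hy1 : ∀ s : ℝ, 0 < s → HasDerivAt y1 (c ^ 2 * ((c * s) ^ 3 + P * (c * s) + L) * y s) s)
    (h1 : Tendsto (fun s : ℝ => y s * ((c * s) ^ (3 / 4 : ℂ) * Complex.exp (Th P (c * s)))) atTop (𝓝 k))
    (h2 : Tendsto (fun s : ℝ => y1 s * ((c * s) ^ (-(3 / 4) : ℂ) * Complex.exp (Th P (c * s)))) atTop (𝓝 (-(c * k)))) :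
    Tendsto y (𝓝[>] 0) (𝓝 (k * gA (P, L))) ∧ Tendsto y1 (𝓝[>] 0) (𝓝 (c * (k * gB (P, L)))) := by
  have hf : ∀ c0 c1 : ℂ, ∀ s : ℝ, HasDerivAt (fun s : ℝ => fs P L c0 c1 (c * s)) (c * fs' P L c0 c1 (c * s)) s := by
    intro c0 c1 s
    have h0 : HasDerivAt (fun s : ℂ => c * s) c (s:ℂ) := by
      simpa using (hasDerivAt_id (s:ℂ)).const_mul c
    have h1 : HasDerivAt (fun s : ℂ => fs P L c0 c1 (c * s)) (fs' P L c0 c1 (c * s) * c) (s:ℂ) :=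
      (fs_hasDerivAt P L c0 c1 (c * s)).comp (s:ℂ) h0
    exact h1.comp_ofReal.congr_deriv (by ring)
  have hf' : ∀ c0 c1 : ℂ, ∀ s : ℝ, HasDerivAt (fun s : ℝ => fs' P L c0 c1 (c * s))
      (c * (((c * s) ^ 3 + P * (c * s) + L) * fs P L c0 c1 (c * s))) s := by
    intro c0 c1 s
    have h0 : HasDerivAt (fun s : ℂ => c * s) c (s:ℂ) := by
      simpa using (hasDerivAt_id (s:ℂ)).const_mul c
    have h1 : HasDerivAt (fun s : ℂ => fs' P L c0 c1 (c * s)) ((((c * s) ^ 3 + P * (c * s) + L) * fs P L c0 c1 (c * s)) * c) (s:ℂ) :=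
      (fs'_hasDerivAt P L c0 c1 (c * s)).comp (s:ℂ) h0
    exact h1.comp_ofReal.congr_deriv (by ring)
  have hw : ∀ c0 c1 : ℂ, ∃ K, ∀ s : ℝ, 0 < s → y s * (c * fs' P L c0 c1 (c * s)) - y1 s * fs P L c0 c1 (c * s) = K := by
    intro c0 c1
    have hd : ∀ s : ℝ, 0 < s → HasDerivAt (fun s : ℝ => y s * (c * fs' P L c0 c1 (c * s)) - y1 s * fs P L c0 c1 (c * s)) 0 s := by
      intro s hs
      refine (((hy s hs).mul ((hf' c0 c1 s).const_mul c)).sub ((hy1 s hs).mul (hf c0 c1 s))).congr_deriv ?_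
      ring
    refine ⟨_, fun s hs => isOpen_Ioi.is_const_of_deriv_eq_zero isPreconnected_Ioi
      (fun x hx => (hd x hx).differentiableAt.differentiableWithinAt) (fun x hx => (hd x hx).deriv) hs (mem_Ioi.2 one_pos)⟩
  obtain ⟨k0, hk0⟩ := hw 1 0
  obtain ⟨k1, hk1⟩ := hw 0 1
  set d0 := k1 / c with hd0
  set d1 := -k0 / c with hd1
  have ey : ∀ s : ℝ, 0 < s → y s = fs P L d0 d1 (c * s) ∧ y1 s = c * fs' P L d0 d1 (c * s) := by
    intro s hs
    have w0 := hk0 s hs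
    have w1 := hk1 s hs
    have w3 := wronsk_fs P L 1 0 0 1 (c * s)
    have e0 : c * d0 = k1 := by rw [hd0]; field_simp
    have e1 : c * d1 = -k0 := by rw [hd1]; field_simp
    rw [(fs_lin P L d0 d1 (c * s)).1, (fs_lin P L d0 d1 (c * s)).2]
    constructor
    · apply mul_left_cancel₀ hc
      linear_combination (-c * y s) * w3 - fs P L 0 1 (c * s) * w0 + fs P L 1 0 (c * s) * w1 -
        fs P L 1 0 (c * s) * e0 - fs P L 0 1 (c * s) * e1
    · linear_combination (-y1 s) * w3 - fs' P L 0 1 (c * s) * w0 + fs' P L 1 0 (c * s) * w1 -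
        fs' P L 1 0 (c * s) * e0 - fs' P L 0 1 (c * s) * e1
  have hg := gAB P L
  have he := (Y0_decay hg).2.2.comp hray
  have hexp : ∀ z, Complex.exp (Th P z) * Complex.exp (-Th P z) = 1 := by
    intro z; rw [← Complex.exp_add]; simp
  have hne : ∀ᶠ s : ℝ in atTop, c * (s:ℂ) ≠ 0 := hray.eventually (ev_ne.filter_mono SN_le)
  have g1 := (hg.1.mono_left SN_le).comp hray
  have g2 := (hg.2.mono_left SN_le).comp hray
  have hw0 : c * (d0 * gB (P, L) - d1 * gA (P, L)) = 0 := by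
    have h3 := (((h1.mul g2).const_mul c).sub (h2.mul g1)).mul (he.mul he)
    simp only [mul_zero, Function.comp_def] at h3
    refine tendsto_nhds_unique (Tendsto.congr' ?_ tendsto_const_nhds) h3
    filter_upwards [hne, eventually_gt_atTop 0] with s h0 hs
    rw [← wronsk_fs P L d0 d1 _ _ (c * s), (ey s hs).1, (ey s hs).2]
    have e2 := cpow_34' h0
    have e3 := hexp (c * s)
    have e4 : (Complex.exp (Th P (c * s)) * Complex.exp (-Th P (c * s))) ^ 2 = 1 := by rw [e3]; norm_num
    linear_combination (-c * (fs P L d0 d1 (c * s) * fs' P L (gA (P, L)) (gB (P, L)) (c * s) - fs' P L d0 d1 (c * s) * fs P L (gA (P, L)) (gB (P, L)) (c * s))) *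
      ((c * s) ^ (-(3 / 4) : ℂ) * (c * s) ^ (3 / 4 : ℂ) * e4 + e2)
  have hw0' := (mul_eq_zero.1 hw0).resolve_left hc
  have r0 : d0 * 1 = gA (P, L) * k := by
    refine tendsto_nhds_unique (g1.const_mul d0) ((h1.const_mul (gA (P, L))).congr' ?_)
    filter_upwards [eventually_gt_atTop 0] with s hs
    simp only [Function.comp]
    rw [(ey s hs).1, (fs_lin P L d0 d1 _).1, (fs_lin P L (gA (P, L)) _ _).1]
    linear_combination (-fs P L 0 1 (c * s) * ((c * s) ^ (3 / 4 : ℂ) * Complex.exp (Th P (c * s)))) * hw0'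
  have r1 : d1 * 1 = gB (P, L) * k := by
    refine tendsto_nhds_unique (g1.const_mul d1) ((h1.const_mul (gB (P, L))).congr' ?_)
    filter_upwards [eventually_gt_atTop 0] with s hs
    simp only [Function.comp]
    rw [(ey s hs).1, (fs_lin P L d0 d1 _).1, (fs_lin P L (gA (P, L)) _ _).1]
    linear_combination (fs P L 1 0 (c * s) * ((c * s) ^ (3 / 4 : ℂ) * Complex.exp (Th P (c * s)))) * hw0'
  constructor
  · have t := ((hf d0 d1 0).continuousAt.tendsto).mono_left (nhdsWithin_le_nhds (s := Ioi 0))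
    simp only [Complex.ofReal_zero, mul_zero, fs_zero] at t
    rw [show k * gA (P, L) = d0 by linear_combination -r0]
    refine t.congr' ?_
    filter_upwards [self_mem_nhdsWithin] with s hs
    exact (ey s hs).1.symm
  · have t := (((hf' d0 d1 0).continuousAt.tendsto).mono_left (nhdsWithin_le_nhds (s := Ioi 0))).const_mul c
    simp only [Complex.ofReal_zero, mul_zero, fs'_zero] at t
    rw [show k * gB (P, L) = d1 by linear_combination -r1]
    refine t.congr' ?_
    filter_upwards [self_mem_nhdsWithin] with s hs
    exact (ey s hs).2.symm

theorem q4_lim (p β : ℂ) : Tendsto (fun s : ℝ => Qf p β s / (s:ℂ) ^ 3) atTop (𝓝 1) := by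
  have hi : Tendsto (fun s : ℝ => ((s⁻¹ : ℝ) : ℂ)) atTop (𝓝 0) := by
    have := (Complex.continuous_ofReal.tendsto 0).comp tendsto_inv_atTop_zero
    simpa [Function.comp_def] using this
  have h := ((hi.pow 2).const_mul p).add ((hi.pow 3).const_mul β)
  have h' := h.const_add 1
  simp only [ne_eq, OfNat.ofNat_ne_zero, not_false_eq_true, zero_pow, mul_zero, add_zero] at h'
  refine h'.congr' ?_
  filter_upwards [eventually_gt_atTop 0] with s hs
  have : (s:ℂ) ≠ 0 := by exact_mod_cast hs.ne'
  unfold Qf; push_cast; field_simp; ring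

theorem sq_one : sq 1 = 1 := sq_unique (by norm_num) (by norm_num)

theorem one_slit : (1:ℂ) ∈ slitPlane := Or.inl (by norm_num)

theorem sqsq_eq {z : ℂ} {s : ℝ} (hs : 0 < s) (hz : z ∈ slitPlane) (hz2 : z / (s:ℂ) ^ 3 ∈ slitPlane) :
    sq (sq z) = ((s ^ (3 / 4 : ℝ) : ℝ) : ℂ) * sq (sq (z / (s:ℂ) ^ 3)) := by
  have hsn : (s:ℂ) ≠ 0 := by exact_mod_cast hs.ne'
  have ht : 0 < s ^ (3 / 4 : ℝ) := Real.rpow_pos_of_pos hs _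
  have e1 : ((s ^ (3 / 4 : ℝ)) ^ 2) ^ 2 = s ^ 3 := by
    rw [← pow_mul, ← Real.rpow_natCast, ← Real.rpow_mul hs.le]
    norm_num
  have e2 : sq z = ((s ^ (3 / 4 : ℝ)) ^ 2 : ℝ) * sq (z / (s:ℂ) ^ 3) := by
    rw [← sq_real_mul (by positivity) hz2, e1]
    congr 1; push_cast; field_simp
  rw [e2, sq_real_mul ht]
  exact Or.inl (sq_re_pos hz2)

theorem sqsq_lim (p β : ℂ) : Tendsto (fun s : ℝ => sq (sq (Qf p β s / (s:ℂ) ^ 3))) atTop (𝓝 1) := by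
  have h1 : Tendsto sq (𝓝 1) (𝓝 1) := by
    have := (sq_diff one_slit).continuousAt.tendsto
    rwa [sq_one] at this
  exact h1.comp (h1.comp (q4_lim p β))

end PTC

open Complex Filter

namespace PTC
open Topology Set MeasureTheory

theorem sqQ_deriv {p β : ℂ} {s : ℝ} (hQ : Qf p β s ∈ slitPlane) :
    HasDerivAt (fun s : ℝ => sq (Qf p β s)) ((3 * (s:ℂ) ^ 2 + p) / (2 * sq (Qf p β s))) s := by
  have h1 : HasDerivAt (fun z : ℂ => z ^ 3 + p * z + β) (3 * (s:ℂ) ^ 2 + p) (s:ℂ) := by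
    have := (((hasDerivAt_id (s:ℂ)).pow 3).add ((hasDerivAt_id (s:ℂ)).const_mul p)).add_const β
    refine this.congr_deriv ?_
    simp
  have h2 : HasDerivAt (fun z : ℂ => sq (z ^ 3 + p * z + β)) (sq (Qf p β s) / (2 * Qf p β s) * (3 * (s:ℂ) ^ 2 + p)) (s:ℂ) :=
    HasDerivAt.comp (h₂ := sq) (s:ℂ) (sq_hasDerivAt hQ) h1
  refine h2.comp_ofReal.congr_deriv ?_
  have hne : sq (Qf p β s) ≠ 0 := sq_ne (slitPlane_ne_zero hQ)
  have h3 := sq_sq (Qf p β s)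
  change sq (Qf p β s) / (2 * Qf p β s) * _ = _
  nth_rewrite 2 [← h3]
  field_simp

theorem theta_deriv (p : ℂ) {s : ℝ} (hs : 0 < s) :
    HasDerivAt (fun s : ℝ => ((√s : ℝ) : ℂ) * (2 / 5 * (s:ℂ) ^ 2 + p)) (s * (√s : ℝ) + p / (2 * (√s : ℝ))) s := by
  have h1 : HasDerivAt (fun s : ℝ => ((√s : ℝ) : ℂ)) ((1 / (2 * √s) : ℝ) : ℂ) s := (Real.hasDerivAt_sqrt hs.ne').ofReal_comp
  have h2 : HasDerivAt (fun s : ℝ => 2 / 5 * (s:ℂ) ^ 2 + p) (4 / 5 * (s:ℂ)) s := by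
    have : HasDerivAt (fun z : ℂ => 2 / 5 * z ^ 2 + p) (4 / 5 * (s:ℂ)) (s:ℂ) := by
      have := (((hasDerivAt_id (s:ℂ)).pow 2).const_mul (2 / 5)).add_const p
      refine this.congr_deriv ?_
      simp; ring
    exact this.comp_ofReal
  refine (h1.mul h2).congr_deriv ?_
  have hr : ((√s : ℝ) : ℂ) ≠ 0 := by exact_mod_cast (Real.sqrt_pos.2 hs).ne'
  have hr2 : ((√s : ℝ) : ℂ) ^ 2 = s := by exact_mod_cast Real.sq_sqrt hs.le
  push_cast
  field_simp
  rw [hr2]; ring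

/-- WKB solution on the half line -/
theorem wkb_ray {p β ν : ℂ} {η b : ℝ → ℂ} (hν : ν ≠ 0) (hQ : ∀ s : ℝ, 0 < s → Qf p β s ∈ slitPlane)
    (hη : ∀ t : ℝ, 0 < t → HasDerivAt η (-2 * (ν * sq (Qf p β t)) * b t) t)
    (hb : ∀ t : ℝ, 0 < t → HasDerivAt b (2 * (ν * sq (Qf p β t)) * b t - mf ν p β t * (1 + η t)) t) :
    ∃ g : ℝ → ℂ, (∀ s, 0 < s → g s = Complex.exp (ν * (Jp p β s - ((√s : ℝ) : ℂ) * (2 / 5 * (s:ℂ) ^ 2 + p))) / sq (sq (Qf p β s))) ∧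
    ∀ t : ℝ, 0 < t → 
    HasDerivAt (fun t => g t * (1 + η t)) (g t * ((-(ν * sq (Qf p β t)) - (3 * (t:ℂ) ^ 2 + p) / (4 * sq (Qf p β t) ^ 2)) * (1 + η t) - 2 * (ν * sq (Qf p β t)) * b t)) t ∧
    HasDerivAt (fun t => g t * ((-(ν * sq (Qf p β t)) - (3 * (t:ℂ) ^ 2 + p) / (4 * sq (Qf p β t) ^ 2)) * (1 + η t) - 2 * (ν * sq (Qf p β t)) * b t)) (ν ^ 2 * Qf p β t * (g t * (1 + η t))) t := by
  refine ⟨_, fun s hs => rfl, fun t ht => ?_⟩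
  set g : ℝ → ℂ := fun s => Complex.exp (ν * (Jp p β s - ((√s : ℝ) : ℂ) * (2 / 5 * (s:ℂ) ^ 2 + p))) / sq (sq (Qf p β s)) with hg
  have hW := sqQ_deriv (hQ t ht)
  have hWne : sq (Qf p β t) ≠ 0 := sq_ne (slitPlane_ne_zero (hQ t ht))
  have hWW := sq_sq (Qf p β t)
  have hVne : sq (sq (Qf p β t)) ≠ 0 := sq_ne hWne
  have hVV := sq_sq (sq (Qf p β t))
  have hslit : sq (Qf p β t) ∈ slitPlane := Or.inl (sq_re_pos (hQ t ht))
  have hV : HasDerivAt (fun s : ℝ => sq (sq (Qf p β s)))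
      (sq (sq (Qf p β t)) / (2 * sq (Qf p β t)) * ((3 * (t:ℂ) ^ 2 + p) / (2 * sq (Qf p β t)))) t :=
    HasDerivAt.comp (h₂ := sq) t (sq_hasDerivAt hslit) hW
  have hE : HasDerivAt (fun s : ℝ => Complex.exp (ν * (Jp p β s - ((√s : ℝ) : ℂ) * (2 / 5 * (s:ℂ) ^ 2 + p)))) (Complex.exp (ν * (Jp p β t - ((√t : ℝ) : ℂ) * (2 / 5 * (t:ℂ) ^ 2 + p))) * (ν * (-psi p β t - (↑t * (√t : ℝ) + p / (2 * (√t : ℝ)))))) t :=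
    (((Jp_deriv hQ ht).sub (theta_deriv p ht)).const_mul ν).cexp
  have hgd : HasDerivAt g (g t * (-(ν * sq (Qf p β t)) - (3 * (t:ℂ) ^ 2 + p) / (4 * sq (Qf p β t) ^ 2))) t := by
    refine (hE.div hV hVne).congr_deriv ?_
    simp only [hg, psi, smul_eq_mul]
    field_simp
    ring
  have hq : HasDerivAt (fun t : ℝ => ν * sq (Qf p β t)) (ν * ((3 * (t:ℂ) ^ 2 + p) / (2 * sq (Qf p β t)))) t := hW.const_mul ν
  have hD : HasDerivAt (fun s : ℝ => 3 * (s:ℂ) ^ 2 + p) (6 * (t:ℂ)) t := by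
    have : HasDerivAt (fun z : ℂ => 3 * z ^ 2 + p) (6 * (t:ℂ)) (t:ℂ) := by
      have := (((hasDerivAt_id (t:ℂ)).pow 2).const_mul 3).add_const p
      refine this.congr_deriv ?_
      simp; ring
    exact this.comp_ofReal
  have hq1 : HasDerivAt (fun t : ℝ => ν * ((3 * (t:ℂ) ^ 2 + p) / (2 * sq (Qf p β t)))) _ t :=
    (hD.div (hW.const_mul 2) (mul_ne_zero two_ne_zero hWne)).const_mul ν
  have e1 : ∀ t : ℝ, sq (Qf p β t) ≠ 0 → (3 * (t:ℂ) ^ 2 + p) / (4 * sq (Qf p β t) ^ 2) =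
      ν * ((3 * (t:ℂ) ^ 2 + p) / (2 * sq (Qf p β t))) / (2 * (ν * sq (Qf p β t))) := by
    intro t h; field_simp; norm_num
  have key := wkb_solves (η := η) (b := b) (g := g) (q := fun t : ℝ => ν * sq (Qf p β t))
    (q1 := fun t : ℝ => ν * ((3 * (t:ℂ) ^ 2 + p) / (2 * sq (Qf p β t)))) (m := mf ν p β t) (Q := ν ^ 2 * Qf p β t) (t := t)
    (mul_ne_zero hν hWne) hq hq1 (by rw [← e1 t hWne]; exact hgd) (hη t ht) (hb t ht) (by
      unfold mf
      have h4 := hWW.symm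
      generalize sq (Qf p β t) = W at h4 hWne ⊢
      rw [h4]
      field_simp
      ring)
  refine ⟨key.1.congr_deriv (by rw [e1 t hWne]), ?_⟩
  refine key.2.congr_of_eventuallyEq ?_
  filter_upwards [lt_mem_nhds ht] with s hs
  rw [e1 s (sq_ne (slitPlane_ne_zero (hQ s hs)))]

end PTC

open Complex Filter

namespace PTC
open Topology Set MeasureTheory

theorem rt_ray {ρ α s : ℝ} (hρ : 0 < ρ) (hs : 0 < s) (hα : |α| ≤ 6) :
    ((ρ * rt α) ^ 4 * s : ℂ) ^ (3 / 4 : ℂ) = (ρ * rt α) ^ 3 * ((s ^ (3 / 4 : ℝ) : ℝ) : ℂ) ∧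
    sq ((ρ * rt α) ^ 4 * s : ℂ) = (ρ * rt α) ^ 2 * ((√s : ℝ) : ℂ) := by
  have ha := abs_le.1 hα
  have e : ((ρ * rt α) ^ 4 * s : ℂ) = ((ρ ^ 4 * s : ℝ) : ℂ) * rt (4 * α) := by
    rw [mul_pow, rt_pow]; push_cast; ring
  have ht : 0 < ρ ^ 4 * s := by positivity
  have hrp : ∀ c : ℝ, (ρ ^ 4 * s) ^ c = ρ ^ (4 * c) * s ^ c := by
    intro c
    rw [Real.mul_rpow (by positivity) hs.le, Real.rpow_mul hρ.le]
    norm_num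
  constructor
  · have h := ray_cpow (θ := 4 * α) (3 / 4) ht (by linarith) (by linarith)
    rw [hrp, show (4 * (3 / 4) : ℝ) = (3 : ℕ) by norm_num, Real.rpow_natCast, ← e] at h
    rw [show (3 / 4 : ℂ) = ((3 / 4 : ℝ) : ℂ) by push_cast; rfl, h, mul_pow, rt_pow,
      show 4 * α * (3 / 4) = (3 : ℕ) * α by push_cast; ring]
    push_cast; ring
  · have h := ray_cpow (θ := 4 * α) (1 / 2) ht (by linarith) (by linarith)
    rw [hrp, show (4 * (1 / 2) : ℝ) = (2 : ℕ) by norm_num, Real.rpow_natCast, ← e] at h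
    rw [sq, show (1 / 2 : ℂ) = ((1 / 2 : ℝ) : ℂ) by push_cast; rfl, h, mul_pow, rt_pow,
      show 4 * α * (1 / 2) = (2 : ℕ) * α by push_cast; ring, Real.sqrt_eq_rpow]
    push_cast; ring

theorem rt_ray_SN {ρ α : ℝ} (hρ : 0 < ρ) (hα : |α| ≤ 6) : Tendsto (fun s : ℝ => (ρ * rt α : ℂ) ^ 4 * s) atTop SN := by
  have h0 : |(rt (4 * α)).im| < 0.68 * (rt (4 * α)).re := by
    rw [rt_im, rt_re]
    have hpi := Real.pi_lt_d2
    have hpi0 := Real.pi_pos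
    have h1 : |4 * α * (Real.pi / 180)| ≤ 0.42 := by
      rw [abs_mul, abs_mul, abs_of_pos (by positivity : (0:ℝ) < Real.pi / 180)]
      norm_num
      nlinarith [abs_nonneg α]
    have h2 := Real.one_sub_sq_div_two_le_cos (x := 4 * α * (Real.pi / 180))
    have h3 : |Real.sin (4 * α * (Real.pi / 180))| ≤ |4 * α * (Real.pi / 180)| := Real.abs_sin_le_abs
    have h4 : (4 * α * (Real.pi / 180)) ^ 2 ≤ 0.42 ^ 2 := sq_le_sq' (by linarith [(abs_le.1 h1).1]) (abs_le.1 h1).2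
    norm_num at *
    linarith
  have := (line_SN 0 h0).comp (tendsto_id.const_mul_atTop (show 0 < ρ ^ 4 by positivity))
  refine this.congr fun s => ?_
  simp only [Function.comp, id, mul_pow, rt_pow]
  push_cast; ring

/-- asymptotic evaluation of the subdominant solution at the origin -/
theorem wkb_AB {c0 M : ℝ} (hc : 0 < c0) (hc1 : c0 ≤ 1) (hM : 0 ≤ M) : ∃ C : ℝ, 0 < C ∧ ∀ (ρ α : ℝ) (p β n ν : ℂ), El c0 p β → ‖p‖ ≤ M →
    0 < ρ → |α| ≤ 6 → n = ρ * rt α → ν = n ^ 10 → 0 < ν.re → |ν.im| ≤ 1.3 * ν.re → C ≤ ‖ν‖ →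
    ∃ e1 e2 : ℂ, ‖e1‖ ≤ C / ‖ν‖ ∧ ‖e2‖ ≤ C / ‖ν‖ ∧
      gA (p * n ^ 8, β * n ^ 12) * (n ^ 3 * sq (sq β)) = Complex.exp (ν * Ps p β) * (1 + e1) ∧
      gB (p * n ^ 8, β * n ^ 12) = -(n ^ 3 * sq (sq β)) * Complex.exp (ν * Ps p β) * (1 + e2) := by
  obtain ⟨C, hC, H⟩ := wkb_line (M := M) hc hc1
  refine ⟨3 * C + M / c0 ^ 2, by positivity, fun ρ α p β n ν hEl hp hρ hα hn hνn hν0 hν hνC => ?_⟩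
  have hCle : C ≤ 3 * C + M / c0 ^ 2 := by have : 0 ≤ M / c0 ^ 2 := by positivity
                                           linarith
  obtain ⟨η, b, hηb⟩ := H ν p β hEl hp hν0 hν (hCle.trans hνC)
  have hnν : 0 < ‖ν‖ := lt_of_lt_of_le hC (hCle.trans hνC)
  have hνne : ν ≠ 0 := norm_pos_iff.1 hnν
  have hnne : n ≠ 0 := by rintro rfl; apply hνne; rw [hνn]; norm_num
  have hQ : ∀ s : ℝ, 0 < s → Qf p β s ∈ slitPlane := fun s hs => hEl.slit hc hs.le
  have hQ0 : Qf p β ((0:ℝ)) = β := by simp [Qf]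
  have hβ : β ∈ slitPlane := by have := hEl.slit hc le_rfl; rwa [hQ0] at this
  have hβn : c0 ≤ ‖β‖ := by have := hEl.norm_ge le_rfl; rw [hQ0] at this; simpa using this
  have hβ0 : β ≠ 0 := slitPlane_ne_zero hβ
  have hsβ0 : sq β ≠ 0 := sq_ne hβ0
  have hssβ0 : sq (sq β) ≠ 0 := sq_ne hsβ0
  have hssq := sq_sq (sq β)
  obtain ⟨g, hg, hgd⟩ := wkb_ray (η := η) (b := b) hνne hQ
    (fun t ht => by have := (hηb t (by linarith)).2.2.1; rwa [max_eq_left ht.le] at this)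
    (fun t ht => by have := (hηb t (by linarith)).2.2.2; rwa [max_eq_left ht.le] at this)
  -- decay of η, b
  have hdec : Tendsto (fun t : ℝ => C / ‖ν‖ * (2 + t) ^ (-(1 / 2) : ℝ)) atTop (𝓝 0) := by
    have h1 : Tendsto (fun t : ℝ => (2 + t) ^ (-(1 / 2) : ℝ)) atTop (𝓝 0) :=
      (tendsto_rpow_neg_atTop (by norm_num)).comp (tendsto_atTop_add_const_left _ 2 tendsto_id)
    simpa using h1.const_mul (C / ‖ν‖)
  have hηT : Tendsto η atTop (𝓝 0) := squeeze_zero_norm' (by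
    filter_upwards [eventually_gt_atTop 0] with t ht using (hηb t (by linarith)).1) hdec
  have hbT : Tendsto b atTop (𝓝 0) := squeeze_zero_norm' (by
    filter_upwards [eventually_gt_atTop 0] with t ht using (hηb t (by linarith)).2.1) hdec
  have hJT : Tendsto (fun s => Complex.exp (ν * Jp p β s)) atTop (𝓝 1) := by
    have := ((Jp_top hQ).const_mul ν).cexp
    simpa using this
  have hRT := sqsq_lim p β
  have hslE : ∀ᶠ s : ℝ in atTop, Qf p β s / (s:ℂ) ^ 3 ∈ slitPlane :=
    (q4_lim p β).eventually (isOpen_slitPlane.mem_nhds one_slit)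
  have hTh : ∀ s : ℝ, 0 < s → Th (p * n ^ 8) (n ^ 4 * s) = ν * (((√s : ℝ) : ℂ) * (2 / 5 * (s:ℂ) ^ 2 + p)) := by
    intro s hs
    rw [Th, hn, (rt_ray hρ hs hα).2, ← hn, hνn]; ring
  have hz34 : ∀ s : ℝ, 0 < s → (n ^ 4 * s : ℂ) ^ (3 / 4 : ℂ) = n ^ 3 * ((s ^ (3 / 4 : ℝ) : ℝ) : ℂ) := by
    intro s hs; rw [hn, (rt_ray hρ hs hα).1]
  have hz34' : ∀ s : ℝ, 0 < s → (n ^ 4 * s : ℂ) ^ (-(3 / 4) : ℂ) = (n ^ 3 * ((s ^ (3 / 4 : ℝ) : ℝ) : ℂ))⁻¹ := by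
    intro s hs; rw [Complex.cpow_neg, hz34 s hs]
  have hgE : ∀ s : ℝ, 0 < s → g s * Complex.exp (Th (p * n ^ 8) (n ^ 4 * s)) = Complex.exp (ν * Jp p β s) / sq (sq (Qf p β s)) := by
    intro s hs
    rw [hg s hs, hTh s hs, div_mul_eq_mul_div, ← Complex.exp_add]
    congr 2; ring
  have hDT : Tendsto (fun s : ℝ => (3 * (s:ℂ) ^ 2 + p) / (4 * ν * sq (Qf p β s) ^ 3)) atTop (𝓝 0) := by
    have hi : Tendsto (fun s : ℝ => ((s⁻¹ : ℝ) : ℂ)) atTop (𝓝 0) := by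
      have := (Complex.continuous_ofReal.tendsto 0).comp tendsto_inv_atTop_zero
      simpa [Function.comp_def] using this
    have hW : Tendsto (fun s : ℝ => (sq (Qf p β s))⁻¹) atTop (𝓝 0) := by
      rw [tendsto_zero_iff_norm_tendsto_zero]
      have h3 : Tendsto (fun s : ℝ => ((c0 * s) ^ (1 / 2 : ℝ))⁻¹) atTop (𝓝 0) :=
        tendsto_inv_atTop_zero.comp ((tendsto_rpow_atTop (by norm_num)).comp (tendsto_id.const_mul_atTop hc))
      refine squeeze_zero' (Eventually.of_forall fun _ => norm_nonneg _) ?_ h3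
      filter_upwards [eventually_gt_atTop 1] with s hs
      rw [norm_inv, norm_sq]
      have : c0 * s ≤ ‖Qf p β s‖ := by
        refine le_trans ?_ (hEl.norm_ge (by linarith))
        have : s ≤ s ^ 3 := by nlinarith [mul_pos (by linarith : 0 < s) (by linarith : 0 < s)]
        exact mul_le_mul_of_nonneg_left (by linarith) hc.le
      have h0 : 0 < c0 * s := mul_pos hc (by linarith)
      gcongr
    have hinv := (q4_lim p β).inv₀ one_ne_zero
    have h := ((hi.const_mul 3).add ((hi.pow 3).const_mul p)).mul (hinv.mul (hW.const_mul (4 * ν)⁻¹))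
    simp only [ne_eq, OfNat.ofNat_ne_zero, not_false_eq_true, zero_pow, mul_zero, add_zero] at h
    refine h.congr' ?_
    filter_upwards [eventually_gt_atTop 0] with s hs
    have h0 : (s:ℂ) ≠ 0 := by exact_mod_cast hs.ne'
    have h1 : sq (Qf p β s) ≠ 0 := sq_ne (slitPlane_ne_zero (hQ s hs))
    have e := sq_sq (Qf p β s)
    generalize sq (Qf p β s) = W at e h1 ⊢
    rw [← e]; push_cast; field_simp
  have m := ray_match (P := p * n ^ 8) (L := β * n ^ 12) (c := n ^ 4) (k := n ^ 3) (pow_ne_zero _ hnne)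
    (by rw [hn]; exact rt_ray_SN hρ hα) (fun s hs => (hgd s hs).1)
    (fun s hs => (hgd s hs).2.congr_deriv (by rw [hνn, Qf]; ring))
    (by
      have h1 := ((hJT.mul (hηT.const_add 1)).mul (hRT.inv₀ one_ne_zero)).const_mul (n ^ 3)
      simp only [add_zero, mul_one, inv_one] at h1
      refine h1.congr' ?_
      filter_upwards [eventually_gt_atTop 0, hslE] with s hs hsl
      have hsp : ((s ^ (3 / 4 : ℝ) : ℝ) : ℂ) ≠ 0 := by exact_mod_cast (Real.rpow_pos_of_pos hs _).ne'
      have e1 := hgE s hs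
      have e2 := sqsq_eq hs (hQ s hs) hsl
      have h0 : sq (sq (Qf p β s / (s:ℂ) ^ 3)) ≠ 0 := sq_ne (sq_ne (slitPlane_ne_zero hsl))
      rw [e2] at e1
      rw [hz34 s hs, show g s * (1 + η s) * (n ^ 3 * ((s ^ (3 / 4 : ℝ) : ℝ) : ℂ) * Complex.exp (Th (p * n ^ 8) (n ^ 4 * s))) =
        (g s * Complex.exp (Th (p * n ^ 8) (n ^ 4 * s))) * ((1 + η s) * (n ^ 3 * ((s ^ (3 / 4 : ℝ) : ℝ) : ℂ))) by ring, e1]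
      field_simp)
    (by
      have h1 := ((hJT.mul hRT).mul ((((hDT.const_sub (-1)).mul (hηT.const_add 1))).sub (hbT.const_mul 2))).const_mul (n ^ 7)
      simp only [add_zero, mul_one, mul_zero, sub_zero] at h1
      rw [show -(n ^ 4 * n ^ 3) = n ^ 7 * (1 * -1) by ring]
      refine h1.congr' ?_
      filter_upwards [eventually_gt_atTop 0, hslE] with s hs hsl
      have hsp : ((s ^ (3 / 4 : ℝ) : ℝ) : ℂ) ≠ 0 := by exact_mod_cast (Real.rpow_pos_of_pos hs _).ne'
      have e1 := hgE s hs
      have e2 := sqsq_eq hs (hQ s hs) hsl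
      have e3 := sq_sq (sq (Qf p β s))
      have h0 : sq (sq (Qf p β s / (s:ℂ) ^ 3)) ≠ 0 := sq_ne (sq_ne (slitPlane_ne_zero hsl))
      have hV0 : sq (sq (Qf p β s)) ≠ 0 := sq_ne (sq_ne (slitPlane_ne_zero (hQ s hs)))
      rw [hz34' s hs, show ∀ X : ℂ, g s * X * ((n ^ 3 * ((s ^ (3 / 4 : ℝ) : ℝ) : ℂ))⁻¹ * Complex.exp (Th (p * n ^ 8) (n ^ 4 * s))) =
        (g s * Complex.exp (Th (p * n ^ 8) (n ^ 4 * s))) * X * (n ^ 3 * ((s ^ (3 / 4 : ℝ) : ℝ) : ℂ))⁻¹ from fun X => by ring, e1]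
      have e4 : sq (sq (Qf p β s / (s:ℂ) ^ 3)) = sq (sq (Qf p β s)) / ((s ^ (3 / 4 : ℝ) : ℝ) : ℂ) := by rw [e2]; field_simp
      rw [e4]
      have key : ∀ V W T E D y1 y2 : ℂ, V ≠ 0 → T ≠ 0 → V ^ 2 = W →
          n ^ 7 * (E * (V / T) * ((-1 - D / (4 * n ^ 10 * W ^ 3)) * (1 + y1) - 2 * y2)) =
          E / V * ((-(n ^ 10 * W) - D / (4 * W ^ 2)) * (1 + y1) - 2 * (n ^ 10 * W) * y2) * (n ^ 3 * T)⁻¹ := by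
        rintro V W T E D y1 y2 hV hT rfl
        field_simp
      have := key _ _ _ (Complex.exp (ν * Jp p β s)) (3 * (s:ℂ) ^ 2 + p) (η s) (b s) hV0 hsp e3
      rw [← hνn] at this
      exact this)
  -- values at 0
  have h0mem : (-1:ℝ) < 0 := by norm_num
  have hη0 : Tendsto η (𝓝[>] 0) (𝓝 (η 0)) := ((hηb 0 h0mem).2.2.1.continuousAt.tendsto).mono_left nhdsWithin_le_nhds
  have hb0 : Tendsto b (𝓝[>] 0) (𝓝 (b 0)) := ((hηb 0 h0mem).2.2.2.continuousAt.tendsto).mono_left nhdsWithin_le_nhds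
  have hs0 : Tendsto (fun s : ℝ => s) (𝓝[>] 0) (𝓝 0) := nhdsWithin_le_nhds
  have hsc : Tendsto (fun s : ℝ => (s:ℂ)) (𝓝[>] 0) (𝓝 0) := by
    have := (Complex.continuous_ofReal.tendsto 0).comp hs0
    rw [Complex.ofReal_zero] at this; exact this
  have hW0 : Tendsto (fun s : ℝ => sq (Qf p β s)) (𝓝[>] 0) (𝓝 (sq β)) := by
    have := (hEl.cont hc).tendsto 0
    rw [max_self, hQ0] at this
    refine (this.mono_left nhdsWithin_le_nhds).congr' ?_
    filter_upwards [self_mem_nhdsWithin] with s hs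
    rw [max_eq_left (le_of_lt hs)]
  have hV0 : Tendsto (fun s : ℝ => sq (sq (Qf p β s))) (𝓝[>] 0) (𝓝 (sq (sq β))) :=
    ((sq_diff (Or.inl (sq_re_pos hβ))).continuousAt.tendsto).comp hW0
  have hr0 : Tendsto (fun s : ℝ => ((√s : ℝ) : ℂ)) (𝓝[>] 0) (𝓝 0) := by
    have : Continuous (fun s : ℝ => ((√s : ℝ) : ℂ)) := by fun_prop
    simpa using (this.tendsto 0).mono_left nhdsWithin_le_nhds
  have hg0 : Tendsto g (𝓝[>] 0) (𝓝 (Complex.exp (ν * Ps p β) / sq (sq β))) := by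
    have h1 := ((((Jp_zero hQ).sub (hr0.mul (((hsc.pow 2).const_mul (2 / 5)).add_const p))).const_mul ν).cexp).div hV0 hssβ0
    simp only [zero_mul, sub_zero] at h1
    refine h1.congr' ?_
    filter_upwards [self_mem_nhdsWithin] with s hs
    rw [hg s hs]; rfl
  have f1 := tendsto_nhds_unique m.1 (hg0.mul (hη0.const_add 1))
  have f2 := tendsto_nhds_unique m.2 (hg0.mul ((((hW0.const_mul ν).neg.sub ((((hsc.pow 2).const_mul 3).add_const p).div
    ((hW0.pow 2).const_mul 4) (mul_ne_zero (by norm_num : (4:ℂ) ≠ 0) (pow_ne_zero _ hsβ0)))).mul (hη0.const_add 1)).sub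
      (((hW0.const_mul ν).const_mul 2).mul hb0)))
  have hpow : (2 + (0:ℝ)) ^ (-(1 / 2) : ℝ) ≤ 1 := Real.rpow_le_one_of_one_le_of_nonpos (by norm_num) (by norm_num)
  have hη1 : ‖η 0‖ ≤ C / ‖ν‖ := (hηb 0 h0mem).1.trans (mul_le_of_le_one_right (by positivity) hpow)
  have hb1 : ‖b 0‖ ≤ C / ‖ν‖ := (hηb 0 h0mem).2.1.trans (mul_le_of_le_one_right (by positivity) hpow)
  refine ⟨η 0, (1 + p / (4 * ν * sq β ^ 3)) * (1 + η 0) + 2 * b 0 - 1, ?_, ?_, ?_, ?_⟩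
  · exact hη1.trans (by gcongr)
  · have hd : ‖p / (4 * ν * sq β ^ 3)‖ ≤ M / (4 * c0 ^ 2) / ‖ν‖ := by
      have h1 : ‖sq β‖ ^ 2 = ‖β‖ := norm_sq_sq β
      have h2 : c0 ≤ ‖sq β‖ := by
        by_contra hh; push Not at hh
        nlinarith [norm_nonneg (sq β)]
      have h3 : c0 ^ 2 ≤ ‖sq β‖ ^ 3 := by
        rw [show ‖sq β‖ ^ 3 = ‖sq β‖ ^ 2 * ‖sq β‖ by ring, h1]; nlinarith [norm_nonneg (sq β)]
      rw [norm_div, norm_mul, norm_mul, norm_pow, div_div]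
      simp only [Complex.norm_ofNat]
      rw [show 4 * c0 ^ 2 * ‖ν‖ = 4 * ‖ν‖ * c0 ^ 2 by ring]
      gcongr
    have hη2 : ‖η 0‖ ≤ 1 := hη1.trans (by rw [div_le_one hnν]; linarith)
    have e : (1 + p / (4 * ν * sq β ^ 3)) * (1 + η 0) + 2 * b 0 - 1 = p / (4 * ν * sq β ^ 3) * (1 + η 0) + (η 0 + 2 * b 0) := by ring
    rw [e]
    have t1 : ‖p / (4 * ν * sq β ^ 3) * (1 + η 0)‖ ≤ M / (4 * c0 ^ 2) / ‖ν‖ * 2 := by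
      rw [norm_mul]
      have : ‖1 + η 0‖ ≤ 2 := (norm_add_le _ _).trans (by rw [norm_one]; linarith)
      gcongr
    have t2 : ‖η 0 + 2 * b 0‖ ≤ C / ‖ν‖ + 2 * (C / ‖ν‖) := by
      refine (norm_add_le _ _).trans ?_
      rw [norm_mul]; simp only [Complex.norm_ofNat]
      linarith
    refine (norm_add_le _ _).trans ((add_le_add t1 t2).trans ?_)
    have h5 : (3 * C + M / c0 ^ 2) / ‖ν‖ = M / (4 * c0 ^ 2) / ‖ν‖ * 2 + (C / ‖ν‖ + 2 * (C / ‖ν‖)) + M / (2 * c0 ^ 2) / ‖ν‖ := by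
      field_simp; ring
    rw [h5]
    have : 0 ≤ M / (2 * c0 ^ 2) / ‖ν‖ := by positivity
    linarith
  · have : n ^ 3 * gA (p * n ^ 8, β * n ^ 12) * sq (sq β) = Complex.exp (ν * Ps p β) * (1 + η 0) := by
      rw [f1]; field_simp
    linear_combination this
  · apply mul_left_cancel₀ (pow_ne_zero 7 hnne)
    rw [show n ^ 7 * gB (p * n ^ 8, β * n ^ 12) = n ^ 4 * (n ^ 3 * gB (p * n ^ 8, β * n ^ 12)) by ring, f2, hνn]
    have key : ∀ V W E y1 y2 : ℂ, V ≠ 0 → V ^ 2 = W →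
        E / V * ((-(n ^ 10 * W) - (3 * 0 ^ 2 + p) / (4 * W ^ 2)) * (1 + y1) - 2 * (n ^ 10 * W) * y2) =
        n ^ 7 * (-(n ^ 3 * V) * E * (1 + ((1 + p / (4 * n ^ 10 * W ^ 3)) * (1 + y1) + 2 * y2 - 1))) := by
      rintro V W E y1 y2 hV rfl
      field_simp
      ring
    exact key _ _ _ _ _ hssβ0 hssq

end PTC

open Complex Filter
namespace PTC
open Topology Set MeasureTheory

theorem cs72 : 0.309 < (rt 72).re ∧ (rt 72).re < 0.3093 ∧ 0.951 < (rt 72).im ∧ (rt 72).im < 0.9512 := by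
  have h5 : √5 ^ 2 = 5 := Real.sq_sqrt (by norm_num)
  have h5' : 2.236 < √5 := Real.lt_sqrt_of_sq_lt (by norm_num)
  have h5'' : √5 < 2.23607 := by rw [Real.sqrt_lt' (by norm_num)]; norm_num
  have hc : (rt 72).re = (√5 - 1) / 4 := by
    rw [rt_re, show (72 * (Real.pi / 180) : ℝ) = 2 * (Real.pi / 5) by ring, Real.cos_two_mul, Real.cos_pi_div_five]
    nlinarith
  have hs : 0 < (rt 72).im := by
    rw [rt_im]; apply Real.sin_pos_of_pos_of_lt_pi <;> nlinarith [Real.pi_pos]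
  have h1 : (rt 72).re ^ 2 + (rt 72).im ^ 2 = 1 := by
    rw [rt_re, rt_im]; exact Real.cos_sq_add_sin_sq _
  have hq : (rt 72).im ^ 2 = (5 + √5) / 8 := by rw [hc] at h1; nlinarith
  refine ⟨by rw [hc]; linarith, by rw [hc]; linarith, ?_, ?_⟩
  · nlinarith
  · nlinarith

/-- the `κ`-rectangle -/
def Rect (K : ℝ) : Set ℂ := {κ | -0.001 < κ.re ∧ κ.re < K ∧ |κ.im| < 0.001}

theorem Rect_open (K : ℝ) : IsOpen (Rect K) := by
  refine (isOpen_lt continuous_const continuous_re).inter ((isOpen_lt continuous_re continuous_const).inter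
    (isOpen_lt (continuous_abs.comp continuous_im) continuous_const))

theorem Rect_norm {K : ℝ} {κ : ℂ} (hK : 0 < K) (h : κ ∈ Rect K) : ‖κ‖ ≤ K + 1 := by
  obtain ⟨h1, h2, h3⟩ := h
  have := Complex.norm_le_abs_re_add_abs_im κ
  have h4 : |κ.re| ≤ K + 0.5 := abs_le.2 ⟨by linarith, by linarith⟩
  linarith

theorem El_aux {x y s c d : ℝ} (hs : 0 ≤ s) (hx : -0.001 < x) (hy : |y| < 0.001)
    (hc0 : 0.309 < c) (hc1 : c ≤ 1) (hd0 : 0 ≤ d) (hd : d < 0.9512) :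
    0.3 * (1 + s ^ 3) ≤ s ^ 3 + (c * x + d * y) * s + c ∧
    |d * (1 - x * s) + c * y * s| ≤ 3.2 * (s ^ 3 + (c * x + d * y) * s + c) := by
  have h3 : s ≤ 1 + s ^ 3 := by nlinarith [sq_nonneg (s - 1), mul_nonneg hs (sq_nonneg (s-1))]
  have h30 : 0 ≤ s ^ 3 := by positivity
  obtain ⟨y1, y2⟩ := abs_lt.1 hy
  have k1 : -0.001 * s ≤ d * y * s := by nlinarith [mul_nonneg hd0 hs]
  have k2 : -0.001 * s ≤ c * y * s := by nlinarith [mul_nonneg (by linarith : 0 ≤ c) hs]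
  have k2' : c * y * s ≤ 0.001 * s := by nlinarith [mul_nonneg (by linarith : 0 ≤ c) hs]
  have k3 : -0.001 * s ≤ c * x * s := by nlinarith [mul_nonneg (by linarith : 0 ≤ c) hs]
  have k4 : -0.001 * s ≤ x * s := by nlinarith
  have k5 : 0.3089 * (x * s + 0.001 * s) ≤ c * x * s + 0.001 * s := by
    nlinarith [mul_nonneg (by linarith : 0 ≤ c - 0.3089) (by linarith : 0 ≤ x * s + 0.001 * s)]
  have k6 : d * (x * s + 0.001 * s) ≤ 0.9512 * (x * s + 0.001 * s) :=
    mul_le_mul_of_nonneg_right hd.le (by linarith)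
  have k7 : 0 ≤ d * (x * s + 0.001 * s) := mul_nonneg hd0 (by linarith)
  have k8 : d * (0.001 * s) ≤ 0.001 * s := by nlinarith
  have k9 : 0 ≤ d * (0.001 * s) := by positivity
  constructor
  · nlinarith
  · rw [abs_le]; constructor <;> nlinarith

theorem El_rect {K : ℝ} {κ : ℂ} (h : κ ∈ Rect K) : El 0.3 κ 1 ∧ El 0.3 (rt 72 * κ) (rt (-72)) ∧
    El 0.3 (rt (-72) * κ) (rt 72) := by
  obtain ⟨h1, -, h3⟩ := h
  obtain ⟨a1, a2, a3, a4⟩ := cs72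
  have r3 : ∀ s : ℝ, ((s:ℂ)^3).re = s ^ 3 ∧ ((s:ℂ)^3).im = 0 := fun s => by
    rw [← ofReal_pow]; exact ⟨ofReal_re _, ofReal_im _⟩
  refine ⟨fun s hs => ?_, fun s hs => ?_, fun s hs => ?_⟩
  · have := El_aux (x := κ.re) (y := κ.im) (c := 1) (d := 0) hs h1 h3 (by norm_num) le_rfl le_rfl (by norm_num)
    unfold Qf
    simp only [add_re, add_im, mul_re, mul_im, r3, ofReal_re, ofReal_im, one_re, one_im]
    convert this using 2 <;> ring_nf
  · have := El_aux (x := κ.re) (y := -κ.im) (c := (rt 72).re) (d := (rt 72).im) hs h1 (by rwa [abs_neg]) a1 (by linarith) (by linarith) a4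
    unfold Qf
    simp only [add_re, add_im, mul_re, mul_im, r3, ofReal_re, ofReal_im, (rt_neg_re 72).1, (rt_neg_re 72).2]
    rw [← abs_neg]
    convert this using 2 <;> ring_nf
  · have := El_aux (x := κ.re) (y := κ.im) (c := (rt 72).re) (d := (rt 72).im) hs h1 h3 a1 (by linarith) (by linarith) a4
    unfold Qf
    simp only [add_re, add_im, mul_re, mul_im, r3, ofReal_re, ofReal_im, (rt_neg_re 72).1, (rt_neg_re 72).2]
    convert this using 2 <;> ring_nf

noncomputable def nn (ν : ℂ) : ℂ := ν ^ (1 / 10 : ℂ)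
noncomputable def XX (κ ν : ℂ) : ℂ := rt 18 / 2 * WR 0 216 (κ * nn ν ^ 8) (nn ν ^ 12)
noncomputable def YY (κ ν : ℂ) : ℂ := rt (-18) / 2 * WR 0 144 (κ * nn ν ^ 8) (nn ν ^ 12)
noncomputable def PhX (κ : ℂ) : ℂ := Ps κ 1 + Ps (rt (-72) * κ) (rt 72)
noncomputable def PhY (κ : ℂ) : ℂ := Ps κ 1 + Ps (rt 72 * κ) (rt (-72))

/-- the sector of large `ν` -/
def Sec (C : ℝ) : Set ℂ := {ν | 0 < ν.re ∧ |ν.im| < 1.3 * ν.re ∧ C < ‖ν‖}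

theorem Sec_open (C : ℝ) : IsOpen (Sec C) :=
  (isOpen_lt continuous_const continuous_re).inter ((isOpen_lt (continuous_abs.comp continuous_im) (by fun_prop)).inter
    (isOpen_lt continuous_const continuous_norm))

theorem plucker (p l : ℂ) : FF (-p) l * WR 0 144 p l * WR 0 216 p l =
    8 * rt (-90) * (1 + rt 18 / 2 * WR 0 216 p l + rt (-18) / 2 * WR 0 144 p l) := by
  have e01 := WR_adj 0 p l
  have e12 := WR_adj 72 p l
  have e23 := WR_adj 144 p l
  have e34 := WR_adj 216 p l
  have e45 := WR_adj 288 p l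
  norm_num at e01 e12 e23 e34 e45
  have e04 : WR 0 288 p l = 2 * rt (-54) := by
    have : WR 0 288 p l = - WR 288 360 p l := by
      obtain ⟨h1, h2⟩ := cAB_period 0 p l
      rw [zero_add] at h1 h2
      rw [WR, WR, h1, h2]; ring
    rw [this, e45, show (-54 : ℝ) = -234 + 180 by norm_num, ← neg_rt]; ring
  have pl : WR 72 288 p l * WR 0 144 p l * WR 0 216 p l = WR 72 144 p l * WR 0 288 p l * WR 0 216 p l
      + WR 0 72 p l * WR 216 288 p l * WR 0 144 p l + WR 0 72 p l * WR 0 288 p l * WR 144 216 p l := by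
    simp only [WR]; ring
  rw [FF, neg_neg, pl, e01, e12, e23, e34, e04]
  have f1 : rt (-18) * rt (-54) = rt (-90) * rt 18 := by rw [← rt_add, ← rt_add]; norm_num
  have f2 : rt 54 * rt (-162) = rt (-90) * rt (-18) := by rw [← rt_add, ← rt_add]; norm_num
  have f3 : rt 54 * rt (-54) = 1 := by rw [mul_comm]; exact rt_neg 54
  linear_combination 4 * WR 0 216 p l * f1 + 4 * WR 0 144 p l * f2 + 8 * rt (-90) * f3

theorem nn_spec {ν : ℂ} (h0 : 0 < ν.re) (h : |ν.im| < 1.3 * ν.re) : ∃ ρ α : ℝ, 0 < ρ ∧ |α| ≤ 6 ∧ nn ν = ρ * rt α ∧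
    ν = nn ν ^ 10 := by
  have hν : ν ≠ 0 := by rintro rfl; simp at h0
  have hn : 0 < ‖ν‖ := norm_pos_iff.2 hν
  refine ⟨Real.exp (Real.log ‖ν‖ / 10), ν.arg * 18 / Real.pi, Real.exp_pos _, ?_, ?_, ?_⟩
  · have harg : |ν.arg| ≤ Real.pi / 3 := by
      by_contra hc
      push Not at hc
      have h1 : Real.cos ν.arg < 1 / 2 := by
        rw [← Real.cos_pi_div_three, ← Real.cos_abs ν.arg]
        exact Real.cos_lt_cos_of_nonneg_of_le_pi (by positivity) (Complex.abs_arg_le_pi ν) hc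
      rw [Complex.cos_arg hν, div_lt_iff₀ hn] at h1
      have h2 := Complex.sq_norm ν
      rw [Complex.normSq_apply] at h2
      have h3 : ν.im ^ 2 < (1.3 * ν.re) ^ 2 := sq_lt_sq' (by linarith [neg_abs_le ν.im]) (lt_of_le_of_lt (le_abs_self _) h)
      nlinarith
    rw [abs_div, abs_mul, abs_of_pos Real.pi_pos, abs_of_pos (by norm_num : (0:ℝ) < 18), div_le_iff₀ Real.pi_pos]
    linarith
  · rw [nn, cpow_def_of_ne_zero hν, rt, ofReal_exp, ← Complex.exp_add]
    congr 1
    conv_lhs => rw [← re_add_im (Complex.log ν)]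
    rw [Complex.log_re, Complex.log_im]
    push_cast
    have : (Real.pi : ℂ) ≠ 0 := by exact_mod_cast Real.pi_ne_zero
    field_simp
    ring
  · rw [nn, ← cpow_nat_mul]; norm_num

theorem sqsq_one : sq (sq 1) = 1 := by
  have : sq 1 = 1 := sq_unique (by simp) (by norm_num)
  rw [this, this]

theorem rt_re_pos {x : ℝ} (h : |x| < 90) : 0 < (rt x).re := by
  rw [rt_re]
  obtain ⟨h1, h2⟩ := abs_lt.1 h
  apply Real.cos_pos_of_mem_Ioo
  constructor <;> nlinarith [Real.pi_pos]

theorem sqsq_rt {x : ℝ} (h : |x| < 45) : sq (sq (rt (4 * x))) = rt x := by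
  have hx : |2 * x| < 90 := by rw [abs_mul, abs_two]; linarith
  have : sq (rt (4 * x)) = rt (2 * x) := sq_unique (rt_re_pos hx) (by rw [rt_pow]; congr 1; push_cast; ring)
  rw [this]
  exact sq_unique (rt_re_pos (by linarith)) (by rw [rt_pow]; norm_num)

end PTC

open Complex Filter
namespace PTC
open Topology Set MeasureTheory

theorem pair_lemma {A0 B0 A B N E0 E r t e1 e2 f1 f2 : ℂ} {q : ℝ} (hN : N ≠ 0) (ht : -(t * r ^ 2) = 1)
    (h1 : A0 * N = E0 * (1 + e1)) (h2 : B0 = -N * E0 * (1 + e2))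
    (h3 : A * (N * r) = E * (1 + f1)) (h4 : B = -(N * r) * E * (1 + f2)) (hq0 : 0 ≤ q) (hq : q ≤ 1)
    (n1 : ‖e1‖ ≤ q) (n2 : ‖e2‖ ≤ q) (m1 : ‖f1‖ ≤ q) (m2 : ‖f2‖ ≤ q) :
    ∃ ε : ℂ, ‖ε‖ ≤ 3 * q ∧ r / 2 * (A0 * (t * B) - B0 * A) = E0 * E * (1 + ε) := by
  refine ⟨((e1 + f2 + e1 * f2) + (e2 + f1 + e2 * f1)) / 2, ?_, ?_⟩
  · have g1 : ‖e1 * f2‖ ≤ q := by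
      rw [norm_mul]; calc _ ≤ q * 1 := mul_le_mul n1 (m2.trans hq) (norm_nonneg _) hq0
        _ = q := mul_one q
    have g2 : ‖e2 * f1‖ ≤ q := by
      rw [norm_mul]; calc _ ≤ q * 1 := mul_le_mul n2 (m1.trans hq) (norm_nonneg _) hq0
        _ = q := mul_one q
    rw [norm_div, Complex.norm_ofNat, div_le_iff₀ two_pos]
    have := norm_add_le (e1 + f2 + e1 * f2) (e2 + f1 + e2 * f1)
    have := norm_add₃_le (a := e1) (b := f2) (c := e1 * f2)
    have := norm_add₃_le (a := e2) (b := f1) (c := e2 * f1)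
    linarith
  · have hr : r ≠ 0 := by rintro rfl; simp at ht
    have hA0 : A0 = E0 * (1 + e1) / N := by field_simp; exact h1
    have hA : A = E * (1 + f1) / (N * r) := by field_simp; linear_combination h3
    have ht' : t = -1 / r ^ 2 := by field_simp; linear_combination -ht
    rw [hA0, hA, h2, h4, ht']
    field_simp
    ring

theorem wkb_XY (K : ℝ) (hK : 0 < K) : ∃ C : ℝ, 0 < C ∧ ∀ κ ∈ Rect K, ∀ ν ∈ Sec C,
    (∃ ε, ‖ε‖ ≤ C / ‖ν‖ ∧ XX κ ν = Complex.exp (ν * PhX κ) * (1 + ε)) ∧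
    (∃ ε, ‖ε‖ ≤ C / ‖ν‖ ∧ YY κ ν = Complex.exp (ν * PhY κ) * (1 + ε)) := by
  obtain ⟨C, hC, H⟩ := wkb_AB (c0 := 0.3) (M := K + 1) (by norm_num) (by norm_num) (by positivity)
  refine ⟨3 * C, by positivity, fun κ hκ ν ⟨hν0, hν1, hν2⟩ => ?_⟩
  obtain ⟨ρ, α, hρ, hα, hn, hn10⟩ := nn_spec hν0 hν1
  obtain ⟨E1, E2, E3⟩ := El_rect hκ
  have hκn := Rect_norm hK hκ
  have hCν : C ≤ ‖ν‖ := by linarith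
  have hνp : 0 < ‖ν‖ := hC.trans_le hCν
  have hq : C / ‖ν‖ ≤ 1 := (div_le_one hνp).2 hCν
  have hnn : nn ν ≠ 0 := by
    rw [hn]; exact mul_ne_zero (by exact_mod_cast hρ.ne') (rt_ne _)
  have h72 : rt 432 = rt 72 := by rw [show (432:ℝ) = 72 + 360 by norm_num, rt_add_360]
  have h72' : rt 288 = rt (-72) := by rw [show (288:ℝ) = -72 + 360 by norm_num, rt_add_360]
  have h648 : rt 648 = rt (-72) := by
    rw [show (648:ℝ) = -72 + 360 + 360 by norm_num, rt_add_360, rt_add_360]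
  obtain ⟨e1, e2, n1, n2, a1, a2⟩ := H ρ α κ 1 (nn ν) ν E1 hκn hρ hα hn hn10 hν0 hν1.le hCν
  obtain ⟨f1, f2, m1, m2, b1, b2⟩ := H ρ α _ _ (nn ν) ν E2 (by rwa [norm_mul, rt_norm, one_mul]) hρ hα hn hn10 hν0 hν1.le hCν
  obtain ⟨g1, g2, l1, l2, c1, c2⟩ := H ρ α _ _ (nn ν) ν E3 (by rwa [norm_mul, rt_norm, one_mul]) hρ hα hn hn10 hν0 hν1.le hCν
  have hs1 : sq (sq (rt 72)) = rt 18 := by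
    have := sqsq_rt (x := 18) (by rw [abs_of_pos] <;> norm_num)
    norm_num at this; exact this
  have hs2 : sq (sq (rt (-72))) = rt (-18) := by
    have := sqsq_rt (x := -18) (by rw [abs_of_neg] <;> norm_num)
    norm_num at this; exact this
  rw [sqsq_one, mul_one] at a1 a2
  rw [one_mul] at a1 a2
  rw [hs2] at b1 b2
  rw [hs1] at c1 c2
  constructor
  · obtain ⟨ε, h1, h2⟩ := pair_lemma (t := rt (-216)) (pow_ne_zero 3 hnn)
      (by rw [rt_pow, ← rt_add, neg_rt]; norm_num [rt_zero]) a1 a2 c1 c2 (by positivity) hq n1 n2 l1 l2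
    refine ⟨ε, by rw [mul_div_assoc]; exact h1, ?_⟩
    rw [PhX, mul_add ν, Complex.exp_add, ← h2, XX, WR, cA, cA, cB, cB]
    norm_num [rt_zero, h72, h648, mul_assoc]
  · obtain ⟨ε, h1, h2⟩ := pair_lemma (t := rt (-144)) (pow_ne_zero 3 hnn)
      (by rw [rt_pow, ← rt_add, neg_rt]; norm_num [rt_zero]) a1 a2 b1 b2 (by positivity) hq n1 n2 m1 m2
    refine ⟨ε, by rw [mul_div_assoc]; exact h1, ?_⟩
    rw [PhY, mul_add ν, Complex.exp_add, ← h2, YY, WR, cA, cA, cB, cB]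
    norm_num [rt_zero, h72, h72', mul_assoc]

theorem Ps_diff {U : Set ℂ} {b : ℂ} {β : ℂ} {M : ℝ} (hU : IsOpen U) (hM : ∀ κ ∈ U, ‖b * κ‖ ≤ M) (hβ : ‖β‖ ≤ M)
    (h : ∀ κ ∈ U, ∀ s : ℝ, 0 < s → Qf (b * κ) β s ∈ slitPlane) :
    DifferentiableOn ℂ (fun κ => Ps (b * κ) β) U := by
  unfold Ps
  refine hol_param hU (B := fun s => (2 + 3 * M + M ^ 2) * env s) (env_int.const_mul _)
    (fun κ hκ => (psi_cont (h κ hκ)).aestronglyMeasurable measurableSet_Ioi) ?_ ?_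
  · refine (ae_restrict_iff' measurableSet_Ioi).2 (Eventually.of_forall fun s hs => ?_)
    intro κ hκ
    refine DifferentiableAt.differentiableWithinAt ?_
    have h1 := sq_diff (h κ hκ s hs)
    have h2 : DifferentiableAt ℂ (fun κ => Qf (b * κ) β s) κ := by unfold Qf; fun_prop
    have h3 : DifferentiableAt ℂ (fun κ => sq (Qf (b * κ) β s)) κ :=
      DifferentiableAt.comp (f := fun κ => Qf (b * κ) β s) κ h1 h2
    unfold psi
    exact h3.sub (by fun_prop)
  · refine (ae_restrict_iff' measurableSet_Ioi).2 (Eventually.of_forall fun s hs κ hκ => ?_)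
    exact psi_le (hM κ hκ) hβ hs (h κ hκ s hs)

theorem Ph_diff {K : ℝ} (hK : 0 < K) : DifferentiableOn ℂ PhX (Rect K) ∧ DifferentiableOn ℂ PhY (Rect K) := by
  have hn : ∀ x, ∀ κ ∈ Rect K, ‖rt x * κ‖ ≤ K + 1 := fun x κ hκ => by
    rw [norm_mul, rt_norm, one_mul]; exact Rect_norm hK hκ
  have h0 : DifferentiableOn ℂ (fun κ => Ps κ 1) (Rect K) := by
    have := Ps_diff (b := 1) (β := 1) (M := K + 1) (Rect_open K) (fun κ hκ => by rw [one_mul]; exact Rect_norm hK hκ)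
      (by rw [norm_one]; linarith) (fun κ hκ s hs => by
        rw [one_mul]; exact (El_rect hκ).1.slit (by norm_num) hs.le)
    simpa using this
  exact ⟨h0.add (Ps_diff (Rect_open K) (hn _) (by rw [rt_norm]; linarith) fun κ hκ s hs =>
      (El_rect hκ).2.2.slit (by norm_num) hs.le),
    h0.add (Ps_diff (Rect_open K) (hn _) (by rw [rt_norm]; linarith) fun κ hκ s hs =>
      (El_rect hκ).2.1.slit (by norm_num) hs.le)⟩

theorem nn_diff {ν : ℂ} (h : 0 < ν.re) : DifferentiableAt ℂ nn ν := by
  unfold nn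
  exact differentiableAt_id.cpow_const (Or.inl h)

theorem log_hol {S : Set (ℂ × ℂ)} {f Φ : ℂ × ℂ → ℂ} {q : ℂ × ℂ → ℝ} (hf : HolOn S f) (hΦ : HolOn S Φ)
    (hq : ∀ x ∈ S, q x ≤ 1 / 2) (h : ∀ x ∈ S, ∃ ε, ‖ε‖ ≤ q x ∧ f x = Complex.exp (Φ x) * (1 + ε)) :
    ∃ e : ℂ × ℂ → ℂ, HolOn S e ∧ ∀ x ∈ S, ‖e x‖ ≤ 2 * q x ∧ f x = Complex.exp (Φ x + e x) := by
  have hm : HolOn S (fun x => f x * Complex.exp (-Φ x)) :=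
    hf.mul (HolOn.post (φ := fun z => Complex.exp (-z)) (T := univ) (by fun_prop) hΦ (mapsTo_univ _ _))
  have key : ∀ x ∈ S, ∃ ε, ‖ε‖ ≤ q x ∧ f x * Complex.exp (-Φ x) = 1 + ε := fun x hx => by
    obtain ⟨ε, h1, h2⟩ := h x hx
    refine ⟨ε, h1, ?_⟩
    rw [h2, mul_right_comm, ← Complex.exp_add, add_neg_cancel, Complex.exp_zero, one_mul]
  have hsl : ∀ x ∈ S, f x * Complex.exp (-Φ x) ∈ slitPlane := fun x hx => by
    obtain ⟨ε, h1, h2⟩ := key x hx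
    rw [h2]
    exact mem_slitPlane_of_norm_lt_one (by linarith [hq x hx])
  refine ⟨fun x => Complex.log (f x * Complex.exp (-Φ x)), HolOn.post (T := slitPlane)
    (fun z hz => (differentiableAt_log hz).differentiableWithinAt) hm hsl, fun x hx => ⟨?_, ?_⟩⟩
  · obtain ⟨ε, h1, h2⟩ := key x hx
    simp only [h2]
    have := Complex.norm_log_one_add_half_le_self (z := ε) (by linarith [hq x hx])
    linarith [norm_nonneg ε]
  · simp only []
    rw [Complex.exp_add, Complex.exp_log (slitPlane_ne_zero (hsl x hx)), mul_comm, mul_assoc, ← Complex.exp_add,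
      neg_add_cancel, Complex.exp_zero, mul_one]

theorem WR_hol (x y : ℝ) : HolOn univ (fun w : ℂ × ℂ => WR x y w.1 w.2) := by
  obtain ⟨hA, hB⟩ := gA_gB_hol
  have a1 : ∀ x, HolOn univ (fun w : ℂ × ℂ => cA x w.1 w.2) := fun x =>
    hA.comp_diff (φ := fun w : ℂ × ℂ => (rt (3 * x) * w.1, rt (2 * x) * w.2)) (by fun_prop) (mapsTo_univ _ _)
  have b1 : ∀ x, HolOn univ (fun w : ℂ × ℂ => cB x w.1 w.2) := fun x =>
    (HolOn.const _).mul
      (hB.comp_diff (φ := fun w : ℂ × ℂ => (rt (3 * x) * w.1, rt (2 * x) * w.2)) (by fun_prop) (mapsTo_univ _ _))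
  exact ((a1 x).mul (b1 y)).sub ((b1 x).mul (a1 y))

theorem wkb_main (K : ℝ) (hK : 0 < K) : ∃ (C : ℝ) (eu ev : ℂ × ℂ → ℂ), 0 < C ∧
    HolOn (Rect K ×ˢ Sec C) eu ∧ HolOn (Rect K ×ˢ Sec C) ev ∧ ∀ x ∈ Rect K ×ˢ Sec C,
    ‖eu x‖ ≤ C / ‖x.2‖ ∧ ‖ev x‖ ≤ C / ‖x.2‖ ∧
    (FF (-(x.1 * nn x.2 ^ 8)) (nn x.2 ^ 12) = 0 ↔
      1 + Complex.exp (x.2 * PhX x.1 + eu x) + Complex.exp (x.2 * PhY x.1 + ev x) = 0) := by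
  obtain ⟨C, hC, H⟩ := wkb_XY K hK
  have hsub : Sec (2 * C) ⊆ Sec C := fun ν h => ⟨h.1, h.2.1, by linarith [h.2.2]⟩
  have hq : ∀ x ∈ Rect K ×ˢ Sec (2 * C), C / ‖x.2‖ ≤ 1 / 2 := fun x hx => by
    have := hx.2.2.2
    rw [div_le_iff₀ (by linarith)]; linarith
  have hmap : DifferentiableOn ℂ (fun x : ℂ × ℂ => (x.1 * nn x.2 ^ 8, nn x.2 ^ 12)) (Rect K ×ˢ Sec (2 * C)) := by
    intro x hx
    have h1 := nn_diff hx.2.1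
    have h2 : DifferentiableAt ℂ (fun x : ℂ × ℂ => nn x.2) x := DifferentiableAt.comp (f := fun x : ℂ × ℂ => x.2) x h1 differentiableAt_snd
    exact ((differentiableAt_fst.mul (h2.pow 8)).prodMk (h2.pow 12)).differentiableWithinAt
  have hX : HolOn (Rect K ×ˢ Sec (2 * C)) (fun x => XX x.1 x.2) :=
    ((HolOn.const (rt 18 / 2)).mul ((WR_hol 0 216).comp_diff (φ := fun x : ℂ × ℂ => (x.1 * nn x.2 ^ 8, nn x.2 ^ 12))
      hmap (mapsTo_univ _ _))).congr (fun x _ => by simp only [XX])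
  have hY : HolOn (Rect K ×ˢ Sec (2 * C)) (fun x => YY x.1 x.2) :=
    ((HolOn.const (rt (-18) / 2)).mul ((WR_hol 0 144).comp_diff (φ := fun x : ℂ × ℂ => (x.1 * nn x.2 ^ 8, nn x.2 ^ 12))
      hmap (mapsTo_univ _ _))).congr (fun x _ => by simp only [YY])
  obtain ⟨d1, d2⟩ := Ph_diff hK
  have p1 : HolOn (Rect K ×ˢ Sec (2 * C)) (fun x => x.2 * PhX x.1) := HolOn.of_diff
    (differentiableOn_snd.mul (d1.comp differentiableOn_fst (fun x hx => hx.1)))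
  have p2 : HolOn (Rect K ×ˢ Sec (2 * C)) (fun x => x.2 * PhY x.1) := HolOn.of_diff
    (differentiableOn_snd.mul (d2.comp differentiableOn_fst (fun x hx => hx.1)))
  obtain ⟨eu, hu1, hu2⟩ := log_hol (q := fun x => C / ‖x.2‖) hX p1 hq (fun x hx => (H x.1 hx.1 x.2 (hsub hx.2)).1)
  obtain ⟨ev, hv1, hv2⟩ := log_hol (q := fun x => C / ‖x.2‖) hY p2 hq (fun x hx => (H x.1 hx.1 x.2 (hsub hx.2)).2)
  refine ⟨2 * C, eu, ev, by positivity, hu1, hv1, fun x hx => ⟨?_, ?_, ?_⟩⟩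
  · rw [mul_div_assoc]; exact (hu2 x hx).1
  · rw [mul_div_assoc]; exact (hv2 x hx).1
  · rw [← (hu2 x hx).2, ← (hv2 x hx).2]
    have hp := plucker (x.1 * nn x.2 ^ 8) (nn x.2 ^ 12)
    have x1 : WR 0 216 (x.1 * nn x.2 ^ 8) (nn x.2 ^ 12) ≠ 0 := fun h0 => by
      have := (hu2 x hx).2
      rw [XX, h0, mul_zero] at this
      exact Complex.exp_ne_zero _ this.symm
    have x2 : WR 0 144 (x.1 * nn x.2 ^ 8) (nn x.2 ^ 12) ≠ 0 := fun h0 => by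
      have := (hv2 x hx).2
      rw [YY, h0, mul_zero] at this
      exact Complex.exp_ne_zero _ this.symm
    rw [XX, YY]
    constructor
    · intro h
      rw [h, zero_mul, zero_mul] at hp
      exact (mul_eq_zero.1 hp.symm).resolve_left (mul_ne_zero (by norm_num) (rt_ne _))
    · intro h
      rw [h, mul_zero] at hp
      exact (mul_eq_zero.1 ((mul_eq_zero.1 hp).resolve_right x1)).resolve_right x2

end PTC

open Complex Filter
namespace PTC
open Topology Set MeasureTheory

theorem kern_aux {x : ℝ} (h1 : 1 ≤ x) (h2 : x < 1.1) :
    0.9068 ≤ x * (1.4535 * x ^ 2 - 0.4635 * x + 0.09 - 1.4268 * 3.25 * (x - 1)) := by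
  obtain ⟨t, rfl⟩ : ∃ t, x = 1 + t := ⟨x - 1, by ring⟩
  have h3 : 0 ≤ t := by linarith
  have h4 : t ^ 2 ≤ 0.1 * t := by nlinarith
  have h5 : 0 ≤ t ^ 3 := by positivity
  ring_nf
  linarith

set_option maxHeartbeats 1000000 in
theorem kern_poly {x z w c d : ℝ} (hx : 1 ≤ x) (hz : 0 ≤ z) (hc : 0.309 < c) (hc' : c < 0.3093) (hd' : d < 0.9512)
    (hw : w = x ^ 2 - z ^ 2 - 1) (hzw : 2 * c * (x * z) ≤ d * w) (hw0 : 0 ≤ w) :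
    (c * x + d * z - c * (x ^ 2 + z ^ 2)) * (2 * c + 1.5 * w) ≤ 0.99 * w * (x ^ 2 + z ^ 2) := by
  have hxz : 0 ≤ x * z := mul_nonneg (by linarith) hz
  have h1 : 0.649 * (x * z) ≤ w := by
    have : 0.618 * (x * z) ≤ 0.9512 * w := by nlinarith
    linarith
  have hxx : 0 ≤ x ^ 2 - x + z ^ 2 := by nlinarith [sq_nonneg z]
  have h2 : c * x + d * z - c * (x ^ 2 + z ^ 2) ≤ 0.9512 * z - 0.309 * (x ^ 2 - x + z ^ 2) := by
    nlinarith [mul_nonneg (by linarith : 0 ≤ c - 0.309) hxx, mul_nonneg (by linarith : 0 ≤ 0.9512 - d) hz]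
  have h3 : (c * x + d * z - c * (x ^ 2 + z ^ 2)) * (2 * c + 1.5 * w) ≤
      (0.9512 * z - 0.309 * (x ^ 2 - x + z ^ 2)) * (2 * c + 1.5 * w) := mul_le_mul_of_nonneg_right h2 (by nlinarith)
  refine h3.trans ?_
  have h4 : (0.9512 * z - 0.309 * (x ^ 2 - x + z ^ 2)) * (2 * c + 1.5 * w) ≤
      0.9512 * z * (0.6186 + 1.5 * w) - 0.309 * (x ^ 2 - x + z ^ 2) * (0.618 + 1.5 * w) := by
    nlinarith [mul_nonneg hz (by linarith : 0 ≤ 0.6186 - 2 * c), mul_nonneg hxx (by linarith : 0 ≤ 2 * c - 0.618)]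
  refine h4.trans ?_
  have h5 : 0.09 * w ≤ 0.309 * 0.618 * (x ^ 2 - x + z ^ 2) := by rw [hw]; nlinarith [sq_nonneg z]
  set B := 0.99 * (x ^ 2 + z ^ 2) + 0.4635 * (x ^ 2 - x + z ^ 2) + 0.09 - 1.4268 * z with hB
  have h6 : 0.9068 ≤ x * B := by
    by_cases hx1 : 1.1 ≤ x
    · have : 0.85 ≤ B := by rw [hB]; nlinarith [sq_nonneg (z - 0.49)]
      nlinarith
    · push Not at hx1
      have hzt : z ≤ 3.25 * (x - 1) := by
        have : 0.649 * (x * z) ≤ x ^ 2 - 1 := by nlinarith [sq_nonneg z]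
        nlinarith
      have : 1.4535 * x ^ 2 - 0.4635 * x + 0.09 - 1.4268 * 3.25 * (x - 1) ≤ B := by rw [hB]; nlinarith [sq_nonneg z]
      have h7 : x * (1.4535 * x ^ 2 - 0.4635 * x + 0.09 - 1.4268 * 3.25 * (x - 1)) ≤ x * B :=
        mul_le_mul_of_nonneg_left this (by linarith)
      exact (kern_aux hx hx1).trans h7
  have h8 : 0.5885 * z ≤ w * B := by
    have a1 : 0.5885 * (x * z) ≤ 0.9068 * w := by linarith
    have a2 : 0.9068 * w ≤ x * B * w := mul_le_mul_of_nonneg_right h6 hw0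
    have : x * (0.5885 * z) ≤ x * (w * B) := by linarith
    exact le_of_mul_le_mul_left this (by linarith)
  rw [hB] at h8
  have h9 : 0.9512 * 0.6186 * z ≤ 0.5885 * z := mul_le_mul_of_nonneg_right (by norm_num) hz
  clear_value B
  clear h1 h2 h3 h4 h6 hxx hxz hzw hw hB
  linarith

theorem kern {x y c d σ δ v : ℝ} (hx0 : 0 < x) (hc : 0.309 < c) (hc' : c < 0.3093) (hd : 0.951 < d) (hd' : d < 0.9512)
    (h1 : x ^ 2 - y ^ 2 = 1 + c * σ) (h2 : 2 * x * y = -(d * δ)) (hδ : δ ≤ σ) (hσ : 0 ≤ σ) (hv : 0 < v) (hv2 : v ^ 2 = 1 + σ) :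
    c * (x / (x ^ 2 + y ^ 2) - 1) - d * (y / (x ^ 2 + y ^ 2)) ≤ 0.99 * (1 - 1 / v) := by
  have hx : 1 ≤ x := by nlinarith [sq_nonneg y, mul_nonneg (by linarith : 0 ≤ c) hσ]
  have hn : 0 < x ^ 2 + y ^ 2 := by positivity
  have hv1 : 1 ≤ v := by nlinarith
  have hr : 0 ≤ 0.99 * (1 - 1 / v) := by
    have : 1 / v ≤ 1 := (div_le_one hv).2 hv1
    linarith
  have e : c * (x / (x ^ 2 + y ^ 2) - 1) - d * (y / (x ^ 2 + y ^ 2)) =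
      (c * x + d * (-y) - c * (x ^ 2 + (-y) ^ 2)) / (x ^ 2 + y ^ 2) := by field_simp; ring
  rw [e]
  by_cases hy : 0 ≤ y
  · refine le_trans (div_nonpos_of_nonpos_of_nonneg ?_ hn.le) hr
    nlinarith [mul_nonneg (by linarith : 0 ≤ d) hy, mul_nonneg (by linarith : 0 ≤ c) (by nlinarith [sq_nonneg y] : 0 ≤ x ^ 2 - x + y ^ 2)]
  · push Not at hy
    have key := kern_poly (x := x) (z := -y) (w := c * σ) hx (by linarith) hc hc' hd' (by linarith)
      (by nlinarith [mul_nonneg (by linarith : 0 ≤ c) (mul_nonneg (by linarith : 0 ≤ d) (by linarith : 0 ≤ σ - δ))]) (by positivity)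
    have h3 : (c * x + d * (-y) - c * (x ^ 2 + (-y) ^ 2)) * (2 + 1.5 * σ) ≤ 0.99 * σ * (x ^ 2 + y ^ 2) := by
      have : c * ((c * x + d * (-y) - c * (x ^ 2 + (-y) ^ 2)) * (2 + 1.5 * σ)) ≤ c * (0.99 * σ * (x ^ 2 + y ^ 2)) := by
        linarith
      exact le_of_mul_le_mul_left this (by linarith)
    have h4 : σ / (2 + 1.5 * σ) ≤ 1 - 1 / v := by
      have hvs : v ≤ 1 + σ / 2 := by nlinarith [sq_nonneg (v - 1)]
      rw [div_le_iff₀ (by positivity)]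
      have : 1 - 1 / v = (v - 1) / v := by field_simp
      rw [this, div_mul_eq_mul_div, le_div_iff₀ hv]
      have hs : σ = (v - 1) * (v + 1) := by nlinarith
      have : 0 ≤ (v - 1) * (2 + 1.5 * σ - (v + 1) * v) := mul_nonneg (by linarith) (by nlinarith)
      nlinarith
    calc _ ≤ 0.99 * (σ / (2 + 1.5 * σ)) := by
          rw [← mul_div_assoc, div_le_div_iff₀ hn (by positivity)]; exact h3
      _ ≤ _ := by linarith

end PTC

open Complex Filter
namespace PTC
open Topology Set MeasureTheory

theorem sq_parts {z : ℂ} (hz : z ∈ slitPlane) : 0 < (sq z).re ∧ (sq z).re ^ 2 - (sq z).im ^ 2 = z.re ∧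
    2 * (sq z).re * (sq z).im = z.im := by
  have h := sq_sq z
  refine ⟨sq_re_pos hz, ?_, ?_⟩
  · have := congrArg re h; simp only [pow_two, mul_re] at this ⊢; linarith
  · have := congrArg im h; simp only [pow_two, mul_im] at this ⊢; linarith

theorem sq_conj {z : ℂ} (hz : z ∈ slitPlane) : sq (starRingEnd ℂ z) = starRingEnd ℂ (sq z) := by
  apply sq_unique
  · simpa using sq_re_pos hz
  · rw [← map_pow, sq_sq]

theorem rt_m72 : (rt (-72)).re = (rt 72).re ∧ (rt (-72)).im = -(rt 72).im := by
  rw [← rt_conj]; simp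

theorem Qp_re (κ s : ℝ) : (Qf (rt (-72) * κ) (rt 72) s).re = s ^ 3 + (rt 72).re * (κ * s + 1) := by
  have := rt_m72
  simp only [Qf, add_re, mul_re, ofReal_re, ofReal_im, this.1, this.2, mul_im, ← ofReal_pow]; ring

theorem Qp_im (κ s : ℝ) : (Qf (rt (-72) * κ) (rt 72) s).im = (rt 72).im * (1 - κ * s) := by
  have := rt_m72
  simp only [Qf, add_im, mul_re, ofReal_re, ofReal_im, this.1, this.2, mul_im, ← ofReal_pow]; ring

theorem Qp_slit {κ s : ℝ} (hκ : 0 ≤ κ) (hs : 0 < s) : Qf (rt (-72) * κ) (rt 72) s ∈ slitPlane := by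
  left; rw [Qp_re]; have := cs72.1; positivity

theorem Q1_eq (κ s : ℝ) : Qf κ 1 s = ((s ^ 3 + κ * s + 1 : ℝ) : ℂ) := by simp [Qf]

theorem Q1_slit {κ s : ℝ} (hκ : 0 ≤ κ) (hs : 0 < s) : Qf κ 1 s ∈ slitPlane := by
  rw [Q1_eq]; left; rw [ofReal_re]; positivity

theorem Qm_conj (κ s : ℝ) : Qf (rt 72 * κ) (rt (-72)) s = starRingEnd ℂ (Qf (rt (-72) * κ) (rt 72) s) := by
  simp [Qf, rt_conj]

theorem psi_conj {p β : ℂ} {s : ℝ} (h : Qf p β s ∈ slitPlane) :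
    psi (starRingEnd ℂ p) (starRingEnd ℂ β) s = starRingEnd ℂ (psi p β s) := by
  have e : Qf (starRingEnd ℂ p) (starRingEnd ℂ β) s = starRingEnd ℂ (Qf p β s) := by simp [Qf]
  simp only [psi, e, sq_conj h, map_sub, map_add, map_div₀, map_mul, conj_ofReal, map_ofNat]

theorem Ps_conj {p β : ℂ} (h : ∀ s : ℝ, 0 < s → Qf p β s ∈ slitPlane) :
    Ps (starRingEnd ℂ p) (starRingEnd ℂ β) = starRingEnd ℂ (Ps p β) := by
  unfold Ps
  rw [← integral_conj]
  exact setIntegral_congr_fun measurableSet_Ioi (fun s hs => psi_conj (h s hs))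

theorem Ph_conj {κ : ℝ} (hκ : 0 ≤ κ) : PhY κ = starRingEnd ℂ (PhX κ) := by
  have h1 := Ps_conj (fun s hs => Q1_slit hκ hs)
  have h2 := Ps_conj (fun s hs => Qp_slit hκ hs)
  simp only [map_mul, rt_conj, conj_ofReal, map_one, neg_neg] at h1 h2
  simp only [PhX, PhY, map_add, ← h1, ← h2]

theorem int_pos {f : ℝ → ℝ} (hf : IntegrableOn f (Ioi 0)) (h : ∀ s, 0 < s → 0 < f s) :
    0 < ∫ s in Ioi 0, f s := by
  rw [setIntegral_pos_iff_support_of_nonneg_ae ?_ hf]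
  · have : Function.support f ∩ Ioi 0 = Ioi 0 := by
      ext s; simp only [mem_inter_iff, Function.mem_support, mem_Ioi, and_iff_right_iff_imp]
      exact fun hs => (h s hs).ne'
    rw [this]; simp
  · filter_upwards [ae_restrict_mem measurableSet_Ioi] with s hs using (h s hs).le

/-- the integrand of `PhX` -/
noncomputable def gX (κ s : ℝ) : ℂ := psi κ 1 s + psi (rt (-72) * κ) (rt 72) s

theorem gX_int {κ : ℝ} (hκ : 0 ≤ κ) : IntegrableOn (gX κ) (Ioi 0) :=
  (psi_int (fun s hs => Q1_slit hκ hs)).add (psi_int (fun s hs => Qp_slit hκ hs))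

theorem PhX_eq {κ : ℝ} (hκ : 0 ≤ κ) : PhX κ = ∫ s in Ioi 0, gX κ s := by
  unfold PhX Ps gX
  rw [integral_add (psi_int (fun s hs => Q1_slit hκ hs)) (psi_int (fun s hs => Qp_slit hκ hs))]

theorem PhX_re {κ : ℝ} (hκ : 0 ≤ κ) : (PhX κ).re = ∫ s in Ioi 0, (gX κ s).re := by
  rw [PhX_eq hκ]; exact (integral_re (gX_int hκ)).symm

theorem PhX_im {κ : ℝ} (hκ : 0 ≤ κ) : (PhX κ).im = ∫ s in Ioi 0, (gX κ s).im := by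
  rw [PhX_eq hκ]; exact (integral_im (gX_int hκ)).symm

theorem gX_parts (κ s : ℝ) : (gX κ s).re = (sq (Qf κ 1 s)).re + (sq (Qf (rt (-72) * κ) (rt 72) s)).re
      - (2 * (s * √s) + (1 + (rt 72).re) * κ / (2 * √s)) ∧
    (gX κ s).im = (sq (Qf κ 1 s)).im + (sq (Qf (rt (-72) * κ) (rt 72) s)).im + (rt 72).im * κ / (2 * √s) := by
  have e1 : (s * √s + κ / (2 * √s) : ℂ) = ((s * √s + κ / (2 * √s) : ℝ) : ℂ) := by push_cast; rfl
  have e2 : (s * √s + rt (-72) * κ / (2 * √s) : ℂ) = ((s * √s : ℝ) : ℂ) + rt (-72) * ((κ / (2 * √s) : ℝ) : ℂ) := by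
    push_cast; ring
  have := rt_m72
  constructor
  · simp only [gX, psi, e1, e2, add_re, sub_re, ofReal_re, mul_re, ofReal_im, this.1, this.2]; ring
  · simp only [gX, psi, e1, e2, add_im, sub_im, ofReal_im, mul_im, ofReal_re, this.1, this.2]; ring

theorem sq_Q1 {κ s : ℝ} (hκ : 0 ≤ κ) (hs : 0 < s) : sq (Qf κ 1 s) = (√(s ^ 3 + κ * s + 1) : ℝ) := by
  have h : 0 < s ^ 3 + κ * s + 1 := by positivity
  apply sq_unique
  · rw [ofReal_re]; positivity
  · rw [Q1_eq, ← ofReal_pow, Real.sq_sqrt h.le]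

theorem ssq (s : ℝ) (hs : 0 < s) : (s * √s) ^ 2 = s ^ 3 := by
  rw [mul_pow, Real.sq_sqrt hs.le]; ring

theorem T_pos {κ : ℝ} (hκ : 0 ≤ κ) : 0 < (PhX κ).im := by
  rw [PhX_im hκ]
  refine int_pos (gX_int hκ).im (fun s hs => ?_)
  rw [(gX_parts κ s).2, sq_Q1 hκ hs, ofReal_im, zero_add]
  obtain ⟨h1, h2, h3⟩ := sq_parts (Qp_slit hκ hs)
  rw [Qp_re] at h2
  rw [Qp_im] at h3
  set x := (sq (Qf (rt (-72) * κ) (rt 72) s)).re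
  set y := (sq (Qf (rt (-72) * κ) (rt 72) s)).im
  have hc := cs72
  set c := (rt 72).re
  set d := (rt 72).im
  have hq : 0 < √s := Real.sqrt_pos.2 hs
  have hq2 : √s ^ 2 = s := Real.sq_sqrt hs.le
  have hx : s * √s ≤ x := by
    apply le_of_sq_le_sq _ h1.le
    rw [ssq s hs]
    have : 0 < c * (κ * s + 1) := by have := hc.1; positivity
    nlinarith [sq_nonneg y]
  have : y + d * κ / (2 * √s) = (2 * x * y * √s + d * κ * x) / (2 * x * √s) := by field_simp
  rw [this, h3]
  apply div_pos _ (by positivity)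
  have hd : 0 < d := by linarith
  have : d * κ * (s * √s) ≤ d * κ * x := by gcongr
  nlinarith [mul_pos hd hq]

theorem P0_pos : 0 < (PhX (0:ℝ)).re := by
  rw [PhX_re le_rfl]
  refine int_pos (gX_int le_rfl).re (fun s hs => ?_)
  rw [(gX_parts 0 s).1, sq_Q1 le_rfl hs, ofReal_re]
  obtain ⟨h1, h2, h3⟩ := sq_parts (Qp_slit le_rfl hs)
  rw [Qp_re] at h2
  set x := (sq (Qf (rt (-72) * (0:ℝ)) (rt 72) s)).re
  set y := (sq (Qf (rt (-72) * (0:ℝ)) (rt 72) s)).im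
  have hc := cs72
  have hx : s * √s < x := by
    apply lt_of_pow_lt_pow_left₀ 2 h1.le
    rw [ssq s hs]
    nlinarith [sq_nonneg y]
  have hx2 : s * √s < √(s ^ 3 + 0 * s + 1) := by
    apply Real.lt_sqrt_of_sq_lt
    rw [ssq s hs]; linarith
  have : (1 + (rt 72).re) * 0 / (2 * √s) = 0 := by simp
  rw [this]; linarith

end PTC

open Complex Filter
namespace PTC
open Topology Set MeasureTheory

theorem gX_deriv {κ s : ℝ} (hκ : 0 ≤ κ) (hs : 0 < s) :
    HasDerivAt (fun t : ℝ => (gX t s).re)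
      ((s / (2 * sq (Qf κ 1 s)) - 1 / (2 * (√s : ℝ)) + (rt (-72) * s / (2 * sq (Qf (rt (-72) * κ) (rt 72) s)) -
        rt (-72) / (2 * (√s : ℝ))) : ℂ).re) κ := by
  have key : ∀ p β : ℂ, Qf (p * κ) β s ∈ slitPlane → HasDerivAt (fun t : ℂ => psi (p * t) β s)
      (p * s / (2 * sq (Qf (p * κ) β s)) - p / (2 * (√s : ℝ))) (κ : ℂ) := by
    intro p β h
    have h1 : HasDerivAt (fun t : ℂ => Qf (p * t) β s) (p * s) (κ : ℂ) := by
      unfold Qf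
      have := ((((hasDerivAt_id (κ : ℂ)).const_mul p).mul_const (s : ℂ)).const_add ((s : ℂ) ^ 3)).add_const β
      simpa using this
    have h2 := HasDerivAt.comp (h₂ := sq) (κ : ℂ) (sq_hasDerivAt h) h1
    have h3 := (((hasDerivAt_id (κ : ℂ)).const_mul p).div_const (2 * (√s : ℝ) : ℂ)).const_add ((s : ℂ) * (√s : ℝ))
    have h4 := h2.sub h3
    refine h4.congr_deriv ?_
    simp only [mul_one]
    congr 1
    have h5 : sq (Qf (p * κ) β s) ≠ 0 := sq_ne (slitPlane_ne_zero h)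
    have h6 : sq (Qf (p * κ) β s) / (2 * Qf (p * κ) β s) = 1 / (2 * sq (Qf (p * κ) β s)) := by
      nth_rewrite 2 [← sq_sq (Qf (p * κ) β s)]
      field_simp
    rw [h6]; ring
  have a := key 1 1 (by rw [one_mul]; exact Q1_slit hκ hs)
  have b := key (rt (-72)) (rt 72) (Qp_slit hκ hs)
  simp only [one_mul] at a
  exact (a.add b).real_of_complex

theorem gX_deriv_le {κ s : ℝ} (hκ : 0 ≤ κ) (hs : 0 < s) :
    ((s / (2 * sq (Qf κ 1 s)) - 1 / (2 * (√s : ℝ)) + (rt (-72) * s / (2 * sq (Qf (rt (-72) * κ) (rt 72) s)) -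
        rt (-72) / (2 * (√s : ℝ))) : ℂ).re) ≤ if s ≤ 1 then -0.001 else 0 := by
  have hq : 0 < √s := Real.sqrt_pos.2 hs
  have hq2 : √s ^ 2 = s := Real.sq_sqrt hs.le
  obtain ⟨h1, h2, h3⟩ := sq_parts (Qp_slit hκ hs)
  rw [Qp_re] at h2
  rw [Qp_im] at h3
  rw [sq_Q1 hκ hs]
  set u := sq (Qf (rt (-72) * κ) (rt 72) s) with hu
  set V := √(s ^ 3 + κ * s + 1) with hV
  have hV2 : V ^ 2 = s ^ 3 + κ * s + 1 := Real.sq_sqrt (by positivity)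
  have hV0 : 0 < V := Real.sqrt_pos.2 (by positivity)
  have hc := cs72
  have hm := rt_m72
  set c := (rt 72).re
  set d := (rt 72).im
  set ss := s * √s with hss
  have hss0 : 0 < ss := by positivity
  have hss2 : ss ^ 2 = s ^ 3 := ssq s hs
  have K := kern (x := u.re / ss) (y := u.im / ss) (c := c) (d := d) (σ := κ / s ^ 2 + 1 / s ^ 3) (δ := κ / s ^ 2 - 1 / s ^ 3)
    (v := V / ss) (by positivity) hc.1 hc.2.1 hc.2.2.1 hc.2.2.2
    (by rw [div_pow, div_pow, ← sub_div, h2, hss2]; field_simp)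
    (by
      have : 2 * (u.re / ss) * (u.im / ss) = (2 * u.re * u.im) / ss ^ 2 := by field_simp
      rw [this, h3, hss2]; field_simp; ring)
    (by have : 0 < 1 / s ^ 3 := by positivity
        linarith) (by positivity) (by positivity)
    (by rw [div_pow, hV2, hss2]; field_simp; ring)
  have hN : 0 < u.re ^ 2 + u.im ^ 2 := by positivity
  have e : ((s / (2 * (V:ℂ)) - 1 / (2 * (√s : ℝ)) + (rt (-72) * s / (2 * u) -
        rt (-72) / (2 * (√s : ℝ))) : ℂ).re) = (1 / (2 * √s)) * (-(1 - 1 / (V / ss)) +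
      (c * ((u.re / ss) / ((u.re / ss) ^ 2 + (u.im / ss) ^ 2) - 1) - d * ((u.im / ss) / ((u.re / ss) ^ 2 + (u.im / ss) ^ 2)))) := by
    have e1 : (rt (-72) * s / (2 * u)).re = s * (c * u.re - d * u.im) / (2 * (u.re ^ 2 + u.im ^ 2)) := by
      have hu0 : u ≠ 0 := fun h => by rw [h] at h1; simp at h1
      have : rt (-72) * s / (2 * u) = ((s / (2 * (u.re ^ 2 + u.im ^ 2)) : ℝ) : ℂ) * (rt (-72) * starRingEnd ℂ u) := by
        have h5 : ((u.re ^ 2 + u.im ^ 2 : ℝ) : ℂ) = u * starRingEnd ℂ u := by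
          rw [mul_conj, normSq_apply]; congr 1; ring
        have hcu : starRingEnd ℂ u ≠ 0 := by simpa using hu0
        rw [ofReal_div, ofReal_mul, h5]
        push_cast
        field_simp
      rw [this, re_ofReal_mul, mul_re, conj_re, conj_im, hm.1, hm.2]
      field_simp
    have e2 : (rt (-72) / (2 * (√s : ℝ))).re = c / (2 * √s) := by
      have : rt (-72) / (2 * (√s : ℝ)) = ((1 / (2 * √s) : ℝ) : ℂ) * rt (-72) := by push_cast; ring
      rw [this, re_ofReal_mul, hm.1]; ring
    have e3 : (s / (2 * (V:ℂ)) - 1 / (2 * (√s : ℝ)) : ℂ) = ((s / (2 * V) - 1 / (2 * √s) : ℝ) : ℂ) := by push_cast; rfl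
    rw [e3, add_re, sub_re, e1, e2, ofReal_re, div_pow, div_pow, ← add_div, hss2]
    have h7 : ss * √s = s ^ 2 := by rw [hss, mul_assoc, ← pow_two, hq2]; ring
    have h8 : ∀ a : ℝ, (a / ss) / ((u.re ^ 2 + u.im ^ 2) / s ^ 3) = √s * (s * a) / (u.re ^ 2 + u.im ^ 2) := by
      intro a
      rw [div_div_div_eq, div_eq_div_iff (by positivity) (by positivity)]
      have : √s * (s * a) * (ss * (u.re ^ 2 + u.im ^ 2)) = (ss * √s) * (s * a) * (u.re ^ 2 + u.im ^ 2) := by ring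
      rw [this, h7]; ring
    rw [h8, h8, one_div_div, hss]
    field_simp
    ring
  rw [e]
  have hA : 1 - 1 / (V / ss) = 1 - ss / V := by rw [one_div_div]
  have hVs : ss ≤ V := by
    apply le_of_sq_le_sq _ hV0.le
    rw [hss2, hV2]
    have : 0 ≤ κ * s := by positivity
    linarith
  have h9 : 0 ≤ 1 - ss / V := by have := (div_le_one hV0).2 hVs; linarith
  rw [hA] at K ⊢
  split_ifs with h
  · have hV3 : 1.4 * ss ≤ V := by
      apply le_of_sq_le_sq _ hV0.le
      have : 0 ≤ κ * s := by positivity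
      have h10 : s ^ 3 ≤ 1 := pow_le_one₀ hs.le h
      rw [mul_pow, hss2, hV2]
      nlinarith
    have h11 : ss / V ≤ 1 / 1.4 := by rw [div_le_div_iff₀ hV0 (by norm_num)]; linarith
    have h12 : √s ≤ 1 := Real.sqrt_le_one.2 h
    have h13 : 1 / 2 ≤ 1 / (2 * √s) := by
      apply one_div_le_one_div_of_le (by positivity); linarith
    set X := c * ((u.re / ss) / ((u.re / ss) ^ 2 + (u.im / ss) ^ 2) - 1) - d * ((u.im / ss) / ((u.re / ss) ^ 2 + (u.im / ss) ^ 2))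
    have h14 : -(1 - ss / V) + X ≤ -0.002 := by linarith
    nlinarith
  · exact mul_nonpos_of_nonneg_of_nonpos (by positivity) (by linarith)

theorem gX_diff {a b s : ℝ} (ha : 0 ≤ a) (hab : a ≤ b) (hs : 0 < s) :
    (gX b s).re - (gX a s).re ≤ (if s ≤ 1 then -0.001 else 0) * (b - a) := by
  have hd : ∀ x ∈ Icc a b, HasDerivAt (fun t : ℝ => (gX t s).re) _ x := fun x hx => gX_deriv (ha.trans hx.1) hs
  refine Convex.image_sub_le_mul_sub_of_deriv_le (D := Icc a b) (f := fun t : ℝ => (gX t s).re) (convex_Icc a b)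
    (fun x hx => (hd x hx).continuousAt.continuousWithinAt)
    (fun x hx => (hd x (interior_subset hx)).differentiableAt.differentiableWithinAt) ?_ a (left_mem_Icc.2 hab) b
    (right_mem_Icc.2 hab) hab
  intro x hx
  rw [(hd x (interior_subset hx)).deriv]
  exact gX_deriv_le (ha.trans (interior_subset hx).1) hs

theorem P_dec {a b : ℝ} (ha : 0 ≤ a) (hab : a ≤ b) : (PhX b).re - (PhX a).re ≤ -0.001 * (b - a) := by
  have i1 : IntegrableOn (fun s => (gX a s).re) (Ioi 0) := (gX_int ha).re
  have i2 : IntegrableOn (fun s => (gX b s).re) (Ioi 0) := (gX_int (ha.trans hab)).re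
  rw [PhX_re ha, PhX_re (ha.trans hab), ← integral_sub i2 i1]
  have h1 : IntegrableOn (fun s : ℝ => (Ioc (0:ℝ) 1).indicator (fun _ => -0.001 * (b - a)) s) (Ioi 0) := by
    rw [IntegrableOn, integrable_indicator_iff measurableSet_Ioc]
    exact integrableOn_const (by simp [Measure.restrict_apply])
  have h2 : ∫ s in Ioi (0:ℝ), (Ioc (0:ℝ) 1).indicator (fun _ => -0.001 * (b - a)) s = -0.001 * (b - a) := by
    rw [setIntegral_indicator measurableSet_Ioc]
    have : Ioi (0:ℝ) ∩ Ioc 0 1 = Ioc 0 1 := inter_eq_right.2 (fun x hx => hx.1)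
    rw [this, setIntegral_const]; simp
  rw [← h2]
  refine setIntegral_mono_on (i2.sub i1) h1 measurableSet_Ioi (fun s hs => ?_)
  have := gX_diff ha hab hs
  refine this.trans (le_of_eq ?_)
  simp only [indicator, mem_Ioc]
  have hs' : 0 < s := hs
  by_cases h : s ≤ 1 <;> simp [h, hs']

end PTC

open Complex Filter
namespace PTC
open Topology Set MeasureTheory

noncomputable def PP (κ : ℂ) : ℂ := (PhX κ + PhY κ) / 2
noncomputable def TT (κ : ℂ) : ℂ := (PhX κ - PhY κ) / (2 * I)

theorem PP_real {κ : ℝ} (h : 0 ≤ κ) : PP κ = ((PhX κ).re : ℂ) := by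
  rw [PP, Ph_conj h, add_conj]; push_cast; ring

theorem TT_real {κ : ℝ} (h : 0 ≤ κ) : TT κ = ((PhX κ).im : ℂ) := by
  rw [TT, Ph_conj h, sub_conj]; push_cast; field_simp

theorem PT_diff {K : ℝ} (hK : 0 < K) : DifferentiableOn ℂ PP (Rect K) ∧ DifferentiableOn ℂ TT (Rect K) :=
  ⟨((Ph_diff hK).1.add (Ph_diff hK).2).div_const _, ((Ph_diff hK).1.sub (Ph_diff hK).2).div_const _⟩

theorem mem_Rect {K x : ℝ} (h : 0 ≤ x) (hx : x < K) : (x : ℂ) ∈ Rect K := by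
  refine ⟨?_, ?_, ?_⟩ <;> simp <;> linarith

theorem PT_facts : ∃ K κs : ℝ, 0 < κs ∧ κs < K ∧ (∀ x : ℝ, 0 ≤ x → x < κs → 0 < (PhX x).re) ∧ (PhX κs).re = 0 ∧
    deriv PP κs ≠ 0 := by
  set r0 := (PhX (0:ℝ)).re with hr0
  have h0 : 0 < r0 := P0_pos
  set b := 1000 * r0 with hb
  have hb0 : 0 < b := by positivity
  have hK : 0 < b + 1 := by linarith
  have hcont : ContinuousOn (fun x : ℝ => (PhX x).re) (Icc 0 b) := by
    refine continuous_re.comp_continuousOn ((Ph_diff hK).1.continuousOn.comp continuous_ofReal.continuousOn ?_)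
    intro x hx; exact mem_Rect hx.1 (by linarith [hx.2])
  have hbneg : (PhX b).re ≤ 0 := by
    have := P_dec le_rfl hb0.le
    rw [hb] at this ⊢; linarith
  obtain ⟨κs, hκ, hz⟩ := intermediate_value_Icc' hb0.le hcont (show (0:ℝ) ∈ Icc _ _ from ⟨hbneg, h0.le⟩)
  have hz : (PhX κs).re = 0 := hz
  have hκ0 : 0 < κs := by
    rcases hκ.1.lt_or_eq with h | h
    · exact h
    · rw [← h] at hz; exact absurd hz h0.ne'
  refine ⟨b + 1, κs, hκ0, by linarith [hκ.2], fun x hx hx' => ?_, hz, ?_⟩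
  · have := P_dec hx hx'.le
    rw [hz] at this; linarith
  · intro hd
    have hdiff : HasDerivAt PP (deriv PP κs) κs :=
      ((PT_diff hK).1.differentiableAt ((Rect_open _).mem_nhds (mem_Rect hκ0.le (by linarith [hκ.2])))).hasDerivAt
    rw [hd] at hdiff
    have h1 : HasDerivAt (fun x : ℝ => (PP x).re) (0:ℂ).re κs := hdiff.real_of_complex
    have h2 := (hasDerivWithinAt_iff_tendsto_slope' (s := Ioi κs) (by simp)).1 h1.hasDerivWithinAt
    have h3 : ∀ᶠ x in 𝓝[>] κs, slope (fun x : ℝ => (PP x).re) κs x ≤ -0.001 := by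
      filter_upwards [self_mem_nhdsWithin] with x hx
      have hx : κs < x := hx
      rw [slope_def_field, PP_real hκ.1, PP_real (hκ.1.trans hx.le), ofReal_re, ofReal_re, div_le_iff₀ (by linarith)]
      exact P_dec hκ.1 hx.le
    have h4 := le_of_tendsto h2 h3
    norm_num at h4

/-- sector in the phase variable -/
def Wd (R : ℝ) : Set ℂ := {w | 0 < w.re ∧ |w.im| < 1.2 * w.re ∧ R < ‖w‖}

theorem Wd_open (C : ℝ) : IsOpen (Wd C) :=
  (isOpen_lt continuous_const continuous_re).inter ((isOpen_lt (continuous_abs.comp continuous_im) (by fun_prop)).inter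
    (isOpen_lt continuous_const continuous_norm))

noncomputable def GG (x : ℂ × ℂ) : ℂ × ℂ := (-(x.1 * nn (x.2 / TT x.1) ^ 8), nn (x.2 / TT x.1) ^ 12)

theorem sec_div {w t : ℂ} {B C : ℝ} (hw : w ∈ Wd (C * B)) (ht : |t.im| < 0.01 * t.re) (htB : ‖t‖ < B)
    (hC : 0 ≤ C) : w / t ∈ Sec C := by
  obtain ⟨h1, h2, h3⟩ := hw
  have ht0 : 0 < t.re := by have := abs_nonneg t.im; linarith
  have htn : t ≠ 0 := fun h => by rw [h] at ht0; simp at ht0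
  have hN : 0 < normSq t := normSq_pos.2 htn
  have e1 : (w / t).re = (w.re * t.re + w.im * t.im) / normSq t := by rw [div_re]; ring
  have e2 : (w / t).im = (w.im * t.re - w.re * t.im) / normSq t := by rw [div_im]; ring
  rw [abs_lt] at h2 ht
  have a1 : |w.im * t.im| ≤ 0.012 * (w.re * t.re) := by
    rw [abs_mul]
    calc |w.im| * |t.im| ≤ (1.2 * w.re) * (0.01 * t.re) :=
          mul_le_mul (abs_le.2 ⟨by linarith, by linarith⟩) (abs_le.2 ⟨by linarith, by linarith⟩) (abs_nonneg _) (by positivity)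
      _ = _ := by ring
  have a2 : |w.im * t.re| ≤ 1.2 * (w.re * t.re) := by
    rw [abs_mul, abs_of_pos ht0]
    have : |w.im| ≤ 1.2 * w.re := abs_le.2 ⟨by linarith, by linarith⟩
    nlinarith
  have a3 : |w.re * t.im| ≤ 0.01 * (w.re * t.re) := by
    rw [abs_mul, abs_of_pos h1]
    have : |t.im| ≤ 0.01 * t.re := abs_le.2 ⟨by linarith, by linarith⟩
    nlinarith
  have hp : 0 < w.re * t.re := mul_pos h1 ht0
  rw [abs_le] at a1 a2 a3
  refine ⟨?_, ?_, ?_⟩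
  · rw [e1]; apply div_pos _ hN; linarith
  · rw [e1, e2, abs_div, abs_of_pos hN, ← mul_div_assoc]
    apply (div_lt_div_iff_of_pos_right hN).2
    rw [abs_lt]; constructor <;> linarith
  · rw [norm_div, lt_div_iff₀ (norm_pos_iff.2 htn)]
    nlinarith [norm_nonneg t]

theorem sec_mul {ν t : ℂ} {b R : ℝ} (hb : 0 < b) (h1 : 0 < ν.re) (h2 : |ν.im| ≤ 1.04 * ν.re) (hR : R / b < ‖ν‖) (ht : |t.im| < 0.01 * t.re)
    (htb : b < t.re) : ν * t ∈ Wd R := by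
  have ht0 : 0 < t.re := by linarith
  have a1 : |ν.im * t.im| ≤ 0.0104 * (ν.re * t.re) := by
    rw [abs_mul]
    calc |ν.im| * |t.im| ≤ (1.04 * ν.re) * (0.01 * t.re) := mul_le_mul h2 ht.le (abs_nonneg _) (by positivity)
      _ = _ := by ring
  have a2 : |ν.im * t.re| ≤ 1.04 * (ν.re * t.re) := by
    rw [abs_mul, abs_of_pos ht0]; nlinarith
  have a3 : |ν.re * t.im| ≤ 0.01 * (ν.re * t.re) := by
    rw [abs_mul, abs_of_pos h1]; nlinarith
  have hp : 0 < ν.re * t.re := mul_pos h1 ht0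
  rw [abs_le] at a1 a2 a3
  refine ⟨?_, ?_, ?_⟩
  · rw [mul_re]; linarith
  · rw [mul_im, mul_re, abs_lt]; constructor <;> linarith
  · rw [norm_mul]
    rw [div_lt_iff₀ hb] at hR
    have := re_le_norm t
    nlinarith [norm_nonneg ν]

/-- the data describing the asymptotic zero equation -/
structure LD where
  Ω : Set ℂ
  Ωo : IsOpen Ω
  ks : ℝ
  p : ℂ → ℂ
  e1 : ℂ × ℂ → ℂ
  e2 : ℂ × ℂ → ℂ
  R : ℝ
  C : ℝ
  hC : 0 < C
  hks : 0 < ks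
  mem : ∀ x : ℝ, 0 ≤ x → x ≤ ks → (x : ℂ) ∈ Ω
  pd : DifferentiableOn ℂ p Ω
  pim : ∀ x : ℝ, 0 ≤ x → x ≤ ks → (p x).im = 0
  pre : ∀ x : ℝ, 0 ≤ x → x < ks → 0 < (p x).re
  pz : p ks = 0
  pd0 : deriv p ks ≠ 0
  h1 : HolOn (Ω ×ˢ Wd R) e1
  h2 : HolOn (Ω ×ˢ Wd R) e2
  b1 : ∀ x ∈ Ω ×ˢ Wd R, ‖e1 x‖ ≤ C / ‖x.2‖
  b2 : ∀ x ∈ Ω ×ˢ Wd R, ‖e2 x‖ ≤ C / ‖x.2‖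

def LD.Eq (L : LD) (x : ℂ × ℂ) : Prop :=
  1 + 2 * Complex.exp (x.2 * L.p x.1 + L.e2 x) * Complex.cos (x.2 + L.e1 x) = 0

theorem LD_exists : ∃ L : LD, ContinuousOn GG (L.Ω ×ˢ Wd L.R) ∧ (∀ x ∈ L.Ω ×ˢ Wd L.R, FF (GG x).1 (GG x).2 = 0 ↔ L.Eq x) ∧
    ∃ b, 0 < b ∧ ∀ κ ∈ L.Ω, |(TT κ).im| < 0.01 * (TT κ).re ∧ b < (TT κ).re := by
  obtain ⟨K, κs, hκ0, hκK, hpos, hz, hd⟩ := PT_facts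
  have hK : 0 < K := hκ0.trans hκK
  obtain ⟨C, eu, ev, hC, hu, hv, H⟩ := wkb_main K hK
  obtain ⟨hPd, hTd⟩ := PT_diff hK
  have hcont : ContinuousOn (fun x : ℝ => (PhX x).im) (Icc 0 κs) := by
    refine continuous_im.comp_continuousOn ((Ph_diff hK).1.continuousOn.comp continuous_ofReal.continuousOn ?_)
    intro x hx; exact mem_Rect hx.1 (by linarith [hx.2])
  obtain ⟨x0, hx0, hmin⟩ := isCompact_Icc.exists_isMinOn (nonempty_Icc.2 hκ0.le) hcont
  obtain ⟨x1, hx1, hmax⟩ := isCompact_Icc.exists_isMaxOn (nonempty_Icc.2 hκ0.le) hcont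
  set b := (PhX x0).im / 2 with hb
  have hb0 : 0 < b := half_pos (T_pos hx0.1)
  set B := (PhX x1).im + 1 with hB
  have hB0 : 0 < B := by have := T_pos hx1.1; linarith
  set Ω : Set ℂ := Rect K ∩ TT ⁻¹' {t | |t.im| < 0.01 * t.re ∧ b < t.re ∧ ‖t‖ < B} with hΩ
  have hΩo : IsOpen Ω := hTd.continuousOn.isOpen_inter_preimage (Rect_open K)
    ((isOpen_lt (continuous_abs.comp continuous_im) (by fun_prop)).inter
      ((isOpen_lt continuous_const continuous_re).inter (isOpen_lt continuous_norm continuous_const)))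
  have hmem : ∀ x : ℝ, 0 ≤ x → x ≤ κs → (x : ℂ) ∈ Ω := by
    intro x hx hx'
    have h1 := hmin (show x ∈ Icc 0 κs from ⟨hx, hx'⟩)
    have h2 := hmax (show x ∈ Icc 0 κs from ⟨hx, hx'⟩)
    have h1 : (PhX x0).im ≤ (PhX x).im := h1
    have h2 : (PhX x).im ≤ (PhX x1).im := h2
    have h3 := T_pos hx
    refine ⟨mem_Rect hx (by linarith), ?_⟩
    show |(TT x).im| < 0.01 * (TT x).re ∧ b < (TT x).re ∧ ‖TT x‖ < B
    rw [TT_real hx, ofReal_im, ofReal_re, norm_real, Real.norm_of_nonneg h3.le, abs_zero]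
    have := T_pos hx0.1
    exact ⟨by positivity, by linarith, by linarith⟩
  have hT0 : ∀ κ ∈ Ω, TT κ ≠ 0 := fun κ hκ h => by
    have := hκ.2.2.1; rw [h] at this; simp at this; linarith
  have hsub : Ω ⊆ Rect K := inter_subset_left
  have hTc : ContinuousOn TT Ω := (hTd.mono hsub).continuousOn
  have hφ : DifferentiableOn ℂ (fun x : ℂ × ℂ => (x.1, x.2 / TT x.1)) (Ω ×ˢ Wd (C * B)) := by
    have q : DifferentiableOn ℂ (fun x : ℂ × ℂ => TT x.1) (Ω ×ˢ Wd (C * B)) :=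
      (hTd.mono hsub).comp (f := fun x : ℂ × ℂ => x.1) differentiableOn_fst fun x hx => hx.1
    have q2 : DifferentiableOn ℂ (fun x : ℂ × ℂ => x.2) (Ω ×ˢ Wd (C * B)) := differentiableOn_snd
    have q3 : DifferentiableOn ℂ (fun x : ℂ × ℂ => x.2 / TT x.1) (Ω ×ˢ Wd (C * B)) := 
      by
      refine (q2.mul (q.inv fun x hx => hT0 _ hx.1)).congr fun x _ => ?_
      simp [div_eq_mul_inv]
    exact differentiableOn_fst.prodMk q3
  have hm : MapsTo (fun x : ℂ × ℂ => (x.1, x.2 / TT x.1)) (Ω ×ˢ Wd (C * B)) (Rect K ×ˢ Sec C) :=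
    fun x hx => ⟨hsub hx.1, sec_div hx.2 hx.1.2.1 hx.1.2.2.2 hC.le⟩
  have hu' := hu.comp_diff hφ hm
  have hv' := hv.comp_diff hφ hm
  have hbd : ∀ x ∈ Ω ×ˢ Wd (C * B), C / ‖x.2 / TT x.1‖ ≤ (C * B) / ‖x.2‖ := by
    intro x hx
    rw [norm_div, div_div_eq_mul_div]
    gcongr
    exact hx.1.2.2.2.le
  refine ⟨⟨Ω, hΩo, κs, fun κ => PP κ / TT κ, fun x => (eu (x.1, x.2 / TT x.1) - ev (x.1, x.2 / TT x.1)) * (1 / (2 * I)),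
    fun x => (eu (x.1, x.2 / TT x.1) + ev (x.1, x.2 / TT x.1)) * (1 / 2), C * B, C * B, mul_pos hC hB0, hκ0, hmem,
    (hPd.mono hsub).div (hTd.mono hsub) hT0, ?_, ?_, ?_, ?_, (hu'.sub hv').mul (HolOn.const _), (hu'.add hv').mul (HolOn.const _),
    ?_, ?_⟩, ?_, ?_, b, hb0, fun κ hκ => ⟨hκ.2.1, hκ.2.2.1⟩⟩
  · intro x hx _
    simp only [PP_real hx, TT_real hx, ← ofReal_div, ofReal_im]
  · intro x hx hx'
    simp only [PP_real hx, TT_real hx, ← ofReal_div, ofReal_re]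
    exact div_pos (hpos x hx hx') (T_pos hx)
  · simp only [PP_real hκ0.le, hz, ofReal_zero, zero_div]
  · have hn := (Rect_open K).mem_nhds (mem_Rect hκ0.le hκK)
    have h1 := (hPd.differentiableAt hn).hasDerivAt.div (hTd.differentiableAt hn).hasDerivAt (hT0 _ (hmem _ hκ0.le le_rfl))
    have h2 : deriv (fun κ => PP κ / TT κ) κs = _ := h1.deriv
    rw [h2, PP_real hκ0.le, hz]
    have := hT0 _ (hmem _ hκ0.le le_rfl)
    simp [hd, this]
  · intro x hx
    have h := H _ (hm hx)
    have h3 := hbd x hx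
    have h4 := norm_sub_le (eu (x.1, x.2 / TT x.1)) (ev (x.1, x.2 / TT x.1))
    have h5 : ‖(1 / (2 * I) : ℂ)‖ = 1 / 2 := by simp
    rw [norm_mul, h5]
    have := h.1; have := h.2.1; dsimp only at *; linarith
  · intro x hx
    have h := H _ (hm hx)
    have h3 := hbd x hx
    have h4 := norm_add_le (eu (x.1, x.2 / TT x.1)) (ev (x.1, x.2 / TT x.1))
    have h5 : ‖(1 / 2 : ℂ)‖ = 1 / 2 := by simp
    rw [norm_mul, h5]
    have := h.1; have := h.2.1; dsimp only at *; linarith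
  · have h1 : ContinuousOn (fun x : ℂ × ℂ => nn (x.2 / TT x.1)) (Ω ×ˢ Wd (C * B)) := by
      intro x hx
      exact (nn_diff (hm hx).2.1).continuousAt.comp_continuousWithinAt (f := fun x : ℂ × ℂ => x.2 / TT x.1)
        (hφ.continuousOn.snd x hx)
    exact ((continuousOn_fst.mul (h1.pow 8)).neg).prodMk (h1.pow 12)
  · intro x hx
    have h := (H _ (hm hx)).2.2
    dsimp only at h
    rw [GG, h, LD.Eq]
    dsimp only
    have ht := hT0 _ hx.1
    set u := eu (x.1, x.2 / TT x.1)
    set v := ev (x.1, x.2 / TT x.1)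
    have e1 : PhX x.1 = PP x.1 + I * TT x.1 := by rw [PP, TT]; field_simp; ring
    have e2 : PhY x.1 = PP x.1 - I * TT x.1 := by rw [PP, TT]; field_simp; ring
    have e3 : x.2 / TT x.1 * PhX x.1 + u = (x.2 * (PP x.1 / TT x.1) + (u + v) * (1 / 2)) + (x.2 + (u - v) * (1 / (2 * I))) * I := by
      rw [e1]; field_simp; ring
    have e4 : x.2 / TT x.1 * PhY x.1 + v = (x.2 * (PP x.1 / TT x.1) + (u + v) * (1 / 2)) + -(x.2 + (u - v) * (1 / (2 * I))) * I := by
      rw [e2]; field_simp; ring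
    set A := x.2 * (PP x.1 / TT x.1) + (u + v) * (1 / 2)
    rw [e3, e4, Complex.exp_add A, Complex.exp_add A, Complex.cos]
    have : ∀ a b c : ℂ, 1 + a * b + a * c = 1 + 2 * a * ((b + c) / 2) := by intros; ring
    rw [this]

end PTC

open Complex Filter
namespace PTC
open Topology Set MeasureTheory

theorem contr {X : Type*} [TopologicalSpace X] {D : Set X} {c : ℂ} {ρ : ℝ} (hρ : 0 ≤ ρ) {f : X → ℂ → ℂ}
    (hm : ∀ x ∈ D, ∀ u ∈ Metric.closedBall c ρ, f x u ∈ Metric.closedBall c ρ)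
    (hl : ∀ x ∈ D, ∀ u ∈ Metric.closedBall c ρ, ∀ v ∈ Metric.closedBall c ρ, ‖f x u - f x v‖ ≤ 1 / 2 * ‖u - v‖)
    (hc : ∀ u ∈ Metric.closedBall c ρ, ContinuousOn (fun x => f x u) D) :
    ∃ φ : X → ℂ, ContinuousOn φ D ∧ ∀ x ∈ D, φ x ∈ Metric.closedBall c ρ ∧ f x (φ x) = φ x ∧
      ∀ u ∈ Metric.closedBall c ρ, f x u = u → u = φ x := by
  have hex : ∀ x ∈ D, ∃ u ∈ Metric.closedBall c ρ, f x u = u := by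
    intro x hx
    have hcomp : IsComplete (Metric.closedBall c ρ) := Metric.isClosed_closedBall.isComplete
    have hmt : MapsTo (f x) (Metric.closedBall c ρ) (Metric.closedBall c ρ) := hm x hx
    have hk : ContractingWith (1 / 2 : NNReal) (hmt.restrict _ _ _) := by
      refine ⟨by norm_num [← NNReal.coe_lt_coe], LipschitzWith.of_dist_le_mul fun u v => ?_⟩
      rw [Subtype.dist_eq, Subtype.dist_eq, dist_eq_norm, dist_eq_norm]
      simpa using hl x hx u u.2 v v.2
    obtain ⟨u, hu, hfu, -⟩ := hk.exists_fixedPoint' hcomp hmt (x := c) (Metric.mem_closedBall_self hρ) (edist_ne_top _ _)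
    exact ⟨u, hu, hfu⟩
  choose! φ h1 h2 using hex
  have huniq : ∀ x ∈ D, ∀ u ∈ Metric.closedBall c ρ, f x u = u → u = φ x := by
    intro x hx u hu hfu
    have := hl x hx u hu (φ x) (h1 x hx)
    rw [hfu, h2 x hx] at this
    have h0 : ‖u - φ x‖ = 0 := by have := norm_nonneg (u - φ x); linarith
    exact sub_eq_zero.1 (norm_eq_zero.1 h0)
  refine ⟨φ, fun x0 hx0 => ?_, fun x hx => ⟨h1 x hx, h2 x hx, huniq x hx⟩⟩
  have hb : ∀ x ∈ D, ‖φ x - φ x0‖ ≤ 2 * ‖f x (φ x0) - f x0 (φ x0)‖ := by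
    intro x hx
    have a1 := hl x hx (φ x) (h1 x hx) (φ x0) (h1 x0 hx0)
    have a2 : φ x - φ x0 = (f x (φ x) - f x (φ x0)) + (f x (φ x0) - f x0 (φ x0)) := by
      rw [h2 x hx, h2 x0 hx0]; ring
    have a3 := norm_add_le (f x (φ x) - f x (φ x0)) (f x (φ x0) - f x0 (φ x0))
    rw [← a2] at a3
    linarith
  rw [ContinuousWithinAt, tendsto_iff_norm_sub_tendsto_zero]
  have h3 := hc (φ x0) (h1 x0 hx0) x0 hx0
  rw [ContinuousWithinAt, tendsto_iff_norm_sub_tendsto_zero] at h3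
  have h4 := h3.const_mul 2
  rw [mul_zero] at h4
  exact squeeze_zero' (Eventually.of_forall fun x => norm_nonneg _) (by
    filter_upwards [self_mem_nhdsWithin] with x hx using hb x hx) h4

/-- half-integer multiples of pi -/
noncomputable def NN (n : ℕ) : ℝ := Real.pi * (n + 1 / 2)

theorem cos_NN (n : ℕ) (t : ℂ) : Complex.cos (NN n + t) = -((-1) ^ n * Complex.sin t) := by
  induction n with
  | zero =>
    have : (NN 0 + t : ℂ) = t + Real.pi / 2 := by rw [NN]; push_cast; ring
    rw [this, Complex.cos_add_pi_div_two]; ring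
  | succ n ih =>
    have : (NN (n + 1) + t : ℂ) = (NN n + t) + Real.pi := by rw [NN, NN]; push_cast; ring
    rw [this, Complex.cos_add_pi, ih]; ring

theorem NN_ge (n : ℕ) : (n : ℝ) ≤ NN n := by
  have := Real.pi_gt_three
  have h : (0:ℝ) ≤ n := Nat.cast_nonneg n
  rw [NN]; nlinarith

theorem NN_succ (n : ℕ) : NN (n + 1) = NN n + Real.pi := by rw [NN, NN]; push_cast; ring

theorem Wd_ball {R N : ℝ} (hN : R + 20 ≤ N) (hN' : 20 ≤ N) {w : ℂ} (hw : w ∈ Metric.closedBall (N:ℂ) 4) : w ∈ Wd R ∧ N / 2 ≤ ‖w‖ := by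
  rw [Metric.mem_closedBall, dist_eq_norm] at hw
  have h1 := abs_re_le_norm (w - N)
  have h2 := abs_im_le_norm (w - N)
  simp only [sub_re, sub_im, ofReal_re, ofReal_im, sub_zero] at h1 h2
  have h3 := re_le_norm w
  rw [abs_le] at h1 h2
  refine ⟨⟨?_, ?_, ?_⟩, ?_⟩
  · linarith
  · rw [abs_lt]; constructor <;> linarith
  · linarith
  · linarith

/-- uniform smallness of error terms and their derivative -/
theorem err_small {Ω : Set ℂ} {R C : ℝ} {e : ℂ × ℂ → ℂ} (hC : 0 < C) (he : HolOn (Ω ×ˢ Wd R) e)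
    (hb : ∀ x ∈ Ω ×ˢ Wd R, ‖e x‖ ≤ C / ‖x.2‖) {η : ℝ} (hη : 0 < η) : ∃ M, ∀ N : ℝ, M ≤ N → ∀ κ ∈ Ω,
    (∀ w ∈ Metric.closedBall (N : ℂ) 4, w ∈ Wd R) ∧ (∀ w ∈ Metric.closedBall (N : ℂ) 4, ‖e (κ, w)‖ ≤ η) ∧
    ∀ w ∈ Metric.closedBall (N : ℂ) 1, DifferentiableAt ℂ (fun w => e (κ, w)) w ∧ ‖deriv (fun w => e (κ, w)) w‖ ≤ η := by
  refine ⟨|R| + 20 + 2 * C / η, fun N hN κ hκ => ?_⟩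
  have hp : 0 < 2 * C / η := by positivity
  have hN1 : R + 20 ≤ N := by have := le_abs_self R; linarith
  have hN2 : 20 ≤ N := by have := abs_nonneg R; linarith
  have hN3 : 2 * C / η ≤ N := by have := abs_nonneg R; linarith
  have hw := fun w (h : w ∈ Metric.closedBall (N : ℂ) 4) => Wd_ball hN1 hN2 h
  have hs : ∀ w ∈ Metric.closedBall (N : ℂ) 4, ‖e (κ, w)‖ ≤ η := by
    intro w h
    refine (hb (κ, w) ⟨hκ, (hw w h).1⟩).trans ?_
    have h2 := (hw w h).2
    rw [div_le_iff₀ (by linarith)]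
    rw [div_le_iff₀ hη] at hN3
    simp only
    nlinarith
  have hd : DifferentiableOn ℂ (fun w => e (κ, w)) (Wd R) :=
    he.2 (Wd R) (fun w => (κ, w)) (Wd_open R) ((differentiable_const κ).prodMk differentiable_id).differentiableOn
      fun w h => ⟨hκ, h⟩
  refine ⟨fun w h => (hw w h).1, hs, fun w h => ?_⟩
  have hsub : Metric.closedBall w 1 ⊆ Metric.closedBall (N : ℂ) 4 := by
    apply Metric.closedBall_subset_closedBall'
    rw [Metric.mem_closedBall] at h; linarith
  have h4 := (hw w (hsub (Metric.mem_closedBall_self (by norm_num)))).1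
  refine ⟨hd.differentiableAt ((Wd_open R).mem_nhds h4), ?_⟩
  have := Complex.norm_deriv_le_of_forall_mem_sphere_norm_le (f := fun w => e (κ, w)) (c := w) (R := 1) (C := η) one_pos
    (DifferentiableOn.diffContOnCl (by
      rw [closure_ball _ one_ne_zero]
      exact hd.mono fun z hz => (hw z (hsub hz)).1)) (fun z hz => hs z (hsub (Metric.sphere_subset_closedBall hz)))
  simpa using this

theorem sin_near {t : ℂ} (h : ‖t‖ ≤ 0.31) : ‖t - Complex.sin t‖ ≤ 0.01 ∧ ‖1 - Complex.cos t‖ ≤ 0.06 ∧ ‖Complex.cos t‖ ≤ 1.06 := by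
  have h1 := Complex.sin_bound (x := t) (by linarith)
  have h2 := Complex.cos_bound (x := t) (by linarith)
  have h3 : ‖t‖ ^ 2 ≤ 0.31 ^ 2 := by gcongr
  have h4 : ‖t‖ ^ 3 ≤ 0.31 ^ 3 := by gcongr
  have h5 : ‖t‖ ^ 4 ≤ 0.31 ^ 4 := by gcongr
  have h6 : ‖t‖ ^ 5 ≤ 0.31 ^ 5 := by gcongr
  have hs : ‖t - Complex.sin t‖ ≤ 0.01 := by
    have : t - Complex.sin t = t ^ 3 / 6 - (Complex.sin t - (t - t ^ 3 / 6)) := by ring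
    rw [this]
    refine (norm_sub_le _ _).trans ?_
    rw [norm_div, norm_pow]
    simp only [RCLike.norm_ofNat]
    linarith
  have hc : ‖1 - Complex.cos t‖ ≤ 0.06 := by
    have : 1 - Complex.cos t = t ^ 2 / 2 - (Complex.cos t - (1 - t ^ 2 / 2)) := by ring
    rw [this]
    refine (norm_sub_le _ _).trans ?_
    rw [norm_div, norm_pow]
    simp only [RCLike.norm_ofNat]
    linarith
  refine ⟨hs, hc, ?_⟩
  have : Complex.cos t = 1 - (1 - Complex.cos t) := by ring
  rw [this]
  refine (norm_sub_le _ _).trans ?_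
  rw [norm_one]; linarith

end PTC

open Complex Filter
namespace PTC
open Topology Set MeasureTheory

/-- the leaf domain -/
def LD.D (L : LD) (n : ℕ) : Set ℂ := {κ | κ ∈ L.Ω ∧ |(L.p κ).im| ≤ 5 * (L.p κ).re ∧ 1.2 ≤ NN n * (L.p κ).re}

theorem exp_small {N : ℝ} (hN : 100 ≤ N) {p w e : ℂ} (hp : |p.im| ≤ 5 * p.re) (hp2 : 1.2 ≤ N * p.re)
    (hw : w ∈ Metric.closedBall (N:ℂ) 0.3) (he : ‖e‖ ≤ 0.01) :
    ‖Complex.exp (-(w * p + e))‖ ≤ 0.35 ∧ ‖p‖ * ‖Complex.exp (-(w * p + e))‖ ≤ 0.1 := by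
  have hx : 0 < p.re := by by_contra h; push Not at h; nlinarith
  have hn : ‖p‖ ≤ 6 * p.re := by
    have := norm_le_abs_re_add_abs_im p
    rw [abs_of_pos hx] at this; linarith
  have hr : (N - 1.8) * p.re - 0.01 ≤ (w * p + e).re := by
    have h1 : w * p + e = N * p + ((w - N) * p + e) := by ring
    rw [h1, add_re, re_ofReal_mul]
    have h2 : ‖(w - N) * p + e‖ ≤ 0.3 * (6 * p.re) + 0.01 := by
      refine (norm_add_le _ _).trans (add_le_add ?_ he)
      rw [norm_mul]
      rw [Metric.mem_closedBall, dist_eq_norm] at hw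
      exact mul_le_mul hw hn (norm_nonneg _) (by norm_num)
    have h3 := abs_re_le_norm ((w - N) * p + e)
    rw [abs_le] at h3
    linarith
  have hE : ‖Complex.exp (-(w * p + e))‖ ≤ Real.exp (-((N - 1.8) * p.re - 0.01)) := by
    rw [norm_exp, Real.exp_le_exp, neg_re]; linarith
  constructor
  · refine hE.trans ?_
    have h1 : 1.1 ≤ (N - 1.8) * p.re - 0.01 := by nlinarith
    have h2 : Real.exp (-((N - 1.8) * p.re - 0.01)) ≤ Real.exp (-1.1) := Real.exp_le_exp.2 (by linarith)
    refine h2.trans ?_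
    rw [Real.exp_neg]
    have h3 : Real.exp 1 ≥ 2.7 := by have := Real.exp_one_gt_d9; linarith
    have h4 : Real.exp 0.1 ≥ 1.1 := by have := Real.add_one_le_exp 0.1; linarith
    have h5 : Real.exp 1.1 = Real.exp 1 * Real.exp 0.1 := by rw [← Real.exp_add]; norm_num
    have h6 : 2.9 ≤ Real.exp 1.1 := by rw [h5]; nlinarith
    calc (Real.exp 1.1)⁻¹ ≤ (2.9)⁻¹ := inv_anti₀ (by norm_num) h6
      _ ≤ _ := by norm_num
  · have hy : ∀ y : ℝ, 0 ≤ y → y * Real.exp (-y) ≤ 1 := by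
      intro y hy
      rw [Real.exp_neg, ← div_eq_mul_inv, div_le_one (Real.exp_pos _)]
      have := Real.add_one_le_exp y; linarith
    set y := (N - 1.8) * p.re with hyd
    have hy0 : 0 ≤ y := mul_nonneg (by linarith) hx.le
    have h1 := hy y hy0
    have h2 : Real.exp (-(y - 0.01)) = Real.exp (-y) * Real.exp 0.01 := by rw [← Real.exp_add]; congr 1; ring
    have h3 : Real.exp 0.01 ≤ 1.1 := by
      have := Real.exp_bound_div_one_sub_of_interval' (x := 0.01) (by norm_num) (by norm_num)
      norm_num at this ⊢; linarith
    rw [h2] at hE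
    have h4 : ‖Complex.exp (-(w * p + e))‖ ≤ Real.exp (-y) * 1.1 := hE.trans (by gcongr)
    have h5 : 98 * p.re ≤ y := by rw [hyd]; nlinarith
    calc ‖p‖ * ‖Complex.exp (-(w * p + e))‖ ≤ (6 * p.re) * (Real.exp (-y) * 1.1) := by gcongr
      _ ≤ 0.1 := by nlinarith [Real.exp_pos (-y)]

theorem eq_iff_fix (n : ℕ) (s t : ℂ) : 1 + 2 * Complex.exp s * Complex.cos (NN n + t) = 0 ↔
    Complex.sin t = (-1) ^ n * (Complex.exp (-s) / 2) := by
  rw [cos_NN, Complex.exp_neg]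
  have h0 := Complex.exp_ne_zero s
  have h1 : ((-1 : ℂ) ^ n) * (-1) ^ n = 1 := by rw [← mul_pow]; simp
  constructor
  · intro h
    have h2 : 2 * Complex.exp s * ((-1) ^ n * Complex.sin t) = 1 := by linear_combination -h
    field_simp
    linear_combination (-1) ^ n * h2 - 2 * Complex.exp s * Complex.sin t * h1
  · intro h
    rw [h]
    field_simp
    linear_combination -h1

theorem leaf (L : LD) : ∃ n0 : ℕ, ∀ n, n0 ≤ n → ∃ φ : ℂ → ℂ, ContinuousOn φ (L.D n) ∧
    (∀ w ∈ Metric.closedBall (NN n : ℂ) 4, w ∈ Wd L.R) ∧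
    ∀ κ ∈ L.D n, φ κ ∈ Metric.closedBall (NN n : ℂ) 0.3 ∧ L.Eq (κ, φ κ) ∧
      ∀ w ∈ Metric.closedBall (NN n : ℂ) 0.3, L.Eq (κ, w) → w = φ κ := by
  obtain ⟨M1, hM1⟩ := err_small L.hC L.h1 L.b1 (η := 0.01) (by norm_num)
  obtain ⟨M2, hM2⟩ := err_small L.hC L.h2 L.b2 (η := 0.01) (by norm_num)
  obtain ⟨n0, hn0⟩ := exists_nat_ge (max (max M1 M2) 100)
  refine ⟨n0, fun n hn => ?_⟩
  have hN : max (max M1 M2) 100 ≤ NN n := hn0.trans ((Nat.cast_le.2 hn).trans (NN_ge n))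
  set N := NN n with hNd
  have hN1 : M1 ≤ N := (le_max_left _ _).trans ((le_max_left _ _).trans hN)
  have hN2 : M2 ≤ N := (le_max_right _ _).trans ((le_max_left _ _).trans hN)
  have hN3 : 100 ≤ N := (le_max_right _ _).trans hN
  have hb : Metric.closedBall (N:ℂ) 0.3 ⊆ Metric.closedBall (N:ℂ) 1 := Metric.closedBall_subset_closedBall (by norm_num)
  have hb4 : Metric.closedBall (N:ℂ) 0.3 ⊆ Metric.closedBall (N:ℂ) 4 := Metric.closedBall_subset_closedBall (by norm_num)
  have hWd := (hM1 N hN1 _ (L.mem 0 le_rfl L.hks.le)).1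
  set f : ℂ → ℂ → ℂ := fun κ w => w - Complex.sin (w - N + L.e1 (κ, w)) +
    (-1) ^ n * (Complex.exp (-(w * L.p κ + L.e2 (κ, w))) / 2) with hf
  have hnorm : ‖((-1 : ℂ) ^ n)‖ = 1 := by simp
  have ht : ∀ κ ∈ L.D n, ∀ w ∈ Metric.closedBall (N:ℂ) 0.3, ‖w - N + L.e1 (κ, w)‖ ≤ 0.31 := by
    intro κ hκ w hw
    have h1 := (hM1 N hN1 κ hκ.1).2.1 w (hb4 hw)
    rw [Metric.mem_closedBall, dist_eq_norm] at hw
    exact (norm_add_le _ _).trans (by linarith)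
  have hmaps : ∀ κ ∈ L.D n, ∀ w ∈ Metric.closedBall (N:ℂ) 0.3, f κ w ∈ Metric.closedBall (N:ℂ) 0.3 := by
    intro κ hκ w hw
    have h1 := (hM1 N hN1 κ hκ.1).2.1 w (hb4 hw)
    have h2 := (hM2 N hN2 κ hκ.1).2.1 w (hb4 hw)
    have h3 := (exp_small hN3 hκ.2.1 hκ.2.2 hw h2).1
    have h4 := (sin_near (ht κ hκ w hw)).1
    rw [Metric.mem_closedBall, dist_eq_norm]
    have e : f κ w - N = ((w - N + L.e1 (κ, w)) - Complex.sin (w - N + L.e1 (κ, w))) - L.e1 (κ, w) +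
      (-1) ^ n * (Complex.exp (-(w * L.p κ + L.e2 (κ, w))) / 2) := by rw [hf]; ring
    rw [e]
    refine (norm_add_le _ _).trans ?_
    rw [norm_mul, hnorm, one_mul, norm_div]
    have := norm_sub_le ((w - N + L.e1 (κ, w)) - Complex.sin (w - N + L.e1 (κ, w))) (L.e1 (κ, w))
    simp only [RCLike.norm_ofNat]
    linarith
  have hlip : ∀ κ ∈ L.D n, ∀ u ∈ Metric.closedBall (N:ℂ) 0.3, ∀ v ∈ Metric.closedBall (N:ℂ) 0.3,
      ‖f κ u - f κ v‖ ≤ 1 / 2 * ‖u - v‖ := by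
    intro κ hκ u hu v hv
    have hder : ∀ w ∈ Metric.closedBall (N:ℂ) 0.3, HasDerivAt (f κ) (1 - Complex.cos (w - N + L.e1 (κ, w)) * (1 + deriv (fun w => L.e1 (κ, w)) w)
        + (-1) ^ n * (Complex.exp (-(w * L.p κ + L.e2 (κ, w))) * -(L.p κ + deriv (fun w => L.e2 (κ, w)) w) / 2)) w := by
      intro w hw
      have d1 := ((hM1 N hN1 κ hκ.1).2.2 w (hb hw)).1.hasDerivAt
      have d2 := ((hM2 N hN2 κ hκ.1).2.2 w (hb hw)).1.hasDerivAt
      have a1 := (((hasDerivAt_id w).sub_const (N:ℂ)).add d1).csin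
      have a2 := ((((hasDerivAt_id w).mul_const (L.p κ)).add d2).neg.cexp.div_const 2).const_mul ((-1 : ℂ) ^ n)
      have a3 := ((hasDerivAt_id w).sub a1).add a2
      refine a3.congr_deriv ?_
      simp
    refine Convex.norm_image_sub_le_of_norm_hasDerivWithin_le (s := Metric.closedBall (N:ℂ) 0.3) (f := f κ)
      (fun w hw => (hder w hw).hasDerivWithinAt) (fun w hw => ?_) (convex_closedBall _ _) hv hu
    have h1 := ((hM1 N hN1 κ hκ.1).2.2 w (hb hw)).2
    have h2 := (hM2 N hN2 κ hκ.1).2.1 w (hb4 hw)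
    have h2' := ((hM2 N hN2 κ hκ.1).2.2 w (hb hw)).2
    obtain ⟨h3, h3'⟩ := exp_small hN3 hκ.2.1 hκ.2.2 hw h2
    obtain ⟨-, h4, h5⟩ := sin_near (ht κ hκ w hw)
    set c := Complex.cos (w - N + L.e1 (κ, w))
    set E := Complex.exp (-(w * L.p κ + L.e2 (κ, w)))
    set d1 := deriv (fun w => L.e1 (κ, w)) w
    set d2 := deriv (fun w => L.e2 (κ, w)) w
    have e : 1 - c * (1 + d1) + (-1) ^ n * (E * -(L.p κ + d2) / 2) = (1 - c) - c * d1 - (-1) ^ n * ((L.p κ * E + E * d2) / 2) := by ring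
    rw [e]
    refine (norm_sub_le _ _).trans ?_
    have q1 := norm_sub_le (1 - c) (c * d1)
    have q2 : ‖c * d1‖ ≤ 1.06 * 0.01 := by rw [norm_mul]; gcongr
    have q3 : ‖L.p κ * E + E * d2‖ ≤ 0.1 + 0.35 * 0.01 := by
      refine (norm_add_le _ _).trans (add_le_add ?_ ?_)
      · rw [norm_mul]; exact h3'
      · rw [norm_mul]; gcongr
    rw [norm_mul, hnorm, one_mul, norm_div]
    simp only [RCLike.norm_ofNat]
    linarith
  have hcont : ∀ w ∈ Metric.closedBall (N:ℂ) 0.3, ContinuousOn (fun κ => f κ w) (L.D n) := by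
    intro w hw
    have hm : MapsTo (fun κ : ℂ => (κ, w)) (L.D n) (L.Ω ×ˢ Wd L.R) := fun κ hκ => ⟨hκ.1, hWd w (hb4 hw)⟩
    have c1 : ContinuousOn (fun κ : ℂ => L.e1 (κ, w)) (L.D n) := L.h1.1.comp (by fun_prop) hm
    have c2 : ContinuousOn (fun κ : ℂ => L.e2 (κ, w)) (L.D n) := L.h2.1.comp (by fun_prop) hm
    have c3 : ContinuousOn L.p (L.D n) := L.pd.continuousOn.mono fun κ hκ => hκ.1
    rw [hf]
    fun_prop
  have hEq : ∀ κ w, L.Eq (κ, w) ↔ f κ w = w := by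
    intro κ w
    have e1 : w + L.e1 (κ, w) = N + (w - N + L.e1 (κ, w)) := by ring
    rw [LD.Eq]
    dsimp only
    rw [e1, eq_iff_fix, hf]
    dsimp only
    constructor
    · intro h; rw [h]; ring
    · intro h; linear_combination -h
  obtain ⟨φ, h1, h2⟩ := contr (by norm_num) hmaps hlip hcont
  exact ⟨φ, h1, hWd, fun κ hκ => ⟨(h2 κ hκ).1, (hEq _ _).2 (h2 κ hκ).2.1, fun w hw h => (h2 κ hκ).2.2 w hw ((hEq _ _).1 h)⟩⟩

end PTC

open Complex Filter
namespace PTC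
open Topology Set MeasureTheory

theorem loc_inv {p : ℂ → ℂ} {Ω : Set ℂ} {a : ℂ} (hΩ : IsOpen Ω) (ha : a ∈ Ω) (hp : DifferentiableOn ℂ p Ω) (hz : p a = 0)
    (hd : deriv p a ≠ 0) : ∃ (k : ℂ → ℂ) (δ : ℝ), 0 < δ ∧ DifferentiableOn ℂ k (Metric.ball 0 δ) ∧
      (∀ r ∈ Metric.ball (0:ℂ) δ, k r ∈ Ω ∧ p (k r) = r) ∧ ∀ᶠ κ in 𝓝 a, k (p κ) = κ := by
  have han : AnalyticAt ℂ p a := hp.analyticAt (hΩ.mem_nhds ha)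
  have hc : ContDiffAt ℂ 1 p a := han.contDiffAt
  have hd1 : HasDerivAt p (deriv p a) a := han.differentiableAt.hasDerivAt
  have hd2 := hd1.hasFDerivAt_equiv hd
  set k := hc.localInverse hd2 one_ne_zero with hk
  have h1 : ContDiffAt ℂ 1 k (p a) := hc.to_localInverse hd2 one_ne_zero
  have hs := hc.hasStrictFDerivAt' hd2 one_ne_zero
  have hkeq : k = hs.localInverse := rfl
  have h2 : ∀ᶠ κ in 𝓝 a, k (p κ) = κ := hs.eventually_left_inverse
  have h3 : ∀ᶠ r in 𝓝 (p a), p (k r) = r := hs.eventually_right_inverse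
  have h4 : Tendsto k (𝓝 (p a)) (𝓝 a) := hs.localInverse_tendsto
  have h5 : ∀ᶠ r in 𝓝 (p a), ContDiffAt ℂ 1 k r := h1.eventually (by simp)
  have h6 : ∀ᶠ r in 𝓝 (p a), k r ∈ Ω := h4 (hΩ.mem_nhds ha)
  have h7 := h3.and (h5.and h6)
  rw [hz] at h7
  obtain ⟨δ, hδ, hb⟩ := Metric.eventually_nhds_iff_ball.1 h7
  exact ⟨k, δ, hδ, fun r hr => ((hb r hr).2.1.differentiableAt one_ne_zero).differentiableWithinAt,
    fun r hr => ⟨(hb r hr).2.2, (hb r hr).1⟩, h2⟩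

theorem sin_est {θ : ℝ} {e : ℂ} (h1 : 0.1 ≤ θ) (h2 : θ ≤ Real.pi - 0.1) (he : ‖e‖ ≤ 0.005) :
    0.17 ≤ (2 * Complex.sin (θ + e)).re ∧ ‖2 * Complex.sin (θ + e) - (2 * Real.sin θ : ℝ)‖ ≤ 0.02 := by
  have hs := Complex.sin_bound (x := e) (by linarith)
  have hc := Complex.cos_bound (x := e) (by linarith)
  have hn := norm_nonneg e
  have q2 : ‖e‖ ^ 2 ≤ 0.005 ^ 2 := by gcongr
  have q3 : ‖e‖ ^ 3 ≤ 0.005 ^ 3 := by gcongr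
  have q4 : ‖e‖ ^ 4 ≤ 0.005 ^ 4 := by gcongr
  have q5 : ‖e‖ ^ 5 ≤ 0.005 ^ 5 := by gcongr
  have a1 : ‖Complex.sin e‖ ≤ 0.006 := by
    have : Complex.sin e = (Complex.sin e - (e - e ^ 3 / 6)) + (e - e ^ 3 / 6) := by ring
    rw [this]
    have b1 := norm_add_le (Complex.sin e - (e - e ^ 3 / 6)) (e - e ^ 3 / 6)
    have b2 := norm_sub_le e (e ^ 3 / 6)
    have b3 : ‖e ^ 3 / 6‖ = ‖e‖ ^ 3 / 6 := by rw [norm_div, norm_pow]; simp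
    linarith
  have a2 : ‖Complex.cos e - 1‖ ≤ 0.001 := by
    have : Complex.cos e - 1 = (Complex.cos e - (1 - e ^ 2 / 2)) - e ^ 2 / 2 := by ring
    rw [this]
    have b1 := norm_sub_le (Complex.cos e - (1 - e ^ 2 / 2)) (e ^ 2 / 2)
    have b3 : ‖e ^ 2 / 2‖ = ‖e‖ ^ 2 / 2 := by rw [norm_div, norm_pow]; simp
    linarith
  have a3 : ‖2 * Complex.sin (θ + e) - (2 * Real.sin θ : ℝ)‖ ≤ 0.02 := by
    have : 2 * Complex.sin (θ + e) - (2 * Real.sin θ : ℝ) = 2 * ((Real.sin θ : ℂ) * (Complex.cos e - 1) + (Real.cos θ : ℂ) * Complex.sin e) := by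
      rw [Complex.sin_add]; push_cast; ring
    rw [this, norm_mul]
    have b1 := norm_add_le ((Real.sin θ : ℂ) * (Complex.cos e - 1)) ((Real.cos θ : ℂ) * Complex.sin e)
    have b2 : ‖(Real.sin θ : ℂ) * (Complex.cos e - 1)‖ ≤ 1 * 0.001 := by
      rw [norm_mul, norm_real]; exact mul_le_mul (Real.abs_sin_le_one θ) a2 (norm_nonneg _) zero_le_one
    have b3 : ‖(Real.cos θ : ℂ) * Complex.sin e‖ ≤ 1 * 0.006 := by
      rw [norm_mul, norm_real]; exact mul_le_mul (Real.abs_cos_le_one θ) a1 (norm_nonneg _) zero_le_one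
    simp only [RCLike.norm_ofNat]
    linarith
  refine ⟨?_, a3⟩
  have h4 := abs_re_le_norm (2 * Complex.sin (θ + e) - (2 * Real.sin θ : ℝ))
  rw [sub_re, ofReal_re] at h4
  have h5 := abs_le.1 (h4.trans a3)
  have h6 : 0.099 ≤ Real.sin θ := by
    have hl : ∀ x : ℝ, 0.1 ≤ x → x ≤ Real.pi / 2 → 0.099 ≤ Real.sin x := by
      intro x hx hx'
      have m1 : Real.sin 0.1 ≤ Real.sin x := Real.sin_le_sin_of_le_of_le_pi_div_two (by linarith [Real.pi_gt_three]) hx' hx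
      have m2 := Real.sin_gt_sub_cube (x := 0.1) (by norm_num)
      norm_num at m2 m1 ⊢
      linarith
    by_cases h : θ ≤ Real.pi / 2
    · exact hl θ h1 h
    · push Not at h
      rw [← Real.sin_pi_sub]
      exact hl _ (by linarith) (by linarith)
  linarith

theorem log_est {z : ℂ} (h1 : 0.17 ≤ z.re) (h2 : ‖z‖ ≤ 2.1) : ‖Complex.log z‖ ≤ 6 ∧ |(Complex.log z).im| ≤ 1.6 := by
  have hz : 0.17 ≤ ‖z‖ := h1.trans (re_le_norm z)
  have him : |(Complex.log z).im| ≤ 1.6 := by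
    rw [log_im]
    have := (Complex.abs_arg_le_pi_div_two_iff (z := z)).2 (by linarith)
    have h3 := Real.pi_lt_d2
    linarith
  have hre : |(Complex.log z).re| ≤ 2 := by
    rw [log_re, abs_le]
    have he := Real.exp_one_gt_d9
    constructor
    · rw [Real.le_log_iff_exp_le (by linarith), Real.exp_neg]
      have : Real.exp 2 = Real.exp 1 * Real.exp 1 := by rw [← Real.exp_add]; norm_num
      have h3 : 7 ≤ Real.exp 2 := by rw [this]; nlinarith
      calc (Real.exp 2)⁻¹ ≤ 7⁻¹ := inv_anti₀ (by norm_num) h3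
        _ ≤ _ := by linarith
    · have := Real.log_le_sub_one_of_pos (x := ‖z‖) (by linarith)
      linarith
  refine ⟨?_, him⟩
  have := norm_le_abs_re_add_abs_im (Complex.log z)
  linarith

end PTC

open Complex Filter
namespace PTC
open Topology Set MeasureTheory

theorem exp_A (n : ℕ) : ∃ A : ℂ, Complex.exp A = (-1) ^ n ∧ A.re = 0 ∧ |A.im| ≤ 3.15 ∧ ‖A‖ ≤ 4 := by
  rcases n.even_or_odd with h | h
  · exact ⟨0, by simp [h.neg_one_pow], by simp, by simp; norm_num, by simp⟩
  · refine ⟨Real.pi * I, by rw [h.neg_one_pow, Complex.exp_pi_mul_I], by simp, ?_, ?_⟩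
    · have := Real.pi_lt_d2
      simp [abs_of_pos Real.pi_pos]; linarith
    · have := Real.pi_lt_d2
      simp [abs_of_pos Real.pi_pos]; linarith

theorem log_small {z : ℂ} (h : ‖z‖ ≤ 0.22) (h0 : 0.17 ≤ ‖z‖) : (Complex.log z).re ≤ -1.4 := by
  rw [log_re, Real.log_le_iff_le_exp (by linarith)]
  have e1 := Real.exp_one_lt_d9
  have e2 := Real.exp_bound_div_one_sub_of_interval' (x := 0.4) (by norm_num) (by norm_num)
  have e3 : Real.exp 1.4 = Real.exp 1 * Real.exp 0.4 := by rw [← Real.exp_add]; norm_num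
  have e4 : Real.exp 0.4 ≤ 1.6667 := by norm_num at e2 ⊢; linarith
  have e5 : Real.exp 1.4 ≤ 4.54 := by
    rw [e3]
    have e6 : Real.exp 1 * Real.exp 0.4 ≤ 2.7182818286 * 1.6667 :=
      mul_le_mul e1.le e4 (Real.exp_pos _).le (by norm_num)
    refine e6.trans (by norm_num)
  rw [Real.exp_neg]
  have : (4.54 : ℝ)⁻¹ ≤ (Real.exp 1.4)⁻¹ := inv_anti₀ (Real.exp_pos _) e5
  norm_num at this ⊢
  linarith

theorem bridge (L : LD) {k : ℂ → ℂ} {δ : ℝ} (hδ : 0 < δ) (hk : DifferentiableOn ℂ k (Metric.ball 0 δ))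
    (hkΩ : ∀ r ∈ Metric.ball (0:ℂ) δ, k r ∈ L.Ω ∧ L.p (k r) = r) : ∃ n1 : ℕ, ∀ n, n1 ≤ n → ∃ ψ : ℝ → ℂ,
      ContinuousOn ψ (Icc (NN n + 0.1) (NN n + Real.pi - 0.1)) ∧ ∀ w ∈ Icc (NN n + 0.1) (NN n + Real.pi - 0.1),
      ‖ψ w‖ ≤ δ / 2 ∧ L.Eq (k (ψ w), w) ∧ ((w : ℂ) ∈ Wd L.R) ∧
      (w = NN n + 0.1 ∨ w = NN n + Real.pi - 0.1 → |(ψ w).im| ≤ 5 * (ψ w).re ∧ 1.35 ≤ w * (ψ w).re) := by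
  obtain ⟨M1, hM1⟩ := err_small L.hC L.h1 L.b1 (η := 0.005) (by norm_num)
  obtain ⟨M2, hM2⟩ := err_small L.hC L.h2 L.b2 (η := 0.005) (by norm_num)
  obtain ⟨n0, hn0⟩ := exists_nat_ge (max (max M1 M2) (100 + 100 / δ))
  refine ⟨n0, fun n hn => ?_⟩
  have hN : max (max M1 M2) (100 + 100 / δ) ≤ NN n := hn0.trans ((Nat.cast_le.2 hn).trans (NN_ge n))
  set N := NN n with hNd
  have hN1 : M1 ≤ N := (le_max_left _ _).trans ((le_max_left _ _).trans hN)
  have hN2 : M2 ≤ N := (le_max_right _ _).trans ((le_max_left _ _).trans hN)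
  have hN3 : 100 + 100 / δ ≤ N := (le_max_right _ _).trans hN
  have hdp : 0 < 100 / δ := by positivity
  have hN4 : 100 ≤ N * δ := by
    have : 100 / δ ≤ N := by linarith
    rwa [div_le_iff₀ hδ] at this
  have hpi := Real.pi_lt_d2
  obtain ⟨A, hA, hAre, hAim, hAn⟩ := exp_A n
  set Jc := Icc (N + 0.1) (N + Real.pi - 0.1) with hJ
  have hwb : ∀ w ∈ Jc, (w : ℂ) ∈ Metric.closedBall (N:ℂ) 4 := by
    intro w hw
    rw [Metric.mem_closedBall, dist_eq_norm, ← ofReal_sub, norm_real, Real.norm_eq_abs, abs_le]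
    constructor <;> linarith [hw.1, hw.2]
  have hWd := (hM1 N hN1 _ (L.mem 0 le_rfl L.hks.le)).1
  set Z : ℝ → ℂ → ℂ := fun w r => 2 * Complex.sin ((w - N : ℝ) + L.e1 (k r, w)) with hZ
  set h : ℝ → ℂ → ℂ := fun w r => A - Complex.log (Z w r) - L.e2 (k r, w) with hh
  have hb1 : ∀ w ∈ Jc, ∀ r ∈ Metric.ball (0:ℂ) δ, ‖L.e1 (k r, w)‖ ≤ 0.005 ∧ ‖L.e2 (k r, w)‖ ≤ 0.005 :=
    fun w hw r hr => ⟨(hM1 N hN1 _ (hkΩ r hr).1).2.1 w (hwb w hw), (hM2 N hN2 _ (hkΩ r hr).1).2.1 w (hwb w hw)⟩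
  have hZ1 : ∀ w ∈ Jc, ∀ r ∈ Metric.ball (0:ℂ) δ, 0.17 ≤ (Z w r).re ∧ ‖Z w r - (2 * Real.sin (w - N) : ℝ)‖ ≤ 0.02 :=
    fun w hw r hr => sin_est (by linarith [hw.1]) (by linarith [hw.2]) (hb1 w hw r hr).1
  have hZ2 : ∀ w ∈ Jc, ∀ r ∈ Metric.ball (0:ℂ) δ, ‖Z w r‖ ≤ 2.1 := by
    intro w hw r hr
    have h1 := norm_sub_norm_le (Z w r) ((2 * Real.sin (w - N) : ℝ) : ℂ)
    have h2 := (hZ1 w hw r hr).2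
    rw [norm_real, Real.norm_eq_abs, abs_mul, abs_two] at h1
    have h3 := Real.abs_sin_le_one (w - N)
    linarith
  have hhb : ∀ w ∈ Jc, ∀ r ∈ Metric.ball (0:ℂ) δ, ‖h w r‖ ≤ 11 := by
    intro w hw r hr
    have h1 := (log_est (hZ1 w hw r hr).1 (hZ2 w hw r hr)).1
    have h2 := norm_sub_le (A - Complex.log (Z w r)) (L.e2 (k r, w))
    have h3 := norm_sub_le A (Complex.log (Z w r))
    have h4 := (hb1 w hw r hr).2
    rw [hh]; linarith
  have hslit : ∀ w ∈ Jc, ∀ r ∈ Metric.ball (0:ℂ) δ, Z w r ∈ slitPlane := fun w hw r hr => by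
    left; have := (hZ1 w hw r hr).1; linarith
  have hhd : ∀ w ∈ Jc, DifferentiableOn ℂ (h w) (Metric.ball 0 δ) := by
    intro w hw
    have hm : MapsTo (fun r => (k r, (w : ℂ))) (Metric.ball (0:ℂ) δ) (L.Ω ×ˢ Wd L.R) :=
      fun r hr => ⟨(hkΩ r hr).1, hWd w (hwb w hw)⟩
    have hγ : DifferentiableOn ℂ (fun r => (k r, (w : ℂ))) (Metric.ball (0:ℂ) δ) := hk.prodMk (differentiableOn_const _)
    have d1 := L.h1.2 _ _ Metric.isOpen_ball hγ hm
    have d2 := L.h2.2 _ _ Metric.isOpen_ball hγ hm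
    have d3 : DifferentiableOn ℂ (Z w) (Metric.ball 0 δ) := ((d1.const_add _).csin).const_mul 2
    exact ((d3.clog (hslit w hw)).const_sub A).sub d2
  have hw0 : ∀ w ∈ Jc, N ≤ w := fun w hw => by linarith [hw.1]
  have hhalf : Metric.closedBall (0:ℂ) (δ / 2) ⊆ Metric.ball 0 δ := Metric.closedBall_subset_ball (by linarith)
  have hmaps : ∀ w ∈ Jc, ∀ r ∈ Metric.closedBall (0:ℂ) (δ / 2), h w r / w ∈ Metric.closedBall (0:ℂ) (δ / 2) := by
    intro w hw r hr
    have h1 := hhb w hw r (hhalf hr)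
    have h2 := hw0 w hw
    have h3 : 0 < w := by linarith
    rw [mem_closedBall_zero_iff, norm_div, norm_real, Real.norm_of_nonneg h3.le, div_le_iff₀ h3]
    nlinarith
  have hlip : ∀ w ∈ Jc, ∀ u ∈ Metric.closedBall (0:ℂ) (δ / 2), ∀ v ∈ Metric.closedBall (0:ℂ) (δ / 2),
      ‖h w u / w - h w v / w‖ ≤ 1 / 2 * ‖u - v‖ := by
    intro w hw u hu v hv
    have h2 := hw0 w hw
    have h3 : 0 < w := by linarith
    have key : ‖h w u - h w v‖ ≤ 44 / δ * ‖u - v‖ := by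
      refine Convex.norm_image_sub_le_of_norm_hasDerivWithin_le (s := Metric.closedBall (0:ℂ) (δ / 2)) (f := h w)
        (f' := deriv (h w)) (fun r hr => ((hhd w hw).differentiableAt (Metric.isOpen_ball.mem_nhds (hhalf hr))).hasDerivAt.hasDerivWithinAt)
        (fun r hr => ?_) (convex_closedBall _ _) hv hu
      have hsub : Metric.closedBall r (δ / 4) ⊆ Metric.ball 0 δ := by
        apply Metric.closedBall_subset_ball'
        rw [Metric.mem_closedBall] at hr; linarith
      have := Complex.norm_deriv_le_of_forall_mem_sphere_norm_le (f := h w) (c := r) (R := δ / 4) (C := 11) (by positivity)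
        (DifferentiableOn.diffContOnCl (by
          rw [closure_ball _ (by positivity)]
          exact (hhd w hw).mono hsub)) (fun z hz => hhb w hw z (hsub (Metric.sphere_subset_closedBall hz)))
      refine this.trans (le_of_eq ?_)
      field_simp; norm_num
    rw [← sub_div, norm_div, norm_real, Real.norm_of_nonneg h3.le, div_le_iff₀ h3]
    refine key.trans ?_
    have h4 : 44 / δ ≤ 1 / 2 * w := by rw [div_le_iff₀ hδ]; nlinarith
    have := mul_le_mul_of_nonneg_right h4 (norm_nonneg (u - v))
    linarith
  have hcont : ∀ r ∈ Metric.closedBall (0:ℂ) (δ / 2), ContinuousOn (fun w : ℝ => h w r / w) Jc := by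
    intro r hr
    have hm : MapsTo (fun w : ℝ => (k r, (w : ℂ))) Jc (L.Ω ×ˢ Wd L.R) := fun w hw => ⟨(hkΩ r (hhalf hr)).1, hWd w (hwb w hw)⟩
    have c1 : ContinuousOn (fun w : ℝ => L.e1 (k r, w)) Jc := L.h1.1.comp (by fun_prop) hm
    have c2 : ContinuousOn (fun w : ℝ => L.e2 (k r, w)) Jc := L.h2.1.comp (by fun_prop) hm
    have c3 : ContinuousOn (fun w : ℝ => Z w r) Jc := by rw [hZ]; fun_prop
    have c4 : ContinuousOn (fun w : ℝ => Complex.log (Z w r)) Jc := c3.clog fun w hw => hslit w hw r (hhalf hr)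
    have c5 : ContinuousOn (fun w : ℝ => (w:ℂ)) Jc := by fun_prop
    refine ((continuousOn_const.sub c4).sub c2).div c5 fun w hw => ?_
    have := hw0 w hw
    exact ofReal_ne_zero.2 (by linarith)
  obtain ⟨ψ, h1, h2⟩ := contr (f := fun w r => h w r / w) (by positivity) hmaps hlip hcont
  refine ⟨ψ, h1, fun w hw => ?_⟩
  obtain ⟨g1, g2, -⟩ := h2 w hw
  have hwp : 0 < w := by have := hw0 w hw; linarith
  have hfix : w * ψ w = h w (ψ w) := by
    have : (w : ℂ) ≠ 0 := ofReal_ne_zero.2 hwp.ne'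
    nth_rewrite 1 [← g2]; field_simp
  have hψ := hhalf g1
  have hZ0 : Z w (ψ w) ≠ 0 := slitPlane_ne_zero (hslit w hw _ hψ)
  refine ⟨mem_closedBall_zero_iff.1 g1, ?_, hWd w (hwb w hw), ?_⟩
  · rw [LD.Eq]
    dsimp only
    rw [(hkΩ _ hψ).2, hfix]
    have e1 : (w : ℂ) + L.e1 (k (ψ w), w) = N + ((w - N : ℝ) + L.e1 (k (ψ w), w)) := by push_cast; ring
    have e2 : h w (ψ w) + L.e2 (k (ψ w), w) = A - Complex.log (Z w (ψ w)) := by rw [hh]; ring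
    rw [e1, e2, cos_NN, Complex.exp_sub, hA, Complex.exp_log hZ0]
    have e3 : Complex.sin ((w - N : ℝ) + L.e1 (k (ψ w), w)) = Z w (ψ w) / 2 := by rw [hZ]; ring
    rw [e3]
    have e4 : ((-1 : ℂ) ^ n) * (-1) ^ n = 1 := by rw [← mul_pow]; simp
    field_simp
    linear_combination -e4
  · intro hend
    have hsin : Real.sin (w - N) ≤ 0.1 := by
      have hs : Real.sin 0.1 ≤ 0.1 := Real.sin_le (by norm_num)
      rcases hend with h | h
      · rw [h]; simpa using hs
      · have : w - N = Real.pi - 0.1 := by rw [h]; ring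
        rw [this, Real.sin_pi_sub]; exact hs
    have hsin0 : 0 ≤ Real.sin (w - N) := Real.sin_nonneg_of_nonneg_of_le_pi (by linarith [hw.1]) (by linarith [hw.2])
    have z1 := hZ1 w hw _ hψ
    have zn : ‖Z w (ψ w)‖ ≤ 0.22 := by
      have h1 := norm_sub_norm_le (Z w (ψ w)) ((2 * Real.sin (w - N) : ℝ) : ℂ)
      rw [norm_real, Real.norm_of_nonneg (by positivity)] at h1
      linarith [z1.2]
    have l1 := log_small zn (z1.1.trans (re_le_norm _))
    have l2 := (log_est z1.1 (by linarith)).2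
    have ee := (hb1 w hw _ hψ).2
    have r1 := congrArg re hfix
    have r2 := congrArg im hfix
    have h5 := abs_re_le_norm (L.e2 (k (ψ w), w))
    have h6 := abs_im_le_norm (L.e2 (k (ψ w), w))
    rw [re_ofReal_mul, hh] at r1
    rw [im_ofReal_mul, hh] at r2
    simp only [sub_re, sub_im, hAre] at r1 r2
    have h7 := abs_le.1 (h5.trans ee)
    have h8 := abs_le.1 (h6.trans ee)
    have h9 := abs_le.1 l2
    have h10 := abs_le.1 hAim
    have hA1 : 1.35 ≤ w * (ψ w).re := by rw [r1]; linarith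
    refine ⟨?_, hA1⟩
    have : |w * (ψ w).im| ≤ w * (5 * (ψ w).re) := by
      rw [r2, abs_le]; constructor <;> linarith
    rw [abs_mul, abs_of_pos hwp] at this
    exact le_of_mul_le_mul_left this hwp

end PTC

open Complex Filter
namespace PTC
open Topology Set MeasureTheory

theorem near_cos {z : ℂ} (hz : 0 ≤ z.re) (h : ‖Complex.cos z‖ ≤ 0.05) : ∃ n : ℕ, ‖z - NN n‖ ≤ 0.19 := by
  have hre : (Complex.cos z).re = Real.cos z.re * Real.cosh z.im := by
    rw [Complex.cos_eq z, ← ofReal_cos, ← ofReal_sin, ← ofReal_cosh, ← ofReal_sinh, ← ofReal_mul, ← ofReal_mul]; simp only [sub_re, sub_im, ofReal_re, ofReal_im, re_ofReal_mul, im_ofReal_mul, I_re, I_im]; ring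
  have him : (Complex.cos z).im = -(Real.sin z.re * Real.sinh z.im) := by
    rw [Complex.cos_eq z, ← ofReal_cos, ← ofReal_sin, ← ofReal_cosh, ← ofReal_sinh, ← ofReal_mul, ← ofReal_mul]; simp only [sub_re, sub_im, ofReal_re, ofReal_im, re_ofReal_mul, im_ofReal_mul, I_re, I_im]; ring
  have h1 := (abs_re_le_norm (Complex.cos z)).trans h
  have h2 := (abs_im_le_norm (Complex.cos z)).trans h
  rw [hre, abs_mul] at h1
  rw [him, abs_neg, abs_mul] at h2
  have c1 : 1 ≤ |Real.cosh z.im| := (Real.one_le_cosh _).trans (le_abs_self _)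
  have c2 : |Real.cos z.re| ≤ 0.05 := by nlinarith [abs_nonneg (Real.cos z.re)]
  have c3 : 0.99 ≤ |Real.sin z.re| := by
    have := Real.sin_sq_add_cos_sq z.re
    have a1 := sq_abs (Real.cos z.re)
    have a2 := sq_abs (Real.sin z.re)
    by_contra hh
    push Not at hh
    nlinarith [abs_nonneg (Real.cos z.re), abs_nonneg (Real.sin z.re)]
  have c4 : |Real.sinh z.im| ≤ 0.051 := by
    by_contra hh
    push Not at hh
    nlinarith [abs_nonneg (Real.sinh z.im), abs_nonneg (Real.sin z.re)]
  have c5 : |z.im| ≤ 0.051 := by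
    rw [Real.abs_sinh] at c4
    exact (Real.self_le_sinh_iff.2 (abs_nonneg _)).trans c4
  set n := ⌊z.re / Real.pi⌋₊ with hn
  have hp := Real.pi_pos
  have n1 : (n:ℝ) * Real.pi ≤ z.re := by
    rw [← le_div_iff₀ hp]; exact Nat.floor_le (by positivity)
  have n2 : z.re < (n + 1) * Real.pi := by
    rw [← div_lt_iff₀ hp]; exact Nat.lt_floor_add_one _
  refine ⟨n, ?_⟩
  set t := z.re - NN n with ht
  have t0 : |t| ≤ Real.pi / 2 := by
    rw [abs_le]; simp only [ht, NN]; constructor <;> nlinarith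
  have t1 : |Real.sin t| ≤ 0.05 := by
    have := cos_NN n t
    rw [← ofReal_add, show NN n + t = z.re by rw [ht]; ring] at this
    have h3 : ‖Complex.cos (z.re : ℂ)‖ = ‖Complex.sin (t : ℂ)‖ := by rw [this]; simp
    rw [← ofReal_cos, ← ofReal_sin, norm_real, norm_real] at h3
    rw [Real.norm_eq_abs, Real.norm_eq_abs] at h3
    rw [← h3]; exact c2
  have t2 := Real.mul_abs_le_abs_sin t0
  have t3 : |t| ≤ 0.08 := by
    have : 2 / Real.pi * |t| ≤ 0.05 := t2.trans t1
    have hp3 := Real.pi_lt_d2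
    rw [div_mul_eq_mul_div, div_le_iff₀ hp] at this
    nlinarith
  calc ‖z - NN n‖ ≤ |(z - NN n).re| + |(z - NN n).im| := norm_le_abs_re_add_abs_im _
    _ = |t| + |z.im| := by simp [ht]
    _ ≤ _ := by linarith

theorem near_zero (L : LD) : ∃ δ2, 0 < δ2 ∧ ∃ n2 : ℕ, (∀ n, n2 ≤ n → Metric.ball 0 δ2 ⊆ L.D n) ∧
    ∀ m : ℝ, ∃ R2, L.R ≤ R2 ∧ ∀ κ w : ℂ, ‖κ‖ < δ2 → w ∈ Wd R2 → L.Eq (κ, w) →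
      ∃ n : ℕ, m ≤ n ∧ w ∈ Metric.closedBall (NN n : ℂ) 0.3 := by
  have h0 : (0:ℂ) ∈ L.Ω := by simpa using L.mem 0 le_rfl L.hks.le
  have hp0 : 0 < (L.p 0).re := by simpa using L.pre 0 le_rfl L.hks
  have hpi : (L.p 0).im = 0 := by simpa using L.pim 0 le_rfl L.hks.le
  set p0 := (L.p 0).re with hp0d
  have hc : ContinuousAt L.p 0 := (L.pd.differentiableAt (L.Ωo.mem_nhds h0)).continuousAt
  have hev : ∀ᶠ κ in 𝓝 (0:ℂ), κ ∈ L.Ω ∧ dist (L.p κ) (L.p 0) < 0.1 * p0 :=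
    Filter.Eventually.and (L.Ωo.mem_nhds h0) (hc (Metric.ball_mem_nhds _ (by positivity)))
  obtain ⟨δ2, hδ, hb⟩ := Metric.eventually_nhds_iff.1 hev
  have key : ∀ κ : ℂ, ‖κ‖ < δ2 → κ ∈ L.Ω ∧ 0.9 * p0 ≤ (L.p κ).re ∧ |(L.p κ).im| ≤ 0.1 * p0 := by
    intro κ hκ
    obtain ⟨k1, k2⟩ := hb (show dist κ 0 < δ2 by simpa using hκ)
    rw [dist_eq_norm] at k2
    refine ⟨k1, ?_, ?_⟩
    · have := ((abs_re_le_norm _).trans k2.le)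
      rw [sub_re, abs_le] at this
      linarith
    · have := ((abs_im_le_norm _).trans k2.le)
      rwa [sub_im, hpi, sub_zero] at this
  obtain ⟨n2, hn2⟩ := exists_nat_ge (2 / p0)
  refine ⟨δ2, hδ, n2, fun n hn κ hκ => ?_, fun m => ?_⟩
  · obtain ⟨k1, k2, k3⟩ := key κ (mem_ball_zero_iff.1 hκ)
    refine ⟨k1, by linarith, ?_⟩
    have : 2 / p0 ≤ NN n := hn2.trans ((Nat.cast_le.2 hn).trans (NN_ge n))
    rw [div_le_iff₀ hp0] at this
    nlinarith
  · refine ⟨max (max L.R 1) (max (max (10 * L.C) (100 / p0)) (10 * |m| + 30)), by simp, ?_⟩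
    intro κ w hκ hw hE
    obtain ⟨w1, w2, w3⟩ := hw
    simp only [max_lt_iff] at w3
    obtain ⟨⟨w3, w4⟩, ⟨w5, w6⟩, w7⟩ := w3
    obtain ⟨k1, k2, k3⟩ := key κ hκ
    have hmem : (κ, w) ∈ L.Ω ×ˢ Wd L.R := ⟨k1, w1, w2, w3⟩
    have b1 := L.b1 _ hmem
    have b2 := L.b2 _ hmem
    dsimp only at b1 b2
    have hCw : L.C / ‖w‖ ≤ 0.1 := by
      rw [div_le_iff₀ (by linarith)]; linarith
    have hw22 : ‖w‖ ≤ 2.2 * w.re := by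
      refine (norm_le_abs_re_add_abs_im w).trans ?_
      rw [abs_of_pos w1]; linarith
    have hre : 0.7 * w.re * p0 ≤ (w * L.p κ).re := by
      rw [mul_re]
      have : w.im * (L.p κ).im ≤ |w.im| * |(L.p κ).im| := by rw [← abs_mul]; exact le_abs_self _
      have h5 : |w.im| * |(L.p κ).im| ≤ (1.2 * w.re) * (0.1 * p0) := by gcongr
      nlinarith
    rw [div_lt_iff₀ hp0] at w6
    have hre2 : 20 ≤ (w * L.p κ + L.e2 (κ, w)).re := by
      rw [add_re]
      have := ((abs_re_le_norm _).trans b2)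
      have := neg_abs_le (L.e2 (κ, w)).re
      nlinarith
    have hex : 20 ≤ ‖Complex.exp (w * L.p κ + L.e2 (κ, w))‖ := by
      rw [norm_exp]
      have := Real.add_one_le_exp (w * L.p κ + L.e2 (κ, w)).re
      linarith
    rw [LD.Eq] at hE
    dsimp only at hE
    have hco : ‖Complex.cos (w + L.e1 (κ, w))‖ ≤ 0.05 := by
      have h6 : 2 * Complex.exp (w * L.p κ + L.e2 (κ, w)) * Complex.cos (w + L.e1 (κ, w)) = -1 := by
        linear_combination hE
      have h7 := congrArg norm h6
      rw [norm_mul, norm_mul, norm_neg, norm_one] at h7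
      simp only [Complex.norm_ofNat] at h7
      nlinarith [norm_nonneg (Complex.cos (w + L.e1 (κ, w)))]
    have her := (abs_re_le_norm _).trans (b1.trans hCw)
    have her' := neg_abs_le (L.e1 (κ, w)).re
    obtain ⟨n, hn⟩ := near_cos (z := w + L.e1 (κ, w)) (by rw [add_re]; linarith) hco
    refine ⟨n, ?_, ?_⟩
    · have h8 := (abs_re_le_norm _).trans hn
      rw [sub_re, add_re, ofReal_re, abs_le, NN] at h8
      have := le_abs_self m
      nlinarith [Real.pi_lt_d2, Real.pi_pos, abs_nonneg m]
    · rw [mem_closedBall_iff_norm]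
      calc ‖w - NN n‖ = ‖(w + L.e1 (κ, w) - NN n) - L.e1 (κ, w)‖ := by congr 1; ring
        _ ≤ _ := norm_sub_le _ _
        _ ≤ 0.3 := by linarith

theorem leaves (L : LD) : ∃ S ⊆ L.Ω ×ˢ Wd L.R, IsPreconnected S ∧ S.Nonempty ∧ (∀ x ∈ S, L.Eq x) ∧
    ∃ δ2, 0 < δ2 ∧ ∃ R2, ∀ κ w : ℂ, ‖κ‖ < δ2 → w ∈ Wd R2 →
      κ ∈ L.Ω ∧ w ∈ Wd L.R ∧ (L.Eq (κ, w) → (κ, w) ∈ S) := by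
  have hksm : (L.ks : ℂ) ∈ L.Ω := L.mem _ L.hks.le le_rfl
  obtain ⟨k, δ, hδ, hk, hkΩ, hki⟩ := loc_inv L.Ωo hksm L.pd L.pz L.pd0
  obtain ⟨n1, hbr⟩ := bridge L hδ hk hkΩ
  obtain ⟨n0, hlf⟩ := leaf L
  obtain ⟨δ2, hδ2, n2, hD2, hnz⟩ := near_zero L
  -- the real point κ1
  have hc : ContinuousAt L.p L.ks := (L.pd.differentiableAt (L.Ωo.mem_nhds hksm)).continuousAt
  have hev : ∀ᶠ κ in 𝓝 (L.ks:ℂ), k (L.p κ) = κ ∧ dist (L.p κ) 0 < δ / 2 := by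
    have hb : Metric.ball (0:ℂ) (δ / 2) ∈ 𝓝 (L.p L.ks) := by
      rw [L.pz]
      exact Metric.ball_mem_nhds _ (by positivity)
    exact hki.and (hc.eventually hb)
  have hev2 : ∀ᶠ x : ℝ in 𝓝[<] L.ks, (k (L.p x) = x ∧ dist (L.p x) 0 < δ / 2) ∧ 0 < x ∧ x < L.ks := by
    refine Filter.Eventually.and ?_ (Ioo_mem_nhdsLT L.hks)
    exact (continuous_ofReal.continuousAt.eventually hev).filter_mono nhdsWithin_le_nhds
  obtain ⟨x1, ⟨e1, e2⟩, x1p, x1k⟩ := hev2.exists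
  rw [dist_zero_right] at e2
  -- min on the segment
  have hpc : ContinuousOn (fun x : ℝ => (L.p x).re) (Icc 0 x1) := by
    refine continuous_re.comp_continuousOn (L.pd.continuousOn.comp continuous_ofReal.continuousOn ?_)
    intro x hx
    exact L.mem x hx.1 (hx.2.trans x1k.le)
  obtain ⟨xm, hxm, hmin⟩ := isCompact_Icc.exists_isMinOn ⟨0, left_mem_Icc.2 x1p.le⟩ hpc
  set m := (L.p xm).re with hm
  have hmp : 0 < m := L.pre xm hxm.1 (lt_of_le_of_lt hxm.2 x1k)
  have hmin' : ∀ x ∈ Icc (0:ℝ) x1, m ≤ (L.p x).re := fun x hx => hmin hx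
  obtain ⟨n3, hn3⟩ := exists_nat_ge (2 / m)
  obtain ⟨n4, hn4⟩ := exists_nat_ge (max (max (n0:ℝ) n1) (max (max (n2:ℝ) n3) 1))
  have hn4' : n0 ≤ n4 ∧ n1 ≤ n4 ∧ n2 ≤ n4 ∧ n3 ≤ n4 ∧ 1 ≤ n4 := by
    simp only [max_le_iff, Nat.cast_le, Nat.one_le_cast] at hn4
    tauto
  obtain ⟨q0, q1, q2, q3, q4⟩ := hn4'
  let cone : ℕ → Set ℂ := fun n => {r | ‖r‖ ≤ δ / 2 ∧ |r.im| ≤ 5 * r.re ∧ 1.2 ≤ NN n * r.re}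
  have hcone : ∀ n, Convex ℝ (cone n) := by
    intro n r hr s hs a b ha hb hab
    obtain ⟨r1, r2, r3⟩ := hr
    obtain ⟨s1, s2, s3⟩ := hs
    refine ⟨?_, ?_, ?_⟩
    · calc ‖a • r + b • s‖ ≤ ‖a • r‖ + ‖b • s‖ := norm_add_le _ _
        _ = a * ‖r‖ + b * ‖s‖ := by rw [norm_smul, norm_smul, Real.norm_of_nonneg ha, Real.norm_of_nonneg hb]
        _ ≤ a * (δ / 2) + b * (δ / 2) := by gcongr
        _ = _ := by rw [← add_mul, hab, one_mul]
    · simp only [add_im, real_smul, re_ofReal_mul, im_ofReal_mul, add_re]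
      rw [abs_le] at *
      constructor <;> nlinarith
    · simp only [real_smul, re_ofReal_mul, add_re]
      nlinarith
  have hconeB : ∀ n, cone n ⊆ Metric.ball 0 δ := by
    intro n r hr
    rw [mem_ball_zero_iff]; linarith [hr.1]
  have hNm : ∀ n, n4 ≤ n → 1.2 ≤ NN n * m := by
    intro n hn
    have : 2 / m ≤ NN n := hn3.trans ((Nat.cast_le.2 (q3.trans hn)).trans (NN_ge n))
    rw [div_le_iff₀ hmp] at this
    linarith
  let A : ℕ → Set ℂ := fun n => (Metric.ball 0 δ2 ∪ ofReal '' Icc 0 x1) ∪ k '' cone n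
  have hx1c : ∀ n, n4 ≤ n → L.p x1 ∈ cone n := by
    intro n hn
    have h3 := hmin' x1 (right_mem_Icc.2 x1p.le)
    refine ⟨e2.le, ?_, ?_⟩
    · rw [L.pim x1 x1p.le x1k.le, abs_zero]; linarith
    · refine (hNm n hn).trans (mul_le_mul_of_nonneg_left h3 ?_)
      exact (Nat.cast_nonneg n).trans (NN_ge n)
  have hAD : ∀ n, n4 ≤ n → A n ⊆ L.D n := by
    rintro n hn κ ((h | ⟨x, hx, rfl⟩) | ⟨r, hr, rfl⟩)
    · exact hD2 n (q2.trans hn) h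
    · refine ⟨L.mem x hx.1 (hx.2.trans x1k.le), ?_, ?_⟩
      · rw [L.pim x hx.1 (hx.2.trans x1k.le), abs_zero]; linarith [hmin' x hx]
      · refine (hNm n hn).trans (mul_le_mul_of_nonneg_left (hmin' x hx) ?_)
        exact (Nat.cast_nonneg n).trans (NN_ge n)
    · obtain ⟨g1, g2⟩ := hkΩ r (hconeB n hr)
      refine ⟨g1, ?_, ?_⟩
      · rw [g2]; exact hr.2.1
      · rw [g2]; exact hr.2.2
  have hAp : ∀ n, n4 ≤ n → IsPreconnected (A n) := by
    intro n hn
    refine IsPreconnected.union (x1:ℂ) (Or.inr ⟨x1, right_mem_Icc.2 x1p.le, rfl⟩) ⟨_, hx1c n hn, e1⟩ ?_ ?_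
    · refine IsPreconnected.union 0 (Metric.mem_ball_self hδ2) ⟨0, left_mem_Icc.2 x1p.le, by simp⟩ ?_ ?_
      · exact (convex_ball _ _).isPreconnected
      · exact isPreconnected_Icc.image _ continuous_ofReal.continuousOn
    · exact (hcone n).isPreconnected.image _ (hk.continuousOn.mono (hconeB n))
  have hlf' : ∀ n, ∃ φ : ℂ → ℂ, n4 ≤ n → ContinuousOn φ (L.D n) ∧
      (∀ w ∈ Metric.closedBall (NN n : ℂ) 4, w ∈ Wd L.R) ∧ ∀ κ ∈ L.D n,
      φ κ ∈ Metric.closedBall (NN n : ℂ) 0.3 ∧ L.Eq (κ, φ κ) ∧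
      ∀ w ∈ Metric.closedBall (NN n : ℂ) 0.3, L.Eq (κ, w) → w = φ κ := by
    intro n
    by_cases hn : n4 ≤ n
    · obtain ⟨φ, h⟩ := hlf n (q0.trans hn)
      exact ⟨φ, fun _ => h⟩
    · exact ⟨0, fun h => absurd h hn⟩
  choose φ hφ using hlf'
  have hbr' : ∀ n, ∃ ψ : ℝ → ℂ, n4 ≤ n → 
      ContinuousOn ψ (Icc (NN n + 0.1) (NN n + Real.pi - 0.1)) ∧ ∀ w ∈ Icc (NN n + 0.1) (NN n + Real.pi - 0.1),
      ‖ψ w‖ ≤ δ / 2 ∧ L.Eq (k (ψ w), w) ∧ ((w : ℂ) ∈ Wd L.R) ∧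
      (w = NN n + 0.1 ∨ w = NN n + Real.pi - 0.1 → |(ψ w).im| ≤ 5 * (ψ w).re ∧ 1.35 ≤ w * (ψ w).re) := by
    intro n
    by_cases hn : n4 ≤ n
    · obtain ⟨φ, h⟩ := hbr n (q1.trans hn)
      exact ⟨φ, fun _ => h⟩
    · exact ⟨0, fun h => absurd h hn⟩
  choose ψ hψ using hbr'
  let lf : ℕ → Set (ℂ × ℂ) := fun n => (fun κ => (κ, φ n κ)) '' A n
  let br : ℕ → Set (ℂ × ℂ) := fun n => (fun w : ℝ => (k (ψ n w), (w:ℂ))) '' Icc (NN n + 0.1) (NN n + Real.pi - 0.1)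
  have hpi := Real.pi_gt_three
  have hII : ∀ n, NN n + 0.1 ≤ NN n + Real.pi - 0.1 := by intro n; linarith
  have hlfp : ∀ n, n4 ≤ n → IsPreconnected (lf n) := by
    intro n hn
    exact (hAp n hn).image _ (continuousOn_id.prodMk ((hφ n hn).1.mono (hAD n hn)))
  have hbrp : ∀ n, n4 ≤ n → IsPreconnected (br n) := by
    intro n hn
    refine isPreconnected_Icc.image _ (ContinuousOn.prodMk ?_ continuous_ofReal.continuousOn)
    refine hk.continuousOn.comp (hψ n hn).1 fun w hw => ?_
    rw [mem_ball_zero_iff]; linarith [((hψ n hn).2 w hw).1]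
  have hlfmem : ∀ n, n4 ≤ n → ∀ κ ∈ A n, ∀ w ∈ Metric.closedBall (NN n : ℂ) 0.3, L.Eq (κ, w) → (κ, w) ∈ lf n := by
    intro n hn κ hκ w hw hE
    refine ⟨κ, hκ, ?_⟩
    rw [((hφ n hn).2.2 κ (hAD n hn hκ)).2.2 w hw hE]
  have hNN1 : ∀ n, n4 ≤ n → 1 ≤ NN n := by
    intro n hn
    have : ((1:ℕ):ℝ) ≤ n := Nat.cast_le.2 (q4.trans hn)
    have := NN_ge n
    push_cast at *
    linarith
  have hleft : ∀ n, n4 ≤ n → (k (ψ n (NN n + 0.1)), ((NN n + 0.1 : ℝ):ℂ)) ∈ lf n := by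
    intro n hn
    have hw := left_mem_Icc.2 (hII n)
    obtain ⟨g1, g2, g3, g4⟩ := (hψ n hn).2 _ hw
    obtain ⟨g5, g6⟩ := g4 (Or.inl rfl)
    refine hlfmem n hn _ (Or.inr ⟨_, ⟨g1, g5, ?_⟩, rfl⟩) _ ?_ g2
    · have := hNN1 n hn
      have h0 : 0 ≤ (ψ n (NN n + 0.1)).re := by have := abs_nonneg (ψ n (NN n + 0.1)).im; linarith
      nlinarith
    · rw [mem_closedBall_iff_norm, ← ofReal_sub, norm_real, add_sub_cancel_left]; norm_num [abs_of_pos]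
  have hright : ∀ n, n4 ≤ n → (k (ψ n (NN n + Real.pi - 0.1)), ((NN n + Real.pi - 0.1 : ℝ):ℂ)) ∈ lf (n+1) := by
    intro n hn
    have hw := right_mem_Icc.2 (hII n)
    obtain ⟨g1, g2, g3, g4⟩ := (hψ n hn).2 _ hw
    obtain ⟨g5, g6⟩ := g4 (Or.inr rfl)
    refine hlfmem (n+1) (by omega) _ (Or.inr ⟨_, ⟨g1, g5, ?_⟩, rfl⟩) _ ?_ g2
    · have h0 : 0 ≤ (ψ n (NN n + Real.pi - 0.1)).re := by have := abs_nonneg (ψ n (NN n + Real.pi - 0.1)).im; linarith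
      rw [NN_succ]
      nlinarith
    · rw [mem_closedBall_iff_norm, ← ofReal_sub, norm_real, NN_succ,
        show NN n + Real.pi - 0.1 - (NN n + Real.pi) = -0.1 by ring]; norm_num [abs_of_pos]
  let T : ℕ → Set (ℂ × ℂ) := fun j => lf (j + n4) ∪ br (j + n4)
  have hTp : ∀ j, IsPreconnected (T j) := by
    intro j
    have hn : n4 ≤ j + n4 := by omega
    exact IsPreconnected.union _ (hleft _ hn) ⟨_, left_mem_Icc.2 (hII _), rfl⟩ (hlfp _ hn) (hbrp _ hn)
  have hmemT : ∀ j, ∀ x ∈ T j, x ∈ L.Ω ×ˢ Wd L.R ∧ L.Eq x := by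
    rintro j x (⟨κ, hκ, rfl⟩ | ⟨w, hw, rfl⟩)
    · have hn : n4 ≤ j + n4 := by omega
      have hD := hAD _ hn hκ
      obtain ⟨g1, g2, -⟩ := (hφ _ hn).2.2 κ hD
      exact ⟨⟨hD.1, (hφ _ hn).2.1 _ (Metric.closedBall_subset_closedBall (by norm_num) g1)⟩, g2⟩
    · have hn : n4 ≤ j + n4 := by omega
      obtain ⟨g1, g2, g3, -⟩ := (hψ _ hn).2 w hw
      exact ⟨⟨(hkΩ _ (by rw [mem_ball_zero_iff]; linarith)).1, g3⟩, g2⟩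
  refine ⟨⋃ j, T j, ?_, ?_, ?_, ?_, ?_⟩
  · intro x hx
    obtain ⟨j, hj⟩ := mem_iUnion.1 hx
    exact (hmemT j x hj).1
  · refine IsPreconnected.iUnion_of_chain hTp fun j => ?_
    have hn : n4 ≤ j + n4 := by omega
    refine ⟨_, Or.inr ⟨_, right_mem_Icc.2 (hII (j + n4)), rfl⟩, Or.inl ?_⟩
    have := hright _ hn
    rwa [show j + n4 + 1 = Order.succ j + n4 by rw [Order.succ_eq_add_one]; ring] at this
  · have := hleft n4 le_rfl
    exact ⟨_, mem_iUnion.2 ⟨0, Or.inl (by simpa using this)⟩⟩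
  · intro x hx
    obtain ⟨j, hj⟩ := mem_iUnion.1 hx
    exact (hmemT j x hj).2
  · obtain ⟨R2, hR, h⟩ := hnz n4
    refine ⟨δ2, hδ2, R2, fun κ w hκ hw => ⟨?_, ?_, fun hE => ?_⟩⟩
    · exact (hD2 n4 q2 (mem_ball_zero_iff.2 hκ)).1
    · exact ⟨hw.1, hw.2.1, lt_of_le_of_lt hR hw.2.2⟩
    · obtain ⟨n, hn, hb⟩ := h κ w hκ hw hE
      have hn' : n4 ≤ n := by exact_mod_cast hn
      refine mem_iUnion.2 ⟨n - n4, Or.inl ?_⟩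
      rw [Nat.sub_add_cancel hn']
      exact hlfmem n hn' κ (Or.inl (Or.inl (mem_ball_zero_iff.2 hκ))) w hb hE

end PTC

open Complex Filter
namespace PTC
open Topology Set MeasureTheory

theorem prop_decay {x : ℝ} (hx : rt (5 * x) = 1) {p l c0 c1 : ℂ} (hc : c0 * cB x p l - c1 * cA x p l = 0)
    {G : Filter ℝ} {z : ℝ → ℂ} (hz : Tendsto (fun s => rt (-x) * z s) G SN) :
    Tendsto (fun s => fs p l c0 c1 (z s)) G (𝓝 0) ∧ Tendsto (fun s => fs' p l c0 c1 (z s)) G (𝓝 0) := by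
  obtain ⟨μ, h0, h1⟩ : ∃ μ : ℂ, c0 = μ * cA x p l ∧ c1 = μ * cB x p l := by
    by_cases hA : cA x p l = 0
    · have hB : cB x p l ≠ 0 := fun h => cAB_ne x p l ⟨hA, h⟩
      refine ⟨c1 / cB x p l, ?_, by field_simp⟩
      rw [hA, mul_zero, sub_zero] at hc
      rw [hA, mul_zero]
      exact (mul_eq_zero.1 hc).resolve_right hB
    · refine ⟨c0 / cA x p l, by field_simp, ?_⟩
      field_simp
      linear_combination -hc
  obtain ⟨d1, d2⟩ := rot_decay hx p l hz
  have e1 := d1.const_mul μ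
  have e2 := d2.const_mul μ
  rw [mul_zero] at e1 e2
  constructor
  · refine e1.congr fun s => ?_
    rw [(fs_lin p l c0 c1 _).1, (fs_lin p l (cA x p l) _ _).1, h0, h1]; ring
  · refine e2.congr fun s => ?_
    rw [(fs_lin p l c0 c1 _).2, (fs_lin p l (cA x p l) _ _).2, h0, h1]; ring

theorem numrange {a lam : ℂ} (h : (a, lam) ∈ cubicSpectralLocus) {φ η : ℝ}
    (h1 : |(rt (18 + φ)).im| < 0.68 * (rt (18 + φ)).re) (h2 : |(rt (-18 + φ)).im| < 0.68 * (rt (-18 + φ)).re)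
    (h3 : 0 < (rt (5 * φ)).re) :
    ∃ x : ℝ, 3 * η * x ^ 2 - x * (a * rt (-(2 * φ))).im + η * (a * rt (-(2 * φ))).re - η ^ 3 - (rt (-(3 * φ)) * lam).re < 0 := by
  obtain ⟨y, hy⟩ := h
  dsimp only at hy
  have hs := eig_sol hy
  obtain ⟨c0, c1, hc, he, w1, w2⟩ := eig_coef hy
  have he' : ∀ z, deriv y z = fs' (-a) lam c0 c1 z := by
    intro z
    rw [show y = fs (-a) lam c0 c1 from funext he]
    exact (Sol.fs (-a) lam c0 c1 z).1.deriv
  by_contra hcon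
  push Not at hcon
  set q : ℂ := I * rt φ with hq
  let z : ℝ → ℂ := fun x => q * (x - I * η)
  have hzd : ∀ x, HasDerivAt z q x := by
    intro x
    have := ((hasDerivAt_id (x:ℂ)).sub_const (I * η)).const_mul q
    simpa using this.comp_ofReal
  have htop : Tendsto (fun s => rt (-72) * z s) atTop SN := by
    refine (line_SN (-(I * η)) h1).congr fun t => ?_
    rw [rt_add, ← u72.1]; simp only [z, hq]; ring
  have hbot : Tendsto (fun s => rt (-288) * z s) atBot SN := by
    refine ((line_SN (I * η) h2).comp tendsto_neg_atBot_atTop).congr fun t => ?_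
    simp only [Function.comp]
    rw [rt_add, ← u72.2.2.1]; simp only [z, hq]; push_cast; ring
  obtain ⟨t1, t2⟩ := prop_decay r5.1 w1 htop
  obtain ⟨b1, b2⟩ := prop_decay r5.2.2.2 w2 hbot
  let Y : ℝ → ℂ := fun x => y (z x)
  let Y1 : ℝ → ℂ := fun x => q * deriv y (z x)
  have hY : ∀ x, HasDerivAt Y (Y1 x) x := by
    intro x
    have := (hs (z x)).1.comp x (hzd x)
    exact this.congr_deriv (by simp only [Y1]; ring)
  have hY1 : ∀ x, HasDerivAt Y1 (q ^ 2 * (((z x) ^ 3 + -a * z x + lam) * Y x)) x := by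
    intro x
    have := ((hs (z x)).2.comp x (hzd x)).const_mul q
    exact this.congr_deriv (by simp only [Y]; ring)
  let E : ℝ → ℝ := fun x => (rt (-(5 * φ)) * (starRingEnd ℂ (Y x) * Y1 x)).re
  let B : ℝ → ℝ := fun x => 3 * η * x ^ 2 - x * (a * rt (-(2 * φ))).im + η * (a * rt (-(2 * φ))).re - η ^ 3 - (rt (-(3 * φ)) * lam).re
  have hE : ∀ x, HasDerivAt E ((rt (5 * φ)).re * ‖Y1 x‖ ^ 2 + B x * ‖Y x‖ ^ 2) x := by
    intro x
    have hst : HasDerivAt (fun x => starRingEnd ℂ (Y x)) (starRingEnd ℂ (Y1 x)) x := by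
      have := (hY x).star
      exact this
    have h5 := (hst.mul (hY1 x)).const_mul (rt (-(5 * φ)))
    have h6 := Complex.reCLM.hasFDerivAt.comp_hasDerivAt x h5
    refine h6.congr_deriv ?_
    simp only [Complex.reCLM_apply]
    have k1 : rt (-(5 * φ)) * (starRingEnd ℂ (Y1 x) * Y1 x) = rt (-(5 * φ)) * ((‖Y1 x‖ ^ 2 : ℝ) : ℂ) := by
      rw [Complex.conj_mul']; push_cast; ring
    have k2 : rt (-(5 * φ)) * (starRingEnd ℂ (Y x) * (q ^ 2 * (((z x) ^ 3 + -a * z x + lam) * Y x)))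
        = (I * (x - I * η) ^ 3 + I * (a * rt (-(2 * φ))) * (x - I * η) - rt (-(3 * φ)) * lam) * ((‖Y x‖ ^ 2 : ℝ) : ℂ) := by
      have e5 : rt (-(5 * φ)) * rt φ ^ 5 = 1 := by rw [rt_pow]; exact_mod_cast rt_neg (5 * φ)
      have e2 : rt (-(2 * φ)) = rt (-(5 * φ)) * rt φ ^ 3 := by rw [rt_pow, ← rt_add]; congr 1; push_cast; ring
      have e3 : rt (-(3 * φ)) = rt (-(5 * φ)) * rt φ ^ 2 := by rw [rt_pow, ← rt_add]; congr 1; push_cast; ring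
      have e1 : ((‖Y x‖ ^ 2 : ℝ) : ℂ) = starRingEnd ℂ (Y x) * Y x := by rw [Complex.conj_mul']; push_cast; ring
      rw [e1, e2, e3]
      simp only [z, hq]
      have hI : I ^ 2 = -1 := I_sq
      have hI4 : I ^ 4 = 1 := I_pow_four
      have hI5 : I ^ 5 = I := by rw [pow_succ, hI4, one_mul]
      have hI3 : I ^ 3 = -I := I_pow_three
      rw [show ∀ c w : ℂ, rt (-(5 * φ)) * (c * ((I * rt φ) ^ 2 * (((I * rt φ * w) ^ 3 + -a * (I * rt φ * w) + lam) * Y x)))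
        = (I ^ 5 * (rt (-(5 * φ)) * rt φ ^ 5) * w ^ 3 - I ^ 3 * a * (rt (-(5 * φ)) * rt φ ^ 3) * w + I ^ 2 * (rt (-(5 * φ)) * rt φ ^ 2) * lam) * (c * Y x) from
          fun c w => by ring]
      rw [e5, hI5, hI3, hI]
      ring
    rw [mul_add, k1, k2, Complex.add_re, mul_comm (rt (-(5 * φ))), Complex.re_ofReal_mul, mul_comm _ ((‖Y x‖ ^ 2 : ℝ) : ℂ),
      Complex.re_ofReal_mul, (rt_neg_re _).1]
    have k3 : (I * ((x:ℂ) - I * η) ^ 3 + I * (a * rt (-(2 * φ))) * (x - I * η) - rt (-(3 * φ)) * lam).re = B x := by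
      simp only [B]
      rw [Complex.sub_re, Complex.add_re]
      congr 1
      have hI3 : I ^ 3 = -I := I_pow_three
      have r1 : I * ((x:ℂ) - I * η) ^ 3 = ((3 * η * x ^ 2 - η ^ 3 : ℝ) : ℂ) + ((x ^ 3 - 3 * x * η ^ 2 : ℝ) : ℂ) * I := by
        push_cast
        linear_combination (-3 * (x:ℂ) ^ 2 * η + 3 * x * I * η ^ 2 - η ^ 3 * (I ^ 2 - 1)) * I_sq
      have r2 : I * (a * rt (-(2 * φ))) * ((x:ℂ) - I * η) = (x:ℂ) * (I * (a * rt (-(2 * φ)))) + (η : ℂ) * (a * rt (-(2 * φ))) := by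
        linear_combination (-(a * rt (-(2 * φ))) * η) * I_sq
      rw [r1, r2]
      simp only [Complex.add_re, Complex.re_ofReal_mul, Complex.ofReal_re, Complex.I_mul_re, Complex.I_re, mul_zero]
      ring
    rw [k3]; ring
  have hB : ∀ x, 0 ≤ B x := hcon
  have hmono : Monotone E := monotone_of_deriv_nonneg (fun x => (hE x).differentiableAt) fun x => by
    rw [(hE x).deriv]
    have := hB x
    positivity
  have hlim : ∀ G : Filter ℝ, Tendsto (fun s => fs (-a) lam c0 c1 (z s)) G (𝓝 0) →
      Tendsto (fun s => fs' (-a) lam c0 c1 (z s)) G (𝓝 0) → Tendsto E G (𝓝 0) := by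
    intro G g1 g2
    have g3 : Tendsto Y G (𝓝 0) := g1.congr fun s => (he _).symm
    have g4 : Tendsto Y1 G (𝓝 0) := by
      have := g2.const_mul q
      rw [mul_zero] at this
      exact this.congr fun s => by simp only [Y1]; rw [he']
    have g5 : Tendsto (fun x => starRingEnd ℂ (Y x)) G (𝓝 0) := by
      have := (Complex.continuous_conj.tendsto 0).comp g3
      rwa [map_zero] at this
    have g6 := (Complex.continuous_re.tendsto _).comp ((g5.mul g4).const_mul (rt (-(5 * φ))))
    rw [mul_zero, mul_zero, Complex.zero_re] at g6
    exact g6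
  have hE0 : ∀ x, E x = 0 := by
    intro x
    apply le_antisymm
    · exact hmono.ge_of_tendsto (hlim _ t1 t2) x
    · exact hmono.le_of_tendsto (hlim _ b1 b2) x
  have hY10 : ∀ x, Y1 x = 0 := by
    intro x
    have h7 := (hE x).unique ((hasDerivAt_const x (0:ℝ)).congr_of_eventuallyEq (Filter.Eventually.of_forall hE0))
    have h8 : 0 ≤ B x * ‖Y x‖ ^ 2 := mul_nonneg (hB x) (by positivity)
    have h9 : (rt (5 * φ)).re * ‖Y1 x‖ ^ 2 ≤ 0 := by linarith
    by_contra hne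
    have : 0 < ‖Y1 x‖ := norm_pos_iff.2 hne
    have : 0 < (rt (5 * φ)).re * ‖Y1 x‖ ^ 2 := by positivity
    linarith
  have hYc : ∀ x, Y x = Y 0 := by
    intro x
    exact is_const_of_deriv_eq_zero (fun x => (hY x).differentiableAt) (fun x => by rw [(hY x).deriv, hY10]) x 0
  have hY0 : ∀ x, Y x = 0 := by
    intro x
    rw [hYc]
    have g3 : Tendsto Y atTop (𝓝 0) := t1.congr fun s => (he _).symm
    exact tendsto_nhds_unique (tendsto_const_nhds.congr fun x => (hYc x).symm) g3
  have hqne : q ≠ 0 := mul_ne_zero I_ne_zero (rt_ne _)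
  -- uniqueness of ODE
  apply hy.2.1
  have hyan : AnalyticOnNhd ℂ y univ := fun w _ => hy.1.analyticAt w
  have hfreq : ∃ᶠ w in 𝓝[≠] (z 0), y w = (fun _ => (0:ℂ)) w := by
    have hinj : Function.Injective z := by
      intro s t hst
      have := mul_left_cancel₀ hqne hst
      have := sub_left_injective this
      exact_mod_cast this
    have ht : Tendsto z (𝓝[≠] 0) (𝓝[≠] (z 0)) :=
      (hzd 0).continuousAt.continuousWithinAt.tendsto_nhdsWithin fun s hs hh => hs (hinj hh)
    exact ht.frequently (Filter.Frequently.of_forall fun s => hY0 s)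
  have := hyan.eqOn_of_preconnected_of_frequently_eq (fun w _ => analyticAt_const) isPreconnected_univ (mem_univ _) hfreq
  funext w
  exact this (mem_univ w)

end PTC

open Complex Filter
namespace PTC
open Topology Set MeasureTheory

theorem re_bound {lam : ℂ} {s : ℝ} (hs : 0 < s) (h : (((3 * s ^ 2 : ℝ) : ℂ), lam) ∈ cubicSpectralLocus) :
    2 * s ^ 3 ≤ lam.re := by
  obtain ⟨x, hx⟩ := numrange h (φ := 0) (η := s) (by rw [add_zero]; exact n18.1) (by rw [add_zero]; exact n18.2)
    (by rw [mul_zero, rt_zero]; simp)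
  simp only [mul_zero, neg_zero, rt_zero, mul_one, one_mul, ofReal_im, ofReal_re, sub_zero] at hx
  nlinarith [mul_nonneg hs.le (sq_nonneg x)]

theorem n30 : |(rt 30).im| < 0.68 * (rt 30).re ∧ |(rt (-30)).im| < 0.68 * (rt (-30)).re := by
  have h1 : (rt 30).im = 1 / 2 := by
    rw [rt_im, show (30 * (Real.pi / 180) : ℝ) = Real.pi / 6 by ring, Real.sin_pi_div_six]
  have h2 : (rt 30).re = √3 / 2 := by
    rw [rt_re, show (30 * (Real.pi / 180) : ℝ) = Real.pi / 6 by ring, Real.cos_pi_div_six]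
  have h3 : 1.73 < √3 := Real.lt_sqrt_of_sq_lt (by norm_num)
  rw [(rt_neg_re 30).1, (rt_neg_re 30).2, abs_neg, h1, h2, abs_of_pos (by norm_num)]
  constructor <;> linarith

theorem n6 : |(rt 6).im| < 0.68 * (rt 6).re ∧ |(rt (-6)).im| < 0.68 * (rt (-6)).re := by
  have hp := Real.pi_lt_d2
  have hp0 := Real.pi_pos
  have h1 : |(rt 6).im| ≤ 0.11 := by
    rw [rt_im]
    refine (Real.abs_sin_le_abs).trans ?_
    rw [abs_of_pos (by positivity)]; linarith
  have h2 : 0.9 ≤ (rt 6).re := by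
    rw [rt_re]
    have := Real.one_sub_sq_div_two_le_cos (x := 6 * (Real.pi / 180))
    nlinarith
  rw [(rt_neg_re 6).1, (rt_neg_re 6).2, abs_neg]
  constructor <;> linarith

theorem lam_re {a lam : ℂ} (h : (a, lam) ∈ cubicSpectralLocus) {t : ℝ} (ht : 0 < t) (ha : ‖a‖ ≤ 0.01 * t ^ 2) :
    -0.01 * t ^ 3 ≤ (rt 36 * lam).re ∧ -0.01 * t ^ 3 ≤ (rt (-36) * lam).re := by
  have h60 : 0 < (rt 60).re := by
    rw [rt_re, show (60 * (Real.pi / 180) : ℝ) = Real.pi / 3 by ring, Real.cos_pi_div_three]; norm_num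
  have key : ∀ (c l : ℂ) (x : ℝ), ‖c‖ = 1 → 3 * (0.1 * t) * x ^ 2 - x * (a * c).im + 0.1 * t * (a * c).re - (0.1 * t) ^ 3 - l.re < 0 →
      -0.01 * t ^ 3 ≤ l.re := by
    intro c l x hc hx
    have hac : ‖a * c‖ ≤ 0.01 * t ^ 2 := by rw [norm_mul, hc, mul_one]; exact ha
    have i1 := (abs_im_le_norm _).trans hac
    have i2 := (abs_re_le_norm _).trans hac
    rw [abs_le] at i2
    have i3 : x * (a * c).im ≤ |x| * (0.01 * t ^ 2) := by
      refine (le_abs_self _).trans ?_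
      rw [abs_mul]; gcongr
    have i4 : x ^ 2 = |x| ^ 2 := (sq_abs x).symm
    have i5 : 0.1 * t * (a * c).re ≥ 0.1 * t * (-(0.01 * t ^ 2)) := by
      apply mul_le_mul_of_nonneg_left i2.1; positivity
    have i6 : |x| * (0.01 * t ^ 2) ≤ 3 * (0.1 * t) * |x| ^ 2 + 0.001 * t ^ 3 := by
      have : 0 ≤ t * (|x| - 0.02 * t) ^ 2 := by positivity
      nlinarith [mul_nonneg ht.le (sq_nonneg |x|)]
    rw [i4] at hx
    nlinarith [pow_pos ht 3]
  constructor
  · obtain ⟨x, hx⟩ := numrange h (φ := -12) (η := 0.1 * t)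
      (by rw [show (18 + -12 : ℝ) = 6 by norm_num]; exact n6.1) (by rw [show (-18 + -12 : ℝ) = -30 by norm_num]; exact n30.2)
      (by rw [show (5 * -12 : ℝ) = -60 by norm_num, (rt_neg_re 60).1]; exact h60)
    rw [show (-(3 * -12) : ℝ) = 36 by norm_num] at hx
    exact key _ _ x (rt_norm _) hx
  · obtain ⟨x, hx⟩ := numrange h (φ := 12) (η := 0.1 * t)
      (by rw [show (18 + 12 : ℝ) = 30 by norm_num]; exact n30.1) (by rw [show (-18 + 12 : ℝ) = -6 by norm_num]; exact n6.2)
      (by rw [show (5 * 12 : ℝ) = 60 by norm_num]; exact h60)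
    rw [show (-(3 * 12) : ℝ) = -36 by norm_num] at hx
    exact key _ _ x (rt_norm _) hx

theorem sin_aux {x : ℝ} (h0 : 0.02 < x) (h1 : x ≤ 0.7 * Real.pi) : 0.01 < Real.sin x := by
  have hp := Real.pi_lt_d2
  have hp0 := Real.pi_gt_three
  rcases le_total x (Real.pi / 2) with h | h
  · have := Real.mul_le_sin (by linarith) h
    refine lt_of_lt_of_le ?_ this
    rw [div_mul_eq_mul_div, lt_div_iff₀ Real.pi_pos]; linarith
  · rw [← Real.sin_pi_sub]
    have := Real.mul_le_sin (x := Real.pi - x) (by linarith) (by linarith)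
    refine lt_of_lt_of_le ?_ this
    rw [div_mul_eq_mul_div, lt_div_iff₀ Real.pi_pos]; linarith

theorem lam_arg {lam : ℂ} {t : ℝ} (ht : 0 < t) (hl : ‖lam‖ = t ^ 3)
    (h1 : -0.01 * t ^ 3 ≤ (rt 36 * lam).re) (h2 : -0.01 * t ^ 3 ≤ (rt (-36) * lam).re) :
    |lam.arg| ≤ 0.3 * Real.pi + 0.02 := by
  have hl' : lam = ((t ^ 3 : ℝ) : ℂ) * Complex.exp (lam.arg * I) := by rw [← hl, norm_mul_exp_arg_mul_I]
  have e : ∀ x : ℝ, (rt x * lam).re = t ^ 3 * Real.cos (lam.arg + x * (Real.pi / 180)) := by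
    intro x
    nth_rewrite 1 [hl']
    rw [rt, show Complex.exp ((x * (Real.pi / 180) : ℝ) * I) * (((t ^ 3 : ℝ) : ℂ) * Complex.exp (lam.arg * I))
      = ((t ^ 3 : ℝ) : ℂ) * (Complex.exp (lam.arg * I) * Complex.exp ((x * (Real.pi / 180) : ℝ) * I)) by ring, ← Complex.exp_add, ← add_mul,
      ← ofReal_add, re_ofReal_mul, Complex.exp_ofReal_mul_I_re]
  rw [e] at h1 h2
  have ht3 : 0 < t ^ 3 := by positivity
  have g1 : -0.01 ≤ Real.cos (lam.arg + 36 * (Real.pi / 180)) := by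
    by_contra hh; push Not at hh; nlinarith
  have g2 : -0.01 ≤ Real.cos (lam.arg + -36 * (Real.pi / 180)) := by
    by_contra hh; push Not at hh; nlinarith
  have a1 := neg_pi_lt_arg lam
  have a2 := arg_le_pi lam
  rw [abs_le]
  constructor
  · by_contra hh
    push Not at hh
    have := sin_aux (x := -lam.arg - 0.3 * Real.pi) (by linarith) (by linarith)
    rw [← Real.cos_pi_div_two_sub, show Real.pi / 2 - (-lam.arg - 0.3 * Real.pi) = (lam.arg + -36 * (Real.pi / 180)) + Real.pi by ring,
      Real.cos_add_pi] at this
    linarith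
  · by_contra hh
    push Not at hh
    have := sin_aux (x := lam.arg - 0.3 * Real.pi) (by linarith) (by linarith)
    rw [← Real.cos_pi_div_two_sub, show Real.pi / 2 - (lam.arg - 0.3 * Real.pi) = Real.pi - (lam.arg + 36 * (Real.pi / 180)) by ring,
      Real.cos_pi_sub] at this
    linarith

/-- the point `ν = λ^(5/6)` -/
theorem nu_exists {lam : ℂ} {t : ℝ} (ht : 0 < t) (hl : ‖lam‖ = t ^ 3) (h : |lam.arg| ≤ 0.3 * Real.pi + 0.02) :
    ∃ ν : ℂ, 0 < ν.re ∧ |ν.im| ≤ 1.04 * ν.re ∧ nn ν ^ 12 = lam ∧ ‖nn ν ^ 8‖ = t ^ 2 ∧ ‖ν‖ ^ 2 = t ^ 5 := by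
  have hl0 : lam ≠ 0 := by rw [← norm_pos_iff, hl]; positivity
  have hp := Real.pi_lt_d2
  have hp0 := Real.pi_gt_three
  set β := 5 / 6 * lam.arg with hβ
  have hb : |β| ≤ Real.pi / 4 + 0.017 := by
    rw [hβ, abs_mul, abs_of_pos (by norm_num : (0:ℝ) < 5/6)]; linarith
  have hlog : Complex.log lam = Real.log ‖lam‖ + lam.arg * I := rfl
  have hν : Complex.exp (5 / 6 * Complex.log lam) = ((Real.exp (5 / 6 * Real.log ‖lam‖) : ℝ) : ℂ) * Complex.exp (β * I) := by
    rw [ofReal_exp, ← Complex.exp_add, hlog, hβ]; congr 1; push_cast; ring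
  set ν := Complex.exp (5 / 6 * Complex.log lam) with hνd
  set r := Real.exp (5 / 6 * Real.log ‖lam‖) with hr
  have hr0 : 0 < r := Real.exp_pos _
  have hre : ν.re = r * Real.cos β := by rw [hν, re_ofReal_mul, Complex.exp_ofReal_mul_I_re]
  have him : ν.im = r * Real.sin β := by rw [hν, im_ofReal_mul, Complex.exp_ofReal_mul_I_im]
  have hcos : 0 < Real.cos β := by
    rw [abs_le] at hb
    apply Real.cos_pos_of_mem_Ioo; constructor <;> linarith
  have hsin : |Real.sin β| ≤ 1.04 * Real.cos β := by
    rw [← Real.cos_abs, Real.abs_sin_eq_sin_abs_of_abs_le_pi (by linarith)]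
    set s := |β| - Real.pi / 4 with hs
    have hs1 : s ≤ 0.017 := by linarith
    have hs2 : -(Real.pi / 4) ≤ s := by linarith [abs_nonneg β]
    rw [show |β| = s + Real.pi / 4 by ring, Real.sin_add, Real.cos_add, Real.cos_pi_div_four, Real.sin_pi_div_four]
    have h2 : 0 < √2 / 2 := by positivity
    have key : Real.sin s + Real.cos s ≤ 1.04 * (Real.cos s - Real.sin s) := by
      rcases le_total 0 s with h0 | h0
      · have := Real.sin_le h0
        have := Real.one_sub_sq_div_two_le_cos (x := s)
        nlinarith
      · have := Real.sin_nonpos_of_nonpos_of_neg_pi_le h0 (by linarith)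
        have := Real.cos_nonneg_of_mem_Icc (x := s) ⟨by linarith, by linarith⟩
        nlinarith
    nlinarith
  have hlogν : Complex.log ν = 5 / 6 * Complex.log lam := by
    rw [hνd]
    have him : (5 / 6 * Complex.log lam).im = β := by
      rw [show (5 / 6 : ℂ) = ((5 / 6 : ℝ) : ℂ) by push_cast; rfl, im_ofReal_mul, log_im]
    rw [abs_le] at hb
    apply Complex.log_exp
    · rw [him]; linarith
    · rw [him]; linarith
  have hnn : nn ν = Complex.exp (Complex.log lam / 12) := by
    rw [nn, Complex.cpow_def_of_ne_zero (Complex.exp_ne_zero _), hlogν]; congr 1; ring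
  have hrl : Real.log ‖lam‖ = 3 * Real.log t := by rw [hl, Real.log_pow]; push_cast; ring
  have htl : Real.exp (Real.log t) = t := Real.exp_log ht
  refine ⟨ν, by rw [hre]; positivity, ?_, ?_, ?_, ?_⟩
  · rw [hre, him, abs_mul, abs_of_pos hr0]
    nlinarith
  · rw [hnn, ← Complex.exp_nat_mul, show ((12:ℕ):ℂ) * (Complex.log lam / 12) = Complex.log lam by push_cast; ring, Complex.exp_log hl0]
  · rw [hnn, ← Complex.exp_nat_mul, norm_exp, show (((8:ℕ):ℂ) * (Complex.log lam / 12)) = ((2 / 3 : ℝ) : ℂ) * Complex.log lam by push_cast; ring,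
      re_ofReal_mul, log_re, hrl, show 2 / 3 * (3 * Real.log t) = (2:ℕ) * Real.log t by push_cast; ring, Real.exp_nat_mul, htl]
  · rw [hνd, norm_exp, ← Real.exp_nat_mul, show (5 / 6 : ℂ) = ((5 / 6 : ℝ) : ℂ) by push_cast; rfl,
      re_ofReal_mul, log_re, hrl, show ((2:ℕ):ℝ) * (5 / 6 * (3 * Real.log t)) = (5:ℕ) * Real.log t by push_cast; ring, Real.exp_nat_mul, htl]

end PTC

open Complex Filter
namespace PTC
open Topology Set MeasureTheory

theorem main_piece : ∃ S ⊆ cubicSpectralLocus, IsPreconnected S ∧ S.Nonempty ∧ ∃ ε, 0 < ε ∧ ∃ K : ℝ,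
    ∀ (a lam : ℂ) (t : ℝ), 0 < t → ‖lam‖ = t ^ 3 → K < t → ‖a‖ ≤ ε * t ^ 2 →
      (a, lam) ∈ cubicSpectralLocus → (a, lam) ∈ S := by
  obtain ⟨L, hG, hE, b, hb, hT⟩ := LD_exists
  obtain ⟨S, hS, hp, hn, hSE, δ2, hδ2, R2, hR⟩ := leaves L
  refine ⟨GG '' S, ?_, hp.image _ (hG.mono hS), hn.image _, min 0.01 (δ2 / 2), by positivity, max 1 (R2 / b), ?_⟩
  · rintro _ ⟨x, hx, rfl⟩
    rw [locus_eq]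
    exact (hE x (hS hx)).2 (hSE x hx)
  · intro a lam t ht hl hK ha hZ
    rw [max_lt_iff] at hK
    obtain ⟨k1, k2⟩ := hK
    have ha1 : ‖a‖ ≤ 0.01 * t ^ 2 := ha.trans (by gcongr; exact min_le_left _ _)
    have ha2 : ‖a‖ ≤ δ2 / 2 * t ^ 2 := ha.trans (by gcongr; exact min_le_right _ _)
    obtain ⟨r1, r2⟩ := lam_re hZ ht ha1
    obtain ⟨ν, n1, n2, n3, n4, n5⟩ := nu_exists ht hl (lam_arg ht hl r1 r2)
    have hνt : t ≤ ‖ν‖ := by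
      refine le_of_sq_le_sq ?_ (norm_nonneg _)
      rw [n5]; exact pow_le_pow_right₀ k1.le (by norm_num)
    have hn8 : nn ν ^ 8 ≠ 0 := by rw [← norm_pos_iff, n4]; positivity
    set κ := -a / nn ν ^ 8 with hκ
    have hκ2 : ‖κ‖ < δ2 := by
      rw [hκ, norm_div, norm_neg, n4, div_lt_iff₀ (by positivity)]
      have : 0 < t ^ 2 := by positivity
      nlinarith
    have hκΩ : κ ∈ L.Ω := by
      have : ∃ w, w ∈ Wd R2 := by
        refine ⟨((max 1 (R2 + 1) : ℝ) : ℂ), ?_, ?_, ?_⟩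
        · rw [ofReal_re]; positivity
        · rw [ofReal_re, ofReal_im, abs_zero]; positivity
        · rw [norm_real, Real.norm_of_nonneg (by positivity)]
          have := le_max_right 1 (R2 + 1); linarith
      obtain ⟨w, hw⟩ := this
      exact (hR κ w hκ2 hw).1
    obtain ⟨t1, t2⟩ := hT κ hκΩ
    have hw := sec_mul hb n1 n2 (lt_of_lt_of_le k2 hνt) t1 t2
    obtain ⟨-, hwW, hmem⟩ := hR κ _ hκ2 hw
    have hT0 : TT κ ≠ 0 := by
      intro h0; rw [h0] at t2; simp at t2; linarith
    have hGG : GG (κ, ν * TT κ) = (a, lam) := by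
      rw [GG]
      dsimp only
      rw [mul_div_cancel_right₀ _ hT0, n3, hκ, div_mul_cancel₀ _ hn8, neg_neg]
    refine ⟨_, hmem ?_, hGG⟩
    rw [← hE (κ, ν * TT κ) ⟨hκΩ, hwW⟩, hGG]
    rw [locus_eq] at hZ
    exact hZ

end PTC

open Complex Filter
namespace PTC
open Topology Set MeasureTheory

/-- divide out a zero of an entire function -/
theorem divide_zero {g : ℂ → ℂ} (hg : Differentiable ℂ g) {w : ℂ} (hw : analyticOrderAt g w ≠ ⊤) :
    ∃ h : ℂ → ℂ, Differentiable ℂ h ∧ h w ≠ 0 ∧ ∀ z, g z = (z - w) ^ analyticOrderNatAt g w * h z := by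
  obtain ⟨g1, h1, h2, h3⟩ := (hg.analyticAt w).analyticOrderAt_ne_top.1 hw
  set m := analyticOrderNatAt g w with hm
  classical
  let h : ℂ → ℂ := fun z => if z = w then g1 w else g z / (z - w) ^ m
  have hhw : h w = g1 w := by simp [h]
  have hh : ∀ z, z ≠ w → h z = g z / (z - w) ^ m := fun z hz => by simp [h, hz]
  have hloc : h =ᶠ[𝓝 w] g1 := by
    filter_upwards [h3] with z hz
    by_cases hzw : z = w
    · rw [hzw, hhw]
    · rw [hh z hzw, hz, smul_eq_mul, mul_div_cancel_left₀]
      exact pow_ne_zero _ (sub_ne_zero.2 hzw)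
  refine ⟨h, fun z => ?_, by rw [hhw]; exact h2, fun z => ?_⟩
  · by_cases hzw : z = w
    · rw [hzw]
      exact h1.differentiableAt.congr_of_eventuallyEq hloc
    · have : h =ᶠ[𝓝 z] fun z => g z / (z - w) ^ m := by
        filter_upwards [isOpen_ne.mem_nhds hzw] with x hx using hh x hx
      refine DifferentiableAt.congr_of_eventuallyEq ?_ this
      exact (hg z).div (by fun_prop) (pow_ne_zero _ (sub_ne_zero.2 hzw))
  · by_cases hzw : z = w
    · have := h3.self_of_nhds
      rw [hzw, hhw, this]; rfl
    · rw [hh z hzw, mul_div_cancel₀]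
      exact pow_ne_zero _ (sub_ne_zero.2 hzw)

theorem order_ne_top {g : ℂ → ℂ} (hg : Differentiable ℂ g) {z0 : ℂ} (h0 : g z0 ≠ 0) (w : ℂ) :
    analyticOrderAt g w ≠ ⊤ := by
  intro h
  rw [analyticOrderAt_eq_top] at h
  have han : AnalyticOnNhd ℂ g univ := fun z _ => hg.analyticAt z
  have := han.eqOn_zero_of_preconnected_of_eventuallyEq_zero isPreconnected_univ (mem_univ w) h
  exact h0 (this (mem_univ z0))

theorem argp (j : ℕ) {c : ℂ} {r : ℝ} (hr : 0 < r) (S : Finset ℂ) : ∀ {g : ℂ → ℂ}, Differentiable ℂ g →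
    (∀ z ∈ Metric.closedBall c r, g z = 0 ↔ z ∈ S) → (∀ z ∈ S, z ∈ Metric.ball c r) →
    (∮ z in C(c, r), z ^ j * (deriv g z / g z)) = 2 * Real.pi * I * ∑ w ∈ S, (analyticOrderNatAt g w : ℂ) * w ^ j := by
  classical
  have hcl : closure (Metric.ball c r) = Metric.closedBall c r := closure_ball _ hr.ne'
  have hdd : ∀ {g : ℂ → ℂ}, Differentiable ℂ g → Differentiable ℂ (deriv g) := fun hg =>
    (hg.contDiff (n := 2)).differentiable_deriv_two
  induction S using Finset.induction_on with
  | empty =>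
    intro g hg hS _
    rw [Finset.sum_empty, mul_zero]
    apply DiffContOnCl.circleIntegral_eq_zero hr.le
    apply DifferentiableOn.diffContOnCl
    rw [hcl]
    intro z hz
    have hne : g z ≠ 0 := fun h => by simpa using (hS z hz).1 h
    have := (hdd hg z).div (hg z) hne
    exact ((differentiableAt_id.pow j).mul this).differentiableWithinAt
  | insert w S hwS ih =>
    intro g hg hS hb
    have hwb := hb w (Finset.mem_insert_self _ _)
    have hsph : ∀ z ∈ Metric.sphere c r, g z ≠ 0 := by
      intro z hz h
      have := hb z ((hS z (Metric.sphere_subset_closedBall hz)).1 h)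
      rw [Metric.mem_ball] at this
      rw [Metric.mem_sphere] at hz
      linarith
    have hz0 : c + r ∈ Metric.sphere c r := by simp [abs_of_pos hr]
    have htop := order_ne_top hg (hsph _ hz0)
    obtain ⟨h, hh, hhw, hfac⟩ := divide_zero hg (htop w)
    set m := analyticOrderNatAt g w with hm
    have hgh : ∀ z, z ≠ w → (g z = 0 ↔ h z = 0) := by
      intro z hz
      rw [hfac z, mul_eq_zero, or_iff_right]
      exact pow_ne_zero _ (sub_ne_zero.2 hz)
    have hneS : ∀ z ∈ S, z ≠ w := fun z hz h => hwS (h ▸ hz)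
    have h1 := ih hh (fun z hz => by
      by_cases hzw : z = w
      · rw [hzw]; exact iff_of_false hhw hwS
      · rw [← hgh z hzw, hS z hz, Finset.mem_insert]; tauto) (fun z hz => hb z (Finset.mem_insert_of_mem hz))
    have hord : ∀ z ∈ S, analyticOrderNatAt g z = analyticOrderNatAt h z := by
      intro z hz
      have e1 : g = (fun z => (z - w) ^ m) * h := funext hfac
      have an1 : AnalyticAt ℂ (fun z => (z - w) ^ m) z := by fun_prop
      have o1 : analyticOrderAt (fun z => (z - w) ^ m) z = 0 :=
        an1.analyticOrderAt_eq_zero.2 (pow_ne_zero _ (sub_ne_zero.2 (hneS z hz)))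
      rw [analyticOrderNatAt, analyticOrderNatAt, e1, analyticOrderAt_mul an1 (hh.analyticAt z), o1, zero_add]
    rw [Finset.sum_insert hwS, Finset.sum_congr rfl (fun z hz => by rw [hord z hz]), mul_add, ← h1]
    have hwne : ∀ z ∈ Metric.sphere c r, z ≠ w := by
      intro z hz h
      rw [Metric.mem_ball, ← h] at hwb
      rw [Metric.mem_sphere] at hz
      linarith
    have hhne : ∀ z ∈ Metric.sphere c r, h z ≠ 0 := fun z hz => fun h0 =>
      hsph z hz ((hgh z (hwne z hz)).2 h0)
    have e2 : ∀ z ∈ Metric.sphere c r, z ^ j * (deriv g z / g z) =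
        (z - w)⁻¹ • (m * z ^ j) + z ^ j * (deriv h z / h z) := by
      intro z hz
      have hzw := sub_ne_zero.2 (hwne z hz)
      have hd : HasDerivAt g (m * (z - w) ^ (m - 1) * h z + (z - w) ^ m * deriv h z) z := by
        have := (((hasDerivAt_id z).sub_const w).pow m).mul (hh z).hasDerivAt
        refine (this.congr_of_eventuallyEq (Filter.Eventually.of_forall hfac)).congr_deriv ?_
        simp
      rw [hd.deriv, hfac z, smul_eq_mul]
      have h5 := hhne z hz
      rcases m with _ | m
      · simp
      · rw [Nat.add_sub_cancel, pow_succ]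
        field_simp
    rw [circleIntegral.integral_congr hr.le e2, circleIntegral.integral_add]
    · congr 1
      rw [DiffContOnCl.circleIntegral_sub_inv_smul _ hwb, smul_eq_mul]
      exact DifferentiableOn.diffContOnCl (by fun_prop)
    · apply ContinuousOn.circleIntegrable hr.le
      intro z hz
      have hzw := sub_ne_zero.2 (hwne z hz)
      have c1 : ContinuousAt (fun z : ℂ => (z - w)⁻¹) z := ContinuousAt.inv₀ (by fun_prop) hzw
      have c2 : ContinuousAt (fun z : ℂ => (m : ℂ) * z ^ j) z := by fun_prop
      exact (c1.smul c2).continuousWithinAt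
    · apply ContinuousOn.circleIntegrable hr.le
      intro z hz
      exact (ContinuousAt.mul (by fun_prop) ((hdd hh z).continuousAt.div (hh z).continuousAt (hhne z hz))).continuousWithinAt

theorem hol_circle {E : Type*} [NormedAddCommGroup E] [NormedSpace ℂ E] [ProperSpace E] {W : Set E} (hW : IsOpen W)
    {c : ℂ} {r : ℝ} (hr : 0 ≤ r) {Φ : E → ℂ → ℂ} (hc : ContinuousOn (fun x : E × ℂ => Φ x.1 x.2) (W ×ˢ Metric.sphere c r))
    (hh : ∀ z ∈ Metric.sphere c r, HolOn W (fun w => Φ w z)) : HolOn W (fun w => ∮ z in C(c, r), Φ w z) := by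
  have hloc : ∀ w ∈ W, ∃ V, IsOpen V ∧ w ∈ V ∧ HolOn V (fun w => ∮ z in C(c, r), Φ w z) := by
    intro w hw
    obtain ⟨ρ, hρ, hρW⟩ := Metric.isOpen_iff.1 hW w hw
    have hsub : Metric.closedBall w (ρ / 2) ⊆ W :=
      (Metric.closedBall_subset_ball (by linarith)).trans hρW
    have hK : IsCompact (Metric.closedBall w (ρ / 2) ×ˢ Metric.sphere c r) :=
      (isCompact_closedBall _ _).prod (isCompact_sphere _ _)
    obtain ⟨M, hM⟩ := hK.exists_bound_of_continuousOn (hc.mono (prod_mono_left hsub))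
    have hbs : Metric.ball w (ρ / 2) ⊆ W := Metric.ball_subset_closedBall.trans hsub
    refine ⟨Metric.ball w (ρ / 2), Metric.isOpen_ball, Metric.mem_ball_self (by positivity), ?_⟩
    have e : (fun w => ∮ z in C(c, r), Φ w z) = fun w => ∫ θ in Ioc 0 (2 * Real.pi), deriv (circleMap c r) θ * Φ w (circleMap c r θ) := by
      funext w
      rw [circleIntegral, intervalIntegral.integral_of_le (by positivity)]
      rfl
    rw [e]
    have hcs : ∀ θ, circleMap c r θ ∈ Metric.sphere c r := fun θ => circleMap_mem_sphere c hr θ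
    refine HolOn.integral (B := fun _ => r * M) (integrable_const _) ?_ ?_ ?_
    · intro w' hw'
      have : Continuous fun θ => deriv (circleMap c r) θ * Φ w' (circleMap c r θ) := by
        refine Continuous.mul ?_ ?_
        · rw [show deriv (circleMap c r) = fun θ => circleMap 0 r θ * I from funext fun θ => deriv_circleMap c r θ]
          exact ((continuous_circleMap 0 r).mul continuous_const)
        · have h1 := hc.comp_continuous (f := fun θ : ℝ => (w', circleMap c r θ))
            (continuous_const.prodMk (continuous_circleMap c r)) (fun θ => ⟨hbs hw', hcs θ⟩)
          exact h1
      exact this.aestronglyMeasurable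
    · refine Filter.Eventually.of_forall fun θ => ?_
      exact (HolOn.const _).mul ((hh _ (hcs θ)).mono hbs)
    · refine Filter.Eventually.of_forall fun θ w' hw' => ?_
      have h1 := hM (w', circleMap c r θ) ⟨Metric.ball_subset_closedBall hw', hcs θ⟩
      rw [norm_mul, deriv_circleMap, norm_mul, norm_I, mul_one, norm_circleMap_zero, abs_of_nonneg hr]
      exact mul_le_mul_of_nonneg_left h1 hr
  refine HolOn.of_local hW fun w hw => ?_
  obtain ⟨V, h1, h2, h3⟩ := hloc w hw
  exact ⟨V, h1, h2, h3.mono inter_subset_left⟩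

end PTC

open Complex Filter
namespace PTC
open Topology Set MeasureTheory

theorem deriv_hol {F : ℂ × ℂ → ℂ} (hF : HolOn univ F) :
    HolOn univ (fun w : ℂ × ℂ => deriv (fun z => F (w.1, z)) w.2) := by
  have hFc : Continuous F := continuousOn_univ.1 hF.1
  have hne : ∀ z ∈ Metric.sphere (0:ℂ) 1, z ^ 2 ≠ 0 := by
    intro z hz
    apply pow_ne_zero
    rw [← norm_pos_iff, mem_sphere_zero_iff_norm.1 hz]; exact one_pos
  have h := hol_circle (E := ℂ × ℂ) isOpen_univ (c := 0) (r := 1) zero_le_one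
    (Φ := fun w z => (z ^ 2)⁻¹ * F (w.1, w.2 + z)) ?_ ?_
  · refine ((HolOn.const (2 * Real.pi * I : ℂ)⁻¹).mul h).congr fun w _ => ?_
    have hd : DifferentiableOn ℂ (fun z => F (w.1, w.2 + z)) univ :=
      hF.2 univ (fun z => (w.1, w.2 + z)) isOpen_univ (by fun_prop) (mapsTo_univ _ _)
    have := Complex.two_pi_I_inv_smul_circleIntegral_sub_sq_inv_smul_of_differentiable (U := univ) (c := 0) (w₀ := 0) (R := 1)
      isOpen_univ (subset_univ _) hd (Metric.mem_ball_self one_pos)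
    simp only [sub_zero, smul_eq_mul] at this
    rw [this, deriv_comp_const_add (fun z => F (w.1, z)), add_zero]
  · refine ContinuousOn.mul ?_ (Continuous.continuousOn (by fun_prop))
    exact ContinuousOn.inv₀ (by fun_prop) fun x hx => hne _ hx.2
  · intro z hz
    exact (HolOn.const _).mul (hF.comp_diff (φ := fun w : ℂ × ℂ => (w.1, w.2 + z)) (by fun_prop) (mapsTo_univ _ _))

/-- power sums of the points of `Z1` over `a`, with multiplicity -/
noncomputable def TS (F : ℂ × ℂ → ℂ) (Z1 : Set (ℂ × ℂ)) (j : ℕ) (a : ℂ) : ℂ :=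
  ∑ᶠ z ∈ {z | (a, z) ∈ Z1}, (analyticOrderNatAt (fun z => F (a, z)) z : ℂ) * z ^ j

structure Spl (F : ℂ × ℂ → ℂ) (Z1 Z2 : Set (ℂ × ℂ)) (C : ℝ) : Prop where
  hF : HolOn univ F
  ne : ∀ a, ∃ z, F (a, z) ≠ 0
  c1 : IsClosed Z1
  c2 : IsClosed Z2
  dj : ∀ x, x ∈ Z1 → x ∈ Z2 → False
  un : ∀ x, F x = 0 ↔ x ∈ Z1 ∨ x ∈ Z2
  bd : ∀ a z, (a, z) ∈ Z1 → ‖z‖ ^ 2 ≤ C * (1 + ‖a‖ ^ 3)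

namespace Spl
variable {F : ℂ × ℂ → ℂ} {Z1 Z2 : Set (ℂ × ℂ)} {C : ℝ}

theorem slice (h : Spl F Z1 Z2 C) (a : ℂ) : Differentiable ℂ (fun z => F (a, z)) :=
  differentiableOn_univ.1 (h.hF.2 univ (fun z => (a, z)) isOpen_univ (by fun_prop) (mapsTo_univ _ _))

theorem isol (h : Spl F Z1 Z2 C) (a z : ℂ) : ∀ᶠ w in 𝓝[≠] z, F (a, w) ≠ 0 := by
  by_contra hc
  rw [Filter.not_eventually] at hc
  obtain ⟨z0, hz0⟩ := h.ne a
  have han : AnalyticOnNhd ℂ (fun z => F (a, z)) univ := fun z _ => (h.slice a).analyticAt z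
  have := han.eqOn_zero_of_preconnected_of_frequently_eq_zero isPreconnected_univ (mem_univ z) (hc.mono fun w hw => by simpa using hw)
  exact hz0 (this (mem_univ z0))

theorem bd' (h : Spl F Z1 Z2 C) {a z : ℂ} (hz : (a, z) ∈ Z1) : ‖z‖ ≤ C * (1 + ‖a‖ ^ 3) + 1 := by
  have := h.bd a z hz
  nlinarith [sq_nonneg (‖z‖ - 1)]

theorem fin (h : Spl F Z1 Z2 C) (a : ℂ) : {z | (a, z) ∈ Z1}.Finite := by
  by_contra hinf
  have hinf : {z | (a, z) ∈ Z1}.Infinite := hinf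
  have hsub : {z | (a, z) ∈ Z1} ⊆ Metric.closedBall 0 (C * (1 + ‖a‖ ^ 3) + 1) := fun z hz =>
    mem_closedBall_zero_iff.2 (h.bd' hz)
  obtain ⟨z, -, hz⟩ := hinf.exists_accPt_of_subset_isCompact (isCompact_closedBall _ _) hsub
  rw [accPt_iff_frequently_nhdsNE] at hz
  exact hz ((h.isol a z).mono fun w hw hw' => hw ((h.un _).2 (Or.inl hw')))

theorem TS_eq (h : Spl F Z1 Z2 C) (j : ℕ) (a : ℂ) : TS F Z1 j a =
    ∑ z ∈ (h.fin a).toFinset, (analyticOrderNatAt (fun z => F (a, z)) z : ℂ) * z ^ j := by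
  rw [TS, finsum_mem_eq_finite_toFinset_sum _ (h.fin a)]

theorem TS_diff (h : Spl F Z1 Z2 C) (j : ℕ) : Differentiable ℂ (TS F Z1 j) := by
  classical
  intro a0
  set S0 := (h.fin a0).toFinset with hS0
  have hS0m : ∀ z, z ∈ S0 ↔ (a0, z) ∈ Z1 := by intro z; simp [hS0]
  have hFc : Continuous F := continuousOn_univ.1 h.hF.1
  -- the radius
  have hr0 : ∃ r, 0 < r ∧ ∀ c ∈ S0, ∀ z ∈ Metric.closedBall c (2 * r), F (a0, z) = 0 → z = c := by
    have h1 : ∀ c ∈ S0, ∀ᶠ r in 𝓝[>] (0:ℝ), ∀ z ∈ Metric.closedBall c (2 * r), F (a0, z) = 0 → z = c := by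
      intro c _
      have := h.isol a0 c
      rw [eventually_nhdsWithin_iff, Metric.eventually_nhds_iff] at this
      obtain ⟨ε, hε, hb⟩ := this
      filter_upwards [Ioo_mem_nhdsGT (show (0:ℝ) < ε / 2 by positivity)] with r hr z hz h0
      by_contra hne
      rw [Metric.mem_closedBall] at hz
      exact hb (lt_of_le_of_lt hz (by linarith [hr.2])) hne h0
    have h2 := (Filter.eventually_all_finset S0).2 h1
    obtain ⟨r, hr, hr'⟩ := (h2.and self_mem_nhdsWithin).exists
    exact ⟨r, hr', hr⟩
  obtain ⟨r, hr, hiso⟩ := hr0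
  have hiso' : ∀ c ∈ S0, ∀ z ∈ Metric.closedBall c r, F (a0, z) = 0 → z = c := fun c hc z hz =>
    hiso c hc z (Metric.closedBall_subset_closedBall (by linarith) hz)
  -- neighbourhoods
  have tube : ∀ (K : Set ℂ) (U : Set (ℂ × ℂ)), IsCompact K → IsOpen U → (∀ z ∈ K, (a0, z) ∈ U) →
      ∀ᶠ a in 𝓝 a0, ∀ z ∈ K, (a, z) ∈ U := by
    intro K U hK hU hm
    refine hK.eventually_forall_of_forall_eventually fun z hz => ?_
    exact hU.mem_nhds (hm z hz)
  have hA : ∀ᶠ a in 𝓝 a0, ∀ c ∈ S0, ∀ z ∈ Metric.sphere c r, F (a, z) ≠ 0 := by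
    refine (Filter.eventually_all_finset S0).2 fun c hc => ?_
    refine tube _ {x | F x ≠ 0} (isCompact_sphere _ _) (isOpen_ne_fun hFc continuous_const) ?_
    intro z hz h0
    have := hiso' c hc z (Metric.sphere_subset_closedBall hz) h0
    rw [this, Metric.mem_sphere, dist_self] at hz
    linarith
  have hB : ∀ᶠ a in 𝓝 a0, ∀ c ∈ S0, ∀ z ∈ Metric.closedBall c r, (a, z) ∉ Z2 := by
    refine (Filter.eventually_all_finset S0).2 fun c hc => ?_
    refine tube _ Z2ᶜ (isCompact_closedBall _ _) h.c2.isOpen_compl ?_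
    intro z hz h0
    have := hiso' c hc z hz ((h.un _).2 (Or.inr h0))
    rw [this] at h0
    exact h.dj _ ((hS0m c).1 hc) h0
  have hD : ∀ᶠ a in 𝓝 a0, ∀ z, (a, z) ∈ Z1 → ∃ c ∈ S0, z ∈ Metric.ball c r := by
    set M := |C| * (1 + (‖a0‖ + 1) ^ 3) + 1 with hM
    have hK : IsCompact (Metric.closedBall (0:ℂ) M \ ⋃ c ∈ S0, Metric.ball c r) :=
      (isCompact_closedBall _ _).diff (isOpen_biUnion fun _ _ => Metric.isOpen_ball)
    have h1 := tube _ Z1ᶜ hK h.c1.isOpen_compl (by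
      intro z hz h0
      apply hz.2
      simp only [mem_iUnion]
      exact ⟨z, (hS0m z).2 h0, Metric.mem_ball_self hr⟩)
    filter_upwards [h1, Metric.ball_mem_nhds a0 one_pos] with a ha hab z hz
    by_contra hcon
    refine ha z ⟨?_, ?_⟩ hz
    · rw [mem_closedBall_zero_iff]
      refine (h.bd' hz).trans ?_
      rw [hM]
      have : ‖a‖ ≤ ‖a0‖ + 1 := by
        rw [Metric.mem_ball, dist_eq_norm] at hab
        have := norm_sub_norm_le a a0
        linarith
      gcongr
      exact le_abs_self C
    · simp only [mem_iUnion]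
      rintro ⟨c, hc, hz⟩
      exact hcon ⟨c, hc, hz⟩
  obtain ⟨ρ, hρ, hall⟩ := Metric.eventually_nhds_iff_ball.1 (hA.and (hB.and hD))
  -- the integral representation
  have hrep : ∀ a ∈ Metric.ball a0 ρ, TS F Z1 j a = (2 * Real.pi * I : ℂ)⁻¹ *
      ∑ c ∈ S0, ∮ z in C(c, r), z ^ j * (deriv (fun z => F (a, z)) z / F (a, z)) := by
    intro a ha
    obtain ⟨g1, g2, g3⟩ := hall a ha
    set S := (h.fin a).toFinset with hS
    have hSm : ∀ z, z ∈ S ↔ (a, z) ∈ Z1 := by intro z; simp [hS]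
    have e1 : ∀ c ∈ S0, (∮ z in C(c, r), z ^ j * (deriv (fun z => F (a, z)) z / F (a, z))) =
        2 * Real.pi * I * ∑ w ∈ S.filter (fun z => z ∈ Metric.ball c r), (analyticOrderNatAt (fun z => F (a, z)) w : ℂ) * w ^ j := by
      intro c hc
      refine argp j hr _ (h.slice a) (fun z hz => ?_) (fun z hz => (Finset.mem_filter.1 hz).2)
      rw [Finset.mem_filter, hSm, h.un]
      constructor
      · intro h0
        have h1 : (a, z) ∈ Z1 := h0.resolve_right (g2 c hc z hz)
        refine ⟨h1, ?_⟩
        rw [Metric.mem_ball]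
        refine lt_of_le_of_ne hz fun he => ?_
        exact g1 c hc z he ((h.un _).2 (Or.inl h1))
      · rintro ⟨h0, -⟩; exact Or.inl h0
    rw [Finset.sum_congr rfl e1, ← Finset.mul_sum, ← mul_assoc, inv_mul_cancel₀ (by simp [Real.pi_ne_zero]), one_mul, h.TS_eq, ← hS]
    rw [← Finset.sum_biUnion]
    · refine Finset.sum_congr ?_ fun _ _ => rfl
      ext z
      simp only [Finset.mem_biUnion, Finset.mem_filter]
      constructor
      · intro hz
        obtain ⟨c, hc, hzc⟩ := g3 z ((hSm z).1 hz)
        exact ⟨c, hc, hz, hzc⟩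
      · rintro ⟨c, -, hz, -⟩; exact hz
    · intro c hc c' hc' hne
      rw [Function.onFun, Finset.disjoint_left]
      intro z hz hz'
      have h1 := (Finset.mem_filter.1 hz).2
      have h2 := (Finset.mem_filter.1 hz').2
      apply hne
      symm
      refine hiso c hc c' ?_ ((h.un _).2 (Or.inl ((hS0m c').1 hc')))
      rw [Metric.mem_ball] at h1 h2
      rw [Metric.mem_closedBall]
      have := dist_triangle_left c' c z
      linarith
  have hdiff : DifferentiableOn ℂ (fun a => (2 * Real.pi * I : ℂ)⁻¹ *
      ∑ c ∈ S0, ∮ z in C(c, r), z ^ j * (deriv (fun z => F (a, z)) z / F (a, z))) (Metric.ball a0 ρ) := by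
    refine DifferentiableOn.const_mul ?_ _
    refine DifferentiableOn.fun_sum fun c hc => ?_
    have hdF := deriv_hol h.hF
    have hdFc : Continuous (fun w : ℂ × ℂ => deriv (fun z => F (w.1, z)) w.2) := continuousOn_univ.1 hdF.1
    have hh := hol_circle (E := ℂ) (W := Metric.ball a0 ρ) Metric.isOpen_ball (c := c) hr.le
      (Φ := fun a z => z ^ j * (deriv (fun z => F (a, z)) z / F (a, z))) ?_ ?_
    · exact hh.2 (Metric.ball a0 ρ) id Metric.isOpen_ball differentiableOn_id (mapsTo_id _)
    · refine ContinuousOn.mul (by fun_prop) (ContinuousOn.div hdFc.continuousOn hFc.continuousOn ?_)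
      intro x hx
      exact (hall x.1 hx.1).1 c hc x.2 hx.2
    · intro z hz
      apply HolOn.of_diff
      refine DifferentiableOn.const_mul ?_ _
      refine DifferentiableOn.div ?_ ?_ fun a ha => (hall a ha).1 c hc z hz
      · exact hdF.2 _ (fun a => (a, z)) Metric.isOpen_ball (by fun_prop) (mapsTo_univ _ _)
      · exact h.hF.2 _ (fun a => (a, z)) Metric.isOpen_ball (by fun_prop) (mapsTo_univ _ _)
  have hnb : Metric.ball a0 ρ ∈ 𝓝 a0 := Metric.ball_mem_nhds _ hρ
  exact (hdiff.differentiableAt hnb).congr_of_eventuallyEq (by filter_upwards [hnb] with a ha using hrep a ha)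

end Spl
end PTC

open Complex Filter
namespace PTC
open Topology Set MeasureTheory

theorem affine_of_growth {f : ℂ → ℂ} (hf : Differentiable ℂ f) {B : ℝ} (hB : 0 ≤ B)
    (hb : ∀ a, ‖f a‖ ^ 2 ≤ B * (1 + ‖a‖ ^ 3)) : ∃ p q : ℂ, ∀ a, f a = p + q * a := by
  have h2 : ∀ c, iteratedDeriv 2 f c = 0 := by
    intro c
    by_contra hne
    have hpos : 0 < ‖iteratedDeriv 2 f c‖ := norm_pos_iff.2 hne
    set d := ‖iteratedDeriv 2 f c‖ with hd
    have key : ∀ R : ℝ, ‖c‖ + 1 ≤ R → d ^ 2 * R ≤ 36 * B := by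
      intro R hR
      have hc := norm_nonneg c
      have hR1 : 1 ≤ R := by linarith
      have hR0 : 0 < R := by linarith
      have hS : ∀ z ∈ Metric.sphere c R, ‖f z‖ ≤ Real.sqrt (9 * B * R ^ 3) := by
        intro z hz
        apply Real.le_sqrt_of_sq_le
        refine (hb z).trans ?_
        have hz' : ‖z‖ ≤ 2 * R := by
          have : ‖z - c‖ = R := mem_sphere_iff_norm.1 hz
          have := norm_add_le (z - c) c
          rw [sub_add_cancel] at this
          linarith
        have h3 : ‖z‖ ^ 3 ≤ (2 * R) ^ 3 := pow_le_pow_left₀ (norm_nonneg _) hz' 3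
        have h1 : 1 ≤ R ^ 3 := one_le_pow₀ hR1
        have : 1 + ‖z‖ ^ 3 ≤ 9 * R ^ 3 := by nlinarith
        nlinarith [mul_le_mul_of_nonneg_left this hB]
      have := norm_iteratedDeriv_le_of_forall_mem_sphere_norm_le 2 hR0 (hf.diffContOnCl) hS
      rw [← hd, le_div_iff₀ (by positivity)] at this
      have hsq := pow_le_pow_left₀ (by positivity) this 2
      rw [mul_pow, mul_pow, Real.sq_sqrt (by positivity)] at hsq
      norm_num [Nat.factorial] at hsq
      have h3 : 0 < R ^ 3 := by positivity
      have : (d ^ 2 * R) * R ^ 3 ≤ (36 * B) * R ^ 3 := by nlinarith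
      exact le_of_mul_le_mul_right this h3
    have h1 := key (‖c‖ + 1 + 36 * B / d ^ 2) (by have : 0 ≤ 36 * B / d ^ 2 := by positivity
                                                  linarith)
    have h4 : d ^ 2 * (‖c‖ + 1 + 36 * B / d ^ 2) = d ^ 2 * (‖c‖ + 1) + 36 * B := by
      field_simp
    have : 0 < d ^ 2 * (‖c‖ + 1) := by positivity
    linarith
  have hd : Differentiable ℂ (deriv f) := hf.deriv
  have h2' : ∀ c, deriv (deriv f) c = 0 := by
    intro c; have := h2 c; simpa [iteratedDeriv_succ] using this
  have hq : ∀ c, deriv f c = deriv f 0 := fun c => is_const_of_deriv_eq_zero hd h2' c 0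
  refine ⟨f 0, deriv f 0, fun a => ?_⟩
  have hg : Differentiable ℂ (fun a => f a - deriv f 0 * a) := by fun_prop
  have hg' : ∀ x, deriv (fun a => f a - deriv f 0 * a) x = 0 := by
    intro x
    have h := ((hf x).hasDerivAt).sub ((hasDerivAt_id x).const_mul (deriv f 0))
    have := h.deriv
    simp only [id] at this
    rw [hq x] at this
    rw [mul_one, sub_self] at this
    exact this
  have := is_const_of_deriv_eq_zero hg hg' a 0
  simp at this
  linear_combination this

theorem nat_const {f : ℂ → ℂ} (hf : Continuous f) (m : ℂ → ℕ) (hm : ∀ a, f a = m a) :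
    ∀ a b, m a = m b := by
  have hl : IsLocallyConstant m := by
    rw [IsLocallyConstant.iff_eventually_eq]
    intro a
    filter_upwards [Metric.tendsto_nhds.1 hf.continuousAt.tendsto 1 one_pos] with b hb
    rw [hm, hm, dist_eq_norm] at hb
    have h1 : (((m b : ℤ) - (m a : ℤ) : ℤ) : ℂ) = (m b : ℂ) - m a := by push_cast; rfl
    rw [← h1, Complex.norm_intCast] at hb
    have : |(m b : ℤ) - (m a : ℤ)| < 1 := by exact_mod_cast hb
    rw [Int.abs_lt_one_iff] at this
    omega
  intro a b
  exact hl.apply_eq_of_preconnectedSpace a b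

theorem spl_false {F : ℂ × ℂ → ℂ} {Z1 Z2 : Set (ℂ × ℂ)} {C : ℝ} (h : Spl F Z1 Z2 C)
    (hre : ∀ (s : ℝ) (l : ℂ), 0 < s → (((3 * s ^ 2 : ℝ) : ℂ), l) ∈ Z1 → 2 * s ^ 3 ≤ l.re)
    (hn : Z1.Nonempty) : False := by
  classical
  set o : ℂ → ℂ → ℕ := fun a z => analyticOrderNatAt (fun z => F (a, z)) z with ho
  set m : ℂ → ℕ := fun a => ∑ z ∈ (h.fin a).toFinset, o a z with hmdef
  have hm : ∀ a, TS F Z1 0 a = m a := by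
    intro a
    rw [h.TS_eq 0 a, hmdef]
    push_cast
    exact Finset.sum_congr rfl fun z _ => by simp [ho]
  have hconst := nat_const (h.TS_diff 0).continuous m hm
  have hmem : ∀ a z, z ∈ (h.fin a).toFinset ↔ (a, z) ∈ Z1 := by intro a z; simp
  obtain ⟨⟨a0, z0⟩, hz0⟩ := hn
  have hpos : 1 ≤ m a0 := by
    have h1 : 1 ≤ o a0 z0 := by
      obtain ⟨w, hw⟩ := h.ne a0
      have htop := order_ne_top (h.slice a0) hw z0
      have hz : F (a0, z0) = 0 := (h.un _).2 (Or.inl hz0)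
      have hne : analyticOrderAt (fun z => F (a0, z)) z0 ≠ 0 := by
        rw [((h.slice a0).analyticAt z0).analyticOrderAt_ne_zero]; exact hz
      rw [Nat.one_le_iff_ne_zero]
      intro h0
      apply hne
      have := Nat.cast_analyticOrderNatAt htop
      rw [← this]
      simp only [ho] at h0
      rw [h0]; rfl
    exact h1.trans (Finset.single_le_sum (f := o a0) (fun _ _ => Nat.zero_le _) ((hmem a0 z0).2 hz0))
  set N := m a0 with hN
  have hmN : ∀ a, m a = N := fun a => hconst a a0
  have hg : ∀ a, ‖TS F Z1 1 a‖ ^ 2 ≤ ((N:ℝ) ^ 2 * |C|) * (1 + ‖a‖ ^ 3) := by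
    intro a
    have hb : ‖TS F Z1 1 a‖ ≤ N * Real.sqrt (|C| * (1 + ‖a‖ ^ 3)) := by
      rw [h.TS_eq 1 a, ← hmN a, hmdef]
      push_cast
      rw [Finset.sum_mul]
      refine (norm_sum_le _ _).trans (Finset.sum_le_sum fun z hz => ?_)
      rw [norm_mul, Complex.norm_natCast, pow_one]
      refine mul_le_mul_of_nonneg_left ?_ (Nat.cast_nonneg _)
      apply Real.le_sqrt_of_sq_le
      refine (h.bd a z ((hmem a z).1 hz)).trans ?_
      exact mul_le_mul_of_nonneg_right (le_abs_self C) (by positivity)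
    have := pow_le_pow_left₀ (norm_nonneg _) hb 2
    rw [mul_pow, Real.sq_sqrt (by positivity)] at this
    linarith
  obtain ⟨p, q, hpq⟩ := affine_of_growth (h.TS_diff 1) (by positivity) hg
  have hlow : ∀ s : ℝ, 0 < s → 2 * s ^ 3 ≤ (TS F Z1 1 ((3 * s ^ 2 : ℝ) : ℂ)).re := by
    intro s hs
    have h1 : (N:ℝ) * (2 * s ^ 3) ≤ (TS F Z1 1 ((3 * s ^ 2 : ℝ) : ℂ)).re := by
      rw [h.TS_eq 1, ← hmN ((3 * s ^ 2 : ℝ) : ℂ), hmdef, Complex.re_sum]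
      push_cast
      rw [Finset.sum_mul]
      refine Finset.sum_le_sum fun z hz => ?_
      rw [pow_one, ← Complex.ofReal_natCast, Complex.re_ofReal_mul]
      have hz' := hre s z hs (by rw [← hmem]; push_cast at hz ⊢; exact hz)
      exact mul_le_mul_of_nonneg_left hz' (Nat.cast_nonneg _)
    have hN1 : (1:ℝ) ≤ N := by exact_mod_cast hpos
    have : 0 < s ^ 3 := by positivity
    nlinarith
  set s : ℝ := ‖p‖ + 3 * ‖q‖ + 1 with hs
  have hp0 := norm_nonneg p
  have hq0 := norm_nonneg q
  have hs1 : 1 ≤ s := by linarith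
  have hl := hlow s (by linarith)
  rw [hpq] at hl
  have hu : (p + q * ((3 * s ^ 2 : ℝ) : ℂ)).re ≤ ‖p‖ + ‖q‖ * (3 * s ^ 2) := by
    refine (Complex.re_le_norm _).trans ((norm_add_le _ _).trans ?_)
    rw [norm_mul, Complex.norm_real, Real.norm_of_nonneg (by positivity)]
  have h1 : 1 ≤ s ^ 2 := one_le_pow₀ hs1
  have h3 : s ^ 3 = (‖p‖ + 3 * ‖q‖ + 1) * s ^ 2 := by rw [← hs]; ring
  nlinarith
end PTC

open Complex Filter
namespace PTC
open Topology Set MeasureTheory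

theorem FF_ne (a : ℂ) : ∃ l, FF a l ≠ 0 := by
  set t : ℝ := 10 * (1 + ‖a‖) with ht
  have hn := norm_nonneg a
  have ht0 : 0 < t := by positivity
  have ha : ‖a‖ ≤ 0.01 * t ^ 2 := by rw [ht]; nlinarith
  refine ⟨((-(t ^ 3) : ℝ) : ℂ), fun hF => ?_⟩
  have hm : (a, ((-(t ^ 3) : ℝ) : ℂ)) ∈ cubicSpectralLocus := by rw [locus_eq]; exact hF
  have h1 := (lam_re hm ht0 ha).1
  rw [Complex.re_mul_ofReal] at h1
  have h2 := cs36
  have : 0 < t ^ 3 := by positivity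
  nlinarith [h2.1]

theorem half {Z1 Z2 S : Set (ℂ × ℂ)} (c1 : IsClosed Z1) (c2 : IsClosed Z2)
    (dj : ∀ x, x ∈ Z1 → x ∈ Z2 → False) (un : cubicSpectralLocus = Z1 ∪ Z2)
    (hS : S ⊆ Z2) {ε K : ℝ} (hε : 0 < ε)
    (hm : ∀ (a lam : ℂ) (t : ℝ), 0 < t → ‖lam‖ = t ^ 3 → K < t → ‖a‖ ≤ ε * t ^ 2 →
      (a, lam) ∈ cubicSpectralLocus → (a, lam) ∈ S) (hn : Z1.Nonempty) : False := by
  have h1 : Z1 ⊆ cubicSpectralLocus := by rw [un]; exact subset_union_left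
  have hspl : Spl (fun w : ℂ × ℂ => FF w.1 w.2) Z1 Z2 (|K| ^ 6 + (ε⁻¹) ^ 3) := by
    refine ⟨FF_hol, FF_ne, c1, c2, dj, fun x => ?_, fun a z hz => ?_⟩
    · have : x ∈ cubicSpectralLocus ↔ FF x.1 x.2 = 0 := by rw [locus_eq]; rfl
      rw [← this, un]; rfl
    · set t : ℝ := ‖z‖ ^ ((3:ℝ)⁻¹) with ht
      have ht3 : ‖z‖ = t ^ 3 := by
        rw [ht, ← Real.rpow_natCast, ← Real.rpow_mul (norm_nonneg _)]; norm_num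
      have ht0 : 0 ≤ t := by positivity
      have hsq : ‖z‖ ^ 2 = t ^ 6 := by rw [ht3]; ring
      rw [hsq]
      have ha := norm_nonneg a
      have hA : 0 ≤ |K| ^ 6 := by positivity
      have hB : 0 ≤ (ε⁻¹) ^ 3 := by positivity
      have ha3 : 0 ≤ ‖a‖ ^ 3 := by positivity
      by_cases hK : t ≤ |K|
      · have := pow_le_pow_left₀ ht0 hK 6
        nlinarith [mul_nonneg hA ha3, mul_nonneg hB ha3]
      · push Not at hK
        have ht1 : 0 < t := lt_of_le_of_lt (abs_nonneg K) hK
        by_cases hq : ‖a‖ ≤ ε * t ^ 2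
        · exact (dj _ hz (hS (hm a z t ht1 ht3 (lt_of_le_of_lt (le_abs_self K) hK) hq (h1 hz)))).elim
        · push Not at hq
          have h2 : t ^ 2 ≤ ε⁻¹ * ‖a‖ := by
            rw [inv_mul_eq_div, le_div_iff₀ hε]; linarith
          have := pow_le_pow_left₀ (by positivity) h2 3
          rw [mul_pow, ← pow_mul] at this
          nlinarith [mul_nonneg hA ha3, mul_nonneg hB ha3]
  exact spl_false hspl (fun s l hs hl => re_bound hs (h1 hl)) hn

theorem locus_preconnected : IsPreconnected cubicSpectralLocus := by
  obtain ⟨S, hSZ, hSp, hSn, ε, hε, K, hm⟩ := main_piece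
  rw [isPreconnected_closed_iff]
  intro t t' ht ht' hun h1 h2
  by_contra hne
  have hdj : ∀ x, x ∈ cubicSpectralLocus → x ∈ t → x ∈ t' → False := fun x hx h h' =>
    hne ⟨x, hx, h, h'⟩
  have c1 := locus_closed.inter ht
  have c2 := locus_closed.inter ht'
  have un : cubicSpectralLocus = (cubicSpectralLocus ∩ t) ∪ (cubicSpectralLocus ∩ t') := by
    rw [← inter_union_distrib_left]; exact (inter_eq_left.2 hun).symm
  have hcase : S ⊆ t ∨ S ⊆ t' := by
    by_contra hc
    push Not at hc
    obtain ⟨hc1, hc2⟩ := hc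
    obtain ⟨x, hx, hxt⟩ := not_subset.1 hc1
    obtain ⟨y, hy, hyt⟩ := not_subset.1 hc2
    obtain ⟨w, hw, hw1, hw2⟩ := isPreconnected_closed_iff.1 hSp t t' ht ht' (hSZ.trans hun)
      ⟨y, hy, (hun (hSZ hy)).resolve_right hyt⟩ ⟨x, hx, (hun (hSZ hx)).resolve_left hxt⟩
    exact hdj w (hSZ hw) hw1 hw2
  rcases hcase with h | h
  · refine half c2 c1 (fun x hx hx' => hdj x hx.1 hx'.2 hx.2) ?_ (subset_inter hSZ h) hε hm h2
    rw [union_comm]; exact un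
  · exact half c1 c2 (fun x hx hx' => hdj x hx.1 hx.2 hx'.2) un (subset_inter hSZ h) hε hm h1

theorem locus_final : cubicSpectralLocus.Nonempty ∧ IsClosed cubicSpectralLocus ∧
      IsConnected cubicSpectralLocus := by
  have hn : cubicSpectralLocus.Nonempty := by
    obtain ⟨S, hSZ, -, hSn, -⟩ := main_piece
    exact hSn.mono hSZ
  exact ⟨hn, locus_closed, hn, locus_preconnected⟩
end PTC

theorem cubic_spectral_locus_nonempty_closed_connected :
    cubicSpectralLocus.Nonempty ∧ IsClosed cubicSpectralLocus ∧
      IsConnected cubicSpectralLocus :=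
  PTC.locus_final
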